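/- There exist absolute constants c₀ ≥ 1 and c, c' > 0 with the following property. Let μ be an isotropic log-concave probability measure on ℝⁿ, let c₀·n ≤ m ≤ exp(√n), and let x₁,…,x_m, y₁,…,y_m be mutually independent random vectors each distributed according to μ. Set B_m = absconv{x₁,…,x_m} and A_m = absconv{y₁,…,y_m}. Then, with probability at least 1 − exp(−c'·√n), one has d_BM(X_{A_m}, X_{B_m}) ≥ c·n/ln(1+m/n). -/

import Mathlib

open MeasureTheory Set
open scoped ENNReal RealInnerProductSpace Pointwise BigOperators

noncomputable section

abbrev Euc (n : ℕ) := EuclideanSpace ℝ (Fin n)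

/-- The absolute convex hull of a set. -/
def absConv (n : ℕ) (A : Set (Euc n)) : Set (Euc n) := convexHull ℝ (A ∪ -A)

/-- A log-concave function on `ℝⁿ`. -/
def IsLogConcaveFn (n : ℕ) (f : Euc n → ℝ) : Prop :=
  ∀ x y : Euc n, ∀ a b : ℝ, 0 ≤ a → 0 ≤ b → a + b = 1 →
    f x ^ a * f y ^ b ≤ f (a • x + b • y)

/-- `f` is a log-concave density of `μ` with barycenter `0`, total mass `1`
and identity covariance. -/
def IsIsotropicDensity (n : ℕ) (μ : Measure (Euc n)) (f : Euc n → ℝ) : Prop :=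
  (∀ x, 0 ≤ f x) ∧ IsLogConcaveFn n f ∧
  μ = volume.withDensity (fun x => ENNReal.ofReal (f x)) ∧
  IsProbabilityMeasure μ ∧ (∫ x, x ∂μ) = 0 ∧
  ∀ y z : Euc n, (∫ x, ⟪x, y⟫ * ⟪x, z⟫ ∂μ) = ⟪y, z⟫

/-- An isotropic log-concave probability measure on `ℝⁿ`. -/
def IsIsotropicLogConcave (n : ℕ) (μ : Measure (Euc n)) : Prop :=
  ∃ f, IsIsotropicDensity n μ f

/-- A centrally symmetric convex body. -/
def IsSymmConvexBody (n : ℕ) (K : Set (Euc n)) : Prop :=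
  Convex ℝ K ∧ K = -K ∧ IsCompact K ∧ (0 : Euc n) ∈ interior K

/-- A convex body (not necessarily symmetric). -/
def IsConvexBody (n : ℕ) (K : Set (Euc n)) : Prop :=
  Convex ℝ K ∧ IsCompact K ∧ (interior K).Nonempty

/-- The operator norm of `T : X_K → X_L`, where `X_K` and `X_L` carry the gauges of `K`, `L`. -/
def bodyOpNorm (n : ℕ) (K L : Set (Euc n)) (T : Euc n →ₗ[ℝ] Euc n) : ℝ :=
  sSup ((fun x => gauge L (T x)) '' K)

/-- The Banach–Mazur distance between the normed spaces with unit balls `K` and `L`. -/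
def distBM (n : ℕ) (K L : Set (Euc n)) : ℝ :=
  sInf {d : ℝ | ∃ T : Euc n ≃ₗ[ℝ] Euc n,
    d = bodyOpNorm n K L T.toLinearMap * bodyOpNorm n L K T.symm.toLinearMap}

/-- The `ℓ₂ⁿ → ℓ₂ⁿ` operator norm of a linear map. -/
def eucOpNorm (n : ℕ) (T : Euc n →ₗ[ℝ] Euc n) : ℝ :=
  ‖LinearMap.toContinuousLinearMap T‖

/-- The standard orthonormal basis vectors of `ℝⁿ`, as a set. -/
def stdBasisSet (n : ℕ) : Set (Euc n) :=
  Set.range fun i : Fin n => (EuclideanSpace.single i (1 : ℝ) : Euc n)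

/-- The basis-enriched random polytope `absconv{e₁,…,eₙ, x₁/√n,…,x_m/√n}`. -/
def enrichedBody (n m : ℕ) (x : Fin m → Euc n) : Set (Euc n) :=
  absConv n (stdBasisSet n ∪ Set.range fun j => (Real.sqrt n)⁻¹ • x j)

/-- `s_k(T) ≥ 1`, via the Courant–Fischer characterization of singular values. -/
def SingValGe (n : ℕ) (T : Euc n →ₗ[ℝ] Euc n) (k : ℕ) : Prop :=
  ∃ F : Submodule ℝ (Euc n), k ≤ Module.finrank ℝ F ∧ ∀ x ∈ F, ‖x‖ ≤ ‖T x‖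

/-- A `(k,β)`-mixing operator. -/
def IsMixing (n : ℕ) (T : Euc n →ₗ[ℝ] Euc n) (k : ℕ) (β : ℝ) : Prop :=
  ∃ E : Submodule ℝ (Euc n), k ≤ Module.finrank ℝ E ∧
    ∀ x ∈ E, β * ‖x‖ ≤ ‖Submodule.orthogonalProjectionOnto Eᗮ (T x)‖

/-- The basis constant of the normed space with unit ball `K`. -/
def basisConstant (n : ℕ) (K : Set (Euc n)) : ℝ :=
  sInf {c : ℝ | 0 < c ∧ ∃ b : Module.Basis (Fin n) ℝ (Euc n),
    ∀ k : ℕ, k ≤ n → ∀ lam : Fin n → ℝ,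
      gauge K (∑ i ∈ Finset.univ.filter (fun i : Fin n => (i : ℕ) < k), lam i • b i) ≤
        c * gauge K (∑ i, lam i • b i)}

/-- The polar body. -/
def polarBody (n : ℕ) (B : Set (Euc n)) : Set (Euc n) :=
  {y | ∀ x ∈ B, ⟪x, y⟫ ≤ 1}

/-- The 1-summing norm of the identity `I : X_B* → ℓ₂ⁿ`. -/
def piOneId (n : ℕ) (B : Set (Euc n)) : ℝ :=
  sInf {α : ℝ | 0 < α ∧ ∀ N : ℕ, ∀ z : Fin N → Euc n,
    ∑ j, ‖z j‖ ≤ α * sSup ((fun y => ∑ j, |⟪y, z j⟫|) '' B)}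

/-- The normed space with unit ball `L` admits a `1`-unconditional basis. -/
def HasOneUncondBasis (n : ℕ) (L : Set (Euc n)) : Prop :=
  ∃ b : Module.Basis (Fin n) ℝ (Euc n), ∀ lam : Fin n → ℝ,
    gauge L (∑ i, lam i • b i) = gauge L (∑ i, |lam i| • b i)

set_option linter.all false
open Real (exp)
notation "oR" => ENNReal.ofReal
notation "HCS" => HasCompactSupport
notation "IPM" => IsProbabilityMeasure
notation "pY" => (by positivity)
notation "fP" => (by fun_prop)
notation "nN" => (by norm_num)
notation "lI" => (by linarith)
notation "hlf" => (1 / 2 : ℝ)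
notation "ONB" n:max => OrthonormalBasis (Fin n) ℝ (Euc n)
abbrev Eof := @Filter.Eventually.of_forall
abbrev mll := @mul_le_mul_of_nonneg_left
abbrev mlr := @mul_le_mul_of_nonneg_right
abbrev oRl := @ENNReal.ofReal_le_ofReal
abbrev oRm := @ENNReal.ofReal_mul
abbrev fsc := @Finset.sum_congr
abbrev icm := @integral_const_mul
abbrev ppl := @pow_le_pow_left₀
abbrev fsl := @Finset.sum_le_sum
abbrev mct := @measurable_const
abbrev ict := @integrable_const
abbrev lwd := @lintegral_withDensity_eq_lintegral_mul
abbrev fad := @Finset.sum_add_distrib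
abbrev fms := @Finset.mul_sum
abbrev ifs := @integral_finsetSum
abbrev oie := @ofReal_integral_eq_lintegral_ofReal
abbrev rsl := @real_inner_smul_left
abbrev rin := @real_inner_self_eq_norm_sq
abbrev ric := @real_inner_comm
abbrev ain := @abs_real_inner_le_norm
abbrev mbl := @measurableSet_le
abbrev igf := @integrable_finsetSum
abbrev lcm' := @lintegral_const_mul
abbrev ica := @integral_congr_ae
abbrev aon := @abs_of_nonneg
abbrev ont := @ENNReal.ofReal_ne_top
abbrev orp := @ENNReal.ofReal_pow
abbrev lml := @le_of_mul_le_mul_left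
abbrev iom := @indicator_of_mem
abbrev fcf := @Fintype.card_fin
abbrev iel := @integral_eq_lintegral_of_nonneg_ae
abbrev ora := @ENNReal.ofReal_add
abbrev fsm := @Finset.sum_mul
abbrev fcn := @Finset.sum_le_card_nsmul
abbrev fss := @Finset.sum_le_sum_of_subset_of_nonneg
abbrev isr := @inner_sub_right
abbrev lls := @lintegral_lintegral_swap
abbrev mul' := @measure_union_le
abbrev ppr := @pow_le_pow_right₀
abbrev lcg := @lintegral_congr
abbrev mor := @mul_le_of_le_one_right
abbrev rsr := @real_inner_smul_right
abbrev lmo := @le_mul_of_one_le_left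
abbrev eis := @EuclideanSpace.inner_single_right
abbrev fcu := @Finset.card_univ
abbrev fsd := @Finset.sum_sub_distrib
abbrev orn := @ENNReal.ofReal_natCast
abbrev mpp := @Measure.prod_prod
abbrev ens := @EuclideanSpace.norm_sq_eq
abbrev ord := @ENNReal.ofReal_div_of_pos
abbrev eto := @ENNReal.toReal_ofReal
abbrev olt := @ENNReal.ofReal_lt_top
abbrev lal := @lintegral_add_left
abbrev oro := @ENNReal.ofReal_one
abbrev msm := @measure_mono
abbrev inn := @integral_nonneg
abbrev imn := @integral_mono
abbrev lmn := @lintegral_mono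
abbrev sqn := @sq_nonneg
abbrev mnn := @mul_nonneg
abbrev abn := @abs_nonneg
abbrev nnn := @norm_nonneg
abbrev iad := @integral_add
abbrev isb := @integral_sub
abbrev sem := @smul_eq_mul
abbrev rna := @Real.norm_eq_abs
abbrev ele := @Real.exp_le_exp
abbrev epos := @Real.exp_pos
abbrev enm := @Real.exp_nat_mul
abbrev aoe := @Real.add_one_le_exp
abbrev eadd := @Real.exp_add
abbrev aoa := @ae_of_all
abbrev mlm := @mul_le_mul
abbrev mtw := @memLp_two_iff_integrable_sq
abbrev mmg := @mul_meas_ge_le_integral_of_nonneg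
abbrev tlo := @ENNReal.toReal_le_of_le_ofReal
abbrev nem := @nsmul_eq_mul
abbrev fco := @Finset.sum_comm
lemma bm1 (A B C : Set ℝ) (hA : MeasurableSet A) (hB : MeasurableSet B)
    (hAn : A.Nonempty) (hBn : B.Nonempty) (H : ∀ a ∈ A, ∀ b ∈ B, (a + b) / 2 ∈ C) :
    volume A + volume B ≤ 2 * volume C := by
  have key : ∀ K L : Set ℝ, K ⊆ A → L ⊆ B → IsCompact K → IsCompact L → K.Nonempty → L.Nonempty →
      volume K + volume L ≤ 2 * volume C := by
    intro K L hKA hLB hK hL hKn hLn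
    obtain ⟨a, haK, ha⟩ := hK.exists_isMaxOn hKn continuousOn_id
    obtain ⟨b, hbL, hb⟩ := hL.exists_isMinOn hLn continuousOn_id
    have ha' : ∀ x ∈ K, x ≤ a := fun x hx => ha hx
    have hb' : ∀ x ∈ L, b ≤ x := fun x hx => hb hx
    have e1 : volume ((fun x : ℝ => x + b) '' K) = volume K := by
      simp [image_add_right]
    have e2 : volume ((fun x : ℝ => a + x) '' L) = volume L := by
      simp [image_add_left]
    have hsub : ((fun x : ℝ => x + b) '' K) ∪ ((fun x : ℝ => a + x) '' L) ⊆ (fun x : ℝ => 2 * x) '' C := by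
      rintro x (⟨y, hy, rfl⟩ | ⟨y, hy, rfl⟩)
      · exact ⟨_, H y (hKA hy) b (hLB hbL), by ring⟩
      · exact ⟨_, H a (hKA haK) y (hLB hy), by ring⟩
    have e3 : volume ((fun x : ℝ => 2 * x) '' C) = 2 * volume C := by
      have := Measure.addHaar_smul (volume : Measure ℝ) 2 C
      have h2 : (fun x : ℝ => 2 * x) '' C = (2:ℝ) • C := by ext; simp [Set.mem_smul_set]
      rw [h2, this]; simp
    rw [← e1, ← e2, ← e3]
    rw [← measure_union₀]
    · exact msm hsub
    · exact ((hL.image fP).measurableSet).nullMeasurableSet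
    · refine measure_mono_null (t := {a + b}) ?_ (by simp)
      rintro x ⟨⟨y, hy, rfl⟩, ⟨z, hz, h⟩⟩
      have := ha' y hy; have := hb' z hz
      simp only at h ⊢
      simp; linarith
  refine le_of_forall_lt fun r hr => ?_
  by_contra hcon
  push Not at hcon
  -- inner regularity
  obtain ⟨a0, ha0⟩ := hAn
  obtain ⟨b0, hb0⟩ := hBn
  have hAr : volume A = ⨆ (K) (_ : K ⊆ A) (_ : IsCompact K), volume K := hA.measure_eq_iSup_isCompact _
  have hBr : volume B = ⨆ (K) (_ : K ⊆ B) (_ : IsCompact K), volume K := hB.measure_eq_iSup_isCompact _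
  have h2 : volume A + volume B ≤ 2 * volume C := by
    rw [hAr]
    have h3 : ∀ K ⊆ A, IsCompact K → volume K + volume B ≤ 2 * volume C := by
      intro K hK hKc
      rw [hBr]
      have h4 : ∀ L ⊆ B, IsCompact L → volume K + volume L ≤ 2 * volume C := by
        intro L hL hLc
        refine le_trans (add_le_add (msm (subset_insert a0 K)) (msm (subset_insert b0 L))) ?_
        exact key _ _ (insert_subset ha0 hK) (insert_subset hb0 hL) (hKc.insert _) (hLc.insert _)
          (insert_nonempty _ _) (insert_nonempty _ _)
      by_cases hC : 2 * volume C = ⊤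
      · simp [hC]
      have hKf : volume K ≠ ⊤ := hKc.measure_lt_top.ne
      have : (⨆ (L) (_ : L ⊆ B) (_ : IsCompact L), volume L) ≤ 2 * volume C - volume K := by
        simp only [iSup_le_iff]
        intro L hL hLc
        exact ENNReal.le_sub_of_add_le_left hKf (h4 L hL hLc)
      calc _ ≤ volume K + (2 * volume C - volume K) := by gcongr
        _ = _ := by
          rw [add_tsub_cancel_of_le]
          simpa using h4 ∅ (by simp) isCompact_empty
    by_cases hBf : volume B = ⊤
    · have := h3 ∅ (by simp) isCompact_empty
      simp [hBf] at this ⊢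
      simp [this]
    have : (⨆ (K) (_ : K ⊆ A) (_ : IsCompact K), volume K) ≤ 2 * volume C - volume B := by
      simp only [iSup_le_iff]
      intro K hK hKc
      exact ENNReal.le_sub_of_add_le_right hBf (h3 K hK hKc)
    calc _ ≤ (2 * volume C - volume B) + volume B := by gcongr
      _ = _ := by
        rw [tsub_add_cancel_of_le]
        simpa using h3 ∅ (by simp) isCompact_empty
  exact absurd (lt_of_lt_of_le hr h2) (not_lt.mpr hcon)

lemma lay1 (f : ℝ → ℝ≥0∞) (hf : Measurable f) (h1 : ∀ x, f x ≤ 1) :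
    ∫⁻ x, f x = ∫⁻ s in Ioo (0:ℝ) 1, volume {x | oR s < f x} := by
  have hne : ∀ x, f x ≠ ⊤ := fun x => ne_top_of_le_ne_top ENNReal.one_ne_top (h1 x)
  have e : ∫⁻ x, f x = ∫⁻ x, oR (f x).toReal := by
    congr 1; ext x; rw [ENNReal.ofReal_toReal (hne x)]
  rw [e, lintegral_eq_lintegral_meas_lt _ (by filter_upwards with x using ENNReal.toReal_nonneg)
    hf.ennreal_toReal.aemeasurable]
  have e2 : ∀ s ∈ Ioi (0:ℝ), volume {x | s < (f x).toReal} = volume {x | oR s < f x} := by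
    intro s hs
    congr 1; ext x
    simp [ENNReal.ofReal_lt_iff_lt_toReal (le_of_lt hs) (hne x)]
  rw [setLIntegral_congr_fun measurableSet_Ioi e2]
  rw [← Ioo_union_Ici_eq_Ioi (zero_lt_one' ℝ), lintegral_union measurableSet_Ici
    (by rw [Set.disjoint_left]; intro x hx hx'; exact absurd hx.2 (not_lt.mpr hx'))]
  have : ∫⁻ s in Ici (1:ℝ), volume {x | oR s < f x} = 0 := by
    rw [setLIntegral_congr_fun (g := fun _ => 0) measurableSet_Ici]
    · simp
    · intro s hs
      have : {x | oR s < f x} = ∅ := by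
        ext x
        simp only [mem_ofPred_eq, mem_empty_iff_false, iff_false, not_lt]
        exact (h1 x).trans (by simpa using hs)
      simp only [this, measure_empty]
  rw [this, add_zero]

lemma pl1norm (f g h : ℝ → ℝ≥0∞) (hf : Measurable f) (hg : Measurable g) (hh : Measurable h)
    (f1 : ⨆ x, f x = 1) (g1 : ⨆ x, g x = 1)
    (H : ∀ x y, f x * g y ≤ h ((x + y) / 2) ^ 2) : (∫⁻ x, f x) + (∫⁻ x, g x) ≤ 2 * ∫⁻ x, h x := by
  have hf1 : ∀ x, f x ≤ 1 := fun x => f1 ▸ le_iSup f x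
  have hg1 : ∀ x, g x ≤ 1 := fun x => g1 ▸ le_iSup g x
  have hh' : ∫⁻ x, min (h x) 1 ≤ ∫⁻ x, h x := lmn fun x => min_le_left _ _
  refine le_trans ?_ (mul_le_mul_right hh' 2)
  rw [lay1 f hf hf1, lay1 g hg hg1, lay1 _ (hh.min mct) (fun x => min_le_right _ _)]
  have mm : ∀ k : ℝ → ℝ≥0∞, Measurable (fun s : ℝ => volume {x | oR s < k x}) := by
    intro k
    refine Antitone.measurable ?_
    intro s t hst
    exact msm fun x hx => lt_of_le_of_lt (oRl hst) hx
  rw [← lal (mm f), ← lcm' _ (mm _)]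
  refine setLIntegral_mono (measurable_const.mul (mm _)) ?_
  intro s hs
  have hs1 : oR s < 1 := by simpa using hs.2
  refine bm1 _ _ _ (measurableSet_lt mct hf) (measurableSet_lt mct hg) ?_ ?_ ?_
  · exact lt_iSup_iff.mp (f1 ▸ hs1)
  · exact lt_iSup_iff.mp (g1 ▸ hs1)
  · intro a ha b hb
    simp only [mem_ofPred_eq] at *
    refine lt_min ?_ hs1
    by_contra hc
    push Not at hc
    have : f a * g b ≤ oR s ^ 2 := (H a b).trans (by gcongr)
    rw [sq] at this
    exact absurd this (not_le.mpr (ENNReal.mul_lt_mul ha hb))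

lemma amgm_enn (a b : ℝ≥0∞) : 4 * (a * b) ≤ (a + b) ^ 2 := by
  by_cases ha : a = ⊤
  · simp [ha]
  by_cases hb : b = ⊤
  · simp [hb]
  lift a to NNReal using ha
  lift b to NNReal using hb
  norm_cast
  exact four_mul_le_sq_add a b |>.trans' (by rw [mul_assoc])

lemma pl1bdd (f g h : ℝ → ℝ≥0∞) (hf : Measurable f) (hg : Measurable g) (hh : Measurable h)
    (f1 : ⨆ x, f x ≠ ⊤) (g1 : ⨆ x, g x ≠ ⊤)
    (H : ∀ x y, f x * g y ≤ h ((x + y) / 2) ^ 2) : (∫⁻ x, f x) * (∫⁻ x, g x) ≤ (∫⁻ x, h x) ^ 2 := by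
  set α := ⨆ x, f x
  set β := ⨆ x, g x
  by_cases ha : α = 0
  · have : ∀ x, f x = 0 := fun x => le_antisymm (ha ▸ le_iSup f x) bot_le
    simp [this]
  by_cases hb : β = 0
  · have : ∀ x, g x = 0 := fun x => le_antisymm (hb ▸ le_iSup g x) bot_le
    simp [this]
  set γ := (α * β) ^ (1/2 : ℝ)
  have hγ : γ ^ 2 = α * β := by
    rw [← ENNReal.rpow_natCast, ← ENNReal.rpow_mul]; norm_num
  have hγ0 : γ ≠ 0 := by
    intro h; rw [h] at hγ; simp [ha, hb] at hγ
  have hγt : γ ≠ ⊤ := by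
    intro h; rw [h] at hγ; simp at hγ; exact absurd hγ.symm (ENNReal.mul_ne_top f1 g1)
  have := pl1norm (fun x => α⁻¹ * f x) (fun x => β⁻¹ * g x) (fun x => γ⁻¹ * h x)
    (hf.const_mul _) (hg.const_mul _) (hh.const_mul _)
    (by rw [← ENNReal.mul_iSup]; exact ENNReal.inv_mul_cancel ha f1)
    (by rw [← ENNReal.mul_iSup]; exact ENNReal.inv_mul_cancel hb g1)
    (by
      intro x y
      calc α⁻¹ * f x * (β⁻¹ * g y) = (α⁻¹ * β⁻¹) * (f x * g y) := by ring
        _ = (γ⁻¹)^2 * (f x * g y) := by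
          rw [← ENNReal.mul_inv (Or.inl ha) (Or.inl f1), ← hγ, ENNReal.inv_pow]
        _ ≤ (γ⁻¹)^2 * (h ((x+y)/2))^2 := by gcongr; exact H x y
        _ = _ := by ring)
  rw [lcm' _ hf, lcm' _ hg, lcm' _ hh] at this
  set F := ∫⁻ x, f x
  set G := ∫⁻ x, g x
  set K := ∫⁻ x, h x
  have h4 : 4 * ((α⁻¹ * F) * (β⁻¹ * G)) ≤ 4 * (γ⁻¹ * K)^2 :=
    calc _ ≤ (α⁻¹ * F + β⁻¹ * G)^2 := amgm_enn _ _
      _ ≤ (2 * (γ⁻¹ * K))^2 := by gcongr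
      _ = _ := by ring
  have h5 : γ^2 * ((α⁻¹ * F) * (β⁻¹ * G)) ≤ γ^2 * (γ⁻¹ * K)^2 := by
    gcongr
    exact (ENNReal.mul_le_mul_iff_right nN nN).mp h4
  calc F * G = γ^2 * ((α⁻¹ * F) * (β⁻¹ * G)) := by
        rw [hγ]
        calc F * G = (α * α⁻¹) * (β * β⁻¹) * (F * G) := by
              rw [ENNReal.mul_inv_cancel ha f1, ENNReal.mul_inv_cancel hb g1]; simp
          _ = _ := by ring
    _ ≤ _ := h5
    _ = (γ * γ⁻¹)^2 * K^2 := by ring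
    _ = _ := by rw [ENNReal.mul_inv_cancel hγ0 hγt]; simp

/-- midpoint Prekopa-Leindler property. -/
def PL (E : Type*) [AddCommGroup E] [Module ℝ E] [MeasureSpace E] : Prop :=
  ∀ f g h : E → ℝ≥0∞, Measurable f → Measurable g → Measurable h →
    (∀ x y, f x * g y ≤ h ((1/2 : ℝ) • (x + y)) ^ 2) →
    (∫⁻ x, f x) * (∫⁻ x, g x) ≤ (∫⁻ x, h x) ^ 2

lemma pl_real : PL ℝ := by
  intro f g h hf hg hh H
  have key : ∀ N : ℕ, (∫⁻ x, min (f x) N) * (∫⁻ x, min (g x) N) ≤ (∫⁻ x, h x) ^ 2 := by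
    intro N
    refine pl1bdd _ _ h (hf.min mct) (hg.min mct) hh ?_ ?_ ?_
    · exact ne_top_of_le_ne_top (ENNReal.natCast_ne_top N) (iSup_le fun x => min_le_right _ _)
    · exact ne_top_of_le_ne_top (ENNReal.natCast_ne_top N) (iSup_le fun x => min_le_right _ _)
    · intro x y
      refine le_trans (mul_le_mul' (min_le_left _ _) (min_le_left _ _)) ((H x y).trans_eq ?_)
      congr 2; simp; ring
  have lim : ∀ k : ℝ → ℝ≥0∞, Measurable k → ∫⁻ x, k x = ⨆ N : ℕ, ∫⁻ x, min (k x) N := by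
    intro k hk
    rw [← lintegral_iSup (fun N => hk.min mct)]
    · congr 1; ext x
      rw [← inf_iSup_eq (f := fun N : ℕ => (N : ℝ≥0∞)) , ENNReal.iSup_natCast]; simp
    · intro a b hab x
      exact min_le_min_left _ (by exact_mod_cast hab)
  have mono : ∀ k : ℝ → ℝ≥0∞, Monotone fun N : ℕ => ∫⁻ x, min (k x) N := by
    intro k a b hab
    exact lmn fun x => min_le_min_left _ (by exact_mod_cast hab)
  rw [lim f hf, lim g hg, ENNReal.iSup_mul]
  refine iSup_le fun N => ?_
  rw [ENNReal.mul_iSup]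
  refine iSup_le fun M => ?_
  exact le_trans (mul_le_mul' (mono f (le_max_left N M)) (mono g (le_max_right N M))) (key _)

lemma pl_prod {E F : Type*} [AddCommGroup E] [Module ℝ E] [MeasureSpace E]
    [AddCommGroup F] [Module ℝ F] [MeasureSpace F] [SFinite (volume : Measure E)]
    [SFinite (volume : Measure F)] (hE : PL E) (hF : PL F) : PL (E × F) := by
  intro f g h hf hg hh H
  rw [Measure.volume_eq_prod, lintegral_prod _ hf.aemeasurable, lintegral_prod _ hg.aemeasurable,
    lintegral_prod _ hh.aemeasurable]
  refine hE _ _ _ hf.lintegral_prod_right' hg.lintegral_prod_right' hh.lintegral_prod_right' ?_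
  intro x y
  refine hF _ _ _ (hf.comp measurable_prodMk_left) (hg.comp measurable_prodMk_left)
    (hh.comp measurable_prodMk_left) ?_
  intro a b
  exact H (x, a) (y, b)

lemma pl_transfer {E F : Type*} [AddCommGroup E] [Module ℝ E] [MeasureSpace E]
    [AddCommGroup F] [Module ℝ F] [MeasureSpace F] (hE : PL E) (φ : E → F)
    (hφ : MeasurePreserving φ) (ha : ∀ x y, φ ((1/2 : ℝ) • (x + y)) = (1/2 : ℝ) • (φ x + φ y)) : PL F := by
  intro f g h hf hg hh H
  rw [← hφ.lintegral_comp hf, ← hφ.lintegral_comp hg, ← hφ.lintegral_comp hh]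
  refine hE _ _ _ (hf.comp hφ.measurable) (hg.comp hφ.measurable) (hh.comp hφ.measurable) ?_
  intro x y
  simp only [ha]
  exact H _ _

lemma pl_pi (n : ℕ) : PL (Fin n → ℝ) := by
  induction n with
  | zero =>
    intro f g h hf hg hh H
    have : ∀ k : (Fin 0 → ℝ) → ℝ≥0∞, ∫⁻ x, k x = k 0 := by
      intro k
      rw [lintegral_unique]
      simp only [volume_pi, Measure.pi_univ]
      simp
      congr 1
    rw [this, this, this]
    refine (H 0 0).trans_eq ?_
    simp
  | succ n ih =>
    refine pl_transfer (pl_prod pl_real ih) _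
      (volume_preserving_piFinSuccAbove (fun _ : Fin (n+1) => ℝ) 0).symm ?_
    intro x y
    ext i
    refine Fin.cases ?_ (fun j => ?_) i
    · simp [MeasurableEquiv.piFinSuccAbove, mul_add]
    · simp [MeasurableEquiv.piFinSuccAbove, mul_add]

lemma pl_euc (n : ℕ) : PL (Euc n) := by
  refine pl_transfer (pl_pi n) _ (PiLp.volume_preserving_toLp (Fin n)) ?_
  intro x y
  ext i
  simp [mul_add]
section
end

section
/-- midpoint log-concavity. -/
def MLC {E : Type*} [AddCommGroup E] [Module ℝ E] (g : E → ℝ) : Prop :=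
  (∀ x, 0 ≤ g x) ∧ ∀ x y, g x * g y ≤ g ((1/2 : ℝ) • (x + y)) ^ 2

/-- measure with density. -/
def dens (n : ℕ) (g : Euc n → ℝ) : Measure (Euc n) :=
  volume.withDensity (fun x => oR (g x))

lemma measurable_version (n : ℕ) (f : Euc n → ℝ) (hf0 : ∀ x, 0 ≤ f x) (hf : IsLogConcaveFn n f) :
    ∃ g : Euc n → ℝ, Measurable g ∧ MLC g ∧ dens n f = dens n g := by
  have hmid : ∀ x y, f x * f y ≤ f ((1/2 : ℝ) • (x + y)) ^ 2 := by
    intro x y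
    have h := hf x y (1/2) (1/2) nN nN nN
    rw [← Real.sqrt_eq_rpow, ← Real.sqrt_eq_rpow, ← smul_add] at h
    calc f x * f y = (√(f x) * √(f y))^2 := by
          rw [mul_pow, Real.sq_sqrt (hf0 x), Real.sq_sqrt (hf0 y)]
      _ ≤ _ := by gcongr
  let C : ℝ → Set (Euc n) := fun q => {x | q < f x}
  have hC : ∀ q, 0 ≤ q → Convex ℝ (C q) := by
    intro q hq x hx y hy a b ha hb hab
    have hx' : q < f x := hx
    have hy' : q < f y := hy
    have h := hf x y a b ha hb hab
    refine lt_of_lt_of_le ?_ h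
    set r := min (f x) (f y)
    have hr : q < r := lt_min hx' hy'
    have hr0 : 0 < r := hq.trans_lt hr
    calc q < r := hr
      _ = r ^ a * r ^ b := by rw [← Real.rpow_add hr0, hab, Real.rpow_one]
      _ ≤ _ := by
        exact mlm (Real.rpow_le_rpow hr0.le (min_le_left _ _) ha)
          (Real.rpow_le_rpow hr0.le (min_le_right _ _) hb) pY
          (Real.rpow_nonneg (hf0 x) _)
  let D : Euc n → Set ℝ := fun x => {q | q = 0 ∨ (0 ≤ q ∧ x ∈ interior (C q))}
  have hDb : ∀ x, ∀ q ∈ D x, q ≤ f x := by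
    rintro x q (rfl | ⟨h0, h⟩)
    · exact hf0 x
    · exact le_of_lt (interior_subset h : x ∈ C q)
  have hDbd : ∀ x, BddAbove (D x) := fun x => ⟨f x, hDb x⟩
  let g : Euc n → ℝ := fun x => sSup (D x)
  have hg0 : ∀ x, 0 ≤ g x := fun x => le_csSup (hDbd x) (Or.inl rfl)
  have hlt : ∀ x a, a < g x → a < 0 ∨ ∃ q, 0 ≤ q ∧ a < q ∧ x ∈ interior (C q) := by
    intro x a ha
    obtain ⟨q, hq, haq⟩ := exists_lt_of_lt_csSup (show (D x).Nonempty from ⟨0, Or.inl rfl⟩) ha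
    rcases hq with rfl | ⟨h0, h⟩
    · exact Or.inl haq
    · exact Or.inr ⟨q, h0, haq, h⟩
  refine ⟨g, ?_, ⟨hg0, ?_⟩, ?_⟩
  · refine measurable_of_Ioi fun a => ?_
    by_cases ha : a < 0
    · have : g ⁻¹' Ioi a = univ := by ext x; simpa using ha.trans_le (hg0 x)
      simp [this]
    · push Not at ha
      have : g ⁻¹' Ioi a = ⋃ q ∈ Ioi a, interior (C q) := by
        ext x
        simp only [mem_preimage, mem_Ioi, mem_iUnion]
        constructor
        · intro h
          rcases hlt x a h with h | ⟨q, h0, h1, h2⟩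
          · linarith
          · exact ⟨q, h1, h2⟩
        · rintro ⟨q, hq, hx⟩
          exact lt_of_lt_of_le hq (le_csSup (hDbd x) (Or.inr ⟨ha.trans hq.le, hx⟩))
      rw [this]
      exact (isOpen_biUnion fun q _ => isOpen_interior).measurableSet
  · intro x y
    rcases (hg0 x).eq_or_lt with hx | hx
    · rw [← hx]; simp; positivity
    rcases (hg0 y).eq_or_lt with hy | hy
    · rw [← hy]; simp; positivity
    have hs : √(g x * g y) ≤ g ((1/2:ℝ) • (x+y)) := by
      refine le_of_forall_lt_imp_le_of_dense fun s hs => ?_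
      rcases lt_or_ge s 0 with h | h
      · exact h.le.trans (hg0 _)
      have hs2 : s ^ 2 < g x * g y := by
        rwa [Real.lt_sqrt h] at hs
      -- find q<g x, r<g y with s^2<= q r
      obtain ⟨q, hq, hqx⟩ : ∃ q, s^2 / g y < q ∧ q < g x :=
        exists_between (by rwa [div_lt_iff₀ hy])
      have hq0 : 0 < q := lt_of_le_of_lt pY hq
      obtain ⟨r, hr, hry⟩ : ∃ r, s^2 / q < r ∧ r < g y :=
        exists_between (by rw [div_lt_iff₀ hq0]; rwa [div_lt_iff₀ hy, mul_comm] at hq)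
      have hr0 : 0 ≤ r := le_of_lt (lt_of_le_of_lt pY hr)
      have hsqr : s^2 ≤ q * r := by rw [div_lt_iff₀ hq0] at hr; linarith
      rcases hlt x q hqx with h' | ⟨q', hq0', hqq, hxq⟩
      · linarith
      rcases hlt y r hry with h' | ⟨r', hr0', hrr, hyr⟩
      · linarith
      refine le_csSup (hDbd _) (Or.inr ⟨h, ?_⟩)
      have hop : IsOpen ((1/2:ℝ) • (interior (C q') + interior (C r'))) :=
        (isOpen_interior.add_right).smul₀ nN
      refine interior_maximal ?_ hop (Set.smul_mem_smul_set (Set.add_mem_add hxq hyr))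
      rintro _ ⟨_, ⟨u, hu, v, hv, rfl⟩, rfl⟩
      have hu' : q' < f u := (interior_subset hu : u ∈ C q')
      have hv' : r' < f v := (interior_subset hv : v ∈ C r')
      have h3 := hmid u v
      have h4 : s^2 < f u * f v := by
        have : q * r < f u * f v := mul_lt_mul'' (hqq.trans hu') (hrr.trans hv') hq0.le hr0
        linarith
      exact lt_of_pow_lt_pow_left₀ 2 (hf0 _) (h4.trans_le h3)
    calc g x * g y = √(g x * g y)^2 := (Real.sq_sqrt pY).symm
      _ ≤ _ := by gcongr
  · have hae : ∀ᵐ x, f x = g x := by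
      have : ∀ᵐ x : Euc n, ∀ q : ℚ, 0 ≤ q → x ∉ frontier (C q) := by
        rw [ae_all_iff]
        intro q
        by_cases hq : 0 ≤ q
        · have := (hC q (by exact_mod_cast hq)).addHaar_frontier volume
          filter_upwards [measure_eq_zero_iff_ae_notMem.mp this] with x hx _ using hx
        · filter_upwards with x h using absurd h hq
      filter_upwards [this] with x hx
      refine le_antisymm ?_ (csSup_le ⟨0, Or.inl rfl⟩ (hDb x))
      by_contra hc
      push Not at hc
      obtain ⟨q, hq1, hq2⟩ := exists_rat_btwn hc
      have hq0 : (0:ℝ) ≤ q := (hg0 x).trans hq1.le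
      have hxi : x ∈ interior (C q) := by
        by_contra hi
        exact hx q (by exact_mod_cast hq0) ⟨subset_closure hq2, hi⟩
      exact absurd (le_csSup (hDbd x) (Or.inr ⟨hq0, hxi⟩)) (not_le.mpr hq1)
    unfold dens
    exact withDensity_congr_ae (by filter_upwards [hae] with x hx; rw [hx])

lemma mlc_set (n : ℕ) (g : Euc n → ℝ) (hm : Measurable g) (hg : MLC g) (A B C : Set (Euc n))
    (hA : MeasurableSet A) (hB : MeasurableSet B) (hC : MeasurableSet C)
    (H : ∀ a ∈ A, ∀ b ∈ B, (1/2 : ℝ) • (a + b) ∈ C) :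
    dens n g A * dens n g B ≤ dens n g C ^ 2 := by
  unfold dens
  rw [withDensity_apply _ hA, withDensity_apply _ hB, withDensity_apply _ hC,
    ← lintegral_indicator hA, ← lintegral_indicator hB, ← lintegral_indicator hC]
  have hm' := hm.ennreal_ofReal
  refine pl_euc n _ _ _ (hm'.indicator hA) (hm'.indicator hB) (hm'.indicator hC) ?_
  intro x y
  by_cases hx : x ∈ A
  · by_cases hy : y ∈ B
    · rw [iom hx, iom hy, iom (H x hx y hy),
        ← oRm (hg.1 x), ← orp (hg.1 _)]
      exact oRl (hg.2 x y)
    · simp [hy]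
  · simp [hx]

lemma parallelogram_mid {E : Type*} [NormedAddCommGroup E] [InnerProductSpace ℝ E] (x y : E) :
    ‖(1/2 : ℝ) • (x + y)‖ ^ 2 = (‖x‖^2 + ‖y‖^2) / 2 - ‖x - y‖^2 / 4 := by
  have := parallelogram_law_with_norm ℝ x y
  rw [norm_smul]
  norm_num
  nlinarith

lemma tau_property (n : ℕ) (g : Euc n → ℝ) (hm : Measurable g) (hg : MLC g) (t : ℝ) (ht : 0 ≤ t)
    (S : Set (Euc n)) (hS : MeasurableSet S)
    (hp : IPM (dens n fun x => g x * exp (-t * ‖x‖^2 / 2))) :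
    (dens n fun x => g x * exp (-t * ‖x‖^2 / 2)) S *
      ∫⁻ x, oR (exp (t/4 * Metric.infDist x S ^ 2))
        ∂(dens n fun x => g x * exp (-t * ‖x‖^2 / 2)) ≤ 1 := by
  set ρ : Euc n → ℝ := fun x => g x * exp (-t * ‖x‖^2 / 2)
  have hρm : Measurable ρ := by fun_prop
  have hρ0 : ∀ x, 0 ≤ ρ x := fun x => mnn (hg.1 x) (epos _).le
  have hm' := hρm.ennreal_ofReal
  have h1 : ∫⁻ x, oR (ρ x) = 1 := by
    have := hp.measure_univ
    unfold dens at this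
    rwa [withDensity_apply _ MeasurableSet.univ, setLIntegral_univ] at this
  have he : Measurable fun x : Euc n => oR (exp (t/4 * Metric.infDist x S ^ 2)) := by
    fun_prop
  unfold dens
  rw [withDensity_apply _ hS, ← lintegral_indicator hS, lwd _ hm' he]
  calc _ ≤ (∫⁻ x, oR (ρ x)) ^ 2 := ?_
    _ = 1 := by rw [h1]; simp
  refine pl_euc n _ _ _ (hm'.indicator hS) (hm'.mul he) hm' ?_
  intro x y
  by_cases hx : x ∈ S
  · rw [iom hx, Pi.mul_apply, ← oRm (hρ0 y), ← oRm (hρ0 x),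
      ← orp (hρ0 _)]
    refine oRl ?_
    have hd : Metric.infDist y S ≤ ‖x - y‖ := by
      rw [← dist_eq_norm, dist_comm]; exact Metric.infDist_le_dist_of_mem hx
    have hd0 : 0 ≤ Metric.infDist y S := Metric.infDist_nonneg
    have hpm := parallelogram_mid x y
    simp only [ρ]
    calc g x * exp (-t * ‖x‖^2 / 2) * (g y * exp (-t * ‖y‖^2 / 2) * exp (t / 4 * Metric.infDist y S ^ 2))
        = (g x * g y) * exp (-t * ‖x‖^2 / 2 + -t * ‖y‖^2 / 2 + t / 4 * Metric.infDist y S ^ 2) := by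
          rw [eadd, eadd]; ring
      _ ≤ g ((1/2:ℝ) • (x+y))^2 * exp (2 * (-t * ‖(1/2:ℝ) • (x+y)‖^2 / 2)) := by
          gcongr
          · exact hg.2 x y
          · rw [hpm]
            have : t * Metric.infDist y S ^ 2 ≤ t * ‖x - y‖^2 := by gcongr
            nlinarith
      _ = _ := by rw [mul_pow, ← enm]; norm_num
  · simp [hx]
end

section
/-- working form of isotropic log-concave. -/
structure Iso (n : ℕ) (μ : Measure (Euc n)) : Prop where
  dens : ∃ g, Measurable g ∧ MLC g ∧ μ = dens n g
  prob : IPM μ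
  int : ∀ u : Euc n, Integrable (fun x => ⟪x, u⟫ ^ 2) μ
  mean : ∀ u : Euc n, ∫ x, ⟪x, u⟫ ∂μ = 0
  cov : ∀ u v : Euc n, ∫ x, ⟪x, u⟫ * ⟪x, v⟫ ∂μ = ⟪u, v⟫

lemma Iso.of {n : ℕ} {μ : Measure (Euc n)} (h : IsIsotropicLogConcave n μ) : Iso n μ := by
  obtain ⟨f, hf0, hf, hμ, hp, hm, hc⟩ := h
  have hI : ∀ u : Euc n, Integrable (fun x => ⟪x, u⟫ ^ 2) μ := by
    intro u
    by_cases hu : u = 0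
    · simp [hu]
    by_contra hni
    have := hc u u
    simp only [← sq] at this
    rw [integral_undef hni] at this
    exact hu (inner_self_eq_zero.mp this.symm)
  have hmem : ∀ u : Euc n, MemLp (fun x => ⟪x, u⟫) 2 μ := fun u =>
    (mtw fP).mpr (hI u)
  have hid : Integrable (fun x : Euc n => x) μ := by
    have : (fun x : Euc n => x) = fun x => ∑ i, ⟪x, EuclideanSpace.single i (1:ℝ)⟫ • (EuclideanSpace.single i (1:ℝ) : Euc n) := by
      ext x j
      simp [eis, Pi.single_apply]
    rw [this]
    exact igf _ fun i _ => (((hmem _).integrable nN).smul_const _)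
  refine ⟨?_, hp, hI, ?_, hc⟩
  · obtain ⟨g, h1, h2, h3⟩ := measurable_version n f hf0 hf
    exact ⟨g, h1, h2, hμ.trans h3⟩
  · intro u
    have := integral_inner (𝕜 := ℝ) hid u
    simp only [ric u]
    rw [this, hm]; simp

lemma Iso.memLp {n : ℕ} {μ : Measure (Euc n)} (h : Iso n μ) (u : Euc n) : MemLp (fun x => ⟪x, u⟫) 2 μ :=
  (mtw fP).mpr (h.int u)

lemma Iso.sq {n : ℕ} {μ : Measure (Euc n)} (h : Iso n μ) (u : Euc n) : ∫ x, ⟪x, u⟫ ^ 2 ∂μ = ‖u‖^2 := by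
  rw [← rin, ← h.cov]; simp only [_root_.sq]

lemma geo_seq (a : ℕ → ℝ) (h0 : 3/4 ≤ a 0) (h1 : a 1 ≤ 1/16) (hn : ∀ k, 0 ≤ a k) (hle : a 0 ≤ 1)
    (ha : ∀ k, a (k+1) ≤ a k)
    (H : ∀ k, a k * a (k+2) ≤ a (k+1) ^ 2) (k : ℕ) : a k ≤ (1/12)^k := by
  have key : ∀ k, a (k+1) ≤ a k / 12 := by
    intro k
    induction k with
    | zero => simp only [zero_add]; linarith
    | succ k ih =>
      rcases (hn (k+1)).eq_or_lt with h | h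
      · have := ha (k+1)
        linarith
      · have h2 := H k
        have h3 : 12 * a (k+1) ≤ a k := by linarith
        have : 12 * a (k+1) * a (k+2) ≤ a (k+1)^2 := by nlinarith [hn (k+2)]
        have : 12 * a (k+2) ≤ a (k+1) := by
          by_contra hc; push Not at hc; nlinarith
        show a (k+2) ≤ _
        linarith
  induction k with
  | zero => simpa using hle
  | succ k ih => rw [pow_succ]; have := key k; linarith

lemma Iso.cheb {n : ℕ} {μ : Measure (Euc n)} (h : Iso n μ) (u : Euc n) (hu : ‖u‖ = 1) (r : ℝ) (hr : 0 < r) :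
    μ.real {x | r ≤ |⟪x, u⟫|} ≤ 1 / r ^ 2 := by
  have := h.prob
  have h1 := mmg (μ := μ) (f := fun x => ⟪x, u⟫ ^ 2)
    (by filter_upwards with x using sqn _) (h.int u) (r^2)
  rw [h.sq, hu] at h1
  have e : {x : Euc n | r ≤ |⟪x, u⟫|} = {x | r^2 ≤ ⟪x, u⟫ ^ 2} := by
    ext x
    simp only [mem_ofPred_eq]
    rw [sq_le_sq, abs_of_pos hr]
  rw [e, le_div_iff₀ pY]
  linarith

lemma Iso.tail1 {n : ℕ} {μ : Measure (Euc n)} (h : Iso n μ) (u : Euc n) (hu : ‖u‖ = 1) (r : ℝ) (hr : 0 ≤ r) :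
    μ.real {x | r ≤ ⟪x, u⟫} ≤ 12 * exp (-r/3) := by
  have := h.prob
  obtain ⟨g, hgm, hg, hμ⟩ := h.dens
  let S : ℝ → Set (Euc n) := fun r => {x | r ≤ ⟪x, u⟫}
  have hS : ∀ r, MeasurableSet (S r) := fun r => mbl mct fP
  have hmono : ∀ r s, r ≤ s → μ.real (S s) ≤ μ.real (S r) := fun r s hrs =>
    measureReal_mono (fun x hx => le_trans hrs hx)
  have key := geo_seq (fun k : ℕ => μ.real (S (-2 + 6 * k))) ?_ ?_ (fun k => measureReal_nonneg)
    measureReal_le_one ?_ ?_ ⌊(r+2)/6⌋₊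
  · have hfl : (⌊(r+2)/6⌋₊ : ℝ) ≤ (r+2)/6 := Nat.floor_le pY
    have hfl2 : (r+2)/6 < ⌊(r+2)/6⌋₊ + 1 := Nat.lt_floor_add_one _
    refine (hmono _ _ lI).trans (key.trans ?_)
    have h12 : (1/12 : ℝ) ≤ exp (-2) := by
      rw [Real.exp_neg, one_div]
      refine inv_anti₀ (epos _) ?_
      have : exp 2 = exp 1 ^ 2 := by rw [← enm]; norm_num
      rw [this]
      nlinarith [Real.exp_one_lt_d9, epos 1]
    calc (1/12 : ℝ) ^ ⌊(r+2)/6⌋₊ ≤ exp (-2) ^ ⌊(r+2)/6⌋₊ := by gcongr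
      _ = exp (-2 * ⌊(r+2)/6⌋₊) := by rw [← enm]; ring_nf
      _ ≤ exp (2 + -r/3) := by gcongr; linarith
      _ = exp 2 * exp (-r/3) := eadd _ _
      _ ≤ 12 * exp (-r/3) := by
        gcongr
        have : exp 2 = exp 1 ^ 2 := by rw [← enm]; norm_num
        rw [this]
        nlinarith [Real.exp_one_lt_d9, epos 1]
  · have h1 := h.cheb u hu 2 nN
    have h2 : 1 ≤ μ.real (S (-2)) + μ.real {x : Euc n | 2 ≤ |⟪x, u⟫|} := by
      rw [← probReal_univ (μ := μ)]
      refine le_trans (measureReal_mono ?_) (measureReal_union_le _ _)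
      intro x _
      by_cases hx : (-2:ℝ) ≤ ⟪x, u⟫
      · exact Or.inl hx
      · right
        push Not at hx
        show (2:ℝ) ≤ |⟪x, u⟫|
        rw [abs_of_neg lI]; linarith
    simp only [Nat.cast_zero, mul_zero, add_zero]
    norm_num at h1 ⊢
    linarith
  · have h1 := h.cheb u hu 4 nN
    simp only [Nat.cast_one]
    norm_num at h1 ⊢
    refine le_trans (measureReal_mono ?_) h1
    intro x hx
    exact le_trans (show (4:ℝ) ≤ ⟪x, u⟫ from hx) (le_abs_self _)
  · intro k
    apply hmono
    push_cast; linarith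
  · intro k
    have := mlc_set n g hgm hg (S (-2 + 6 * k)) (S (-2 + 6 * (k+2 : ℕ))) (S (-2 + 6 * (k+1 : ℕ)))
      (hS _) (hS _) (hS _) ?_
    · rw [← hμ] at this
      have h3 := ENNReal.toReal_mono (by finiteness) this
      rw [ENNReal.toReal_mul, ENNReal.toReal_pow] at h3
      exact h3
    · intro a ha b hb
      have ha' : (-2 + 6 * k : ℝ) ≤ ⟪a, u⟫ := ha
      have hb' : (-2 + 6 * (k+2 : ℕ) : ℝ) ≤ ⟪b, u⟫ := hb
      show (-2 + 6 * (k+1 : ℕ) : ℝ) ≤ ⟪(1/2:ℝ) • (a + b), u⟫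
      rw [inner_smul_left, inner_add_left]
      simp only [conj_trivial]
      push_cast at *
      linarith

lemma Iso.tail {n : ℕ} {μ : Measure (Euc n)} (h : Iso n μ) (u : Euc n) (hu : ‖u‖ = 1) (r : ℝ) (hr : 0 ≤ r) :
    μ.real {x | r ≤ |⟪x, u⟫|} ≤ 24 * exp (-r/3) := by
  have := h.prob
  have h1 := h.tail1 u hu r hr
  have h2 := h.tail1 (-u) (by rwa [norm_neg]) r hr
  calc _ ≤ μ.real ({x | r ≤ ⟪x, u⟫} ∪ {x | r ≤ ⟪x, -u⟫}) := by
        refine measureReal_mono fun x hx => ?_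
        rcases le_abs.mp (show r ≤ |⟪x, u⟫| from hx) with h | h
        · exact Or.inl h
        · right; simpa [inner_neg_right] using h
    _ ≤ _ := measureReal_union_le _ _
    _ ≤ _ := by linarith

lemma exp_moment {Ω : Type*} [MeasurableSpace Ω] (μ : Measure Ω) [IPM μ] (X : Ω → ℝ)
    (hX : Measurable X) (H : ∀ r, 0 ≤ r → μ.real {x | r ≤ |X x|} ≤ 24 * exp (-r/3)) :
    ∫⁻ x, oR (exp (|X x| / 6)) ∂μ ≤ oR 300 := by
  have hpt : ∀ x, oR (exp (|X x| / 6)) ≤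
      ∑' k : ℕ, {x | (k:ℝ) ≤ |X x|}.indicator (fun _ => oR (exp ((k+1)/6))) x := by
    intro x
    refine le_trans ?_ (ENNReal.le_tsum ⌊|X x|⌋₊)
    have hx : x ∈ {y | (⌊|X x|⌋₊:ℝ) ≤ |X y|} := by
      rw [mem_ofPred_eq]; exact Nat.floor_le (abn _)
    rw [iom hx]
    refine oRl (ele.mpr ?_)
    have := (Nat.lt_floor_add_one (|X x|)).le
    linarith
  have hms : ∀ k : ℕ, MeasurableSet {x | (k:ℝ) ≤ |X x|} := fun k =>
    mbl mct fP
  calc _ ≤ ∫⁻ x, ∑' k : ℕ, {x | (k:ℝ) ≤ |X x|}.indicator (fun _ => oR (exp ((k+1)/6))) x ∂μ :=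
        lmn hpt
    _ = ∑' k : ℕ, oR (exp ((k+1)/6)) * μ {x | (k:ℝ) ≤ |X x|} := by
        rw [lintegral_tsum (fun k => (measurable_const.indicator (hms k)).aemeasurable)]
        congr 1; ext k
        rw [lintegral_indicator_const (hms k)]
    _ ≤ ∑' k : ℕ, oR (24 * exp (1/6)) * oR (exp (-1/6)) ^ k := by
        refine ENNReal.tsum_le_tsum fun k => ?_
        rw [← ofReal_measureReal, ← oRm pY, ← orp pY,
          ← oRm pY]
        refine oRl ?_
        calc _ ≤ exp ((k+1)/6) * (24 * exp (-k/3)) := by gcongr; exact H k pY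
          _ = 24 * (exp ((k+1)/6) * exp (-k/3)) := by ring
          _ = 24 * exp (1/6 + k * (-1/6)) := by rw [← eadd]; ring_nf
          _ = _ := by rw [eadd, enm]; ring
    _ = oR (24 * exp (1/6)) * (1 - oR (exp (-1/6)))⁻¹ := by
        rw [ENNReal.tsum_mul_left, ENNReal.tsum_geometric]
    _ ≤ oR 300 := by
        have h1 : exp (-1/6) ≤ 6/7 := by
          have := aoe (1/6)
          rw [show (-1/6:ℝ) = -(1/6) by norm_num, Real.exp_neg]
          rw [inv_le_comm₀ (epos _) nN]
          norm_num at this ⊢; linarith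
        have h2 : exp (1/6) ≤ 6/5 := by
          have := Real.one_sub_le_exp_neg (1/6)
          rw [Real.exp_neg] at this
          rw [← inv_inv (exp (1/6)), inv_le_comm₀ pY nN]
          norm_num at this ⊢; linarith
        rw [show (1:ℝ≥0∞) = oR 1 by simp, ← ENNReal.ofReal_sub _ pY,
          ← ENNReal.ofReal_inv_of_pos lI, ← oRm pY]
        refine oRl ?_
        calc _ ≤ 24 * (6/5) * ((1/7 : ℝ))⁻¹ := by
              have : (1 - exp (-1/6))⁻¹ ≤ ((1/7 : ℝ))⁻¹ := inv_anti₀ nN lI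
              have h0 : 0 ≤ (1 - exp (-1/6))⁻¹ := inv_nonneg.mpr lI
              gcongr
          _ ≤ 300 := by norm_num
end

section
/-- smoothness exponent. -/
abbrev smo : WithTop ℕ∞ := ((⊤ : ℕ∞) : WithTop ℕ∞)

/-- partial derivative. -/
def pd {n : ℕ} (i : Fin n) (f : Euc n → ℝ) (x : Euc n) : ℝ :=
  fderiv ℝ f x (EuclideanSpace.single i (1:ℝ))

variable {n : ℕ}

lemma pd_smooth {f : Euc n → ℝ} (hf : ContDiff ℝ smo f) (i : Fin n) : ContDiff ℝ smo (pd i f) :=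
  (hf.fderiv_right (m := smo) (by norm_cast)).clm_apply contDiff_const

lemma smo_diff {f : Euc n → ℝ} (hf : ContDiff ℝ smo f) : Differentiable ℝ f :=
  hf.differentiable (by simp)

lemma pd_cont {f : Euc n → ℝ} (hf : ContDiff ℝ smo f) (i : Fin n) : Continuous (pd i f) :=
  (pd_smooth hf i).continuous

lemma pd_cs {f : Euc n → ℝ} (hf : HCS f) (i : Fin n) : HCS (pd i f) :=
  hf.fderiv_apply (𝕜 := ℝ) _

lemma pd_mul {f g : Euc n → ℝ} (hf : ContDiff ℝ smo f) (hg : ContDiff ℝ smo g) (i : Fin n) (x : Euc n) :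
    pd i (fun x => f x * g x) x = pd i f x * g x + f x * pd i g x := by
  unfold pd
  rw [fderiv_fun_mul (smo_diff hf x) (smo_diff hg x)]
  simp; ring

lemma pd_add {f g : Euc n → ℝ} (hf : ContDiff ℝ smo f) (hg : ContDiff ℝ smo g) (i : Fin n) (x : Euc n) :
    pd i (fun x => f x + g x) x = pd i f x + pd i g x := by
  unfold pd
  rw [fderiv_fun_add (smo_diff hf x) (smo_diff hg x)]
  simp

lemma pd_sum {ι : Type*} (s : Finset ι) {f : ι → Euc n → ℝ} (hf : ∀ j, ContDiff ℝ smo (f j)) (i : Fin n) (x : Euc n) :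
    pd i (fun x => ∑ j ∈ s, f j x) x = ∑ j ∈ s, pd i (f j) x := by
  unfold pd
  rw [fderiv_fun_sum (fun j _ => smo_diff (hf j) x)]
  simp

lemma pd_exp {W : Euc n → ℝ} (hW : ContDiff ℝ smo W) (i : Fin n) (x : Euc n) :
    pd i (fun x => exp (W x)) x = pd i W x * exp (W x) := by
  unfold pd
  rw [fderiv_exp (smo_diff hW x)]
  simp; ring

lemma pd_comm {f : Euc n → ℝ} (hf : ContDiff ℝ smo f) (i j : Fin n) (x : Euc n) :
    pd i (pd j f) x = pd j (pd i f) x := by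
  have hd : DifferentiableAt ℝ (fderiv ℝ f) x :=
    ((hf.fderiv_right (m := smo) (by norm_cast)).differentiable (by simp)) x
  have h := (hf.contDiffAt (x := x)).isSymmSndFDerivAt (n := smo) (by simp [minSmoothness_of_isRCLikeNormedField]; norm_cast)
  have e : ∀ u v : Euc n, fderiv ℝ (fun y => fderiv ℝ f y u) x v = fderiv ℝ (fderiv ℝ f) x v u := by
    intro u v
    rw [fderiv_clm_apply hd (differentiableAt_const _)]
    simp
  unfold pd
  rw [e, e]
  exact h _ _

lemma ccint {f : Euc n → ℝ} (hf : Continuous f) (hc : HCS f) : Integrable f :=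
  hf.integrable_of_hasCompactSupport hc

lemma ibp {f k : Euc n → ℝ} (hf : ContDiff ℝ smo f) (hk : ContDiff ℝ smo k) (hc : HCS k) (i : Fin n) :
    ∫ x, f x * pd i k x = - ∫ x, pd i f x * k x := by
  refine integral_mul_fderiv_eq_neg_fderiv_mul_of_integrable (𝕜 := ℝ) ?_ ?_ ?_ ?_ ?_
  · exact ccint ((pd_cont hf i).mul hk.continuous) hc.mul_left
  · exact ccint (hf.continuous.mul (pd_cont hk i)) (pd_cs hc i).mul_left
  · exact ccint (hf.continuous.mul hk.continuous) hc.mul_left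
  · intro x _; exact smo_diff hf x
  · intro x _; exact smo_diff hk x

/-- the generator. -/
def LL (W h : Euc n → ℝ) (x : Euc n) : ℝ := ∑ i, (pd i (pd i h) x + pd i W x * pd i h x)

lemma LL_smooth {W h : Euc n → ℝ} (hW : ContDiff ℝ smo W) (hh : ContDiff ℝ smo h) : ContDiff ℝ smo (LL W h) :=
  ContDiff.sum fun i _ => (pd_smooth (pd_smooth hh i) i).add ((pd_smooth hW i).mul (pd_smooth hh i))

lemma LL_cs {W h : Euc n → ℝ} (hc : HCS h) : HCS (LL W h) := by
  have : LL W h = ∑ i, fun x => pd i (pd i h) x + pd i W x * pd i h x := by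
    ext x; simp [LL]
  rw [this]
  exact Finset.sum_induction _ HCS (fun _ _ => HasCompactSupport.add) HasCompactSupport.zero
    (fun i _ => (pd_cs (pd_cs hc i) i).add (pd_cs hc i).mul_left)

lemma LL_ibp {W h f : Euc n → ℝ} (hW : ContDiff ℝ smo W) (hh : ContDiff ℝ smo h) (hc : HCS h)
    (hf : ContDiff ℝ smo f) :
    ∫ x, LL W h x * f x * exp (W x) = - ∫ x, (∑ i, pd i h x * pd i f x) * exp (W x) := by
  have he : ContDiff ℝ smo fun x => exp (W x) := hW.exp
  have hce := he.continuous
  have key : ∀ i, ∫ x, (pd i (pd i h) x + pd i W x * pd i h x) * f x * exp (W x)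
      = - ∫ x, pd i h x * pd i f x * exp (W x) := by
    intro i
    have h1 := ibp (hf.mul he) (pd_smooth hh i) (pd_cs hc i) i
    have e1 : ∀ x, pd i (fun x => f x * exp (W x)) x * pd i h x
        = pd i h x * pd i f x * exp (W x) + pd i W x * pd i h x * f x * exp (W x) := by
      intro x
      rw [pd_mul hf he, pd_exp hW]; ring
    have h1' : ∫ x, (f x * exp (W x)) * pd i (pd i h) x = - ∫ x, pd i (fun x => f x * exp (W x)) x * pd i h x := h1
    simp only [e1] at h1'
    have c1 := pd_cont hh i
    have c2 := pd_cont hf i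
    have c3 := pd_cont hW i
    have c4 := hf.continuous
    have c5 := pd_cont (pd_smooth hh i) i
    rw [iad] at h1'
    · have : ∀ x, (pd i (pd i h) x + pd i W x * pd i h x) * f x * exp (W x)
        = (f x * exp (W x)) * pd i (pd i h) x + pd i W x * pd i h x * f x * exp (W x) := by
        intro x; ring
      simp only [this]
      rw [iad, h1']
      · ring
      · exact ccint fP (pd_cs (pd_cs hc i) i).mul_left
      · exact ccint fP ((pd_cs hc i).mul_left.mul_right.mul_right)
    · exact ccint fP ((pd_cs hc i).mul_right.mul_right)
    · exact ccint fP ((pd_cs hc i).mul_left.mul_right.mul_right)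
  unfold LL
  simp only [fsm]
  rw [ifs, ifs, ← Finset.sum_neg_distrib]
  · exact fsc rfl fun i _ => key i
  · intro i _
    have c1 := pd_cont hh i
    have c2 := pd_cont hf i
    exact ccint fP ((pd_cs hc i).mul_right.mul_right)
  · intro i _
    have c1 := pd_cont hh i
    have c3 := pd_cont hW i
    have c4 := hf.continuous
    have c5 := pd_cont (pd_smooth hh i) i
    exact ccint fP (((pd_cs (pd_cs hc i) i).add (pd_cs hc i).mul_left).mul_right.mul_right)

lemma pd_LL {W h : Euc n → ℝ} (hW : ContDiff ℝ smo W) (hh : ContDiff ℝ smo h) (j : Fin n) (x : Euc n) :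
    pd j (LL W h) x = LL W (pd j h) x + ∑ i, pd j (pd i W) x * pd i h x := by
  unfold LL
  rw [pd_sum _ (fun i => (pd_smooth (pd_smooth hh i) i).add ((pd_smooth hW i).mul (pd_smooth hh i))),
    ← fad]
  refine fsc rfl fun i _ => ?_
  rw [pd_add (pd_smooth (pd_smooth hh i) i) ((pd_smooth hW i).mul (pd_smooth hh i)),
    pd_mul (pd_smooth hW i) (pd_smooth hh i), pd_comm (pd_smooth hh i), pd_comm hh j i]
  have : (pd j (pd i h)) = pd i (pd j h) := funext fun y => pd_comm hh j i y
  rw [this]; ring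

lemma bochner {W h : Euc n → ℝ} (hW : ContDiff ℝ smo W) (hh : ContDiff ℝ smo h) (hc : HCS h) :
    ∫ x, LL W h x ^ 2 * exp (W x) = (∑ j, ∫ x, (∑ i, pd i (pd j h) x ^ 2) * exp (W x))
      - ∫ x, (∑ j, ∑ i, pd j (pd i W) x * pd i h x * pd j h x) * exp (W x) := by
  have h1 := LL_ibp hW hh hc (LL_smooth hW hh)
  have h2 : ∀ j, ∫ x, LL W (pd j h) x * pd j h x * exp (W x)
    = - ∫ x, (∑ i, pd i (pd j h) x ^ 2) * exp (W x) := by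
    intro j
    rw [LL_ibp hW (pd_smooth hh j) (pd_cs hc j) (pd_smooth hh j)]
    simp only [sq]
  simp only [sq] at *
  rw [h1]
  have e : ∀ x, (∑ j, pd j h x * pd j (LL W h) x) * exp (W x) =
      (∑ j, LL W (pd j h) x * pd j h x * exp (W x)) +
      (∑ j, ∑ i, pd j (pd i W) x * pd i h x * pd j h x) * exp (W x) := by
    intro x
    rw [← fsm, ← add_mul, ← fad]
    congr 1
    refine fsc rfl fun j _ => ?_
    rw [pd_LL hW hh, mul_add, fms, mul_comm]
    congr 1
    exact fsc rfl fun i _ => by ring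
  have hce := hW.continuous
  simp only [e]
  rw [iad, ifs, fsc rfl (fun j _ => h2 j), Finset.sum_neg_distrib]
  · ring
  · intro j _
    have := (LL_smooth hW (pd_smooth hh j)).continuous
    have := pd_cont hh j
    exact ccint fP (pd_cs hc j).mul_left.mul_right
  · refine igf _ fun j _ => ?_
    have := (LL_smooth hW (pd_smooth hh j)).continuous
    have := pd_cont hh j
    exact ccint fP (pd_cs hc j).mul_left.mul_right
  · have c : ∀ i, Continuous (pd i h) := pd_cont hh
    have c' : ∀ i j, Continuous (pd j (pd i W)) := fun i j => pd_cont (pd_smooth hW i) j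
    simp only [fsm]
    refine igf _ fun j _ => igf _ fun i _ => ?_
    have := c i; have := c j; have := c' i j
    exact ccint fP (pd_cs hc j).mul_left.mul_right

lemma fderiv_eq_sum {f : Euc n → ℝ} (x ξ : Euc n) : fderiv ℝ f x ξ = ∑ i, ξ i * pd i f x := by
  have : ξ = ∑ i, ξ i • (EuclideanSpace.single i (1:ℝ) : Euc n) := by
    ext j; simp [Pi.single_apply]
  conv_lhs => rw [this]
  simp [pd]

lemma line_deriv {f : Euc n → ℝ} (hf : ContDiff ℝ smo f) (x ξ : Euc n) (s : ℝ) :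
    HasDerivAt (fun s : ℝ => f (x + s • ξ)) (∑ i, ξ i * pd i f (x + s • ξ)) s := by
  rw [← fderiv_eq_sum]
  have h1 : HasDerivAt (fun s : ℝ => x + s • ξ) ξ s := by
    simpa using ((hasDerivAt_id s).smul_const ξ).const_add x
  exact (smo_diff hf (x + s • ξ)).hasFDerivAt.comp_hasDerivAt s h1

/-- midpoint strong concavity. -/
def SCv (t : ℝ) (W : Euc n → ℝ) : Prop :=
  ∀ x y, W x + W y + t / 4 * ‖x - y‖^2 ≤ 2 * W ((1/2:ℝ) • (x + y))

lemma hess_bound {W : Euc n → ℝ} (hW : ContDiff ℝ smo W) (t : ℝ) (hs : SCv t W) (x ξ : Euc n) :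
    t * ∑ i, ξ i ^ 2 ≤ - ∑ j, ∑ i, pd j (pd i W) x * ξ i * ξ j := by
  let k : ℝ → ℝ := fun s => W (x + s • ξ) + W (x + s • (-ξ)) + t * s^2 * ‖ξ‖^2
  let k1 : ℝ → ℝ := fun s => ∑ i, ξ i * pd i W (x + s • ξ) + ∑ i, (-ξ) i * pd i W (x + s • (-ξ)) + 2 * t * s * ‖ξ‖^2
  have hk : ∀ s, HasDerivAt k (k1 s) s := by
    intro s
    have h3 : HasDerivAt (fun s : ℝ => t * s^2 * ‖ξ‖^2) (2 * t * s * ‖ξ‖^2) s := by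
      have := ((hasDerivAt_pow 2 s).const_mul t).mul_const (‖ξ‖^2)
      exact this.congr_deriv (by push_cast; ring)
    exact ((line_deriv hW x ξ s).add (line_deriv hW x (-ξ) s)).add h3
  let Q := ∑ j, ∑ i, pd j (pd i W) x * ξ i * ξ j
  have hk1 : HasDerivAt k1 (2 * Q + 2 * t * ‖ξ‖^2) 0 := by
    have a1 : ∀ η : Euc n, HasDerivAt (fun s : ℝ => ∑ i, η i * pd i W (x + s • η))
        (∑ i, η i * ∑ j, η j * pd j (pd i W) (x + (0:ℝ) • η)) 0 := fun η =>
      HasDerivAt.fun_sum fun i _ => (line_deriv (pd_smooth hW i) x η 0).const_mul _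
    have h3 : HasDerivAt (fun s : ℝ => 2 * t * s * ‖ξ‖^2) (2 * t * ‖ξ‖^2) 0 := by
      have := ((hasDerivAt_id (0:ℝ)).const_mul (2 * t)).mul_const (‖ξ‖^2)
      simpa using this
    refine (((a1 ξ).add (a1 (-ξ))).add h3).congr_deriv ?_
    simp only [zero_smul, add_zero, PiLp.neg_apply, neg_mul, fms, mul_neg, Finset.sum_neg_distrib, neg_neg, ← two_mul]
    congr 1
    simp only [Q, fms]
    rw [fco]
    exact fsc rfl fun i _ => fsc rfl fun j _ => by ring
  have hle : ∀ s, k s ≤ k 0 := by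
    intro s
    have := hs (x + s • ξ) (x + s • (-ξ))
    have e1 : (1/2:ℝ) • (x + s • ξ + (x + s • (-ξ))) = x := by
      module
    have e2 : (x + s • ξ) - (x + s • (-ξ)) = (2*s) • ξ := by module
    rw [e1, e2, norm_smul, mul_pow, rna, sq_abs] at this
    simp only [k, zero_smul, add_zero]
    nlinarith
  have hd1 : deriv k = k1 := funext fun s => (hk s).deriv
  have hnorm : ‖ξ‖^2 = ∑ i, ξ i^2 := by rw [ens]; simp
  by_contra hcon
  push Not at hcon
  have hpos : 2 * Q + 2 * t * ‖ξ‖^2 > 0 := by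
    rw [hnorm]; simp only [Q]; linarith
  have hmin := isLocalMin_of_deriv_deriv_pos (f := k) (x₀ := 0) (by rw [hd1, hk1.deriv]; exact hpos)
    (by rw [hd1]; simp [k1]) (hk 0).continuousAt
  have hev : k =ᶠ[nhds 0] fun _ => k 0 := by
    filter_upwards [hmin] with s hs' using le_antisymm (hle s) hs'
  have h2 : k1 =ᶠ[nhds 0] fun _ => 0 := by
    have := hev.deriv
    rw [hd1] at this
    simpa using this
  have h3 : deriv k1 0 = 0 := by
    have := h2.deriv.self_of_nhds
    simpa using this
  rw [hk1.deriv] at h3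
  linarith
end

section
variable {n : ℕ}

/-- mollification. -/
def mol (ψ w : Euc n → ℝ) (x : Euc n) : ℝ := ∫ z, ψ z * w (x - z)

lemma mol_eq (ψ w : Euc n → ℝ) : mol ψ w = MeasureTheory.convolution ψ w (ContinuousLinearMap.lsmul ℝ ℝ) volume := by
  ext x; simp [mol, MeasureTheory.convolution]

lemma mol_smooth {ψ w : Euc n → ℝ} (hψ : ContDiff ℝ smo ψ) (hc : HCS ψ) (hw : LocallyIntegrable w) :
    ContDiff ℝ smo (mol ψ w) := by
  rw [mol_eq]; exact hc.contDiff_convolution_left _ hψ hw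

lemma pd_flip {φ : Euc n → ℝ} (hφ : ContDiff ℝ smo φ) (i : Fin n) (x y : Euc n) :
    pd i (fun y => φ (x - y)) y = - pd i φ (x - y) := by
  unfold pd
  have h1 : HasFDerivAt φ (fderiv ℝ φ (x - y)) (x - y) := (smo_diff hφ _).hasFDerivAt
  have h2 : HasFDerivAt (fun y : Euc n => x - y) (-(ContinuousLinearMap.id ℝ (Euc n))) y := by
    simpa using (hasFDerivAt_id y).const_sub x
  have := h1.comp y h2
  rw [show (fun y => φ (x - y)) = φ ∘ (fun y => x - y) from rfl, this.fderiv]; simp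

lemma pd_shift {φ : Euc n → ℝ} (i : Fin n) (x y : Euc n) :
    pd i (fun y => φ (y + x)) y = pd i φ (y + x) := by
  unfold pd; rw [fderiv_comp_add_right]

lemma const_of_weak {g : Euc n → ℝ} (hg : LocallyIntegrable g)
    (h0 : ∀ ζ : Euc n → ℝ, ContDiff ℝ smo ζ → HCS ζ → ∀ i, ∫ x, g x * pd i ζ x = 0) :
    ∃ c, g =ᵐ[volume] fun _ => c := by
  let φ : ℕ → ContDiffBump (0 : Euc n) := fun k => ⟨1/((k:ℝ)+1), 2 * (1/((k:ℝ)+1)), by positivity, by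
    have : 0 < 1/((k:ℝ)+1) := by positivity
    linarith⟩
  have hlim : Filter.Tendsto (fun k => (φ k).rOut) Filter.atTop (nhds 0) := by
    have := (tendsto_one_div_add_atTop_nhds_zero_nat (𝕜 := ℝ)).const_mul 2
    rwa [mul_zero] at this
  have hae := ContDiffBump.ae_convolution_tendsto_right_of_locallyIntegrable (K := 2) hlim
    (Eof fun k => le_refl _) hg
  have hconst : ∀ k, ∃ c, ∀ x, mol ((φ k).normed volume) g x = c := by
    intro k
    set ψ := (φ k).normed volume with hψ
    have hs : ContDiff ℝ smo ψ := (φ k).contDiff_normed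
    have hcs : HCS ψ := (φ k).hasCompactSupport_normed
    have hd : ∀ x, HasFDerivAt (mol ψ g) (0 : Euc n →L[ℝ] ℝ) x := by
      intro x
      rw [mol_eq]
      have h1 := hcs.hasFDerivAt_convolution_left (ContinuousLinearMap.lsmul ℝ ℝ) (hs.of_le (by norm_cast)) hg x
      have hce : ConvolutionExistsAt (fderiv ℝ ψ) g x ((ContinuousLinearMap.lsmul ℝ ℝ).precompL (Euc n)) volume :=
        (hcs.fderiv (𝕜 := ℝ)).convolutionExists_left _ (hs.continuous_fderiv (by simp)) hg x
      have : ∀ i, (MeasureTheory.convolution (fderiv ℝ ψ) g ((ContinuousLinearMap.lsmul ℝ ℝ).precompL (Euc n)) volume x)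
          (EuclideanSpace.single i (1:ℝ)) = 0 := by
        intro i
        unfold MeasureTheory.convolution
        rw [ContinuousLinearMap.integral_apply hce]
        have h2 := h0 (fun y => ψ (x - y)) (hs.comp (contDiff_const.sub contDiff_id))
          (hcs.comp_homeomorph (Homeomorph.subLeft x)) i
        have h3 := integral_sub_left_eq_self (fun t => g t * pd i (fun y => ψ (x - y)) t) volume x
        rw [h2] at h3
        rw [← neg_eq_zero, ← h3, ← integral_neg]
        refine ica (Eof fun t => ?_)
        simp [pd_flip hs]
        simp [pd]; ring
      have hz : (MeasureTheory.convolution (fderiv ℝ ψ) g ((ContinuousLinearMap.lsmul ℝ ℝ).precompL (Euc n)) volume x) = 0 := by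
       refine ContinuousLinearMap.ext fun v => ?_
       have hv : v = ∑ i, v i • (EuclideanSpace.single i (1:ℝ) : Euc n) := by
        ext j; simp [Finset.sum_apply, Pi.single_apply]
       rw [hv, map_sum]
       simp [this]
      rwa [hz] at h1
    refine ⟨mol ψ g 0, fun x => ?_⟩
    exact is_const_of_fderiv_eq_zero (𝕜 := ℝ) (fun x => (hd x).differentiableAt) (fun x => (hd x).fderiv) x 0
  choose c hc using hconst
  have hae' : ∀ᵐ x : Euc n, Filter.Tendsto c Filter.atTop (nhds (g x)) := by
    filter_upwards [hae] with x hx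
    have : (fun k => MeasureTheory.convolution ((φ k).normed volume) g (ContinuousLinearMap.lsmul ℝ ℝ) volume x) = c := by
      ext k; rw [← mol_eq]; exact hc k x
    rwa [this] at hx
  obtain ⟨x0, hx0⟩ := hae'.exists
  exact ⟨g x0, by filter_upwards [hae'] with x hx; exact tendsto_nhds_unique hx hx0⟩

lemma fub_int {ψ w : Euc n → ℝ} (hψ : Continuous ψ) (hc : HCS ψ) (hw : Integrable w) :
    Integrable (fun p : Euc n × Euc n => ψ p.2 * w (p.1 - p.2)) (volume.prod volume) := by
  simpa using (ccint hψ hc).convolution_integrand (ContinuousLinearMap.lsmul ℝ ℝ) hw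

lemma fub {ψ w k : Euc n → ℝ} (hψ : Continuous ψ) (hc : HCS ψ) (hw : Integrable w)
    (hk : Continuous k) (hkc : HCS k) :
    ∫ z, ψ z * ∫ y, k (y + z) * w y = ∫ x, k x * mol ψ w x := by
  have hi := fub_int hψ hc hw
  obtain ⟨C, hC⟩ := hkc.exists_bound_of_continuous hk
  have hi2 : Integrable (fun p : Euc n × Euc n => k p.1 * (ψ p.2 * w (p.1 - p.2))) (volume.prod volume) :=
    hi.bdd_mul (c := C) (hk.comp continuous_fst).aestronglyMeasurable (Eof fun p => hC _)
  have hs := integral_integral_swap (f := fun x z => k x * (ψ z * w (x - z))) hi2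
  simp only [mol, ← icm]
  rw [hs]
  refine ica (Eof fun z => ?_)
  show ∫ y, ψ z * (k (y + z) * w y) = ∫ x, k x * (ψ z * w (x - z))
  rw [← integral_sub_right_eq_self (fun y => ψ z * (k (y + z) * w y)) z]
  refine ica (Eof fun y => ?_)
  simp; ring

lemma unif_loc {F : Type*} [NormedAddCommGroup F] {f : Euc n → F} (hf : Continuous f) (r η : ℝ) (hη : 0 < η) :
    ∃ ε, 0 < ε ∧ ε ≤ 1 ∧ ∀ x, ‖x‖ ≤ r → ∀ z, ‖z‖ ≤ ε → ‖f x - f (x - z)‖ ≤ η := by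
  have h := (isCompact_closedBall (0 : Euc n) (r+1)).uniformContinuousOn_of_continuous hf.continuousOn
  rw [Metric.uniformContinuousOn_iff] at h
  obtain ⟨δ, hδ, h⟩ := h η hη
  refine ⟨min 1 (δ/2), by positivity, min_le_left _ _, fun x hx z hz => ?_⟩
  have h1 : ‖z‖ ≤ 1 := hz.trans (min_le_left _ _)
  have h2 : ‖z‖ ≤ δ/2 := hz.trans (min_le_right _ _)
  rw [← dist_eq_norm]
  refine (h x (by simp; linarith) (x - z) ?_ (by simp; linarith)).le
  simp; linarith [norm_sub_le x z]

end

section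
variable {n : ℕ}

lemma fub2 {ψ w k : Euc n → ℝ} (hψ : Continuous ψ) (hc : HCS ψ) (hw : Integrable w)
    (hk : Continuous k) (hkc : HCS k) :
    Integrable (fun z => ψ z * ∫ y, k (y + z) * w y) := by
  have hi := fub_int hψ hc hw
  obtain ⟨C, hC⟩ := hkc.exists_bound_of_continuous hk
  have hi2 : Integrable (fun p : Euc n × Euc n => k p.1 * (ψ p.2 * w (p.1 - p.2))) (volume.prod volume) :=
    hi.bdd_mul (c := C) (hk.comp continuous_fst).aestronglyMeasurable (Eof fun p => hC _)
  have := hi2.swap.integral_prod_left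
  refine this.congr (Eof fun z => ?_)
  show ∫ x, k x * (ψ z * w (x - z)) = ψ z * ∫ y, k (y + z) * w y
  rw [← icm, ← integral_sub_right_eq_self (fun y => ψ z * (k (y + z) * w y)) z]
  refine ica (Eof fun y => ?_)
  simp; ring

lemma pd_supp {h : Euc n → ℝ} {r : ℝ} (hr : ∀ x, h x ≠ 0 → ‖x‖ ≤ r) (i : Fin n) (x : Euc n) (hx : pd i h x ≠ 0) :
    ‖x‖ ≤ r := by
  have h1 : tsupport h ⊆ Metric.closedBall 0 r :=
    closure_minimal (fun x hx => by simpa using hr x hx) Metric.isClosed_closedBall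
  have h2 : x ∈ tsupport h := by
    by_contra hc
    apply hx
    unfold pd
    have : x ∉ Function.support (fderiv ℝ h) := fun h3 => hc (support_fderiv_subset ℝ h3)
    rw [Function.notMem_support.1 this]; simp
  simpa using h1 h2

/-- weak equation for the mollified function -/
lemma weak_mol {W u ψ h : Euc n → ℝ} {r : ℝ} (hW : ContDiff ℝ smo W) (hu : Integrable u)
    (h0 : ∀ h : Euc n → ℝ, ContDiff ℝ smo h → HCS h → ∫ x, LL W h x * u x = 0)
    (hψ : ContDiff ℝ smo ψ) (hψc : HCS ψ) (hψ1 : ∀ z, ψ z ≠ 0 → ‖z‖ ≤ 1)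
    (hh : ContDiff ℝ smo h) (hhc : HCS h) (hr : ∀ x, h x ≠ 0 → ‖x‖ ≤ r) :
    ∫ x, ∑ i, pd i h x * (pd i (fun x => exp (-W x) * mol ψ u x) x * exp (W x) +
      (pd i W x * mol ψ u x - mol ψ ((Metric.closedBall (0 : Euc n) (r+1)).indicator (fun y => pd i W y * u y)) x)) = 0 := by
  set w : Fin n → Euc n → ℝ := fun i => (Metric.closedBall (0 : Euc n) (r+1)).indicator (fun y => pd i W y * u y) with hw
  set m := mol ψ u with hm
  set v : Euc n → ℝ := fun x => exp (-W x) * m x with hv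
  have hwi : ∀ i, Integrable (w i) := by
    intro i
    rw [hw]; simp only
    rw [integrable_indicator_iff Metric.isClosed_closedBall.measurableSet]
    obtain ⟨C, hC⟩ := (isCompact_closedBall (0 : Euc n) (r+1)).exists_bound_of_continuousOn (pd_cont hW i).continuousOn
    refine Integrable.bdd_mul (c := C) hu.integrableOn (pd_cont hW i).aestronglyMeasurable ?_
    exact (ae_restrict_iff' Metric.isClosed_closedBall.measurableSet).2 (Eof fun x hx => hC x hx)
  have hms : ContDiff ℝ smo m := mol_smooth hψ hψc hu.locallyIntegrable
  have hmw : ∀ i, ContDiff ℝ smo (mol ψ (w i)) := fun i => mol_smooth hψ hψc (hwi i).locallyIntegrable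
  have hvs : ContDiff ℝ smo v := (hW.neg.exp).mul hms
  have hD : ∀ i, Continuous (pd i (pd i h)) := fun i => pd_cont (pd_smooth hh i) i
  have hp : ∀ i, Continuous (pd i h) := fun i => pd_cont hh i
  have hDc : ∀ i, HCS (pd i (pd i h)) := fun i => pd_cs (pd_cs hhc i) i
  have hpc : ∀ i, HCS (pd i h) := fun i => pd_cs hhc i
  -- pointwise in z
  have hz : ∀ z, ∑ i, (ψ z * (∫ y, pd i (pd i h) (y + z) * u y) + ψ z * ∫ y, pd i h (y + z) * w i y) = 0 := by
    intro z
    by_cases hψz : ψ z = 0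
    · simp [hψz]
    have hz1 := hψ1 z hψz
    have e := h0 (fun y => h (y + z)) (hh.comp (contDiff_id.add contDiff_const)) (hhc.comp_homeomorph (Homeomorph.addRight z))
    have e2 : ∀ y, LL W (fun y => h (y + z)) y * u y = ∑ i, (pd i (pd i h) (y + z) * u y + pd i h (y + z) * w i y) := by
      intro y
      unfold LL
      rw [fsm]
      refine fsc rfl fun i _ => ?_
      have e3 : pd i (fun y => h (y + z)) = fun y => pd i h (y + z) := funext fun y => pd_shift i z y
      rw [e3, pd_shift, add_mul]
      congr 1
      by_cases hx : pd i h (y + z) = 0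
      · simp [hx]
      have := pd_supp hr i _ hx
      have hy : y ∈ Metric.closedBall (0 : Euc n) (r+1) := by
        have := norm_sub_le (y + z) z
        simp at this ⊢; linarith
      rw [hw]; simp only [iom hy]; ring
    simp only [e2] at e
    have b1 : ∀ (k : Euc n → ℝ) (w : Euc n → ℝ), Continuous k → HCS k → Integrable w →
        Integrable fun y => k (y + z) * w y := by
      intro k w hk hkc hw
      obtain ⟨C, hC⟩ := hkc.exists_bound_of_continuous hk
      exact hw.bdd_mul (c := C) (hk.comp fP).aestronglyMeasurable (Eof fun p => hC _)
    rw [ifs _ (fun i _ => (b1 _ _ (hD i) (hDc i) hu).fun_add (b1 _ _ (hp i) (hpc i) (hwi i)))] at e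
    simp only [← mul_add, ← fms]
    rw [mul_eq_zero]; right
    rw [← e]
    refine fsc rfl fun i _ => ?_
    rw [iad (b1 _ _ (hD i) (hDc i) hu) (b1 _ _ (hp i) (hpc i) (hwi i))]
  have hψ' := hψ.continuous
  have h1 : ∑ i, ((∫ x, pd i (pd i h) x * m x) + ∫ x, pd i h x * mol ψ (w i) x) = 0 := by
    have : ∫ z, ∑ i, (ψ z * (∫ y, pd i (pd i h) (y + z) * u y) + ψ z * ∫ y, pd i h (y + z) * w i y) = 0 := by
      simp [hz]
    rw [ifs _ (fun i _ => (fub2 hψ' hψc hu (hD i) (hDc i)).fun_add (fub2 hψ' hψc (hwi i) (hp i) (hpc i)))] at this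
    rw [← this]
    refine fsc rfl fun i _ => ?_
    rw [iad (fub2 hψ' hψc hu (hD i) (hDc i)) (fub2 hψ' hψc (hwi i) (hp i) (hpc i)),
      fub hψ' hψc hu (hD i) (hDc i), fub hψ' hψc (hwi i) (hp i) (hpc i)]
  have h2 := LL_ibp hW hh hhc hvs
  have e1 : ∀ x, v x * exp (W x) = m x := by
    intro x; rw [hv]; simp only; rw [mul_right_comm, ← eadd]; simp
  simp only [mul_assoc, e1] at h2
  have hWc := fun i => pd_cont hW i
  have hvc := fun i => pd_cont hvs i
  have hec : Continuous fun x => exp (W x) := hW.continuous.rexp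
  have hmc := hms.continuous
  have hmwc := fun i => (hmw i).continuous
  have i1 : ∀ i, Integrable fun x => pd i (pd i h) x * m x := fun i => ccint ((hD i).mul hmc) (hDc i).mul_right
  have i2 : ∀ i, Integrable fun x => pd i h x * (pd i W x * m x) := fun i => ccint ((hp i).mul ((hWc i).mul hmc)) (hpc i).mul_right
  have i3 : ∀ i, Integrable fun x => pd i h x * mol ψ (w i) x := fun i => ccint ((hp i).mul (hmwc i)) (hpc i).mul_right
  have i4 : ∀ i, Integrable fun x => pd i h x * (pd i v x * exp (W x)) :=
    fun i => ccint ((hp i).mul ((hvc i).mul hec)) (hpc i).mul_right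
  have h3 : ∫ x, LL W h x * m x = ∑ i, ((∫ x, pd i (pd i h) x * m x) + ∫ x, pd i h x * (pd i W x * m x)) := by
    unfold LL
    simp only [fsm, add_mul]
    rw [ifs]
    · refine fsc rfl fun i _ => ?_
      rw [← iad (i1 i) (i2 i)]
      congr 1; ext x; ring
    · intro i _
      refine ((i1 i).add (i2 i)).congr (Eof fun x => ?_)
      simp; ring
  have h4 : ∫ x, (∑ i, pd i h x * pd i v x) * exp (W x) = ∑ i, ∫ x, pd i h x * (pd i v x * exp (W x)) := by
    rw [← ifs _ fun i _ => i4 i]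
    congr 1; ext x; rw [fsm]; simp only [mul_assoc]
  rw [h3, h4] at h2
  rw [ifs]
  · rw [fad] at h1 h2
    have : ∀ i, ∫ x, pd i h x * (pd i v x * exp (W x) + (pd i W x * m x - mol ψ (w i) x))
        = (∫ x, pd i h x * (pd i v x * exp (W x))) + (∫ x, pd i h x * (pd i W x * m x)) - ∫ x, pd i h x * mol ψ (w i) x := by
      intro i
      rw [← iad (i4 i) (i2 i), ← isb ((i4 i).fun_add (i2 i)) (i3 i)]
      congr 1; ext x; ring
    rw [fsc rfl fun i _ => this i, fsd, fad]
    linarith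
  · intro i _
    refine (((i4 i).add (i2 i)).sub (i3 i)).congr (Eof fun x => ?_)
    simp; ring

lemma jens {ψ u q : Euc n → ℝ} {ρ : ℝ} {x : Euc n} (hψ0 : ∀ z, 0 ≤ ψ z) (hψ : Continuous ψ) (hψc : HCS ψ)
    (hψ1 : ∫ z, ψ z = 1) (hu : Integrable u) (hq : Integrable q)
    (hb : ∀ z, ψ z ≠ 0 → u (x - z) ^ 2 ≤ 2 * ρ * q (x - z)) :
    (∫ z, ψ z * |u (x - z)|) ^ 2 ≤ 2 * ρ * mol ψ q x := by
  obtain ⟨C, hC⟩ := hψc.exists_bound_of_continuous hψ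
  have b : ∀ w : Euc n → ℝ, Integrable w → Integrable fun z => ψ z * w (x - z) := fun w hw =>
    (hw.comp_sub_left x).bdd_mul (c := C) hψ.aestronglyMeasurable (Eof fun p => hC _)
  set a := ∫ z, ψ z * |u (x - z)| with ha
  have ha0 : 0 ≤ a := inn fun z => mnn (hψ0 z) (abn _)
  have h1 : ∫ z, ψ z * (2 * a * |u (x - z)|) ≤ ∫ z, (ψ z * a ^ 2 + 2 * ρ * (ψ z * q (x - z))) := by
    refine imn ?_ ?_ fun z => ?_
    · exact ((b _ hu.abs).const_mul (2 * a)).congr (Eof fun z => by simp; ring)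
    · exact ((ccint hψ hψc).mul_const _).add ((b q hq).const_mul _)
    · by_cases hz : ψ z = 0
      · simp [hz]
      · have := hb z hz
        have h2 : 2 * a * |u (x - z)| ≤ a ^ 2 + 2 * ρ * q (x - z) := by
          nlinarith [sqn (a - |u (x - z)|), sq_abs (u (x - z))]
        simp only
        nlinarith [mll h2 (hψ0 z)]
  rw [iad ((ccint hψ hψc).mul_const _) ((b q hq).const_mul _), integral_mul_const, hψ1, icm] at h1
  have e : ∫ z, ψ z * (2 * a * |u (x - z)|) = 2 * a * a := by
    calc _ = ∫ z, 2 * a * (ψ z * |u (x - z)|) := by congr 1; ext z; ring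
      _ = _ := icm _ _
  rw [e] at h1
  unfold mol
  nlinarith

set_option maxHeartbeats 1000000 in
lemma energy {W g ψ χ : Euc n → ℝ} {r κ ω : ℝ} (hW : ContDiff ℝ smo W) (hu : Integrable fun x => g x * exp (W x))
    (hq : Integrable fun x => g x ^ 2 * exp (W x))
    (h0 : ∀ h : Euc n → ℝ, ContDiff ℝ smo h → HCS h → ∫ x, LL W h x * (g x * exp (W x)) = 0)
    (hψ : ContDiff ℝ smo ψ) (hψc : HCS ψ) (hψ1 : ∀ z, ψ z ≠ 0 → ‖z‖ ≤ 1)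
    (hψ0 : ∀ z, 0 ≤ ψ z) (hψi : ∫ z, ψ z = 1)
    (hloc : ∀ x z, ‖x‖ ≤ r → ψ z ≠ 0 → W (x - z) ≤ W x + Real.log 2 ∧ ∀ i, |pd i W x - pd i W (x - z)| ≤ ω)
    (hχ : ContDiff ℝ smo χ) (hχc : HCS χ) (hχr : ∀ x, χ x ≠ 0 → ‖x‖ ≤ r) (hχ1 : ∀ x, |χ x| ≤ 1)
    (hχd : ∀ i x, |pd i χ x| ≤ κ) :
    ∫ x, ∑ i, χ x ^ 2 * exp (W x) * pd i (fun x => exp (-W x) * mol ψ (fun x => g x * exp (W x)) x) x ^ 2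
      ≤ n * (20 * κ ^ 2 + 8 * ω ^ 2) * ∫ x, g x ^ 2 * exp (W x) := by
  set u : Euc n → ℝ := fun x => g x * exp (W x) with hud
  set q : Euc n → ℝ := fun x => g x ^ 2 * exp (W x) with hqd
  set m := mol ψ u with hm
  set v : Euc n → ℝ := fun x => exp (-W x) * m x with hv
  set K := Metric.closedBall (0 : Euc n) (r+1) with hK
  set w : Fin n → Euc n → ℝ := fun i => K.indicator (fun y => pd i W y * u y) with hw
  set E : Fin n → Euc n → ℝ := fun i x => pd i W x * m x - mol ψ (w i) x with hE
  have hms : ContDiff ℝ smo m := mol_smooth hψ hψc hu.locallyIntegrable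
  have hvs : ContDiff ℝ smo v := (hW.neg.exp).mul hms
  set h : Euc n → ℝ := fun x => χ x * χ x * v x with hh
  have hhs : ContDiff ℝ smo h := (hχ.mul hχ).mul hvs
  have hhc : HCS h := hχc.mul_right.mul_right
  have key := weak_mol hW hu h0 hψ hψc hψ1 hhs hhc (r := r) (fun x hx => hχr x (by
    intro h1; apply hx; rw [hh]; simp [h1]))
  have hwi : ∀ i, Integrable (w i) := by
    intro i
    rw [hw]; simp only
    rw [integrable_indicator_iff Metric.isClosed_closedBall.measurableSet]
    obtain ⟨C, hC⟩ := (isCompact_closedBall (0 : Euc n) (r+1)).exists_bound_of_continuousOn (pd_cont hW i).continuousOn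
    refine Integrable.bdd_mul (c := C) hu.integrableOn (pd_cont hW i).aestronglyMeasurable ?_
    exact (ae_restrict_iff' Metric.isClosed_closedBall.measurableSet).2 (Eof fun x hx => hC x hx)
  have hEc : ∀ i, Continuous (E i) := fun i =>
    ((pd_cont hW i).mul hms.continuous).sub (mol_smooth hψ hψc (hwi i).locallyIntegrable).continuous
  have hj : ∀ x, ‖x‖ ≤ r → (∫ z, ψ z * |u (x - z)|) ^ 2 ≤ 2 * exp (W x) * mol ψ q x := by
    intro x hx
    refine jens hψ0 hψ.continuous hψc hψi hu hq fun z hz => ?_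
    have h1 := (hloc x z hx hz).1
    have h2 : exp (W (x - z)) ≤ 2 * exp (W x) := by
      calc _ ≤ exp (W x + Real.log 2) := ele.2 h1
        _ = _ := by rw [eadd, Real.exp_log nN]; ring
    have h3 : 0 ≤ q (x - z) := by rw [hqd]; positivity
    calc u (x - z) ^ 2 = exp (W (x - z)) * q (x - z) := by rw [hud, hqd]; ring
      _ ≤ _ := mlr h2 h3
  obtain ⟨C, hC⟩ := hψc.exists_bound_of_continuous hψ.continuous
  have b : ∀ x (w : Euc n → ℝ), Integrable w → Integrable fun z => ψ z * w (x - z) := fun x w hw =>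
    (hw.comp_sub_left x).bdd_mul (c := C) hψ.continuous.aestronglyMeasurable (Eof fun p => hC _)
  have hmb : ∀ x, ‖x‖ ≤ r → m x ^ 2 ≤ 2 * exp (W x) * mol ψ q x := by
    intro x hx
    refine le_trans ?_ (hj x hx)
    rw [← sq_abs]
    refine ppl (abn _) ?_ 2
    rw [hm]; unfold mol
    refine (abs_integral_le_integral_abs).trans (imn (b x _ hu).abs (b x _ hu.abs) fun z => ?_)
    simp only [abs_mul, aon (hψ0 z)]; exact le_refl _
  have hEb : ∀ i x, ‖x‖ ≤ r → E i x ^ 2 ≤ ω ^ 2 * (2 * exp (W x) * mol ψ q x) := by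
    intro i x hx
    refine le_trans ?_ (mll (hj x hx) (sqn ω))
    rw [← sq_abs, ← mul_pow]
    refine ppl (abn _) ?_ 2
    have e1 : E i x = ∫ z, (pd i W x * (ψ z * u (x - z)) - ψ z * w i (x - z)) := by
      rw [isb ((b x _ hu).const_mul _) (b x _ (hwi i)), icm]; rfl
    rw [e1, ← icm]
    refine (abs_integral_le_integral_abs).trans (imn (((b x _ hu).const_mul _).sub (b x _ (hwi i))).abs
      ((b x _ hu.abs).const_mul ω) fun z => ?_)
    by_cases hz : ψ z = 0
    · simp [hz]
    have h1 := (hloc x z hx hz).2 i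
    have h2 : x - z ∈ K := by
      have := hψ1 z hz
      have := norm_sub_le x z
      rw [hK]; simp; linarith
    have h3 : w i (x - z) = pd i W (x - z) * u (x - z) := by rw [hw]; simp only [iom h2]
    simp only [h3]
    rw [show pd i W x * (ψ z * u (x - z)) - ψ z * (pd i W (x - z) * u (x - z))
      = (pd i W x - pd i W (x - z)) * (ψ z * u (x - z)) by ring, abs_mul, abs_mul, aon (hψ0 z)]
    exact mlr h1 (mnn (hψ0 z) (abn _))
  have hQ0 : ∀ x, 0 ≤ mol ψ q x := fun x => inn fun z => mnn (hψ0 z) (by rw [hqd]; positivity)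
  have hQi : Integrable (mol ψ q) := by
    rw [mol_eq]; exact (ccint hψ.continuous hψc).integrable_convolution _ hq
  have hQe : ∫ x, mol ψ q x = ∫ x, q x := by
    rw [mol_eq, integral_convolution _ (ccint hψ.continuous hψc) hq]; simp [hψi]
  have hpdh : ∀ i x, pd i h x = 2 * χ x * pd i χ x * v x + χ x ^ 2 * pd i v x := by
    intro i x
    rw [hh, pd_mul (hχ.mul hχ) hvs, pd_mul hχ hχ]; ring
  have hpt : ∀ x, ∑ i, χ x ^ 2 * exp (W x) * pd i v x ^ 2 ≤
      2 * (∑ i, pd i h x * (pd i v x * exp (W x) + E i x)) + n * (20 * κ ^ 2 + 8 * ω ^ 2) * mol ψ q x := by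
    intro x
    by_cases hx : ‖x‖ ≤ r
    · rw [fms, show (n:ℝ) * (20 * κ ^ 2 + 8 * ω ^ 2) * mol ψ q x = ∑ i : Fin n, (20 * κ ^ 2 + 8 * ω ^ 2) * mol ψ q x by
        simp; ring, ← fad]
      refine fsl fun i _ => ?_
      rw [hpdh]
      set s := exp (W x / 2) with hs
      have hs0 : 0 < s := epos _
      have hss : exp (W x) = s * s := by rw [hs, ← eadd]; congr 1; ring
      have hm1 := hmb x hx
      have hE1 := hEb i x hx
      have hvm : m x = v x * (s * s) := by
        rw [← hss, hv]; simp only; rw [mul_right_comm, ← eadd]; simp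
      rw [hvm, hss] at hm1
      rw [hss] at hE1 ⊢
      obtain ⟨e, he⟩ : ∃ e, E i x = s * e := ⟨E i x / s, by field_simp⟩
      rw [he] at hE1 ⊢
      have h1 : (v x * s) ^ 2 ≤ 2 * mol ψ q x := by
        have : s ^ 2 * (v x * s) ^ 2 ≤ s ^ 2 * (2 * mol ψ q x) := by nlinarith
        exact lml this pY
      have h2 : e ^ 2 ≤ ω ^ 2 * (2 * mol ψ q x) := by
        have : s ^ 2 * e ^ 2 ≤ s ^ 2 * (ω ^ 2 * (2 * mol ψ q x)) := by nlinarith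
        exact lml this pY
      have h3 : (pd i χ x) ^ 2 ≤ κ ^ 2 := by
        rw [← sq_abs]; exact ppl (abn _) (hχd i x) 2
      have h4 : (χ x) ^ 2 ≤ 1 := by
        rw [← sq_abs]; nlinarith [abn (χ x), hχ1 x]
      set A := χ x * s * pd i v x with hA
      set B := pd i χ x * (v x * s) with hB
      set e' := χ x * e with he'
      have hB2 : B ^ 2 ≤ κ ^ 2 * (2 * mol ψ q x) := by
        rw [hB, mul_pow]; exact mlm h3 h1 (sqn _) (sqn _)
      have he2 : e' ^ 2 ≤ ω ^ 2 * (2 * mol ψ q x) := by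
        rw [he', mul_pow]; nlinarith [mlr h4 (sqn e)]
      have hid : 2 * ((2 * χ x * pd i χ x * v x + χ x ^ 2 * pd i v x) * (pd i v x * (s * s) + s * e))
          = 2 * ((2 * B + A) * (A + e')) := by rw [hA, hB, he']; ring
      have hid2 : χ x ^ 2 * (s * s) * pd i v x ^ 2 = A ^ 2 := by rw [hA]; ring
      rw [hid, hid2]
      clear_value A B e'
      nlinarith only [sqn (A + 2 * B + e'), sqn B, sqn e', hB2, he2]
    · have h1 : χ x = 0 := by by_contra h; exact hx (hχr x h)
      have h2 : ∀ i, pd i h x = 0 := fun i => by rw [hpdh, h1]; ring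
      simp only [h1, h2]
      simp
      have := hQ0 x
      positivity
  have hvc := fun i => pd_cont hvs i
  have hec : Continuous fun x => exp (W x) := hW.continuous.rexp
  have hhp := fun i => pd_cont hhs i
  have hχ' := hχ.continuous
  have i1 : Integrable fun x => ∑ i, pd i h x * (pd i v x * exp (W x) + E i x) :=
    igf _ fun i _ => ccint ((hhp i).mul (((hvc i).mul hec).add (hEc i))) (pd_cs hhc i).mul_right
  calc _ ≤ ∫ x, (2 * (∑ i, pd i h x * (pd i v x * exp (W x) + E i x)) + n * (20 * κ ^ 2 + 8 * ω ^ 2) * mol ψ q x) := by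
        refine imn ?_ ((i1.const_mul 2).add (hQi.const_mul _)) hpt
        refine igf _ fun i _ => ccint (by have := hvc i; fun_prop) ?_
        have : (fun x => χ x ^ 2 * exp (W x) * pd i v x ^ 2) = fun x => χ x * (χ x * exp (W x) * pd i v x ^ 2) := by
          ext x; ring
        rw [this]; exact hχc.mul_right
    _ = _ := by
        rw [iad (i1.const_mul 2) (hQi.const_mul _), icm, icm, hQe, key]; ring

end

section
variable {n : ℕ}

set_option maxHeartbeats 1000000 in
theorem harm {W g : Euc n → ℝ} (hW : ContDiff ℝ smo W) (hρ : Integrable fun x => exp (W x))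
    (hgm : AEStronglyMeasurable g) (hq : Integrable fun x => g x ^ 2 * exp (W x))
    (h0 : ∀ h : Euc n → ℝ, ContDiff ℝ smo h → HCS h → ∫ x, LL W h x * (g x * exp (W x)) = 0) :
    ∃ c, g =ᵐ[volume] fun _ => c := by
  have hec : Continuous fun x => exp (W x) := hW.continuous.rexp
  have hu : Integrable fun x => g x * exp (W x) := by
    refine (hq.add hρ).mono' (hgm.mul hec.aestronglyMeasurable) (Eof fun x => ?_)
    simp only [norm_mul, rna, abs_of_pos (epos _), Pi.add_apply]
    have : |g x| ≤ g x ^ 2 + 1 := by nlinarith [sq_abs (g x), sqn (|g x| - 1)]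
    nlinarith [epos (W x)]
  set u : Euc n → ℝ := fun x => g x * exp (W x) with hud
  have hgl : LocallyIntegrable g := by
    rw [locallyIntegrable_iff]
    intro K hK
    have hc : Continuous fun x => exp (-W x) := hW.continuous.neg.rexp
    obtain ⟨C, hC⟩ := hK.exists_bound_of_continuousOn hc.continuousOn
    have : IntegrableOn (fun x => exp (-W x) * u x) K := by
      refine Integrable.bdd_mul (c := C) hu.integrableOn hc.aestronglyMeasurable ?_
      exact (ae_restrict_iff' hK.measurableSet).2 (Eof fun x hx => hC x hx)
    refine this.congr_fun (fun x _ => ?_) hK.measurableSet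
    show exp (-W x) * (g x * exp (W x)) = g x
    rw [mul_left_comm, ← eadd]; simp
  refine const_of_weak hgl fun ζ hζ hζc i => ?_
  obtain ⟨χ1, hχ1⟩ : ∃ b : ContDiffBump (0 : Euc n), b.rOut = 2 ∧ b.rIn = 1 := ⟨⟨1, 2, by norm_num, by norm_num⟩, rfl, rfl⟩
  have hχs : ContDiff ℝ smo χ1 := χ1.contDiff
  have hC1 : ∃ C1, ∀ j x, |pd j χ1 x| ≤ C1 := by
    have : ∀ j, ∃ C, ∀ x, |pd j χ1 x| ≤ C := fun j =>
      (pd_cs χ1.hasCompactSupport j).exists_bound_of_continuous (pd_cont hχs j)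
    choose C hC using this
    exact ⟨∑ j, |C j|, fun j x => ((hC j x).trans (le_abs_self _)).trans
      (Finset.single_le_sum (f := fun j => |C j|) (fun j _ => abn _) (Finset.mem_univ j))⟩
  obtain ⟨C1, hC1⟩ := hC1
  obtain ⟨Rζ, hRζ⟩ : ∃ R0 : ℝ, ∀ x, ζ x ≠ 0 → ‖x‖ ≤ R0 := by
    obtain ⟨R0, hR0⟩ := hζc.isBounded.subset_closedBall (0 : Euc n)
    exact ⟨R0, fun x hx => by simpa using hR0 (subset_tsupport _ hx)⟩
  set k : Euc n → ℝ := fun x => exp (-W x) * pd i ζ x with hk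
  have hkc : Continuous k := hW.continuous.neg.rexp.mul (pd_cont hζ i)
  have hkcs : HCS k := (pd_cs hζc i).mul_left
  set S := ∫ x, g x ^ 2 * exp (W x) with hS
  set T := ∫ x, exp (-W x) * ζ x ^ 2 with hT
  have iT : Integrable fun x => exp (-W x) * ζ x ^ 2 := by
    have c1 := hW.continuous
    have c2 := hζ.continuous
    refine ccint fP ?_
    have : (fun x => exp (-W x) * ζ x ^ 2) = fun x => ζ x * (ζ x * exp (-W x)) := by ext x; ring
    rw [this]; exact hζc.mul_right
  set D := (∫ x, |u x|) + (1/2) * (n * (20 * C1 ^ 2 + 8) * S) + (1/2) * T with hD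
  have hgk : ∫ x, g x * pd i ζ x = ∫ x, k x * u x := by
    congr 1; ext x
    simp only [hk, hud]
    rw [show exp (-W x) * pd i ζ x * (g x * exp (W x)) = (exp (-W x) * exp (W x)) * (g x * pd i ζ x) by ring,
      ← eadd]; simp
  have main : ∀ R : ℝ, max 1 Rζ ≤ R → |∫ x, g x * pd i ζ x| ≤ D / R := by
    intro R hR
    have hR1 : 1 ≤ R := (le_max_left _ _).trans hR
    have hR2 : Rζ ≤ R := (le_max_right _ _).trans hR
    have hR0 : 0 < R := by linarith
    obtain ⟨ε1, h1p, h1l, h1⟩ := unif_loc (n := n) (f := fun x => (W x, fun j => pd j W x))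
      (hW.continuous.prodMk (continuous_pi fun j => pd_cont hW j)) (2 * R) (min (Real.log 2) (1/R))
      (lt_min (Real.log_pos nN) pY)
    obtain ⟨ε2, h2p, h2l, h2⟩ := unif_loc hkc (R + 1) (1/R) pY
    obtain ⟨b, hb1, hb2⟩ : ∃ b : ContDiffBump (0 : Euc n), b.rOut ≤ ε1 ∧ b.rOut ≤ ε2 :=
      ⟨⟨min ε1 ε2 / 2, min ε1 ε2, by positivity, by have : 0 < min ε1 ε2 := by positivity
                                                    linarith⟩, min_le_left _ _, min_le_right _ _⟩
    set ψ := b.normed volume with hψ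
    have hψs : ContDiff ℝ smo ψ := b.contDiff_normed
    have hψc : HCS ψ := b.hasCompactSupport_normed
    have hψ0 : ∀ z, 0 ≤ ψ z := fun z => b.nonneg_normed z
    have hψi : ∫ z, ψ z = 1 := b.integral_normed
    have hψz : ∀ z, ψ z ≠ 0 → ‖z‖ ≤ b.rOut := by
      intro z hz
      have : z ∈ Function.support (b.normed volume) := hz
      rw [b.support_normed_eq] at this
      exact (mem_ball_zero_iff.1 this).le
    set χ : Euc n → ℝ := fun x => χ1 (R⁻¹ • x) with hχ
    have hχS : ContDiff ℝ smo χ := hχs.comp (contDiff_id.const_smul _)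
    have hχr : ∀ x, χ x ≠ 0 → ‖x‖ ≤ 2 * R := by
      intro x hx
      have h3 : R⁻¹ • x ∈ Function.support χ1 := hx
      rw [χ1.support_eq, hχ1.1] at h3
      simp only [Metric.mem_ball, dist_zero_right, norm_smul, norm_inv, rna, abs_of_pos hR0] at h3
      rw [inv_mul_lt_iff₀ hR0] at h3; linarith
    have hχone : ∀ x, ‖x‖ ≤ R → χ x = 1 := by
      intro x hx
      refine χ1.one_of_mem_closedBall ?_
      rw [hχ1.2]
      simp only [Metric.mem_closedBall, dist_zero_right, norm_smul, norm_inv, rna, abs_of_pos hR0]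
      rw [inv_mul_le_iff₀ hR0]; linarith
    have hχc : HCS χ := HasCompactSupport.of_support_subset_isCompact
      (isCompact_closedBall (0 : Euc n) (2 * R)) (fun x hx => by simpa using hχr x hx)
    have hχd : ∀ j x, |pd j χ x| ≤ C1 / R := by
      intro j x
      have : pd j χ x = R⁻¹ * pd j χ1 (R⁻¹ • x) := by
        unfold pd; rw [hχ, fderiv_comp_smul]; simp
      rw [this, abs_mul, abs_inv, abs_of_pos hR0, div_eq_inv_mul]
      exact mll (hC1 _ _) pY
    have hen := energy (κ := C1 / R) (ω := 1 / R) (r := 2 * R) hW hu hq h0 hψs hψc (fun z hz => (hψz z hz).trans (hb1.trans h1l)) hψ0 hψi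
      (by
        intro x z hx hz
        have h3 := h1 x hx z ((hψz z hz).trans hb1)
        rw [Prod.norm_def, max_le_iff] at h3
        constructor
        · have := (abs_le.1 (h3.1.trans (min_le_left _ _))).1
          simp at this; linarith
        · intro j
          exact ((norm_le_pi_norm _ j).trans h3.2).trans (min_le_right _ _)) hχS hχc hχr
      (fun x => by rw [aon χ1.nonneg]; exact χ1.le_one) hχd
    set m := mol ψ u with hm
    set v : Euc n → ℝ := fun x => exp (-W x) * m x with hv
    have hms : ContDiff ℝ smo m := mol_smooth hψs hψc hu.locallyIntegrable
    have hvs : ContDiff ℝ smo v := (hW.neg.exp).mul hms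
    have hvc := fun i => pd_cont hvs i
    have s1 : |(∫ x, k x * m x) - ∫ x, k x * u x| ≤ (1/R) * ∫ x, |u x| := by
      obtain ⟨Ck, hCk⟩ := hkcs.exists_bound_of_continuous hkc
      have b1 : ∀ z, Integrable fun y => k (y + z) * u y := fun z =>
        hu.bdd_mul (c := Ck) (hkc.comp fP).aestronglyMeasurable (Eof fun p => hCk _)
      have b0 : Integrable fun y => k y * u y := by simpa using b1 0
      rw [hm, ← fub hψs.continuous hψc hu hkc hkcs]
      have e : ∫ x, k x * u x = ∫ z, ψ z * ∫ x, k x * u x := by rw [integral_mul_const, hψi, one_mul]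
      rw [e, ← isb (fub2 hψs.continuous hψc hu hkc hkcs) ((ccint hψs.continuous hψc).mul_const _)]
      have e2 : (1/R) * ∫ x, |u x| = ∫ z, ψ z * ((1/R) * ∫ x, |u x|) := by rw [integral_mul_const, hψi, one_mul]
      rw [e2]
      refine abs_integral_le_integral_abs.trans (imn
        ((fub2 hψs.continuous hψc hu hkc hkcs).sub ((ccint hψs.continuous hψc).mul_const _)).abs
        ((ccint hψs.continuous hψc).mul_const _) fun z => ?_)
      simp only
      rw [← mul_sub, abs_mul, aon (hψ0 z)]
      by_cases hz : ψ z = 0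
      · simp [hz]
      refine mll ?_ (hψ0 z)
      rw [← isb (b1 z) b0, ← icm]
      refine abs_integral_le_integral_abs.trans (imn ((b1 z).sub b0).abs (hu.abs.const_mul _) fun y => ?_)
      simp only [← sub_mul, abs_mul]
      refine mlr ?_ (abn _)
      have hz1 := (hψz z hz).trans hb2
      by_cases hy : ‖y + z‖ ≤ R + 1
      · simpa using h2 (y + z) hy z hz1
      · have k0 : ∀ x, R < ‖x‖ → k x = 0 := by
          intro x hx
          by_contra hne
          have : pd i ζ x ≠ 0 := fun h => hne (by rw [hk]; simp [h])
          have := pd_supp hRζ i x this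
          linarith
        push Not at hy
        rw [k0 _ lI, k0 y (by have := norm_add_le y z; linarith)]
        simp; positivity
    have s2 : |∫ x, k x * m x| ≤ (R/2) * (n * (20 * (C1/R) ^ 2 + 8 * (1/R) ^ 2) * S) + (1/(2*R)) * T := by
      have e1 : ∫ x, k x * m x = - ∫ x, pd i v x * ζ x := by
        rw [← ibp hvs hζ hζc i]; congr 1; ext x; simp only [hk, hv]; ring
      rw [e1, abs_neg]
      have iE : Integrable fun x => ∑ j, χ x ^ 2 * exp (W x) * pd j v x ^ 2 := by
        refine igf _ fun j _ => ccint (by have := hvc j; have := hχS.continuous; fun_prop) ?_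
        have : (fun x => χ x ^ 2 * exp (W x) * pd j v x ^ 2) = fun x => χ x * (χ x * exp (W x) * pd j v x ^ 2) := by
          ext x; ring
        rw [this]; exact hχc.mul_right
      refine abs_integral_le_integral_abs.trans ?_
      calc _ ≤ ∫ x, ((R/2) * (∑ j, χ x ^ 2 * exp (W x) * pd j v x ^ 2) + (1/(2*R)) * (exp (-W x) * ζ x ^ 2)) := by
            refine imn (ccint ((hvc i).mul hζ.continuous) hζc.mul_left).abs
              ((iE.const_mul _).add (iT.const_mul _)) fun x => ?_
            simp only
            by_cases hx : ζ x = 0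
            · rw [hx]; simp; positivity
            rw [hχone x ((hRζ x hx).trans hR2)]
            have h3 : (1:ℝ) ^ 2 * exp (W x) * pd i v x ^ 2 ≤ ∑ j, (1:ℝ) ^ 2 * exp (W x) * pd j v x ^ 2 :=
              Finset.single_le_sum (f := fun j => (1:ℝ) ^ 2 * exp (W x) * pd j v x ^ 2) (fun j _ => by positivity) (Finset.mem_univ i)
            refine le_trans ?_ (add_le_add (mll h3 pY) le_rfl)
            rw [abs_mul]
            have hE := epos (W x)
            rw [Real.exp_neg]
            set e := exp (W x)
            have : (R/2) * (1 ^ 2 * e * pd i v x ^ 2) + 1/(2*R) * (e⁻¹ * ζ x ^ 2) - |pd i v x| * |ζ x|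
              = (R * e * |pd i v x| - |ζ x|) ^ 2 / (2 * R * e) := by
              rw [← sq_abs (pd i v x), ← sq_abs (ζ x)]
              field_simp; ring
            have h5 : 0 ≤ (R * e * |pd i v x| - |ζ x|) ^ 2 / (2 * R * e) := by positivity
            linarith
        _ = _ := by rw [iad (iE.const_mul _) (iT.const_mul _), icm, icm]
        _ ≤ _ := by
            have := mll hen (show 0 ≤ R/2 by positivity)
            linarith
    rw [hgk]
    have e3 : (R/2) * (n * (20 * (C1/R) ^ 2 + 8 * (1/R) ^ 2) * S) + (1/(2*R)) * T + (1/R) * (∫ x, |u x|) = D / R := by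
      rw [hD]; field_simp; ring
    rw [← e3]
    calc |∫ x, k x * u x| = |(∫ x, k x * m x) - ((∫ x, k x * m x) - ∫ x, k x * u x)| := by congr 1; ring
      _ ≤ _ := (abs_sub _ _).trans (add_le_add s2 s1)
  have hlim : Filter.Tendsto (fun R : ℝ => D / R) Filter.atTop (nhds 0) := Filter.Tendsto.const_div_atTop Filter.tendsto_id D
  have := ge_of_tendsto hlim (Filter.eventually_atTop.2 ⟨_, fun R hR => main R hR⟩)
  exact abs_eq_zero.1 (le_antisymm this (abn _))

end

section
variable {n : ℕ}

/-- measure with density e^W. -/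
def PW (W : Euc n → ℝ) : Measure (Euc n) := volume.withDensity fun x => oR (exp (W x))

lemma PW_int {W : Euc n → ℝ} (hW : Continuous W) (F : Euc n → ℝ) : ∫ x, F x ∂(PW W) = ∫ x, F x * exp (W x) := by
  unfold PW
  rw [integral_withDensity_eq_integral_toReal_smul fP (by simp)]
  refine ica (Eof fun x => ?_)
  simp [eto (epos _).le, mul_comm]

lemma PW_intble {W : Euc n → ℝ} (hW : Continuous W) (F : Euc n → ℝ) :
    Integrable F (PW W) ↔ Integrable fun x => F x * exp (W x) := by
  unfold PW
  rw [integrable_withDensity_iff fP (by simp)]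
  simp [eto (epos _).le]

lemma PW_ae {W : Euc n → ℝ} (hW : Continuous W) (p : Euc n → Prop) :
    (∀ᵐ x ∂(PW W), p x) ↔ ∀ᵐ x, p x := by
  unfold PW
  rw [ae_withDensity_iff fP]
  simp [epos]

/-- spectral gap constant on test functions -/
def Valid (W : Euc n → ℝ) (κ : ℝ) : Prop := ∀ h : Euc n → ℝ, ContDiff ℝ smo h → HCS h →
  ∫ x, (∑ i, pd i h x ^ 2) * exp (W x) ≤ κ * ∫ x, LL W h x ^ 2 * exp (W x)

lemma PW_prob {W : Euc n → ℝ} (hW : Continuous W) (hρ : Integrable fun x => exp (W x)) (h1 : ∫ x, exp (W x) = 1) :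
    IPM (PW W) := by
  constructor
  rw [PW, withDensity_apply _ MeasurableSet.univ, Measure.restrict_univ,
    ← oie hρ (Eof fun x => (epos _).le), h1, oro]

lemma LL_zero {W : Euc n → ℝ} (x : Euc n) : LL W (fun _ => 0) x = 0 := by
  have e : ∀ i : Fin n, pd i (fun _ : Euc n => (0:ℝ)) = fun _ => 0 := fun i => by ext x; simp [pd]
  simp [LL, e]

lemma dense_LL {W : Euc n → ℝ} (hW : ContDiff ℝ smo W) (hρ : Integrable fun x => exp (W x)) (h1 : ∫ x, exp (W x) = 1)
    (a : Lp ℝ 2 (PW W)) (δ : ℝ) (hδ : 0 < δ) :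
    ∃ h : Euc n → ℝ, ContDiff ℝ smo h ∧ HCS h ∧ ∃ c : ℝ, ∃ b : Lp ℝ 2 (PW W),
      (b =ᵐ[PW W] fun x => LL W h x + c) ∧ ‖a - b‖ < δ := by
  have := PW_prob hW.continuous hρ h1
  have hmem : ∀ h : Euc n → ℝ, ContDiff ℝ smo h → HCS h → ∀ c : ℝ, MemLp (fun x => LL W h x + c) 2 (PW W) := by
    intro h hh hc c
    refine MemLp.add ?_ (memLp_const c)
    obtain ⟨C, hC⟩ := (LL_cs (W := W) hc).exists_bound_of_continuous (LL_smooth hW hh).continuous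
    exact MemLp.of_bound (LL_smooth hW hh).continuous.aestronglyMeasurable C (Eof hC)
  let K : Submodule ℝ (Lp ℝ 2 (PW W)) :=
    { carrier := {b | ∃ h : Euc n → ℝ, ContDiff ℝ smo h ∧ HCS h ∧ ∃ c : ℝ, b =ᵐ[PW W] fun x => LL W h x + c}
      zero_mem' := ⟨fun _ => 0, contDiff_const, HasCompactSupport.zero, 0, by
        filter_upwards [Lp.coeFn_zero ℝ 2 (PW W)] with x hx
        rw [hx]; simp [LL_zero]⟩
      add_mem' := by
        rintro b b' ⟨h, hh, hc, c, hb⟩ ⟨h', hh', hc', c', hb'⟩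
        refine ⟨fun x => h x + h' x, hh.add hh', hc.add hc', c + c', ?_⟩
        filter_upwards [hb, hb', Lp.coeFn_add b b'] with x h1 h2 h3
        rw [h3, Pi.add_apply, h1, h2]
        have e : ∀ i, pd i (fun x => h x + h' x) = fun x => pd i h x + pd i h' x := fun i => funext fun x => pd_add hh hh' i x
        simp only [LL, e, pd_add (pd_smooth hh _) (pd_smooth hh' _)]
        rw [show ∑ i, (pd i (pd i h) x + pd i (pd i h') x + pd i W x * (pd i h x + pd i h' x)) =
          ∑ i, (pd i (pd i h) x + pd i W x * pd i h x) + ∑ i, (pd i (pd i h') x + pd i W x * pd i h' x) by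
            rw [← fad]; exact fsc rfl fun i _ => by ring]
        ring
      smul_mem' := by
        rintro s b ⟨h, hh, hc, c, hb⟩
        refine ⟨fun x => s * h x, contDiff_const.mul hh, hc.mul_left, s * c, ?_⟩
        filter_upwards [hb, Lp.coeFn_smul s b] with x h1 h3
        rw [h3, Pi.smul_apply, h1]
        have e0 : ∀ (k : Euc n → ℝ), ContDiff ℝ smo k → ∀ i, pd i (fun x => s * k x) = fun x => s * pd i k x := by
          intro k hk i; ext x
          unfold pd; rw [fderiv_const_mul (smo_diff hk x)]; simp
        simp only [LL, e0 h hh, e0 _ (pd_smooth hh _), sem, mul_add, fms]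
        congr 1
        exact fsc rfl fun i _ => by ring }
  have hK : Kᗮ = ⊥ := by
    rw [Submodule.eq_bot_iff]
    intro w hw
    rw [Submodule.mem_orthogonal] at hw
    have hin : ∀ h : Euc n → ℝ, ContDiff ℝ smo h → HCS h → ∀ c : ℝ, ∫ x, (LL W h x + c) * w x ∂(PW W) = 0 := by
      intro h hh hc c
      have h2 := hw ((hmem h hh hc c).toLp _) ⟨h, hh, hc, c, MemLp.coeFn_toLp _⟩
      rw [L2.inner_def] at h2
      rw [← h2]
      refine ica ?_
      filter_upwards [MemLp.coeFn_toLp (hmem h hh hc c)] with x hx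
      rw [hx]; simp [mul_comm]
    have hc : ∃ c, (w : Euc n → ℝ) =ᵐ[volume] fun _ => c := by
      refine harm hW hρ (Lp.stronglyMeasurable w).aestronglyMeasurable ?_ ?_
      · rw [← PW_intble hW.continuous]
        exact (mtw (Lp.stronglyMeasurable w).aestronglyMeasurable).1 (Lp.memLp w)
      · intro h hh hc
        have := hin h hh hc 0
        rw [PW_int hW.continuous] at this
        simpa [mul_assoc] using this
    obtain ⟨c, hc⟩ := hc
    have hc' : (w : Euc n → ℝ) =ᵐ[PW W] fun _ => c := (PW_ae hW.continuous _).2 hc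
    have h3 := hin (fun _ => 0) contDiff_const HasCompactSupport.zero 1
    have h4 : ∫ x, (LL W (fun _ => 0) x + 1) * w x ∂(PW W) = c := by
      have : ∫ x, (LL W (fun _ => 0) x + 1) * w x ∂(PW W) = ∫ x, c ∂(PW W) := by
        refine ica ?_
        filter_upwards [hc'] with x hx
        rw [hx]; simp [LL_zero]
      rw [this]; simp
    rw [h4] at h3
    rw [h3] at hc'
    exact (Lp.eq_zero_iff_ae_eq_zero).2 hc'
  have htop := (Submodule.topologicalClosure_eq_top_iff (K := K)).2 hK
  have ha : a ∈ closure (K : Set (Lp ℝ 2 (PW W))) := by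
    rw [← Submodule.topologicalClosure_coe, htop]; trivial
  rw [Metric.mem_closure_iff] at ha
  obtain ⟨b, ⟨h, hh, hc, c, hb⟩, hd⟩ := ha δ hδ
  exact ⟨h, hh, hc, c, b, hb, by rwa [← dist_eq_norm]⟩

lemma LL_mean {W h : Euc n → ℝ} (hW : ContDiff ℝ smo W) (hh : ContDiff ℝ smo h) (hc : HCS h) :
    ∫ x, LL W h x * exp (W x) = 0 := by
  have := LL_ibp hW hh hc (f := fun _ => 1) contDiff_const
  simpa [pd] using this

lemma sqi {W k : Euc n → ℝ} (hWc : Continuous W) (hk : Continuous k) (hkc : HCS k) :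
    Integrable fun x => k x ^ 2 * exp (W x) := by
  have : (fun x => k x ^ 2 * exp (W x)) = fun x => k x * (k x * exp (W x)) := by ext x; ring
  rw [this]; exact ccint (f := fun x => k x * (k x * exp (W x))) (hk.mul (hk.mul hWc.rexp)) hkc.mul_right

theorem poincare {W f : Euc n → ℝ} {κ : ℝ} (hW : ContDiff ℝ smo W) (hρ : Integrable fun x => exp (W x))
    (h1 : ∫ x, exp (W x) = 1) (hκ : 0 < κ) (hv : Valid W κ) (hf : ContDiff ℝ smo f)
    (hf2 : Integrable fun x => f x ^ 2 * exp (W x)) (hfd : ∀ i, Integrable fun x => pd i f x ^ 2 * exp (W x)) :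
    (∫ x, f x ^ 2 * exp (W x)) - (∫ x, f x * exp (W x)) ^ 2 ≤ κ * ∫ x, (∑ i, pd i f x ^ 2) * exp (W x) := by
  have hP := PW_prob hW.continuous hρ h1
  set μ := ∫ x, f x * exp (W x) with hμ
  set G := ∫ x, (∑ i, pd i f x ^ 2) * exp (W x) with hG
  have hWc := hW.continuous
  have hfm : MemLp f 2 (PW W) := (mtw hf.continuous.aestronglyMeasurable).2 ((PW_intble hWc _).2 hf2)
  have hgm : MemLp (fun x => f x - μ) 2 (PW W) := hfm.sub (memLp_const μ)
  set F := hgm.toLp _ with hF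
  have hFae := MemLp.coeFn_toLp hgm
  have hfi : Integrable f (PW W) := hfm.integrable nN
  have hmean : ∫ x, (f x - μ) ∂(PW W) = 0 := by
    rw [isb hfi (ict _), PW_int hWc]; simp [hμ]
  have hnorm : ∫ x, (f x - μ) ^ 2 ∂(PW W) = ‖F‖ ^ 2 := by
    rw [← rin, L2.inner_def]
    refine ica ?_
    filter_upwards [hFae] with x hx
    rw [hx]; simp [sq]
  have hvar : ∫ x, (f x - μ) ^ 2 ∂(PW W) = (∫ x, f x ^ 2 * exp (W x)) - μ ^ 2 := by
    have e : ∀ x, (f x - μ) ^ 2 = f x ^ 2 - (2 * μ) * f x + μ ^ 2 := fun x => by ring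
    have i2 : Integrable (fun x => f x ^ 2) (PW W) := (PW_intble hWc _).2 hf2
    simp only [e]
    rw [iad (f := fun x => f x ^ 2 - (2 * μ) * f x) (i2.sub (hfi.const_mul _)) (ict _), isb i2 (hfi.const_mul _), icm,
      PW_int hWc f, PW_int hWc, ← hμ]; simp; ring
  have hG0 : 0 ≤ G := inn fun x => by positivity
  rw [← hvar, hnorm]
  have key : ∀ δ : ℝ, 0 < δ → 2 * ‖F‖ ^ 2 ≤ 2 * ‖F‖ * δ + ((‖F‖ + δ) ^ 2 + κ * G) := by
    intro δ hδ
    obtain ⟨h, hh, hc, c, b, hb, hab⟩ := dense_LL hW hρ h1 F δ hδ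
    have hLc := (LL_smooth hW hh).continuous
    obtain ⟨C, hC⟩ := (LL_cs (W := W) hc).exists_bound_of_continuous hLc
    have hLm : MemLp (LL W h) 2 (PW W) :=
      MemLp.of_bound hLc.aestronglyMeasurable C (Eof hC)
    have hLi : Integrable (LL W h) (PW W) := hLm.integrable nN
    have hL0 : ∫ x, LL W h x ∂(PW W) = 0 := by rw [PW_int hWc, LL_mean hW hh hc]
    have iLf : Integrable (fun x => LL W h x * f x) (PW W) := hLm.integrable_mul hfm
    have eb : ‖b‖ ^ 2 = (∫ x, LL W h x ^ 2 ∂(PW W)) + c ^ 2 := by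
      rw [← rin, L2.inner_def]
      have : ∫ x, inner ℝ (b x) (b x) ∂(PW W) = ∫ x, (LL W h x ^ 2 + (2 * c) * LL W h x + c ^ 2) ∂(PW W) := by
        refine ica ?_
        filter_upwards [hb] with x hx
        rw [hx]; simp; ring
      have iL2 : Integrable (fun x => LL W h x ^ 2) (PW W) := (mtw hLc.aestronglyMeasurable).1 hLm
      rw [this, iad (iL2.fun_add (hLi.const_mul _)) (ict _), iad iL2 (hLi.const_mul _),
        icm, hL0]; simp
    have ei : ⟪F, b⟫ = ∫ x, LL W h x * f x ∂(PW W) := by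
      rw [L2.inner_def]
      have : ∫ x, inner ℝ (F x) (b x) ∂(PW W) = ∫ x, (LL W h x * f x - μ * LL W h x + c * (f x - μ)) ∂(PW W) := by
        refine ica ?_
        filter_upwards [hb, hFae] with x hx hx2
        rw [hx, hx2]; simp; ring
      rw [this, iad (f := fun x => LL W h x * f x - μ * LL W h x) (g := fun x => c * (f x - μ)) (iLf.sub (hLi.const_mul _)) ((hfi.sub (ict _)).const_mul _),
        isb iLf (hLi.const_mul _), icm, icm, hL0]
      have : ∫ x, (f x - μ) ∂(PW W) = 0 := hmean
      simp [this]
    have hIb : ∫ x, LL W h x ^ 2 * exp (W x) ≤ ‖b‖ ^ 2 := by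
      rw [eb, ← PW_int hWc (fun x => LL W h x ^ 2)]; nlinarith [sqn c]
    have hip : 2 * ⟪F, b⟫ ≤ ‖b‖ ^ 2 + κ * G := by
      rw [ei, PW_int hWc, LL_ibp hW hh hc hf]
      have hd := fun i => pd_cont hh i
      have hd' := fun i => pd_cont hf i
      have j1 : Integrable fun x => (∑ i, pd i h x * pd i f x) * exp (W x) := by
        simp only [fsm]
        exact igf _ fun i _ => ccint (((hd i).mul (hd' i)).mul hWc.rexp) (pd_cs hc i).mul_right.mul_right
      have j2 : Integrable fun x => (∑ i, pd i h x ^ 2) * exp (W x) := by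
        simp only [fsm]
        exact igf _ fun i _ => sqi hWc (hd i) (pd_cs hc i)
      have j3 : Integrable fun x => (∑ i, pd i f x ^ 2) * exp (W x) := by
        simp only [fsm]
        exact igf _ fun i _ => hfd i
      have hvh := hv h hh hc
      have hm : ∫ x, (-(2 * κ)) * ((∑ i, pd i h x * pd i f x) * exp (W x)) ≤
          ∫ x, ((∑ i, pd i h x ^ 2) * exp (W x) + κ ^ 2 * ((∑ i, pd i f x ^ 2) * exp (W x))) := by
        refine imn (j1.const_mul _) (j2.add (j3.const_mul _)) fun x => ?_
        simp only
        have : ∑ i, (-(2*κ)) * (pd i h x * pd i f x) ≤ ∑ i, (pd i h x ^ 2 + κ ^ 2 * pd i f x ^ 2) :=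
          fsl fun i _ => by nlinarith [sqn (pd i h x + κ * pd i f x)]
        rw [fad, ← fms, ← fms] at this
        nlinarith [epos (W x)]
      rw [icm, iad j2 (j3.const_mul _), icm] at hm
      have : κ * (2 * -∫ x, (∑ i, pd i h x * pd i f x) * exp (W x)) ≤ κ * (‖b‖ ^ 2 + κ * G) := by nlinarith
      exact lml this hκ
    have hbn : ‖b‖ ≤ ‖F‖ + δ := by
      have := norm_sub_norm_le b F
      rw [norm_sub_rev] at this; linarith
    have hFF : ‖F‖ ^ 2 = ⟪F, F - b⟫ + ⟪F, b⟫ := by rw [← inner_add_right, sub_add_cancel, rin]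
    have hFb := (real_inner_le_norm F (F - b)).trans (mll hab.le (nnn F))
    have : ‖b‖ ^ 2 ≤ (‖F‖ + δ) ^ 2 := ppl (nnn _) hbn 2
    nlinarith
  have hlim : Filter.Tendsto (fun δ : ℝ => 2 * ‖F‖ * δ + ((‖F‖ + δ) ^ 2 + κ * G)) (nhdsWithin 0 (Ioi 0)) (nhds (2 * ‖F‖ * 0 + ((‖F‖ + 0) ^ 2 + κ * G))) := by
    refine Filter.Tendsto.mono_left (Continuous.tendsto fP 0) nhdsWithin_le_nhds
  have := ge_of_tendsto hlim (by filter_upwards [self_mem_nhdsWithin] with δ hδ using key δ hδ)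
  nlinarith

/-- improved Lichnerowicz -/
theorem valid_sqrt {W : Euc n → ℝ} {t R : ℝ} (hW : ContDiff ℝ smo W) (hρ : Integrable fun x => exp (W x))
    (h1 : ∫ x, exp (W x) = 1) (ht : 0 < t) (hR : 0 < R) (hs : SCv t W)
    (hcov : ∀ v : Euc n, (Integrable fun x => ⟪v, x⟫ ^ 2 * exp (W x)) ∧ ∫ x, ⟪v, x⟫ ^ 2 * exp (W x) ≤ R * ‖v‖ ^ 2) :
    Valid W (√(R / t)) ∧ Valid W (1 / t) := by
  have hWc := hW.continuous
  have hI0 : ∀ h : Euc n → ℝ, 0 ≤ ∫ x, LL W h x ^ 2 * exp (W x) := fun h => inn fun x => by positivity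
  have boch : ∀ h : Euc n → ℝ, ContDiff ℝ smo h → HCS h →
      (∑ j, ∫ x, (∑ i, pd i (pd j h) x ^ 2) * exp (W x)) + t * ∫ x, (∑ i, pd i h x ^ 2) * exp (W x)
        ≤ ∫ x, LL W h x ^ 2 * exp (W x) := by
    intro h hh hc
    have hd := fun i => pd_cont hh i
    rw [bochner hW hh hc, sub_eq_add_neg, ← integral_neg, ← icm]
    refine add_le_add le_rfl (imn ?_ ?_ fun x => ?_)
    · simp only [fsm]
      exact (igf _ fun i _ => sqi hWc (hd i) (pd_cs hc i)).const_mul _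
    · refine Integrable.neg ?_
      simp only [fsm]
      refine igf _ fun j _ => igf _ fun i _ => ?_
      have := pd_cont (pd_smooth hW i) j
      have := hd i
      have := hd j
      exact ccint fP (pd_cs hc j).mul_left.mul_right
    · have := hess_bound hW t hs x (WithLp.toLp 2 fun i => pd i h x)
      simp only at this
      simp only [← mul_assoc, ← neg_mul]
      exact mlr this (epos _).le
  have v0 : Valid W (1 / t) := by
    intro h hh hc
    have := boch h hh hc
    have h2 : 0 ≤ ∑ j, ∫ x, (∑ i, pd i (pd j h) x ^ 2) * exp (W x) :=
      Finset.sum_nonneg fun j _ => inn fun x => by positivity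
    rw [one_div, ← div_eq_inv_mul, le_div_iff₀ ht]; linarith
  have vstep : ∀ κ, 0 < κ → Valid W κ → Valid W ((κ + R) / (1 + κ * t)) := by
    intro κ hκ hv h hh hc
    have hb := boch h hh hc
    set I := ∫ x, LL W h x ^ 2 * exp (W x) with hI
    set G := ∫ x, (∑ i, pd i h x ^ 2) * exp (W x) with hG
    have hd := fun i => pd_cont hh i
    have hp : ∀ j, (∫ x, pd j h x ^ 2 * exp (W x)) - (∫ x, pd j h x * exp (W x)) ^ 2
        ≤ κ * ∫ x, (∑ i, pd i (pd j h) x ^ 2) * exp (W x) := fun j =>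
      poincare hW hρ h1 hκ hv (pd_smooth hh j) (sqi hWc (hd j) (pd_cs hc j))
        (fun i => sqi hWc (pd_cont (pd_smooth hh j) i) (pd_cs (pd_cs hc j) i))
    have hsum := fsl fun j (_ : j ∈ (Finset.univ : Finset (Fin n))) => hp j
    rw [fsd, ← fms] at hsum
    have eG : G = ∑ j, ∫ x, pd j h x ^ 2 * exp (W x) := by
      rw [hG, ← ifs _ fun j _ => sqi hWc (hd j) (pd_cs hc j)]
      simp only [fsm]
    set a : Euc n := WithLp.toLp 2 fun j => ∫ x, pd j h x * exp (W x) with ha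
    have han : ‖a‖ ^ 2 = ∑ j, (∫ x, pd j h x * exp (W x)) ^ 2 := by
      rw [ens]; simp [ha]
    have haR : ‖a‖ ^ 2 ≤ R * I := by
      have hlin : ContDiff ℝ smo fun x : Euc n => ⟪a, x⟫ := contDiff_const.inner ℝ contDiff_id
      have e1 := LL_ibp hW hh hc hlin
      have e2 : ∀ i x, pd i (fun x : Euc n => ⟪a, x⟫) x = a i := by
        intro i x
        unfold pd
        rw [show (fun x : Euc n => ⟪a, x⟫) = ⇑(innerSL ℝ a) from rfl, ContinuousLinearMap.fderiv]
        simp [eis]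
      simp only [e2] at e1
      have e3 : ∫ x, (∑ i, pd i h x * a i) * exp (W x) = ‖a‖ ^ 2 := by
        rw [ens]
        simp only [fsm]
        rw [ifs]
        · refine fsc rfl fun i _ => ?_
          rw [rna, sq_abs, sq]
          nth_rewrite 2 [ha]
          simp only
          rw [← icm]; congr 1; ext x; ring
        · intro i _
          exact ccint (((hd i).mul continuous_const).mul hWc.rexp) (pd_cs hc i).mul_right.mul_right
      rw [e3] at e1
      have hLc := (LL_smooth hW hh).continuous
      have hLcs := LL_cs (W := W) hc
      have j1 : Integrable fun x => LL W h x * ⟪a, x⟫ * exp (W x) :=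
        ccint ((hLc.mul hlin.continuous).mul hWc.rexp) hLcs.mul_right.mul_right
      have hm : ∫ x, (-(2 * R)) * (LL W h x * ⟪a, x⟫ * exp (W x)) ≤
          ∫ x, (R ^ 2 * (LL W h x ^ 2 * exp (W x)) + ⟪a, x⟫ ^ 2 * exp (W x)) := by
        refine imn (j1.const_mul _) (((sqi hWc hLc hLcs).const_mul _).add (hcov a).1) fun x => ?_
        simp only
        nlinarith [epos (W x), mnn (sqn (R * LL W h x + ⟪a, x⟫)) (epos (W x)).le]
      rw [icm, iad ((sqi hWc hLc hLcs).const_mul _) (hcov a).1, icm, e1] at hm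
      have h5 := (hcov a).2
      have : R * ‖a‖ ^ 2 ≤ R * (R * I) := by nlinarith
      exact lml this hR
    rw [div_mul_eq_mul_div, le_div_iff₀ pY]
    rw [← eG, ← han] at hsum
    nlinarith
  refine ⟨?_, v0⟩
  set S := {κ : ℝ | 0 < κ ∧ Valid W κ} with hS
  have hSne : S.Nonempty := ⟨1/t, by positivity, v0⟩
  have hSb : BddBelow S := ⟨0, fun κ hκ => hκ.1.le⟩
  set κ0 := sInf S with hκ0
  have hvinf : Valid W κ0 := by
    intro h hh hc
    by_cases hI : ∫ x, LL W h x ^ 2 * exp (W x) = 0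
    · have := (v0 h hh hc); rw [hI] at this ⊢; simpa using this
    have hpos := lt_of_le_of_ne (hI0 h) (Ne.symm hI)
    rw [← div_le_iff₀ hpos]
    exact le_csInf hSne fun κ hκ => by rw [div_le_iff₀ hpos]; exact hκ.2 h hh hc
  have hle : κ0 ≤ √(R / t) := by
    by_contra hcon
    push Not at hcon
    have hq : 0 < √(R / t) := Real.sqrt_pos.2 pY
    have hk : 0 < κ0 := hq.trans hcon
    have hmem : (κ0 + R) / (1 + κ0 * t) ∈ S := ⟨by positivity, vstep κ0 hk hvinf⟩
    have h3 := csInf_le hSb hmem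
    rw [← hκ0, le_div_iff₀ pY] at h3
    have h4 : R / t < κ0 ^ 2 := by
      rw [← Real.sq_sqrt (show 0 ≤ R / t by positivity)]; exact pow_lt_pow_left₀ hcon hq.le nN
    rw [div_lt_iff₀ ht] at h4
    nlinarith
  intro h hh hc
  exact (hvinf h hh hc).trans (mlr hle (hI0 h))

end

section
open ProbabilityTheory
variable {n : ℕ}

abbrev Gam (n : ℕ) : Measure (Euc n) := stdGaussian (Euc n)
def gZ (n : ℕ) : ℝ := ∫ y : Euc n, exp (-(1/2) * ‖y‖ ^ 2)
def gk (y : Euc n) : ℝ := (gZ n)⁻¹ * exp (-(1/2) * ‖y‖ ^ 2)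

lemma gauss_cexp (s : Euc n) : ∫ v : Euc n, Complex.exp (-(1/2:ℂ) * ‖v‖ ^ 2 + Complex.I * ⟪s, v⟫) =
    gZ n * Complex.exp (-(‖s‖ ^ 2 / 2)) := by
  have h := GaussianFourier.integral_cexp_neg_mul_sq_norm_add (V := Euc n) (b := 1/2) nN Complex.I s
  have h0 := GaussianFourier.integral_cexp_neg_mul_sq_norm_add (V := Euc n) (b := 1/2) nN 0 0
  simp only [zero_mul, add_zero, inner_zero_left, norm_zero] at h0
  rw [h]
  have : ((gZ n : ℝ) : ℂ) = ∫ v : Euc n, Complex.exp (-(1/2:ℂ) * ‖v‖ ^ 2) := by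
    rw [gZ, ← integral_complex_ofReal]; congr 1; ext v; push_cast; rfl
  rw [this, h0]
  simp
  congr 1; ring

lemma gk_int : Integrable fun y : Euc n => exp (-(1/2) * ‖y‖ ^ 2) := by
  have := (GaussianFourier.integrable_cexp_neg_mul_sq_norm_add (V := Euc n) (b := 1/2) nN 0 0).norm
  refine this.congr (Eof fun v => ?_)
  simp [Complex.norm_exp]
  norm_cast

lemma gZ_pos : 0 < gZ n := by
  have := integral_exp_pos (μ := (volume : Measure (Euc n))) (f := fun y => -(1/2) * ‖y‖ ^ 2) gk_int
  exact this

lemma gk_pos (y : Euc n) : 0 < gk y := mul_pos (inv_pos.2 gZ_pos) (epos _)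

lemma gk_cont : Continuous (gk : Euc n → ℝ) := by unfold gk; fun_prop

lemma gam_eq : Gam n = dens n gk := by
  have hi : Integrable (gk : Euc n → ℝ) := gk_int.const_mul _
  have h1 : ∫ y : Euc n, gk y = 1 := by
    unfold gk; rw [icm, ← gZ, inv_mul_cancel₀ gZ_pos.ne']
  have : IPM (dens n gk) := by
    constructor
    rw [dens, withDensity_apply _ MeasurableSet.univ, Measure.restrict_univ,
      ← oie hi (Eof fun x => (gk_pos _).le), h1, oro]
  refine Measure.ext_of_charFun ?_
  ext s
  rw [charFun_stdGaussian, charFun_apply, dens,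
    integral_withDensity_eq_integral_toReal_smul (by have := gk_cont (n := n); fun_prop) (by simp)]
  have : ∀ x : Euc n, (oR (gk x)).toReal • Complex.exp (⟪x, s⟫ * Complex.I) =
      ((gZ n)⁻¹ : ℂ) * Complex.exp (-(1/2:ℂ) * ‖x‖ ^ 2 + Complex.I * ⟪s, x⟫) := by
    intro x
    rw [eto (gk_pos x).le, gk, Complex.exp_add, ric, Complex.real_smul]
    push_cast; rw [mul_comm Complex.I]; ring
  simp only [this]
  rw [icm, gauss_cexp, ← mul_assoc, inv_mul_cancel₀, one_mul]
  · norm_cast; rw [neg_div]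
  · norm_cast; exact gZ_pos.ne'

lemma gam_mom (k : ℕ) (hk : k ≠ 0) : Integrable (fun u : Euc n => ‖u‖ ^ k) (Gam n) := by
  have h := IsGaussian.memLp_id (Gam n) k (by simp)
  exact h.integrable_norm_pow hk

/-- strongly log-concave, bounded support -/
structure SLC (n : ℕ) (t D : ℝ) (p : Measure (Euc n)) : Prop where
  dens : ∃ g : Euc n → ℝ, Measurable g ∧ MLC g ∧ (∀ x, D < ‖x‖ → g x = 0) ∧
    p = dens n (fun x => g x * exp (-t * ‖x‖ ^ 2 / 2))
  prob : IPM p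

lemma SLC.ball {t D : ℝ} {p : Measure (Euc n)} (h : SLC n t D p) : ∀ᵐ x ∂p, ‖x‖ ≤ D := by
  obtain ⟨g, hm, -, h0, rfl⟩ := h.dens
  rw [_root_.dens, ae_withDensity_iff fP]
  refine Eof fun x hx => ?_
  by_contra hc
  push Not at hc
  simp [h0 x hc] at hx

/-- scaled Gaussian kernel -/
def gke (ε : ℝ) (u : Euc n) : ℝ := (ε ^ n)⁻¹ * gk (ε⁻¹ • u)

lemma gke_lint {ε : ℝ} (hε : 0 < ε) (y : Euc n) (f : Euc n → ℝ≥0∞) (hf : Measurable f) :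
    ∫⁻ z, f z * oR (gke ε (z - y)) = ∫⁻ u, f (y + ε • u) ∂(Gam n) := by
  have hgc := gk_cont (n := n)
  rw [gam_eq, dens, lwd _ fP fP]
  have h1 := lintegral_map (μ := (volume : Measure (Euc n))) (f := fun z => f (y + z) * oR (gk (ε⁻¹ • z)))
    (g := fun u => ε • u) fP fP
  rw [Measure.map_addHaar_smul _ hε.ne', lintegral_smul_measure] at h1
  simp only [smul_smul, inv_mul_cancel₀ hε.ne', one_smul, finrank_euclideanSpace, fcf] at h1
  rw [← lintegral_add_left_eq_self _ y]
  simp only [add_sub_cancel_left]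
  calc _ = ∫⁻ z, oR |(ε ^ n)⁻¹| * (f (y + z) * oR (gk (ε⁻¹ • z))) := by
        congr 1; ext z; rw [gke, oRm pY, abs_of_pos pY]; ring
    _ = _ := by
        rw [lcm' _ fP]
        rw [← sem, h1]; congr 1; ext u; simp [mul_comm]

lemma gke_smooth (ε : ℝ) : ContDiff ℝ smo (gke ε : Euc n → ℝ) := by
  unfold gke gk
  exact contDiff_const.mul (contDiff_const.mul (Real.contDiff_exp.comp (contDiff_const.mul
    (contDiff_norm_sq ℝ |>.comp (contDiff_const_smul _)))))

lemma gke_pos {ε : ℝ} (hε : 0 < ε) (u : Euc n) : 0 < gke ε u := mul_pos pY (gk_pos _)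

lemma gke_conv {ε B : ℝ} (p : Measure (Euc n)) [IPM p] (hB : ∀ᵐ y ∂p, ‖y‖ ≤ B) :
    ContDiff ℝ smo fun z => ∫ y, gke ε (z - y) ∂p := by
  rw [contDiff_iff_contDiffAt]
  intro z0
  let φ : ContDiffBump (0 : Euc n) := ⟨|B| + ‖z0‖ + 1, |B| + ‖z0‖ + 2, by positivity, by linarith⟩
  have h1 : ContDiff ℝ smo (MeasureTheory.convolution (fun _ => (1:ℝ)) (fun u => φ u * gke ε u) (ContinuousLinearMap.lsmul ℝ ℝ) p) := by
    refine HasCompactSupport.contDiff_convolution_right _ φ.hasCompactSupport.mul_right ?_ (φ.contDiff.mul (gke_smooth ε))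
    exact (ict _).locallyIntegrable
  refine h1.contDiffAt.congr_of_eventuallyEq ?_
  filter_upwards [Metric.ball_mem_nhds z0 one_pos] with z hz
  simp only [MeasureTheory.convolution, ContinuousLinearMap.lsmul_apply, sem, one_mul]
  refine ica ?_
  filter_upwards [hB] with y hy
  rw [φ.one_of_mem_closedBall, one_mul]
  rw [mem_closedBall_zero_iff]
  have h2 := norm_sub_le z y
  have h3 : ‖z‖ ≤ ‖z0‖ + 1 := by
    have := norm_sub_norm_le z z0
    rw [Metric.mem_ball, dist_eq_norm] at hz; linarith
  have := le_abs_self B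
  show ‖z - y‖ ≤ |B| + ‖z0‖ + 1
  linarith

end

section
open ProbabilityTheory
variable {n : ℕ}

lemma gke_le {ε : ℝ} (hε : 0 < ε) (u : Euc n) : gke ε u ≤ (ε ^ n)⁻¹ * (gZ n)⁻¹ := by
  unfold gke gk
  refine mll ?_ pY
  refine mor (inv_nonneg.2 gZ_pos.le) ?_
  rw [Real.exp_le_one_iff]; nlinarith [sqn ‖ε⁻¹ • u‖]

lemma gke_lrho {ε : ℝ} (hε : 0 < ε) (p : Measure (Euc n)) [IPM p] {y : Euc n → Euc n} (hy : Continuous y) (z : Euc n) :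
    oR (∫ x, gke ε (z - y x) ∂p) = ∫⁻ x, oR (gke ε (z - y x)) ∂p := by
  have hc := (gke_smooth (n := n) ε).continuous
  refine oie ?_ (Eof fun x => (gke_pos hε _).le)
  refine (ict ((ε ^ n)⁻¹ * (gZ n)⁻¹)).mono' fP (Eof fun x => ?_)
  rw [rna, abs_of_pos (gke_pos hε _)]; exact gke_le hε _

lemma gke_mid (ε : ℝ) (u w : Euc n) :
    gke ε u * gke ε w * exp ((ε⁻¹) ^ 2 / 4 * ‖u - w‖ ^ 2) = gke ε ((1/2:ℝ) • (u + w)) ^ 2 := by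
  unfold gke gk
  simp only [norm_smul ε⁻¹, mul_pow, parallelogram_mid u w]
  rw [← enm]
  have : exp ((2:ℕ) * (-(1/2) * (‖ε⁻¹‖ ^ 2 * ((‖u‖ ^ 2 + ‖w‖ ^ 2) / 2 - ‖u - w‖ ^ 2 / 4)))) =
    exp (-(1/2) * (‖ε⁻¹‖ ^ 2 * ‖u‖ ^ 2)) * exp (-(1/2) * (‖ε⁻¹‖ ^ 2 * ‖w‖ ^ 2)) * exp ((ε⁻¹) ^ 2 / 4 * ‖u - w‖ ^ 2) := by
    rw [← eadd, ← eadd, rna, sq_abs]; congr 1; push_cast; ring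
  rw [this]; ring

lemma rho_scv {t D ε : ℝ} {p : Measure (Euc n)} (h : SLC n t D p) (ht : 0 < t) (hε : 0 < ε) (P : Euc n →L[ℝ] Euc n)
    (hP : ∀ x, ‖P x‖ ≤ ‖x‖) (a : Euc n) :
    SCv (t / (1 + t * ε ^ 2)) fun z => Real.log (∫ x, gke ε (z - P (x - a)) ∂p) := by
  have := h.prob
  have hc := (gke_smooth (n := n) ε).continuous
  have hy : Continuous fun x => P (x - a) := by fun_prop
  have hpos : ∀ z, 0 < ∫ x, gke ε (z - P (x - a)) ∂p := by
    intro z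
    rw [← ENNReal.ofReal_pos, gke_lrho hε p hy]
    rw [lintegral_pos_iff_support fP]
    have : Function.support (fun x => oR (gke ε (z - P (x - a)))) = univ := by
      ext x; simp [gke_pos hε]
    rw [this]; simp
  set t' := t / (1 + t * ε ^ 2) with ht'
  intro z w
  obtain ⟨g, hgm, hg, -, hp⟩ := h.dens
  set m := (1/2:ℝ) • (z + w)
  have key : (∫ x, gke ε (z - P (x - a)) ∂p) * (∫ x, gke ε (w - P (x - a)) ∂p) * exp (t' / 4 * ‖z - w‖ ^ 2) ≤
      (∫ x, gke ε (m - P (x - a)) ∂p) ^ 2 := by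
    rw [← ENNReal.ofReal_le_ofReal_iff pY, oRm (mnn (hpos _).le (hpos _).le), oRm (hpos _).le,
      orp (hpos _).le, gke_lrho hε p hy, gke_lrho hε p hy, gke_lrho hε p hy]
    have e : ∀ z, ∫⁻ x, oR (gke ε (z - P (x - a))) ∂p =
        ∫⁻ x, oR ((g x * exp (-t * ‖x‖ ^ 2 / 2)) * gke ε (z - P (x - a))) := by
      intro z
      rw [hp, dens, lwd _ fP fP]
      congr 1; ext x
      rw [Pi.mul_apply, ← oRm (mnn (hg.1 x) (epos _).le)]
    rw [e, e, e, mul_assoc, ← lintegral_mul_const (oR (exp (t' / 4 * ‖z - w‖ ^ 2))) fP]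
    refine pl_euc n _ _ _ ?_ ?_ ?_ fun x y => ?_
    iterate 3 fun_prop
    have hn := fun x => mnn (hg.1 x) (epos (-t * ‖x‖ ^ 2 / 2)).le
    rw [← oRm (mnn (hn _) (gke_pos hε _).le), ← oRm (mnn (hn _) (gke_pos hε _).le),
      ← orp (mnn (hn _) (gke_pos hε _).le)]
    refine oRl ?_
    have hmid : m - P ((1/2:ℝ) • (x + y) - a) = (1/2:ℝ) • ((z - P (x - a)) + (w - P (y - a))) := by
      simp only [m, map_sub, map_smul, map_add]; module
    rw [hmid, mul_pow, mul_pow, ← gke_mid, ← enm]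
    have hex : exp (-t * ‖x‖ ^ 2 / 2) * exp (-t * ‖y‖ ^ 2 / 2) * exp (t' / 4 * ‖z - w‖ ^ 2) ≤
        exp ((2:ℕ) * (-t * ‖(1/2:ℝ) • (x + y)‖ ^ 2 / 2)) * exp ((ε⁻¹) ^ 2 / 4 * ‖(z - P (x - a)) - (w - P (y - a))‖ ^ 2) := by
      rw [← eadd, ← eadd, ← eadd, ele, parallelogram_mid]
      set u := (z - P (x - a)) - (w - P (y - a)) with hu
      set v := P (x - y) with hv
      have hzw : z - w = u + v := by simp only [hu, hv, map_sub]; abel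
      have h1 : ‖z - w‖ ≤ ‖u‖ + ‖v‖ := by rw [hzw]; exact norm_add_le _ _
      have h2 : ‖v‖ ≤ ‖x - y‖ := hP _
      have h3 : t' * ‖z - w‖ ^ 2 ≤ (ε⁻¹) ^ 2 * ‖u‖ ^ 2 + t * ‖x - y‖ ^ 2 := by
        have h4 : ‖z - w‖ ^ 2 ≤ (‖u‖ + ‖v‖) ^ 2 := ppl (nnn _) h1 2
        have h5 : ‖v‖ ^ 2 ≤ ‖x - y‖ ^ 2 := ppl (nnn _) h2 2
        have h6 : t' * (‖u‖ + ‖v‖) ^ 2 ≤ (ε⁻¹) ^ 2 * ‖u‖ ^ 2 + t * ‖v‖ ^ 2 := by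
          rw [ht', div_mul_eq_mul_div, div_le_iff₀ pY]
          have : ((ε⁻¹) ^ 2 * ‖u‖ ^ 2 + t * ‖v‖ ^ 2) * (1 + t * ε ^ 2) - t * (‖u‖ + ‖v‖) ^ 2 = (ε⁻¹ * ‖u‖ - t * ε * ‖v‖) ^ 2 := by
            field_simp; ring
          nlinarith [sqn (ε⁻¹ * ‖u‖ - t * ε * ‖v‖)]
        have h7 : t' * ‖z - w‖ ^ 2 ≤ t' * (‖u‖ + ‖v‖) ^ 2 := mll h4 pY
        nlinarith
      push_cast; nlinarith
    have hgg := hg.2 x y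
    have hk1 := gke_pos hε (z - P (x - a))
    have hk2 := gke_pos hε (w - P (y - a))
    calc _ = (g x * g y) * (gke ε (z - P (x - a)) * gke ε (w - P (y - a))) *
          (exp (-t * ‖x‖ ^ 2 / 2) * exp (-t * ‖y‖ ^ 2 / 2) * exp (t' / 4 * ‖z - w‖ ^ 2)) := by ring
      _ ≤ (g ((1/2:ℝ) • (x + y)) ^ 2) * (gke ε (z - P (x - a)) * gke ε (w - P (y - a))) *
          (exp ((2:ℕ) * (-t * ‖(1/2:ℝ) • (x + y)‖ ^ 2 / 2)) * exp ((ε⁻¹) ^ 2 / 4 * ‖(z - P (x - a)) - (w - P (y - a))‖ ^ 2)) := by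
          gcongr
      _ = _ := by ring
  have h8 := Real.log_le_log (mul_pos (mul_pos (hpos _) (hpos _)) (epos _)) key
  rw [Real.log_mul (mul_pos (hpos _) (hpos _)).ne' (epos _).ne', Real.log_mul (hpos _).ne' (hpos _).ne', Real.log_exp,
    Real.log_pow] at h8
  exact_mod_cast h8

end

section
open ProbabilityTheory
variable {n : ℕ}

lemma grow_int {p : Measure (Euc n)} [IPM p] {y : Euc n → Euc n} (hy : Continuous y) {B C : ℝ}
    (hB : ∀ᵐ x ∂p, ‖y x‖ ≤ B) (hC : 0 ≤ C) {F : Euc n → ℝ} (hF : Continuous F) (hb : ∀ z, |F z| ≤ C * (1 + ‖z‖) ^ 4) :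
    (∀ ε : ℝ, 0 < ε → ε ≤ 1 → Integrable (fun w : Euc n × Euc n => F (y w.1 + ε • w.2)) (p.prod (Gam n))) ∧
    Filter.Tendsto (fun k : ℕ => ∫ w, F (y w.1 + (1/((k:ℝ)+1)) • w.2) ∂(p.prod (Gam n))) Filter.atTop (nhds (∫ x, F (y x) ∂p)) := by
  set G : Euc n × Euc n → ℝ := fun w => C * (8 * (1 + |B|) ^ 4 + 8 * ‖w.2‖ ^ 4) with hG
  have hGi : Integrable G (p.prod (Gam n)) :=
    ((ict _).add (((gam_mom 4 nN).comp_snd p).const_mul 8)).const_mul C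
  have hBp : ∀ᵐ w ∂(p.prod (Gam n)), ‖y w.1‖ ≤ B := Measure.quasiMeasurePreserving_fst.ae hB
  have hbd : ∀ ε : ℝ, 0 < ε → ε ≤ 1 → ∀ᵐ w ∂(p.prod (Gam n)), ‖F (y w.1 + ε • w.2)‖ ≤ G w := by
    intro ε hε hε1
    filter_upwards [hBp] with w hw
    refine (hb _).trans (mll ?_ hC)
    have h1 : ‖y w.1 + ε • w.2‖ ≤ |B| + ‖w.2‖ := by
      refine (norm_add_le _ _).trans (add_le_add (hw.trans (le_abs_self B)) ?_)
      rw [norm_smul, rna, abs_of_pos hε]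
      exact mul_le_of_le_one_left (nnn _) hε1
    have h2 : (1 + ‖y w.1 + ε • w.2‖) ^ 4 ≤ ((1 + |B|) + ‖w.2‖) ^ 4 := ppl pY lI 4
    have h3 := add_pow_le (show 0 ≤ 1 + |B| by positivity) (nnn w.2) 4
    norm_num at h3; linarith
  refine ⟨fun ε hε hε1 => hGi.mono' fP (hbd ε hε hε1), ?_⟩
  have e : ∫ x, F (y x) ∂p = ∫ w : Euc n × Euc n, F (y w.1) ∂(p.prod (Gam n)) := by
    rw [integral_fun_fst (μ := p) (ν := Gam n) (fun x => F (y x))]; simp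
  rw [e]
  refine tendsto_integral_of_dominated_convergence G (fun k => by fun_prop) hGi (fun k => hbd _ pY ?_) ?_
  · rw [div_le_one pY]; linarith [(Nat.cast_nonneg k : (0:ℝ) ≤ k)]
  · refine Eof fun w => ?_
    have h0 : Filter.Tendsto (fun k : ℕ => y w.1 + (1/((k:ℝ)+1)) • w.2) Filter.atTop (nhds (y w.1 + (0:ℝ) • w.2)) :=
      (tendsto_one_div_add_atTop_nhds_zero_nat.smul_const _).const_add _
    rw [zero_smul, add_zero] at h0
    exact (hF.tendsto _).comp h0

lemma pw_map {ε : ℝ} (hε : 0 < ε) (p : Measure (Euc n)) [IPM p] {y : Euc n → Euc n} (hy : Continuous y)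
    {W : Euc n → ℝ} (hW : ∀ z, exp (W z) = ∫ x, gke ε (z - y x) ∂p) (hWc : Continuous W) :
    PW W = (p.prod (Gam n)).map fun w => y w.1 + ε • w.2 := by
  have hc := (gke_smooth (n := n) ε).continuous
  refine Measure.ext_of_lintegral _ fun f hf => ?_
  rw [PW, lwd _ fP hf, lintegral_map hf fP, lintegral_prod _ fP]
  simp only [Pi.mul_apply, hW, gke_lrho hε p hy, ← gke_lint hε _ f hf]
  rw [lls fP]
  congr 1; ext z
  rw [lcm' _ fP, mul_comm]

theorem poin_lim {t D R C : ℝ} {p : Measure (Euc n)} (h : SLC n t D p) (ht : 0 < t) (P : Euc n →L[ℝ] Euc n)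
    (hP : ∀ x, ‖P x‖ ≤ ‖x‖) (a : Euc n) (hR : 0 < R) (hcov : ∀ v, ∫ x, ⟪v, P (x - a)⟫ ^ 2 ∂p ≤ R * ‖v‖ ^ 2)
    {F : Euc n → ℝ} (hF : ContDiff ℝ smo F) (hC : 0 ≤ C) (hFb : ∀ z, |F z| ≤ C * (1 + ‖z‖) ^ 2)
    (hFd : ∀ i z, |pd i F z| ≤ C * (1 + ‖z‖) ^ 2) (b : Bool) :
    (∫ x, F (P (x - a)) ^ 2 ∂p) - (∫ x, F (P (x - a)) ∂p) ^ 2 ≤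
      (if b then √(R / t) else 1 / t) * ∫ x, ∑ i, pd i F (P (x - a)) ^ 2 ∂p := by
  have := h.prob
  set y : Euc n → Euc n := fun x => P (x - a) with hyd
  have hy : Continuous y := by fun_prop
  have hB : ∀ᵐ x ∂p, ‖y x‖ ≤ D + ‖a‖ := by
    filter_upwards [h.ball] with x hx
    exact (hP _).trans ((norm_sub_le _ _).trans lI)
  have sq4 : ∀ {G : Euc n → ℝ}, (∀ z, |G z| ≤ C * (1 + ‖z‖) ^ 2) → ∀ z, |G z ^ 2| ≤ C ^ 2 * (1 + ‖z‖) ^ 4 := by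
    intro G hG z
    rw [abs_pow]
    calc _ ≤ (C * (1 + ‖z‖) ^ 2) ^ 2 := ppl (abn _) (hG z) 2
      _ = _ := by ring
  have up4 : ∀ z, |F z| ≤ C * (1 + ‖z‖) ^ 4 := fun z => (hFb z).trans
    (mll (ppr (by linarith [nnn z]) nN) hC)
  obtain ⟨iF, lF⟩ := grow_int hy hB hC hF.continuous up4
  obtain ⟨iF2, lF2⟩ := grow_int hy hB (sqn C) (hF.continuous.pow 2) (sq4 hFb)
  have gd := fun i => grow_int hy hB (sqn C) ((pd_cont hF i).pow 2) (sq4 (hFd i))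
  have lgd : Filter.Tendsto (fun k : ℕ => ∑ i, ∫ w, pd i F (y w.1 + (1/((k:ℝ)+1)) • w.2) ^ 2 ∂(p.prod (Gam n))) Filter.atTop
      (nhds (∑ i, ∫ x, pd i F (y x) ^ 2 ∂p)) := tendsto_finsetSum _ fun i _ => (gd i).2
  have eS : ∫ x, ∑ i, pd i F (P (x - a)) ^ 2 ∂p = ∑ i, ∫ x, pd i F (y x) ^ 2 ∂p := by
    rw [ifs]
    intro i _
    have := pd_cont hF i
    refine (ict (C ^ 2 * (1 + (D + ‖a‖)) ^ 4)).mono' fP ?_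
    filter_upwards [hB] with x hx
    refine (sq4 (hFd i) _).trans ?_
    gcongr
  rw [eS]
  have hlin : ∀ v : Euc n, ∀ z, |⟪v, z⟫ ^ 2| ≤ ‖v‖ ^ 2 * (1 + ‖z‖) ^ 4 := by
    intro v z
    rw [abs_pow]
    have h1 := ain v z
    calc _ ≤ (‖v‖ * ‖z‖) ^ 2 := ppl (abn _) h1 2
      _ = ‖v‖ ^ 2 * ‖z‖ ^ 2 := by ring
      _ ≤ _ := by
        gcongr
        calc ‖z‖ ^ 2 ≤ (1 + ‖z‖) ^ 2 := by gcongr; linarith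
          _ ≤ _ := ppr (by linarith [nnn z]) nN
  set m2 := ∫ u, ‖u‖ ^ 2 ∂(Gam n) with hm2
  have hm20 : 0 ≤ m2 := inn fun u => by positivity
  let Re : ℝ → ℝ := fun ε => (1 + ε) * R + (ε ^ 2 + ε) * m2
  let te : ℝ → ℝ := fun ε => t / (1 + t * ε ^ 2)
  have main : ∀ ε : ℝ, 0 < ε → ε ≤ 1 →
      (∫ w, F (y w.1 + ε • w.2) ^ 2 ∂(p.prod (Gam n))) - (∫ w, F (y w.1 + ε • w.2) ∂(p.prod (Gam n))) ^ 2 ≤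
      (if b then √(Re ε / te ε) else 1 / te ε) * ∑ i, ∫ w, pd i F (y w.1 + ε • w.2) ^ 2 ∂(p.prod (Gam n)) := by
    intro ε hε hε1
    have hc := (gke_smooth (n := n) ε).continuous
    set ρ : Euc n → ℝ := fun z => ∫ x, gke ε (z - y x) ∂p with hρd
    have hρs : ContDiff ℝ smo ρ := by
      have : IPM (p.map y) := Measure.isProbabilityMeasure_map fP
      have h2 := gke_conv (ε := ε) (p.map y) (B := D + ‖a‖) ((ae_map_iff fP (mbl fP fP)).2 hB)
      convert h2 using 2 with z
      rw [integral_map fP fP]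
    have hρ0 : ∀ z, 0 < ρ z := by
      intro z
      rw [← ENNReal.ofReal_pos, hρd]
      simp only
      rw [gke_lrho hε p hy, lintegral_pos_iff_support fP]
      have : Function.support (fun x => oR (gke ε (z - y x))) = univ := by
        ext x; simp [gke_pos hε]
      rw [this]; simp
    set W : Euc n → ℝ := fun z => Real.log (ρ z) with hWd
    have hW : ContDiff ℝ smo W := hρs.log fun z => (hρ0 z).ne'
    have hWe : ∀ z, exp (W z) = ρ z := fun z => Real.exp_log (hρ0 z)
    have hmap := pw_map hε p hy hWe hW.continuous
    have hφ : Measurable fun w : Euc n × Euc n => y w.1 + ε • w.2 := by fun_prop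
    have hPr : IPM (PW W) := hmap ▸ Measure.isProbabilityMeasure_map hφ.aemeasurable
    have tr : ∀ G : Euc n → ℝ, Continuous G → Integrable (fun w : Euc n × Euc n => G (y w.1 + ε • w.2)) (p.prod (Gam n)) →
        (Integrable fun z => G z * exp (W z)) ∧ ∫ z, G z * exp (W z) = ∫ w, G (y w.1 + ε • w.2) ∂(p.prod (Gam n)) := by
      intro G hG hGi
      rw [← PW_intble hW.continuous, ← PW_int hW.continuous, hmap]
      exact ⟨(integrable_map_measure fP hφ.aemeasurable).2 hGi, integral_map hφ.aemeasurable fP⟩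
    obtain ⟨hρi, h1⟩ := tr (fun _ => 1) continuous_const (ict _)
    simp only [one_mul] at hρi h1
    rw [integral_const] at h1
    simp at h1
    have hscv : SCv (te ε) W := rho_scv h ht hε P hP a
    have hte : 0 < te ε := by positivity
    have hRe : 0 < Re ε := by positivity
    have hcv : ∀ v : Euc n, (Integrable fun x => ⟪v, x⟫ ^ 2 * exp (W x)) ∧ ∫ x, ⟪v, x⟫ ^ 2 * exp (W x) ≤ Re ε * ‖v‖ ^ 2 := by
      intro v
      obtain ⟨iv, -⟩ := grow_int hy hB (sqn ‖v‖) (show Continuous fun z : Euc n => ⟪v, z⟫ ^ 2 by fun_prop) (hlin v)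
      obtain ⟨j1, j2⟩ := tr _ (show Continuous fun z : Euc n => ⟪v, z⟫ ^ 2 by fun_prop) (iv ε hε hε1)
      refine ⟨j1, ?_⟩
      rw [j2]
      have ib : Integrable (fun x => ⟪v, y x⟫ ^ 2) p := by
        refine (ict (‖v‖ ^ 2 * (1 + (D + ‖a‖)) ^ 4)).mono' fP ?_
        filter_upwards [hB] with x hx
        refine (hlin v _).trans ?_
        gcongr
      have i1 : Integrable (fun w : Euc n × Euc n => ⟪v, y w.1⟫ ^ 2) (p.prod (Gam n)) := ib.comp_fst (Gam n)
      have i2 : Integrable (fun w : Euc n × Euc n => ‖w.2‖ ^ 2) (p.prod (Gam n)) := (gam_mom 2 nN).comp_snd p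
      calc _ ≤ ∫ w : Euc n × Euc n, ((1 + ε) * ⟪v, y w.1⟫ ^ 2 + ((ε ^ 2 + ε) * ‖v‖ ^ 2) * ‖w.2‖ ^ 2) ∂(p.prod (Gam n)) := by
            refine imn (iv ε hε hε1) ((i1.const_mul _).add (i2.const_mul _)) fun w => ?_
            simp only [inner_add_right, inner_smul_right]
            have h2 : ⟪v, w.2⟫ ^ 2 ≤ ‖v‖ ^ 2 * ‖w.2‖ ^ 2 := by
              rw [← sq_abs, ← mul_pow]; exact ppl (abn _) (ain _ _) 2
            have h3 : (⟪v, y w.1⟫ + ε * ⟪v, w.2⟫) ^ 2 ≤ (1 + ε) * ⟪v, y w.1⟫ ^ 2 + (ε ^ 2 + ε) * ⟪v, w.2⟫ ^ 2 := by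
              nlinarith [mnn hε.le (sqn (⟪v, y w.1⟫ - ⟪v, w.2⟫))]
            nlinarith [mll h2 (show 0 ≤ ε ^ 2 + ε by positivity)]
        _ = (1 + ε) * ∫ x, ⟪v, y x⟫ ^ 2 ∂p + ((ε ^ 2 + ε) * ‖v‖ ^ 2) * m2 := by
            rw [iad (i1.const_mul _) (i2.const_mul _), icm, icm,
              integral_fun_fst (μ := p) (ν := Gam n) (fun x => ⟪v, y x⟫ ^ 2), integral_fun_snd (μ := p) (ν := Gam n) (fun u => ‖u‖ ^ 2)]
            simp [hm2]
        _ ≤ _ := by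
            have := hcov v
            simp only [Re]
            nlinarith [mll this (show 0 ≤ 1 + ε by positivity)]
    obtain ⟨v1, v2⟩ := valid_sqrt hW hρi h1 hte hRe hscv hcv
    obtain ⟨a1, a2⟩ := tr F hF.continuous (iF ε hε hε1)
    obtain ⟨b1, b2⟩ := tr (fun z => F z ^ 2) (hF.continuous.pow 2) (iF2 ε hε hε1)
    have dd := fun i => tr (fun z => pd i F z ^ 2) ((pd_cont hF i).pow 2) ((gd i).1 ε hε hε1)
    have key : ∀ κ, 0 < κ → Valid W κ → (∫ w, F (y w.1 + ε • w.2) ^ 2 ∂(p.prod (Gam n))) - (∫ w, F (y w.1 + ε • w.2) ∂(p.prod (Gam n))) ^ 2 ≤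
      κ * ∑ i, ∫ w, pd i F (y w.1 + ε • w.2) ^ 2 ∂(p.prod (Gam n)) := by
      intro κ hκ hv
      have h5 := poincare hW hρi h1 hκ hv hF b1 (fun i => (dd i).1)
      simp only [fsm] at h5
      rw [ifs _ (fun i _ => (dd i).1), b2, a2, fsc rfl fun i _ => (dd i).2] at h5
      exact h5
    cases b
    · exact key _ pY v2
    · exact key _ (Real.sqrt_pos.2 pY) v1
  have c1 : Filter.Tendsto (fun k : ℕ => 1/((k:ℝ)+1)) Filter.atTop (nhds 0) := tendsto_one_div_add_atTop_nhds_zero_nat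
  have ct : Filter.Tendsto (fun k : ℕ => te (1/((k:ℝ)+1))) Filter.atTop (nhds t) := by
    have : Filter.Tendsto te (nhds 0) (nhds (te 0)) := by
      refine ContinuousAt.tendsto (ContinuousAt.div fP fP (by simp))
    have h0 : te 0 = t := by simp [te]
    rw [h0] at this
    exact this.comp c1
  have cR : Filter.Tendsto (fun k : ℕ => Re (1/((k:ℝ)+1))) Filter.atTop (nhds R) := by
    have : Filter.Tendsto Re (nhds 0) (nhds (Re 0)) := Continuous.tendsto fP _
    have h0 : Re 0 = R := by simp [Re]
    rw [h0] at this
    exact this.comp c1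
  have cK : Filter.Tendsto (fun k : ℕ => if b then √(Re (1/((k:ℝ)+1)) / te (1/((k:ℝ)+1))) else 1 / te (1/((k:ℝ)+1))) Filter.atTop
      (nhds (if b then √(R / t) else 1 / t)) := by
    cases b
    · simpa using ct.inv₀ ht.ne'
    · simpa using (cR.div ct ht.ne').sqrt
  refine le_of_tendsto_of_tendsto' (lF2.sub (lF.pow 2)) (cK.mul lgd) fun k => ?_
  refine main _ pY ?_
  rw [div_le_one pY]; linarith [(Nat.cast_nonneg k : (0:ℝ) ≤ k)]

end

section
open ProbabilityTheory
variable {n : ℕ}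

lemma SLC.int {t D : ℝ} {p : Measure (Euc n)} (h : SLC n t D p) {f : Euc n → ℝ} (hf : Continuous f) : Integrable f p := by
  have := h.prob
  obtain ⟨C, hC⟩ := (isCompact_closedBall (0 : Euc n) D).exists_bound_of_continuousOn hf.continuousOn
  refine (ict C).mono' fP ?_
  filter_upwards [h.ball] with x hx
  exact hC x (by simpa using hx)

/-- covariance data: mean `a`, orthonormal eigenbasis `v`, eigenvalues `l`. -/
structure CovD (p : Measure (Euc n)) (a : Euc n) (v : ONB n) (l : Fin n → ℝ) : Prop where
  mean : ∀ w : Euc n, ∫ x, ⟪w, x - a⟫ ∂p = 0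
  cov : ∀ i j, ∫ x, ⟪v i, x - a⟫ * ⟪v j, x - a⟫ ∂p = if i = j then l i else 0

def T3 (p : Measure (Euc n)) (a : Euc n) (v : ONB n) (i j k : Fin n) : ℝ :=
  ∫ x, ⟪v i, x - a⟫ * (⟪v j, x - a⟫ * ⟪v k, x - a⟫) ∂p

variable {t D : ℝ} {p : Measure (Euc n)} {a : Euc n} {v : ONB n} {l : Fin n → ℝ}

lemma CovD.quad (h : SLC n t D p) (hc : CovD p a v l) (c : Fin n → ℝ) :
    ∫ x, (∑ k, c k * ⟪v k, x - a⟫) ^ 2 ∂p = ∑ k, c k ^ 2 * l k := by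
  have e : ∀ x, (∑ k, c k * ⟪v k, x - a⟫) ^ 2 = ∑ i, ∑ j, (c i * c j) * (⟪v i, x - a⟫ * ⟪v j, x - a⟫) := by
    intro x; rw [sq, Finset.sum_mul_sum]
    exact fsc rfl fun i _ => fsc rfl fun j _ => by ring
  simp only [e]
  rw [ifs _ fun i _ => h.int fP]
  refine fsc rfl fun i _ => ?_
  rw [ifs _ fun j _ => h.int fP]
  simp only [icm, hc.cov]
  simp [sq]

lemma CovD.nonneg (hc : CovD p a v l) (i : Fin n) : 0 ≤ l i := by
  have := hc.cov i i
  rw [if_pos rfl] at this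
  rw [← this]; exact inn fun x => mul_self_nonneg _

/-- orthogonal projection on the small eigenspaces -/
def prj (v : ONB n) (S : Fin n → ℝ) : Euc n →L[ℝ] Euc n :=
  ∑ j, (S j) • (innerSL ℝ (v j)).smulRight (v j)

lemma prj_in (v : ONB n) (S : Fin n → ℝ) (j : Fin n) (x : Euc n) : ⟪v j, prj v S x⟫ = S j * ⟪v j, x⟫ := by
  have : prj v S x = ∑ j, (S j * ⟪v j, x⟫) • v j := by simp [prj, smul_smul]
  rw [this, v.orthonormal.inner_right_fintype]

lemma onb_sq (v : ONB n) (x : Euc n) : ∑ j, ⟪v j, x⟫ ^ 2 = ‖x‖ ^ 2 := by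
  have := v.sum_sq_norm_inner_right x
  simpa [sq_abs] using this

lemma onb_in (v : ONB n) (x y : Euc n) : ∑ j, ⟪v j, x⟫ * ⟪v j, y⟫ = ⟪x, y⟫ := by
  rw [← v.sum_inner_mul_inner x y]
  exact fsc rfl fun j _ => by rw [ric]

lemma prj_contr (v : ONB n) {S : Fin n → ℝ} (hS : ∀ j, S j = 0 ∨ S j = 1) (x : Euc n) : ‖prj v S x‖ ≤ ‖x‖ := by
  refine le_of_sq_le_sq ?_ (nnn _)
  rw [← onb_sq v, ← onb_sq v x]
  refine fsl fun j _ => ?_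
  rw [prj_in]
  rcases hS j with h | h <;> simp [h, sqn]

lemma prj_cov (h : SLC n t D p) (hc : CovD p a v l) {S : Fin n → ℝ} (hS : ∀ j, S j = 0 ∨ S j = 1) {R : ℝ} (hR : ∀ j, S j = 1 → l j ≤ R)
    (hR0 : 0 ≤ R) (w : Euc n) : ∫ x, ⟪w, prj v S (x - a)⟫ ^ 2 ∂p ≤ R * ‖w‖ ^ 2 := by
  have e : ∀ x, ⟪w, prj v S (x - a)⟫ = ∑ k, (⟪v k, w⟫ * S k) * ⟪v k, x - a⟫ := by
    intro x; rw [← onb_in v w]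
    exact fsc rfl fun k _ => by rw [prj_in]; ring
  simp only [e]
  rw [hc.quad h, ← onb_sq v w, fms]
  refine fsl fun k _ => ?_
  rcases hS k with hk | hk
  · simp [hk]; positivity
  · rw [hk, mul_one, mul_comm]; exact mlr (hR k hk) (sqn _)

lemma quadF (M : Euc n →L[ℝ] Euc n) (hM : ∀ x y, ⟪x, M y⟫ = ⟪M x, y⟫) (i : Fin n) (z : Euc n) :
    pd i (fun z => ⟪z, M z⟫) z = 2 * M z i := by
  unfold pd
  have h1 : HasFDerivAt (fun z => ⟪z, M z⟫) _ z := (hasFDerivAt_id z).inner ℝ M.hasFDerivAt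
  rw [h1.fderiv]
  simp [hM, eis, EuclideanSpace.inner_single_left, ric]
  ring

lemma top_le (h : SLC n t D p) (ht : 0 < t) (hc : CovD p a v l) (i : Fin n) : l i ≤ 1 / t := by
  have hs := fun j => hc.nonneg j
  set R := 1 + ∑ j, l j
  have hRj : ∀ j, l j ≤ R := fun j => by
    have := Finset.single_le_sum (fun j _ => hs j) (Finset.mem_univ j); simp only [R]; linarith
  have e2 : ∀ j x, pd j (fun x : Euc n => ⟪v i, x⟫) x = v i j := by
    intro j x
    unfold pd
    rw [show (fun x : Euc n => ⟪v i, x⟫) = ⇑(innerSL ℝ (v i)) from rfl, ContinuousLinearMap.fderiv]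
    simp [eis]
  have := poin_lim (C := 1) (F := fun x => ⟪v i, x⟫) h ht (ContinuousLinearMap.id ℝ _) (fun x => le_rfl) a (R := R)
    (by have := Finset.sum_nonneg fun j (_ : j ∈ Finset.univ) => hs j; simp only [R]; linarith) (fun w => by
      have := prj_cov h hc (S := fun _ => 1) (fun _ => Or.inr rfl) (R := R) (fun j _ => hRj j) ((hs i).trans (hRj i)) w
      convert this using 4 with x
      rw [← onb_in v w (prj v _ (x - a)), ← onb_in v w]
      exact fsc rfl fun j _ => by rw [prj_in, one_mul]; rfl)
    (contDiff_const.inner ℝ contDiff_id) zero_le_one (fun z => ?_) (fun j z => ?_) false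
  · simp only [ContinuousLinearMap.id_apply, e2, hc.mean] at this
    have h0 := h.prob
    have h3 := hc.cov i i
    simp only [if_true, ← sq] at h3
    have h4 : ∑ j, v i j ^ 2 = 1 := by
      have := ens (v i); simp at this; linarith
    rw [h3] at this; simp [h4] at this; simpa using this
  · have := ain (v i) z; simp at this
    nlinarith [nnn z]
  · rw [e2]
    have := PiLp.norm_apply_le (v i) j; simp at this
    nlinarith [nnn z]

theorem third (h : SLC n t D p) (ht : 0 < t) (hc : CovD p a v l) (i : Fin n) :
    ∑ j, ∑ k, (if l j ≤ l i ∧ l k ≤ l i then T3 p a v i j k ^ 2 else 0) ≤ 4 * l i ^ 2 * √(l i / t) := by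
  have := h.prob
  set R := l i with hR
  let S : Fin n → ℝ := fun j => if l j ≤ R then 1 else 0
  have hS : ∀ j, S j = 0 ∨ S j = 1 := fun j => by simp only [S]; split_ifs <;> simp
  have hS1 : ∀ j, S j = 1 → l j ≤ R := fun j hj => by
    by_contra hcon; simp [S, hcon] at hj
  have hSS : ∀ j, S j * S j = S j := fun j => by rcases hS j with h | h <;> simp [h]
  let m : Fin n → Fin n → ℝ := fun j k => S j * S k * T3 p a v i j k
  have hmsym : ∀ j k, m j k = m k j := fun j k => by
    simp only [m, T3]; rw [mul_comm (S j)]; congr 2; ext x; ring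
  have hsum : ∑ j, ∑ k, (if l j ≤ l i ∧ l k ≤ l i then T3 p a v i j k ^ 2 else 0) = ∑ j, ∑ k, m j k ^ 2 := by
    refine fsc rfl fun j _ => fsc rfl fun k _ => ?_
    by_cases h1 : l j ≤ R <;> by_cases h2 : l k ≤ R <;> simp [m, S, h1, h2, ← hR]
  rw [hsum]
  set N := ∑ j, ∑ k, m j k ^ 2 with hN
  let M : Euc n →L[ℝ] Euc n := ∑ j, ∑ k, (m j k) • (innerSL ℝ (v k)).smulRight (v j)
  have hMa : ∀ x, M x = ∑ j, (∑ k, m j k * ⟪v k, x⟫) • v j := by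
    intro x; simp [M, smul_smul, Finset.sum_smul]
  have hMc : ∀ x j, ⟪v j, M x⟫ = ∑ k, m j k * ⟪v k, x⟫ := by
    intro x j; rw [hMa, v.orthonormal.inner_right_fintype]
  have hMq : ∀ x y, ⟪x, M y⟫ = ∑ j, ∑ k, m j k * (⟪v j, x⟫ * ⟪v k, y⟫) := by
    intro x y; rw [← onb_in v]
    refine fsc rfl fun j _ => ?_
    rw [hMc, fms]; exact fsc rfl fun k _ => by ring
  have hMs : ∀ x y, ⟪x, M y⟫ = ⟪M x, y⟫ := by
    intro x y
    rw [← ric (M x) y, hMq, hMq, fco]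
    exact fsc rfl fun j _ => fsc rfl fun k _ => by rw [hmsym]; ring
  have hFP : ∀ x, ⟪prj v S x, M (prj v S x)⟫ = ∑ j, ∑ k, m j k * (⟪v j, x⟫ * ⟪v k, x⟫) := by
    intro x; rw [hMq]
    refine fsc rfl fun j _ => fsc rfl fun k _ => ?_
    rw [prj_in, prj_in]; simp only [m]
    linear_combination (T3 p a v i j k * ⟪v j, x⟫ * ⟪v k, x⟫) * (S k * S k * hSS j + S j * hSS k)
  have hN2 : ∫ x, ⟪v i, x - a⟫ * ⟪prj v S (x - a), M (prj v S (x - a))⟫ ∂p = N := by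
    simp only [hFP, fms]
    rw [ifs _ fun j _ => h.int fP]
    refine fsc rfl fun j _ => ?_
    rw [ifs _ fun j _ => h.int fP]
    refine fsc rfl fun k _ => ?_
    have : ∫ x, ⟪v i, x - a⟫ * (m j k * (⟪v j, x - a⟫ * ⟪v k, x - a⟫)) ∂p = m j k * T3 p a v i j k := by
      rw [T3, ← icm]; congr 1; ext x; ring
    rw [this]; simp only [m]
    linear_combination (-(T3 p a v i j k) ^ 2) * (S k * S k * hSS j + S j * hSS k)
  set q : Euc n → ℝ := fun x => ⟪prj v S (x - a), M (prj v S (x - a))⟫ with hq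
  have hqc : Continuous q := by fun_prop
  have hR0 : 0 ≤ R := hc.nonneg i
  -- Cauchy-Schwarz
  have cs : ∀ α : ℝ, 2 * α * N ≤ α ^ 2 * R + ((∫ x, q x ^ 2 ∂p) - (∫ x, q x ∂p) ^ 2) := by
    intro α
    set μ := ∫ x, q x ∂p
    have h0 : 0 ≤ ∫ x, (α * ⟪v i, x - a⟫ - (q x - μ)) ^ 2 ∂p := inn fun x => sqn _
    have e : ∀ x, (α * ⟪v i, x - a⟫ - (q x - μ)) ^ 2 = α ^ 2 * (⟪v i, x - a⟫ * ⟪v i, x - a⟫) + (-(2 * α)) * (⟪v i, x - a⟫ * q x) +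
      (2 * α * μ) * ⟪v i, x - a⟫ + q x ^ 2 + (-(2 * μ)) * q x + μ ^ 2 := fun x => by ring
    simp only [e] at h0
    iterate 5 rw [iad (h.int fP) (h.int fP)] at h0
    simp only [icm, hc.cov, hc.mean, hN2, integral_const, if_true] at h0
    rw [← hR] at h0
    simp only [probReal_univ, one_smul] at h0
    have hN3 : ∫ x, ⟪v i, x - a⟫ * q x ∂p = N := hN2
    have hμ : ∫ x, q x ∂p = μ := rfl
    rw [hN3, hμ] at h0
    linarith
  have hN0 : 0 ≤ N := Finset.sum_nonneg fun j _ => Finset.sum_nonneg fun k _ => sqn _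
  rcases hR0.eq_or_lt with hz | hpos
  · have : N = 0 := by
      have hV := cs
      rw [← hz] at hV
      set V := (∫ x, q x ^ 2 ∂p) - (∫ x, q x ∂p) ^ 2
      by_contra hne
      have hp := lt_of_le_of_ne hN0 (Ne.symm hne)
      have := hV ((V + 1) / N)
      rw [show 2 * ((V + 1) / N) * N = 2 * (V + 1) by field_simp] at this
      have h2 := hV 0
      simp at this h2; linarith
    rw [this]; positivity
  have hMb : ∀ z, ‖M z‖ ≤ ‖M‖ * ‖z‖ := fun z => M.le_opNorm z
  have hM0 := nnn M
  have po := poin_lim (C := 2 * ‖M‖) (F := fun z => ⟪z, M z⟫) h ht (prj v S) (prj_contr v hS) a hpos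
    (fun w => prj_cov h hc hS hS1 hR0 w) (contDiff_id.inner ℝ M.contDiff) pY (fun z => ?_) (fun j z => ?_) true
  rotate_left
  · have h1 := ain z (M z)
    have h2 := mll (hMb z) (nnn z)
    have h3 : 0 ≤ ‖M‖ * ‖z‖ := by positivity
    nlinarith [mnn hM0 (sqn ‖z‖)]
  · rw [quadF M hMs, abs_mul, abs_two]
    have h1 : |M z j| ≤ ‖M z‖ := PiLp.norm_apply_le (M z) j
    have h2 := hMb z
    have h3 : 0 ≤ ‖M‖ * ‖z‖ := by positivity
    nlinarith [mnn hM0 (sqn ‖z‖)]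
  simp only [quadF M hMs, if_true] at po
  have gr : ∫ x, ∑ j, (2 * M (prj v S (x - a)) j) ^ 2 ∂p ≤ 4 * R * N := by
    have e : ∀ x, ∑ j, (2 * M (prj v S (x - a)) j) ^ 2 = ∑ j, 4 * (∑ k, m j k * ⟪v k, x - a⟫) ^ 2 := by
      intro x
      have h1 := ens (M (prj v S (x - a)))
      rw [← onb_sq v] at h1
      simp only [mul_pow, ← fms]
      have h2 : ∀ j, ⟪v j, M (prj v S (x - a))⟫ = ∑ k, m j k * ⟪v k, x - a⟫ := by
        intro j; rw [hMc]
        refine fsc rfl fun k _ => ?_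
        rw [prj_in]; simp only [m]; linear_combination (S j * T3 p a v i j k * ⟪v k, x - a⟫) * hSS k
      simp only [h2, rna, sq_abs] at h1
      rw [← h1]; norm_num
    simp only [e]
    rw [ifs _ fun j _ => h.int fP]
    simp only [icm, hc.quad h]
    rw [hN, fms]
    refine fsl fun j _ => ?_
    rw [mul_assoc, fms (a := R)]
    refine mll (fsl fun k _ => ?_) nN
    rcases hS k with hk | hk
    · simp [m, hk]
    · rw [mul_comm]; exact mlr (hS1 k hk) (sqn _)
  have hκ := Real.sqrt_nonneg (R / t)
  have h5 := cs (N / R)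
  rw [show 2 * (N / R) * N = 2 * (N ^ 2 / R) by ring, show (N / R) ^ 2 * R = N ^ 2 / R by field_simp] at h5
  have h6 : N ^ 2 / R ≤ √(R / t) * (4 * R * N) := by
    have := mll gr hκ
    linarith
  rw [div_le_iff₀ hpos] at h6
  rcases hN0.eq_or_lt with hz | hNp
  · rw [← hz]; positivity
  · refine le_of_mul_le_mul_right ?_ hNp
    nlinarith

end

section
open ProbabilityTheory
variable {n : ℕ}

def Ef (y : ℝ) : ℝ := if y ≤ 0 then exp y else 1 + y + y ^ 2 / 2
def Ef1 (y : ℝ) : ℝ := if y ≤ 0 then exp y else 1 + y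
def Ef2 (y : ℝ) : ℝ := exp (min y 0)

lemma Ef_der (y : ℝ) : HasDerivAt Ef (Ef1 y) y := by
  have hp : ∀ y : ℝ, HasDerivAt (fun y : ℝ => 1 + y + y ^ 2 / 2) (1 + y) y := fun y => by
    have := ((hasDerivAt_const y (1 : ℝ)).add (hasDerivAt_id y)).add ((hasDerivAt_pow 2 y).div_const 2)
    exact this.congr_deriv (by simp)
  rcases lt_trichotomy y 0 with h | h | h
  · rw [Ef1, if_pos h.le]
    refine (Real.hasDerivAt_exp y).congr_of_eventuallyEq ?_
    filter_upwards [Iio_mem_nhds h] with z hz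
    rw [Ef, if_pos (le_of_lt hz)]
  · subst h
    rw [Ef1, if_pos le_rfl, Real.exp_zero]
    rw [← hasDerivWithinAt_univ, ← Iic_union_Ici (a := (0 : ℝ))]
    refine HasDerivWithinAt.union ?_ ?_
    · have := (Real.hasDerivAt_exp 0).hasDerivWithinAt (s := Iic 0)
      rw [Real.exp_zero] at this
      exact this.congr (fun z hz => if_pos hz) (if_pos le_rfl)
    · have := (hp 0).hasDerivWithinAt (s := Ici 0)
      rw [add_zero] at this
      refine this.congr (fun z hz => ?_) (by simp [Ef])
      rcases (show (0 : ℝ) ≤ z from hz).eq_or_lt with h | h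
      · simp [Ef, ← h]
      · rw [Ef, if_neg (not_le.2 h)]
  · rw [Ef1, if_neg (not_le.2 h)]
    refine (hp y).congr_of_eventuallyEq ?_
    filter_upwards [Ioi_mem_nhds h] with z hz
    rw [Ef, if_neg (not_le.2 hz)]

lemma Ef1_le {a b : ℝ} (h : a ≤ b) : Ef1 b - Ef1 a ≤ Ef2 b * (b - a) := by
  unfold Ef1 Ef2
  by_cases hb : b ≤ 0
  · rw [if_pos hb, if_pos (h.trans hb), min_eq_left hb]
    have h1 := aoe (a - b)
    have h2 : exp a = exp b * exp (a - b) := by rw [← eadd]; ring_nf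
    rw [h2]; nlinarith [epos b]
  · push Not at hb
    rw [if_neg (not_le.2 hb), min_eq_right hb.le, Real.exp_zero]
    split_ifs with ha
    · linarith [aoe a]
    · linarith

lemma Ef2_pos (y : ℝ) : 0 < Ef2 y := epos _
lemma Ef2_mono : Monotone Ef2 := fun a b h => ele.2 (min_le_min_right _ h)
lemma Ef1_nonneg (y : ℝ) : 0 ≤ Ef1 y := by unfold Ef1; split_ifs with h; positivity; linarith
lemma Ef2_le (y : ℝ) : Ef2 y ≤ Ef y := by
  unfold Ef2 Ef; split_ifs with h
  · rw [min_eq_left h]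
  · rw [min_eq_right (not_le.1 h).le]; simp; nlinarith
lemma Ef_pos (y : ℝ) : 0 < Ef y := (Ef2_pos y).trans_le (Ef2_le y)
lemma Ef_cont : Continuous Ef := continuous_iff_continuousAt.2 fun y => (Ef_der y).continuousAt
lemma Ef_mono : Monotone Ef := monotone_of_deriv_nonneg (fun y => (Ef_der y).differentiableAt) fun y => by
  rw [(Ef_der y).deriv]; exact Ef1_nonneg y

lemma Ef2_lip (a b : ℝ) : |Ef2 a - Ef2 b| ≤ |a - b| := by
  wlog h : a ≤ b generalizing a b
  · rw [abs_sub_comm, abs_sub_comm a]; exact this b a (le_of_not_ge h)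
  rw [abs_sub_comm, abs_sub_comm a, aon (sub_nonneg.2 (Ef2_mono h)), aon lI]
  unfold Ef2
  have h1 := aoe (min a 0 - min b 0)
  have h2 : exp (min a 0) = exp (min b 0) * exp (min a 0 - min b 0) := by rw [← eadd]; ring_nf
  have h3 : exp (min b 0) ≤ 1 := Real.exp_le_one_iff.2 (min_le_right _ _)
  have h4 : min b 0 - min a 0 ≤ b - a := by
    rcases min_cases b 0 with h | h <;> rcases min_cases a 0 with h' | h' <;> linarith
  have h5 : min a 0 ≤ min b 0 := min_le_min_right _ h
  rw [h2]; nlinarith [epos (min b 0)]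

lemma Ef_taylor (a b : ℝ) : Ef b ≤ Ef a + Ef1 a * (b - a) + (Ef2 a + Ef2 b) / 2 * (b - a) ^ 2 := by
  have key : ∀ K : ℝ, (∀ s ∈ uIcc a b, |Ef1 s - Ef1 a| ≤ K * |s - a|) → Ef b ≤ Ef a + Ef1 a * (b - a) + K / 2 * (b - a) ^ 2 := by
    intro K hK
    let g : ℝ → ℝ := fun s => Ef a + Ef1 a * (s - a) + K / 2 * (s - a) ^ 2 - Ef s
    have hg : ∀ s, HasDerivAt g (Ef1 a + K * (s - a) - Ef1 s) s := fun s => by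
      have h1 := (hasDerivAt_id s).sub_const a
      have := (((h1.const_mul (Ef1 a)).const_add (Ef a)).add ((h1.pow 2).const_mul (K / 2))).sub (Ef_der s)
      exact this.congr_deriv (by simp; ring)
    have hgc : Continuous g := continuous_iff_continuousAt.2 fun y => (hg y).continuousAt
    suffices h : g a ≤ g b by simp only [g] at h; simp at h; linarith
    rcases le_total a b with hab | hab
    · refine monotoneOn_of_deriv_nonneg (convex_Icc a b) hgc.continuousOn (fun s _ => (hg s).differentiableAt.differentiableWithinAt) (fun s hs => ?_)
        (left_mem_Icc.2 hab) (right_mem_Icc.2 hab) hab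
      rw [(hg s).deriv]
      have := interior_subset hs
      have h2 := hK s (by rwa [uIcc_of_le hab])
      rw [aon (by linarith [this.1] : 0 ≤ s - a)] at h2
      linarith [(abs_le.1 h2).2]
    · refine antitoneOn_of_deriv_nonpos (convex_Icc b a) hgc.continuousOn (fun s _ => (hg s).differentiableAt.differentiableWithinAt) (fun s hs => ?_)
        (left_mem_Icc.2 hab) (right_mem_Icc.2 hab) hab
      rw [(hg s).deriv]
      have := interior_subset hs
      have h2 := hK s (by rwa [uIcc_of_ge hab])
      rw [abs_of_nonpos (by linarith [this.2] : s - a ≤ 0)] at h2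
      linarith [(abs_le.1 h2).1]
  have mono1 : Monotone Ef1 := by
    intro x y h
    unfold Ef1
    split_ifs with h1 h2
    · exact ele.2 h
    · have := Real.exp_le_one_iff.2 h1; linarith
    · linarith
    · linarith
  have h := key (Ef2 (max a b)) fun s hs => by
    have hs' : s ≤ max a b := hs.2
    rcases le_total a s with h | h
    · rw [aon (sub_nonneg.2 (mono1 h)), aon (sub_nonneg.2 h)]
      exact (Ef1_le h).trans (mlr (Ef2_mono hs') lI)
    · rw [abs_sub_comm, abs_sub_comm s, aon (sub_nonneg.2 (mono1 h)), aon (sub_nonneg.2 h)]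
      exact (Ef1_le h).trans (mlr (Ef2_mono (le_max_left _ _)) lI)
  have h2 : Ef2 (max a b) ≤ Ef2 a + Ef2 b := by
    rcases max_cases a b with h | h <;> rw [h.1] <;> linarith [Ef2_pos a, Ef2_pos b]
  nlinarith [sqn (b - a)]

/-- `φ`, `φ'`, `ψ = φ''` -/
def ph (β r x : ℝ) : ℝ := Ef (β * (x - r))
def ps (β r x : ℝ) : ℝ := β ^ 2 * Ef2 (β * (x - r))

lemma ph_taylor (β r a b : ℝ) : ph β r b ≤ ph β r a + β * Ef1 (β * (a - r)) * (b - a) + (ps β r a + ps β r b) / 2 * (b - a) ^ 2 := by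
  have := Ef_taylor (β * (a - r)) (β * (b - r))
  unfold ph ps
  refine this.trans (le_of_eq ?_); ring

lemma ps_lip {β : ℝ} (hβ : 0 ≤ β) (r a b : ℝ) : |ps β r a - ps β r b| ≤ β ^ 3 * |a - b| := by
  have := Ef2_lip (β * (a - r)) (β * (b - r))
  rw [show β * (a - r) - β * (b - r) = β * (a - b) by ring, abs_mul, aon hβ] at this
  unfold ps
  rw [← mul_sub, abs_mul, aon (sqn β)]
  nlinarith [sqn β]

lemma ps_bound {β r t x : ℝ} (hb : 0 ≤ β) (ht : 0 < t) (hr : 0 ≤ r) (hr2 : r ≤ 2) (hx : 0 ≤ x) (hxt : x ≤ 1 / t) :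
    ps β r x * (4 * x ^ 2 * √(x / t)) ≤ (4 / √t) * (32 * β ^ 2 + 8 / √t) * ph β r x := by
  have hst : 0 < √t := Real.sqrt_pos.2 ht
  have e : √(x / t) = √x / √t := Real.sqrt_div hx t
  have h1 : ps β r x * (x ^ 2 * √x) ≤ (32 * β ^ 2 + 8 / √t) * ph β r x := by
    have hE := Ef2_le (β * (x - r))
    have hE0 := Ef2_pos (β * (x - r))
    have hsx := Real.sqrt_nonneg x
    unfold ps ph
    have p8 : 0 ≤ 8 / √t * Ef (β * (x - r)) := by have := Ef_pos (β * (x - r)); positivity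
    rcases le_or_gt x 4 with h | h
    · have : √x ≤ 2 := by rw [Real.sqrt_le_left nN]; linarith
      have h2 : x ^ 2 * √x ≤ 32 := by nlinarith
      have h3 : β ^ 2 * Ef2 (β * (x - r)) * (x ^ 2 * √x) ≤ β ^ 2 * Ef (β * (x - r)) * 32 := by
        have := Ef_pos (β * (x - r)); gcongr
      linarith
    · have h3 : √x ≤ 1 / √t := by
        rw [← Real.sqrt_one, ← Real.sqrt_div zero_le_one]; exact Real.sqrt_le_sqrt hxt
      have h4 : Ef2 (β * (x - r)) ≤ 1 := Real.exp_le_one_iff.2 (min_le_right _ _)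
      have h6 : x ^ 2 ≤ 4 * (x - r) ^ 2 := by nlinarith
      have pb : 0 ≤ 32 * β ^ 2 * Ef (β * (x - r)) := by have := Ef_pos (β * (x - r)); positivity

      have h5 : (β * (x - r)) ^ 2 / 2 ≤ Ef (β * (x - r)) := by
          have h0 : 0 ≤ β * (x - r) := mnn hb lI
          rcases h0.eq_or_lt with h | h
          · rw [← h]; simpa using (Ef_pos 0).le
          · unfold Ef; rw [if_neg (not_le.2 h)]; linarith
      calc β ^ 2 * Ef2 (β * (x - r)) * (x ^ 2 * √x) ≤ β ^ 2 * 1 * (4 * (x - r) ^ 2 * (1 / √t)) := by gcongr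
          _ = 8 / √t * ((β * (x - r)) ^ 2 / 2) := by field_simp; ring
          _ ≤ 8 / √t * Ef (β * (x - r)) := by gcongr
          _ ≤ _ := by linarith

  rw [e]
  calc ps β r x * (4 * x ^ 2 * (√x / √t)) = 4 / √t * (ps β r x * (x ^ 2 * √x)) := by ring
    _ ≤ 4 / √t * ((32 * β ^ 2 + 8 / √t) * ph β r x) := by gcongr
    _ = _ := by ring

lemma sq_ph {β r x : ℝ} (hβ : 0 < β) (hr : 0 ≤ r) (hx : 0 ≤ x) : x ^ 2 ≤ 2 * r ^ 2 + 4 / β ^ 2 * ph β r x := by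
  have := Ef_pos (β * (x - r))
  have h0 : 0 < 4 / β ^ 2 := by positivity
  rcases le_or_gt x r with h | h
  · have : 0 ≤ 4 / β ^ 2 * ph β r x := by unfold ph; positivity
    nlinarith
  · have h1 : 0 < β * (x - r) := mul_pos hβ lI
    have h2 : (β * (x - r)) ^ 2 / 2 ≤ ph β r x := by
      unfold ph Ef; rw [if_neg (not_le.2 h1)]; linarith
    have h3 := mll h2 h0.le
    have h4 : 4 / β ^ 2 * ((β * (x - r)) ^ 2 / 2) = 2 * (x - r) ^ 2 := by field_simp; ring
    nlinarith [sqn (x - 2 * r)]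

variable {v u : ONB n} {l m : Fin n → ℝ}

lemma prj_sym (v : ONB n) (l : Fin n → ℝ) (x y : Euc n) : ⟪x, prj v l y⟫ = ⟪prj v l x, y⟫ := by
  rw [← onb_in v, ← onb_in v (prj v l x)]
  exact fsc rfl fun j _ => by rw [prj_in, prj_in]; ring

theorem klein {β : ℝ} (hβ : 0 ≤ β) (r : ℝ) (v u : ONB n) (l m : Fin n → ℝ) (H : Euc n →L[ℝ] Euc n) (hH : H = prj u m - prj v l) :
    ∑ k, ph β r (m k) ≤ ∑ i, ph β r (l i) + ∑ i, β * Ef1 (β * (l i - r)) * ⟪v i, H (v i)⟫ + ∑ i, ps β r (l i) * ‖H (v i)‖ ^ 2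
      + β ^ 3 * n ^ 2 * ‖H‖ ^ 3 := by
  have hs : ∀ x y, ⟪x, H y⟫ = ⟪H x, y⟫ := fun x y => by
    rw [hH]; simp only [sub_apply, inner_sub_left, isr, prj_sym]
  set w : Fin n → Fin n → ℝ := fun k i => ⟪u k, v i⟫ with hw
  have hwH : ∀ k i, ⟪u k, H (v i)⟫ = (m k - l i) * w k i := fun k i => by
    have : ⟪u k, prj v l (v i)⟫ = l i * w k i := by
      rw [prj_sym, ← ric (prj v l (u k)), prj_in, ric]
    rw [hH, sub_apply, isr, prj_in, this]; ring
  have s1 : ∀ k, ∑ i, w k i ^ 2 = 1 := fun k => by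
    have := onb_sq v (u k); simp only [u.norm_eq_one, one_pow] at this; rw [← this]
    exact fsc rfl fun i _ => by rw [ric]
  have s2 : ∀ i, ∑ k, w k i ^ 2 = 1 := fun i => by
    have := onb_sq u (v i); simpa only [v.norm_eq_one, one_pow] using this
  have s3 : ∀ i, ∑ k, w k i ^ 2 * (m k - l i) = ⟪v i, H (v i)⟫ := fun i => by
    rw [← onb_in u]; exact fsc rfl fun k _ => by rw [hwH]; ring
  have s4 : ∀ i, ∑ k, w k i ^ 2 * (m k - l i) ^ 2 = ‖H (v i)‖ ^ 2 := fun i => by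
    rw [← onb_sq u]; exact fsc rfl fun k _ => by rw [hwH]; ring
  have s5 : ∀ k, ∑ i, w k i ^ 2 * (m k - l i) ^ 2 = ∑ i, w k i * ⟪u k, H (H (v i))⟫ := fun k => by
    trans ⟪H (u k), H (u k)⟫
    · rw [← onb_in v]; refine fsc rfl fun i _ => ?_
      rw [hs, ric, hwH]; ring
    · rw [← hs, ← onb_in v]
      refine fsc rfl fun i _ => ?_
      rw [ric, hs, hs, ric (H (H (v i)))]
  have s6 : ∀ i, ∑ k, w k i * ⟪u k, H (H (v i))⟫ = ‖H (v i)‖ ^ 2 := fun i => by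
    rw [onb_in u, hs, rin]
  have main : ∑ k, ph β r (m k) ≤ ∑ i, ∑ k, w k i ^ 2 * (ph β r (l i) + β * Ef1 (β * (l i - r)) * (m k - l i) + (ps β r (l i) + ps β r (m k)) / 2 * (m k - l i) ^ 2) := by
    rw [fco]
    refine fsl fun k _ => ?_
    conv_lhs => rw [← one_mul (ph β r (m k)), ← s1 k, fsm]
    exact fsl fun i _ => mll (ph_taylor _ _ _ _) (sqn _)
  have e1 : ∀ i, ∑ k, w k i ^ 2 * (ph β r (l i) + β * Ef1 (β * (l i - r)) * (m k - l i) + (ps β r (l i) + ps β r (m k)) / 2 * (m k - l i) ^ 2)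
      = ph β r (l i) + β * Ef1 (β * (l i - r)) * ⟪v i, H (v i)⟫ + 1 / 2 * (ps β r (l i) * ‖H (v i)‖ ^ 2) + 1 / 2 * ∑ k, ps β r (m k) * (w k i ^ 2 * (m k - l i) ^ 2) := fun i => by
    rw [← s3, ← s4]
    have : ph β r (l i) = ph β r (l i) * ∑ k, w k i ^ 2 := by rw [s2, mul_one]
    conv_rhs => rw [this]
    simp only [fms, ← fad]
    exact fsc rfl fun k _ => by ring
  simp only [e1, fad, ← fms] at main
  have e2 : ∑ i, ∑ k, ps β r (m k) * (w k i ^ 2 * (m k - l i) ^ 2) ≤ ∑ i, ps β r (l i) * ‖H (v i)‖ ^ 2 + β ^ 3 * n ^ 2 * ‖H‖ ^ 3 := by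
    rw [fco]
    simp only [← fms, s5, ← s6]
    simp only [fms]
    rw [fco, ← sub_le_iff_le_add', ← fsd]
    have : (β ^ 3 * n ^ 2 * ‖H‖ ^ 3) = ∑ i : Fin n, ∑ k : Fin n, β ^ 3 * ‖H‖ ^ 3 := by simp; ring
    rw [this]
    refine fsl fun i _ => ?_
    rw [← fsd]
    refine fsl fun k _ => ?_
    have a1 : |⟪u k, H (H (v i))⟫| ≤ ‖H‖ ^ 2 := by
      refine (ain _ _).trans ?_
      rw [u.norm_eq_one, one_mul]
      refine (H.le_opNorm _).trans ?_
      have := H.le_opNorm (v i)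
      rw [v.norm_eq_one, mul_one] at this
      nlinarith [nnn H]
    have a2 : |(m k - l i) * w k i| ≤ ‖H‖ := by
      rw [← hwH]
      refine (ain _ _).trans ?_
      rw [u.norm_eq_one, one_mul]
      have := H.le_opNorm (v i)
      rwa [v.norm_eq_one, mul_one] at this
    have a3 := ps_lip hβ r (m k) (l i)
    calc ps β r (m k) * (w k i * ⟪u k, H (H (v i))⟫) - ps β r (l i) * (w k i * ⟪u k, H (H (v i))⟫)
        = (ps β r (m k) - ps β r (l i)) * w k i * ⟪u k, H (H (v i))⟫ := by ring
      _ ≤ |ps β r (m k) - ps β r (l i)| * |w k i| * |⟪u k, H (H (v i))⟫| := by rw [← abs_mul, ← abs_mul]; exact le_abs_self _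
      _ ≤ β ^ 3 * |m k - l i| * |w k i| * ‖H‖ ^ 2 := by gcongr
      _ = β ^ 3 * |(m k - l i) * w k i| * ‖H‖ ^ 2 := by rw [abs_mul]; ring
      _ ≤ β ^ 3 * ‖H‖ * ‖H‖ ^ 2 := by gcongr
      _ = _ := by ring
  have : 0 ≤ β ^ 3 * n ^ 2 * ‖H‖ ^ 3 := by positivity
  linarith

end

section
open ProbabilityTheory
variable {n : ℕ} {t D : ℝ} {p : Measure (Euc n)}

lemma SLC.bd (h : SLC n t D p) {f : Euc n → ℝ} {B : ℝ} (hB : ∀ x, ‖x‖ ≤ D → |f x| ≤ B) : |∫ x, f x ∂p| ≤ B := by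
  have := h.prob
  have h1 := norm_integral_le_of_norm_le_const (f := f) (C := B) (μ := p) (by filter_upwards [h.ball] with x hx using hB x hx)
  simpa using h1

lemma tilt2 (h : SLC n t D p) {ℓ G : Euc n → ℝ} (hℓ : Continuous ℓ) (hG : Continuous G) {L B : ℝ} (hL0 : 0 ≤ L) (hB0 : 0 ≤ B)
    (hL : ∀ x, ‖x‖ ≤ D → |ℓ x| ≤ L) (hB : ∀ x, ‖x‖ ≤ D → |G x| ≤ B) :
    |(∫ x, G x ∂p.tilted ℓ) - (∫ x, G x ∂p) - ((∫ x, G x * ℓ x ∂p) - (∫ x, G x ∂p) * (∫ x, ℓ x ∂p))| ≤ 18 * B * L ^ 2 ∧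
    |(∫ x, G x ∂p.tilted ℓ) - ∫ x, G x ∂p| ≤ 20 * B * L := by
  have := h.prob
  have iE : Integrable (fun x => exp (ℓ x)) p := h.int fP
  have e0 : ∫ x, G x ∂p.tilted ℓ = (∫ x, G x * exp (ℓ x) ∂p) / ∫ x, exp (ℓ x) ∂p := by
    rw [integral_tilted, ← integral_div]; congr 1; ext x; rw [sem]; ring
  set Z := ∫ x, exp (ℓ x) ∂p with hZ
  have hb1 : |∫ x, G x ∂p| ≤ B := h.bd hB
  have hb2 : |∫ x, G x * ℓ x ∂p| ≤ B * L := h.bd fun x hx => by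
    rw [abs_mul]; exact mlm (hB x hx) (hL x hx) (abn _) hB0
  have hb3 : |∫ x, ℓ x ∂p| ≤ L := h.bd hL
  have hZp : 0 < Z := integral_exp_pos iE
  have hb4 : |∫ x, G x ∂p.tilted ℓ| ≤ B := by
    rw [e0, abs_div, abs_of_pos hZp, div_le_iff₀ hZp, hZ, ← icm]
    refine (abs_integral_le_integral_abs).trans (integral_mono_ae (h.int fP) (h.int fP) ?_)
    filter_upwards [h.ball] with x hx
    rw [abs_mul, abs_of_pos (epos _)]
    exact mlr (hB x hx) (epos _).le
  set g0 := ∫ x, G x ∂p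
  set g1 := ∫ x, G x * ℓ x ∂p
  set l1 := ∫ x, ℓ x ∂p
  set g' := ∫ x, G x ∂p.tilted ℓ
  have hcov : |g1 - g0 * l1| ≤ 2 * B * L := by
    have : |g0 * l1| ≤ B * L := by rw [abs_mul]; exact mlm hb1 hb3 (abn _) hB0
    rw [abs_le] at *; constructor <;> linarith
  have key : |g' - g0 - (g1 - g0 * l1)| ≤ 18 * B * L ^ 2 := by
    rcases le_or_gt L 1 with hL1 | hL1
    · have hr : ∀ x, ‖x‖ ≤ D → |exp (ℓ x) - 1 - ℓ x| ≤ L ^ 2 := fun x hx =>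
        (Real.abs_exp_sub_one_sub_id_le ((hL x hx).trans hL1)).trans (sq_le_sq' (by linarith [(abs_le.1 (hL x hx)).1]) (abs_le.1 (hL x hx)).2)
      have r1 : |∫ x, (exp (ℓ x) - 1 - ℓ x) ∂p| ≤ L ^ 2 := h.bd hr
      have r2 : |∫ x, G x * (exp (ℓ x) - 1 - ℓ x) ∂p| ≤ B * L ^ 2 := h.bd fun x hx => by
        rw [abs_mul]; exact mlm (hB x hx) (hr x hx) (abn _) hB0
      have q1 : ∫ x, (exp (ℓ x) - 1 - ℓ x) ∂p = Z - 1 - l1 := by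
        rw [isb (f := fun x => exp (ℓ x) - 1) (h.int fP) (h.int fP), isb iE (ict _)]; simp [Z, l1]
      have q2 : ∫ x, G x * (exp (ℓ x) - 1 - ℓ x) ∂p = g' * Z - g0 - g1 := by
        have : ∀ x, G x * (exp (ℓ x) - 1 - ℓ x) = G x * exp (ℓ x) - G x - G x * ℓ x := fun x => by ring
        simp only [this]
        rw [isb (f := fun x => G x * exp (ℓ x) - G x) (h.int fP) (h.int fP), isb (h.int fP) (h.int fP), e0,
          div_mul_cancel₀ _ hZp.ne']
      rw [q1] at r1; rw [q2] at r2
      have hZ3 : 1 / 3 ≤ Z := by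
        have : ∫ x, (1 / 3 : ℝ) ∂p ≤ Z := integral_mono_ae (ict _) iE (by
          filter_upwards [h.ball] with x hx
          have h1 : exp (-1) ≤ exp (ℓ x) := ele.2 (by linarith [(abs_le.1 (hL x hx)).1])
          have h2 : (1 / 3 : ℝ) ≤ exp (-1) := by
            rw [Real.exp_neg, one_div]; exact inv_anti₀ (epos _) (by linarith [Real.exp_one_lt_d9])
          exact h2.trans h1)
        simpa using this
      have num : |(g' - g0 - (g1 - g0 * l1)) * Z| ≤ 6 * B * L ^ 2 := by
        have e : (g' - g0 - (g1 - g0 * l1)) * Z = (g' * Z - g0 - g1) - (Z - 1 - l1) * g0 - (Z - 1) * (g1 - g0 * l1) := by ring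
        have a1 : |(Z - 1 - l1) * g0| ≤ L ^ 2 * B := by rw [abs_mul]; exact mlm r1 hb1 (abn _) (sqn _)
        have a2 : |Z - 1| ≤ L + L ^ 2 := by rw [abs_le] at *; constructor <;> linarith
        have a3 : |(Z - 1) * (g1 - g0 * l1)| ≤ (L + L ^ 2) * (2 * B * L) := by rw [abs_mul]; exact mlm a2 hcov (abn _) pY
        have a4 : (L + L ^ 2) * (2 * B * L) ≤ 4 * B * L ^ 2 := by nlinarith [mnn hB0 (mnn (sqn L) (sub_nonneg.2 hL1))]
        rw [e, abs_le]; rw [abs_le] at a1 a3 r2; constructor <;> linarith [a1.1, a1.2, a3.1, a3.2, r2.1, r2.2]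
      rw [abs_mul, abs_of_pos hZp] at num
      have := mll hZ3 (abn (g' - g0 - (g1 - g0 * l1)))
      linarith
    · have : 4 * B ≤ 4 * B * L := by nlinarith
      have h2 : B * L ≤ B * L ^ 2 := by nlinarith [mnn hB0 hL0]
      have : |g' - g0 - (g1 - g0 * l1)| ≤ 2 * B + 2 * B * L := by
        rw [abs_le] at *; constructor <;> linarith
      nlinarith [mnn hB0 (sqn L)]
  refine ⟨key, ?_⟩
  rcases le_or_gt L 1 with hL1 | hL1
  · have : 18 * B * L ^ 2 ≤ 18 * B * L := by nlinarith [mnn hB0 hL0]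
    rw [abs_le] at *; constructor <;> linarith
  · have : |g' - g0| ≤ 2 * B := by rw [abs_le] at *; constructor <;> linarith
    nlinarith

lemma ex_cov (h : SLC n t D p) : ∃ a v l, CovD p a v l := by
  have := h.prob
  have hid : Integrable (fun x : Euc n => x) p := by
    rw [← integrable_norm_iff fP]; exact h.int fP
  set a := ∫ x, x ∂p
  have hia : ∀ y : Euc n, Integrable (fun x : Euc n => ⟪y, x - a⟫ • (x - a)) p := fun y => by
    rw [← integrable_norm_iff fP]; exact h.int fP
  let A : Euc n →ₗ[ℝ] Euc n :=
    { toFun := fun y => ∫ x, ⟪y, x - a⟫ • (x - a) ∂p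
      map_add' := fun y z => by rw [← iad (hia y) (hia z)]; congr 1; ext1 x; rw [inner_add_left, add_smul]
      map_smul' := fun c y => by rw [RingHom.id_apply, ← integral_smul]; congr 1; ext1 x; rw [rsl, mul_smul] }
  have hA : ∀ y z, ⟪y, A z⟫ = ∫ x, ⟪y, x - a⟫ * ⟪z, x - a⟫ ∂p := fun y z => by
    change ⟪y, ∫ x, ⟪z, x - a⟫ • (x - a) ∂p⟫ = _
    rw [← integral_inner (hia z)]; congr 1; ext1 x; rw [rsr, mul_comm]
  have hs : A.IsSymmetric := fun y z => by
    rw [← ric, hA, hA]; congr 1; ext1 x; ring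
  have hn : Module.finrank ℝ (Euc n) = n := finrank_euclideanSpace_fin
  refine ⟨a, hs.eigenvectorBasis hn, hs.eigenvalues hn, fun w => ?_, fun i j => ?_⟩
  · rw [integral_inner (f := fun x => x - a) (hid.sub (ict _)), isb hid (ict _)]; simp [a]
  · rw [← hA, hs.apply_eigenvectorBasis]
    have := (hs.eigenvectorBasis hn).inner_eq_ite i j
    simp only [RCLike.ofReal_real_eq_id, id]
    rw [rsr, this]; split_ifs with h <;> simp [h]

/-- chosen covariance data -/
def cD (p : Measure (Euc n)) : Euc n × ONB n × (Fin n → ℝ) :=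
  haveI : Nonempty (Euc n × ONB n × (Fin n → ℝ)) := ⟨0, EuclideanSpace.basisFun _ _, 0⟩
  Classical.epsilon fun c => CovD p c.1 c.2.1 c.2.2

lemma cD_spec (h : SLC n t D p) : CovD p (cD p).1 (cD p).2.1 (cD p).2.2 := by
  obtain ⟨a, v, l, hc⟩ := ex_cov h
  exact Classical.epsilon_spec_aux _ (fun c : Euc n × ONB n × (Fin n → ℝ) => CovD p c.1 c.2.1 c.2.2) ⟨(a, v, l), hc⟩

def Ph (β r : ℝ) (p : Measure (Euc n)) : ℝ := ∑ i, ph β r ((cD p).2.2 i)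
def Tr (p : Measure (Euc n)) : ℝ := ∑ i, (cD p).2.2 i

variable {a : Euc n} {v : ONB n} {l : Fin n → ℝ}

lemma CovD.mean_le (h : SLC n t D p) (hc : CovD p a v l) (hD : 0 ≤ D) : ‖a‖ ≤ D := by
  have := h.prob
  have h1 := hc.mean a
  simp only [isr] at h1
  rw [isb (h.int fP) (ict _)] at h1
  simp only [integral_const, probReal_univ, one_smul, rin] at h1
  have h2 := (abs_le.1 (h.bd (f := fun x => ⟪a, x⟫) (B := ‖a‖ * D) fun x hx => (ain _ _).trans (by gcongr))).2
  by_contra hcon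
  push Not at hcon
  nlinarith [nnn a]

lemma CovD.bil (h : SLC n t D p) (hc : CovD p a v l) (x y : Euc n) : ⟪x, prj v l y⟫ = ∫ z, ⟪x, z - a⟫ * ⟪y, z - a⟫ ∂p := by
  have e : ∀ z, ⟪x, z - a⟫ * ⟪y, z - a⟫ = ∑ i, ∑ j, (⟪v i, x⟫ * ⟪v j, y⟫) * (⟪v i, z - a⟫ * ⟪v j, z - a⟫) := fun z => by
    rw [← onb_in v x, ← onb_in v y, Finset.sum_mul_sum]
    exact fsc rfl fun i _ => fsc rfl fun j _ => by ring
  simp only [e]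
  rw [ifs _ fun i _ => h.int fP, ← onb_in v]
  refine fsc rfl fun i _ => ?_
  rw [ifs _ fun j _ => h.int fP, prj_in]
  simp only [icm, hc.cov]; simp; ring

variable {a' : Euc n} {u : ONB n} {m : Fin n → ℝ} {p' : Measure (Euc n)} {t' : ℝ}

/-- second covariance expanded around the first mean -/
lemma CovD.bil' (h : SLC n t' D p') (hc : CovD p' a' u m) (a x y : Euc n) :
    ⟪x, prj u m y⟫ = (∫ z, ⟪x, z - a⟫ * ⟪y, z - a⟫ ∂p') - (∫ z, ⟪x, z - a⟫ ∂p') * ∫ z, ⟪y, z - a⟫ ∂p' := by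
  have := h.prob
  have hm : ∀ x, ∫ z, ⟪x, z - a⟫ ∂p' = ⟪x, a' - a⟫ := fun x => by
    have e : ∀ z, ⟪x, z - a⟫ = ⟪x, z - a'⟫ + ⟪x, a' - a⟫ := fun z => by rw [← inner_add_right]; congr 1; abel
    rw [ica (aoa _ e), iad (h.int fP) (ict _), hc.mean]; simp
  rw [hm, hm, hc.bil h]
  have e : ∀ z, ⟪x, z - a⟫ * ⟪y, z - a⟫ = ⟪x, z - a'⟫ * ⟪y, z - a'⟫ + ⟪x, a' - a⟫ * ⟪y, z - a'⟫ + ⟪y, a' - a⟫ * ⟪x, z - a'⟫ + ⟪x, a' - a⟫ * ⟪y, a' - a⟫ := fun z => by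
    have e : ∀ x, ⟪x, z - a⟫ = ⟪x, z - a'⟫ + ⟪x, a' - a⟫ := fun x => by rw [← inner_add_right]; congr 1; abel
    rw [e, e]; ring
  rw [ica (aoa _ e)]
  iterate 3 rw [iad (h.int fP) (h.int fP)]
  simp only [icm, hc.mean]; simp

lemma tr_prj (u v : ONB n) (m : Fin n → ℝ) : ∑ i, ⟪v i, prj u m (v i)⟫ = ∑ k, m k := by
  have : ∀ i, ⟪v i, prj u m (v i)⟫ = ∑ k, m k * ⟪u k, v i⟫ ^ 2 := fun i => by
    rw [← onb_in u]; exact fsc rfl fun k _ => by rw [prj_in]; ring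
  simp only [this]
  rw [fco]
  refine fsc rfl fun k _ => ?_
  rw [← fms]
  have := onb_sq v (u k)
  simp only [u.norm_eq_one, one_pow] at this
  simp only [ric] at this ⊢
  rw [this, mul_one]

lemma H_norm (h : SLC n t D p) (hD : 0 ≤ D) (hc : CovD p a v l) {ℓ : Euc n → ℝ} (hℓ : Continuous ℓ) (h' : SLC n t' D (p.tilted ℓ)) (hc' : CovD (p.tilted ℓ) a' u m)
    {L : ℝ} (hL0 : 0 ≤ L) (hL : ∀ x, ‖x‖ ≤ D → |ℓ x| ≤ L) : ‖prj u m - prj v l‖ ≤ 160 * D ^ 2 * L := by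
  have ha := hc.mean_le h hD
  have hB : ∀ x z : Euc n, ‖z‖ ≤ D → |⟪x, z - a⟫| ≤ 2 * D * ‖x‖ := fun x z hz => by
    refine (ain _ _).trans ?_
    have := norm_sub_le z a; nlinarith [nnn x]
  have hxy : ∀ x y, |⟪x, (prj u m - prj v l) y⟫| ≤ 160 * D ^ 2 * L * (‖x‖ * ‖y‖) := fun x y => by
    rw [sub_apply, isr, hc'.bil' h' a, hc.bil h]
    have t1 := (tilt2 h hℓ (G := fun z => ⟪x, z - a⟫ * ⟪y, z - a⟫) fP hL0 (B := (2 * D * ‖x‖) * (2 * D * ‖y‖)) pY hL (fun z hz => by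
      rw [abs_mul]; exact mlm (hB x z hz) (hB y z hz) (abn _) pY)).2
    have t2 := (tilt2 h hℓ (G := fun z => ⟪x, z - a⟫) fP hL0 (B := (2 * D * ‖x‖)) pY hL (hB x)).2
    rw [hc.mean, sub_zero] at t2
    have t3 : |∫ z, ⟪y, z - a⟫ ∂p.tilted ℓ| ≤ 2 * D * ‖y‖ := h'.bd (hB y)
    have t4 := mlm t2 t3 (abn _) pY
    rw [← abs_mul] at t4
    rw [abs_le] at *; constructor <;> nlinarith [t1.1, t1.2, t4.1, t4.2]
  refine ContinuousLinearMap.opNorm_le_bound _ pY fun y => ?_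
  have h1 := hxy ((prj u m - prj v l) y) y
  rw [rin, aon (sqn _)] at h1
  rcases (nnn ((prj u m - prj v l) y)).eq_or_lt with h0 | h0
  · rw [← h0]; positivity
  · refine le_of_mul_le_mul_right ?_ h0; nlinarith

end

section
open ProbabilityTheory
variable {n : ℕ} {t D : ℝ} {p : Measure (Euc n)}

def en (t : ℝ) (θ x : Euc n) : ℝ := ⟪θ, x⟫ - t / 2 * ‖x‖ ^ 2
lemma en_cont (t : ℝ) (θ : Euc n) : Continuous (en t θ) := by unfold en; fun_prop

lemma SLC.tilt (h : SLC n t D p) (s : ℝ) (ζ : Euc n) : SLC n (t + s) D (p.tilted (en s ζ)) := by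
  have hp := h.prob
  have iE : Integrable (fun x => exp (en s ζ x)) p := h.int (by have := en_cont s ζ; fun_prop)
  refine ⟨?_, isProbabilityMeasure_tilted iE⟩
  set Z := ∫ x, exp (en s ζ x) ∂p with hZ
  have hZp : 0 < Z := integral_exp_pos iE
  obtain ⟨g, hm, hg, h0, hd⟩ := h.dens
  refine ⟨fun x => Z⁻¹ * (g x * exp ⟪ζ, x⟫), by fun_prop, ⟨fun x => by have := hg.1 x; positivity, fun x y => ?_⟩, fun x hx => by simp [h0 x hx], ?_⟩
  · have e : exp ⟪ζ, x⟫ * exp ⟪ζ, y⟫ = exp ⟪ζ, hlf • (x + y)⟫ ^ 2 := by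
      rw [← eadd, sq, ← eadd, inner_smul_right, inner_add_right]; ring_nf
    calc _ = Z⁻¹ ^ 2 * (g x * g y) * (exp ⟪ζ, x⟫ * exp ⟪ζ, y⟫) := by ring
      _ ≤ Z⁻¹ ^ 2 * (g (hlf • (x + y)) ^ 2) * (exp ⟪ζ, x⟫ * exp ⟪ζ, y⟫) := by gcongr; exact hg.2 x y
      _ = _ := by rw [e]; ring
  · have hmm : Measurable (en s ζ) := (en_cont s ζ).measurable
    rw [Measure.tilted, ← hZ]
    conv_lhs => rw [hd]
    rw [_root_.dens, _root_.dens, ← withDensity_mul _ fP fP]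
    congr 1; ext x
    simp only [Pi.mul_apply]
    rw [← oRm (mnn (hg.1 x) (epos _).le)]
    congr 1
    have : exp (-t * ‖x‖ ^ 2 / 2) * exp (en s ζ x) = exp ⟪ζ, x⟫ * exp (-(t + s) * ‖x‖ ^ 2 / 2) := by
      rw [← eadd, ← eadd, en]; congr 1; ring
    rw [div_eq_mul_inv (exp _)]; linear_combination (g x * Z⁻¹) * this

variable {a : Euc n} {v : ONB n} {l : Fin n → ℝ}

lemma en_bd (hD : 1 ≤ D) {η : ℝ} (h0 : 0 < η) (h1 : η ≤ 1) {x g z : Euc n} (hx : ‖x‖ ≤ D) (hz : ‖z‖ ≤ D) :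
    |en (η ^ 2) (η ^ 2 • x + η • g) z| ≤ 2 * D ^ 2 * η * (1 + ‖g‖) := by
  unfold en
  rw [inner_add_left, rsl, rsl]
  have a1 : |⟪x, z⟫| ≤ D * D := (ain _ _).trans (mlm hx hz (nnn _) lI)
  have a2 : |⟪g, z⟫| ≤ ‖g‖ * D := (ain _ _).trans (mll hz (nnn _))
  have a3 : ‖z‖ ^ 2 ≤ D ^ 2 := by gcongr
  have hh : η ^ 2 ≤ η := by nlinarith
  have b1 : |η ^ 2 * ⟪x, z⟫| ≤ η * (D * D) := by
    rw [abs_mul, aon (sqn _)]; exact mlm hh a1 (abn _) h0.le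
  have b2 : |η * ⟪g, z⟫| ≤ η * (‖g‖ * D) := by
    rw [abs_mul, abs_of_pos h0]; gcongr
  have b3 : η ^ 2 / 2 * ‖z‖ ^ 2 ≤ η / 2 * D ^ 2 := by gcongr
  have b4 : 0 ≤ η ^ 2 / 2 * ‖z‖ ^ 2 := by positivity
  have b5 : η * (‖g‖ * D) ≤ η * (‖g‖ * (2 * D ^ 2)) := by gcongr; nlinarith
  have b6 : 0 ≤ η * D ^ 2 := by positivity
  rw [abs_le] at *; constructor <;> nlinarith

lemma gen (h : SLC n t D p) (hc : CovD p a v l) (hD : 1 ≤ D) {η : ℝ} (h0 : 0 < η) (h1 : η ≤ 1) {x g : Euc n} (hx : ‖x‖ ≤ D)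
    {G : Euc n → ℝ} (hG : Continuous G) {B : ℝ} (hB0 : 0 ≤ B) (hB : ∀ x, ‖x‖ ≤ D → |G x| ≤ B) :
    |(∫ z, G z ∂p.tilted (en (η ^ 2) (η ^ 2 • x + η • g))) - (∫ z, G z ∂p) - η * ∫ z, G z * ⟪g, z - a⟫ ∂p| ≤ 75 * B * D ^ 4 * (η ^ 2 * (1 + ‖g‖) ^ 2) ∧
    |(∫ z, G z ∂p.tilted (en (η ^ 2) (η ^ 2 • x + η • g))) - (∫ z, G z ∂p)| ≤ 40 * B * D ^ 2 * (η * (1 + ‖g‖)) := by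
  have := h.prob
  have hec := en_cont (η ^ 2) (η ^ 2 • x + η • g)
  obtain ⟨k1, k2⟩ := tilt2 h hec hG (L := 2 * D ^ 2 * η * (1 + ‖g‖)) pY hB0 (fun z hz => en_bd hD h0 h1 hx hz) hB
  refine ⟨?_, k2.trans (le_of_eq (by ring))⟩
  have hcov : |((∫ z, G z * en (η ^ 2) (η ^ 2 • x + η • g) z ∂p) - (∫ z, G z ∂p) * (∫ z, en (η ^ 2) (η ^ 2 • x + η • g) z ∂p)) - η * ∫ z, G z * ⟪g, z - a⟫ ∂p|
      ≤ 3 * B * D ^ 2 * η ^ 2 := by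
    let k : Euc n → ℝ := fun z => η ^ 2 * ⟪x, z⟫ - η ^ 2 / 2 * ‖z‖ ^ 2
    have hk : Continuous k := by fun_prop
    have hkb : ∀ z, ‖z‖ ≤ D → |k z| ≤ 3 / 2 * D ^ 2 * η ^ 2 := fun z hz => by
      have a1 : |⟪x, z⟫| ≤ D * D := (ain _ _).trans (mlm hx hz (nnn _) lI)
      have a3 : ‖z‖ ^ 2 ≤ D ^ 2 := by gcongr
      have b3 : η ^ 2 * ‖z‖ ^ 2 ≤ η ^ 2 * D ^ 2 := by gcongr
      have b4 : 0 ≤ η ^ 2 * ‖z‖ ^ 2 := by positivity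
      have b1 : |η ^ 2 * ⟪x, z⟫| ≤ η ^ 2 * (D * D) := by rw [abs_mul, aon (sqn _)]; gcongr
      simp only [k]
      rw [abs_le] at *; constructor <;> nlinarith
    have e : ∀ z, en (η ^ 2) (η ^ 2 • x + η • g) z = η * ⟪g, z - a⟫ + k z + η * ⟪g, a⟫ := fun z => by
      simp only [en, k, inner_add_left, rsl, isr]; ring
    have i1 : ∫ z, en (η ^ 2) (η ^ 2 • x + η • g) z ∂p = (∫ z, k z ∂p) + η * ⟪g, a⟫ := by
      simp only [e]
      rw [iad (h.int fP) (ict _), iad (h.int fP) (h.int hk), icm, hc.mean]; simp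
    have i2 : ∫ z, G z * en (η ^ 2) (η ^ 2 • x + η • g) z ∂p = η * (∫ z, G z * ⟪g, z - a⟫ ∂p) + (∫ z, G z * k z ∂p) + (η * ⟪g, a⟫) * ∫ z, G z ∂p := by
      have : ∀ z, G z * en (η ^ 2) (η ^ 2 • x + η • g) z = η * (G z * ⟪g, z - a⟫) + G z * k z + (η * ⟪g, a⟫) * G z := fun z => by rw [e]; ring
      simp only [this]
      rw [iad (h.int fP) (h.int fP), iad (h.int fP) (h.int fP), icm, icm]
    rw [i1, i2]
    have c1 : |∫ z, G z * k z ∂p| ≤ B * (3 / 2 * D ^ 2 * η ^ 2) := h.bd fun z hz => by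
      rw [abs_mul]; exact mlm (hB z hz) (hkb z hz) (abn _) hB0
    have c2 : |(∫ z, G z ∂p) * ∫ z, k z ∂p| ≤ B * (3 / 2 * D ^ 2 * η ^ 2) := by
      rw [abs_mul]; exact mlm (h.bd hB) (h.bd hkb) (abn _) hB0
    rw [abs_le] at *; constructor <;> nlinarith [c1.1, c1.2, c2.1, c2.2]
  have h3 : 3 * B * D ^ 2 * η ^ 2 ≤ 3 * B * D ^ 4 * (η ^ 2 * (1 + ‖g‖) ^ 2) := by
    have : D ^ 2 ≤ D ^ 4 := ppr hD nN
    have h5 : 1 ≤ (1 + ‖g‖) ^ 2 := one_le_pow₀ (by linarith [nnn g])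
    have : η ^ 2 ≤ η ^ 2 * (1 + ‖g‖) ^ 2 := le_mul_of_one_le_right (sqn _) h5
    calc _ ≤ 3 * B * D ^ 4 * η ^ 2 := by gcongr
      _ ≤ _ := by gcongr
  have h4 : 18 * B * (2 * D ^ 2 * η * (1 + ‖g‖)) ^ 2 = 72 * B * D ^ 4 * (η ^ 2 * (1 + ‖g‖) ^ 2) := by ring
  rw [h4] at k1
  rw [abs_le] at *; constructor <;> linarith [k1.1, k1.2, hcov.1, hcov.2]

lemma sqexp {η q c K s : ℝ} (h0 : 0 < η) (h1 : η ≤ 1) (hs : 1 ≤ s) (hK : 0 ≤ K) (hq : |q - η * c| ≤ K * (η ^ 2 * s ^ 2)) (hcK : |c| ≤ K * s) :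
    q ^ 2 ≤ η ^ 2 * c ^ 2 + 3 * K ^ 2 * (η ^ 3 * s ^ 4) := by
  set e := q - η * c
  have e1 : q ^ 2 = η ^ 2 * c ^ 2 + 2 * η * (c * e) + e ^ 2 := by simp only [e]; ring
  have e2 : c * e ≤ K * s * (K * (η ^ 2 * s ^ 2)) := (le_abs_self _).trans (by rw [abs_mul]; exact mlm hcK hq (abn _) pY)
  have e3 : e ^ 2 ≤ (K * (η ^ 2 * s ^ 2)) ^ 2 := by rw [← sq_abs]; gcongr
  have e4 : K * s * (K * (η ^ 2 * s ^ 2)) ≤ K ^ 2 * (η ^ 2 * s ^ 4) := by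
    have : s ^ 3 ≤ s ^ 4 := ppr hs nN
    calc _ = K ^ 2 * (η ^ 2 * s ^ 3) := by ring
      _ ≤ _ := by gcongr
  have e5 : (K * (η ^ 2 * s ^ 2)) ^ 2 ≤ K ^ 2 * (η ^ 3 * s ^ 4) := by
    have : η ^ 4 ≤ η ^ 3 := pow_le_pow_of_le_one h0.le h1 nN
    calc _ = K ^ 2 * (η ^ 4 * s ^ 4) := by ring
      _ ≤ _ := by gcongr
  have e6 : 2 * η * (c * e) ≤ 2 * η * (K ^ 2 * (η ^ 2 * s ^ 4)) := mll (e2.trans e4) pY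
  nlinarith

lemma ps_nonneg (β r x : ℝ) : 0 ≤ ps β r x := mnn (sqn _) (Ef2_pos _).le
lemma ps_le (β r x : ℝ) : ps β r x ≤ β ^ 2 := mor (sqn _) (Real.exp_le_one_iff.2 (min_le_right _ _))

variable {a' : Euc n} {u : ONB n} {m : Fin n → ℝ}

def CC (n : ℕ) (β D : ℝ) : ℝ := 3 * β ^ 2 * n ^ 2 * (6700 * D ^ 6) ^ 2 + β ^ 3 * n ^ 2 * (320 * D ^ 4) ^ 3 + 3 * n * (6700 * D ^ 6) ^ 2

theorem step_pt (h : SLC n t D p) (hc : CovD p a v l) (hD : 1 ≤ D) {η : ℝ} (h0 : 0 < η) (h1 : η ≤ 1) {x g : Euc n} (hx : ‖x‖ ≤ D)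
    (hc' : CovD (p.tilted (en (η ^ 2) (η ^ 2 • x + η • g))) a' u m) {β : ℝ} (hβ : 0 ≤ β) (r : ℝ) :
    (∑ k, ph β r (m k) ≤ ∑ i, ph β r (l i)
      + ∑ i, β * Ef1 (β * (l i - r)) * ((∫ z, ⟪v i, z - a⟫ ^ 2 ∂p.tilted (en (η ^ 2) (η ^ 2 • x + η • g))) - l i)
      + η ^ 2 * (∑ i, ps β r (l i) * ∑ j, (∑ k, T3 p a v i j k * ⟪v k, g⟫) ^ 2) + CC n β D * (η ^ 3 * (1 + ‖g‖) ^ 4)) ∧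
    (∑ i, (∫ z, ⟪v i, z - a⟫ ^ 2 ∂p.tilted (en (η ^ 2) (η ^ 2 • x + η • g))) - η ^ 2 * (∑ i, l i ^ 2 * ⟪v i, g⟫ ^ 2) - CC n β D * (η ^ 3 * (1 + ‖g‖) ^ 4) ≤ ∑ k, m k) := by
  have hec := en_cont (η ^ 2) (η ^ 2 • x + η • g)
  have h' := h.tilt (η ^ 2) (η ^ 2 • x + η • g)
  set p' := p.tilted (en (η ^ 2) (η ^ 2 • x + η • g)) with hp'
  set s := 1 + ‖g‖ with hs
  have hs1 : 1 ≤ s := by linarith [nnn g]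
  have hgs : ‖g‖ ≤ s := by linarith
  have ha := hc.mean_le h lI
  have hBa : ∀ (y z : Euc n), ‖z‖ ≤ D → |⟪y, z - a⟫| ≤ 2 * D * ‖y‖ := fun y z hz => by
    refine (ain _ _).trans ?_
    have := norm_sub_le z a; nlinarith [nnn y]
  have hB1 : ∀ i z, ‖z‖ ≤ D → |⟪v i, z - a⟫| ≤ 2 * D := fun i z hz => by simpa using hBa (v i) z hz
  have hB2 : ∀ i j z, ‖z‖ ≤ D → |⟪v i, z - a⟫ * ⟪v j, z - a⟫| ≤ 4 * D ^ 2 := fun i j z hz => by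
    rw [abs_mul]; exact (mlm (hB1 i z hz) (hB1 j z hz) (abn _) pY).trans (le_of_eq (by ring))
  set K := 6700 * D ^ 6 with hK
  have hK0 : 0 ≤ K := by positivity
  have p36 : D ^ 3 ≤ D ^ 6 := ppr hD nN
  have p56 : D ^ 5 ≤ D ^ 6 := ppr hD nN
  have p26 : D ^ 2 ≤ D ^ 6 := ppr hD nN
  set H := prj u m - prj v l with hH
  have hHn : ‖H‖ ≤ 320 * D ^ 4 * (η * s) :=
    (H_norm h lI hc hec h' hc' (L := 2 * D ^ 2 * η * s) pY (fun z hz => en_bd hD h0 h1 hx hz)).trans (le_of_eq (by ring))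
  set mm : Fin n → ℝ := fun i => ∫ z, ⟪v i, z - a⟫ ∂p' with hmm
  have hHij : ∀ i j, ⟪v i, H (v j)⟫ = (∫ z, ⟪v i, z - a⟫ * ⟪v j, z - a⟫ ∂p') - (∫ z, ⟪v i, z - a⟫ * ⟪v j, z - a⟫ ∂p) - mm i * mm j := fun i j => by
    rw [hH, sub_apply, isr, hc'.bil' h' a, hc.bil h]; ring
  have hm1 : ∀ i, |mm i| ≤ 80 * D ^ 3 * (η * s) := fun i => by
    have := (gen h hc hD h0 h1 (x := x) (g := g) hx (G := fun z => ⟪v i, z - a⟫) fP (B := 2 * D) pY (hB1 i)).2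
    rw [hc.mean, sub_zero] at this
    exact this.trans (le_of_eq (by ring))
  have hcg : ∀ i, ∫ z, ⟪v i, z - a⟫ * ⟪g, z - a⟫ ∂p = l i * ⟪v i, g⟫ := fun i => by rw [← hc.bil h, prj_in]
  have hm2 : ∀ i, mm i ^ 2 ≤ η ^ 2 * (l i * ⟪v i, g⟫) ^ 2 + 3 * K ^ 2 * (η ^ 3 * s ^ 4) := fun i => by
    have := (gen h hc hD h0 h1 (x := x) (g := g) hx (G := fun z => ⟪v i, z - a⟫) fP (B := 2 * D) pY (hB1 i)).1
    rw [hc.mean, sub_zero, hcg] at this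
    refine sqexp h0 h1 hs1 hK0 (this.trans ?_) ?_
    · refine mlr ?_ pY; nlinarith
    · rw [← hcg]
      refine (h.bd (B := 2 * D * (2 * D * s)) fun z hz => ?_).trans ?_
      · rw [abs_mul]; exact mlm (hB1 i z hz) ((hBa g z hz).trans (by gcongr)) (abn _) pY
      · have : D ^ 2 * s ≤ D ^ 6 * s := by gcongr
        have : 0 ≤ D ^ 6 * s := by positivity
        nlinarith
  have hTc : ∀ i j, ∫ z, (⟪v i, z - a⟫ * ⟪v j, z - a⟫) * ⟪g, z - a⟫ ∂p = ∑ k, T3 p a v i j k * ⟪v k, g⟫ := fun i j => by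
    have e : ∀ z, (⟪v i, z - a⟫ * ⟪v j, z - a⟫) * ⟪g, z - a⟫ = ∑ k, (⟪v i, z - a⟫ * (⟪v j, z - a⟫ * ⟪v k, z - a⟫)) * ⟪v k, g⟫ := fun z => by
      rw [← onb_in v g, fms]; exact fsc rfl fun k _ => by ring
    simp only [e]
    rw [ifs _ fun k _ => h.int fP]
    simp only [integral_mul_const, T3]
  have hH2 : ∀ i j, ⟪v i, H (v j)⟫ ^ 2 ≤ η ^ 2 * (∑ k, T3 p a v i j k * ⟪v k, g⟫) ^ 2 + 3 * K ^ 2 * (η ^ 3 * s ^ 4) := fun i j => by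
    have := (gen h hc hD h0 h1 (x := x) (g := g) hx (G := fun z => ⟪v i, z - a⟫ * ⟪v j, z - a⟫) fP (B := 4 * D ^ 2) pY (hB2 i j)).1
    rw [hTc] at this
    have hmij : |mm i * mm j| ≤ 6400 * D ^ 6 * (η ^ 2 * s ^ 2) := by
      rw [abs_mul]; exact (mlm (hm1 i) (hm1 j) (abn _) pY).trans (le_of_eq (by ring))
    refine sqexp h0 h1 hs1 hK0 ?_ ?_
    · rw [hHij]
      have e : 75 * (4 * D ^ 2) * D ^ 4 * (η ^ 2 * s ^ 2) = 300 * D ^ 6 * (η ^ 2 * s ^ 2) := by ring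
      rw [e] at this
      rw [abs_le] at *; simp only [hK]; constructor <;> linarith [this.1, this.2, hmij.1, hmij.2]
    · rw [← hTc]
      refine (h.bd (B := 4 * D ^ 2 * (2 * D * s)) fun z hz => ?_).trans ?_
      · rw [abs_mul]; exact mlm (hB2 i j z hz) ((hBa g z hz).trans (by gcongr)) (abn _) pY
      · have : D ^ 3 * s ≤ D ^ 6 * s := by gcongr
        have : 0 ≤ D ^ 6 * s := by positivity
        nlinarith
  have hii : ∀ i, ⟪v i, H (v i)⟫ = (∫ z, ⟪v i, z - a⟫ ^ 2 ∂p') - l i - mm i ^ 2 := fun i => by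
    rw [hHij, hc.cov, if_pos rfl]; simp only [← sq]
  have hη3 : 0 ≤ η ^ 3 * s ^ 4 := by positivity
  constructor
  · have kl := klein hβ r v u l m H hH
    have b1 : ∑ i, β * Ef1 (β * (l i - r)) * ⟪v i, H (v i)⟫ ≤ ∑ i, β * Ef1 (β * (l i - r)) * ((∫ z, ⟪v i, z - a⟫ ^ 2 ∂p') - l i) :=
      fsl fun i _ => mll (by rw [hii]; linarith [sqn (mm i)]) (mnn hβ (Ef1_nonneg _))
    have b2 : ∑ i, ps β r (l i) * ‖H (v i)‖ ^ 2 ≤ ∑ i, (η ^ 2 * (ps β r (l i) * ∑ j, (∑ k, T3 p a v i j k * ⟪v k, g⟫) ^ 2) + β ^ 2 * n * (3 * K ^ 2 * (η ^ 3 * s ^ 4))) := by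
      refine fsl fun i _ => ?_
      have : ‖H (v i)‖ ^ 2 ≤ η ^ 2 * (∑ j, (∑ k, T3 p a v i j k * ⟪v k, g⟫) ^ 2) + n * (3 * K ^ 2 * (η ^ 3 * s ^ 4)) := by
        rw [← onb_sq v, fms]
        refine (fsl fun j _ => ?_).trans (le_of_eq (?_ : ∑ j, (η ^ 2 * (∑ k, T3 p a v i j k * ⟪v k, g⟫) ^ 2 + 3 * K ^ 2 * (η ^ 3 * s ^ 4)) = _))
        · have hsym : ⟪v j, H (v i)⟫ = ⟪v i, H (v j)⟫ := by
            rw [hHij, hHij]; simp only [mul_comm]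
          rw [hsym]; exact hH2 i j
        · rw [fad]; simp
      calc _ ≤ ps β r (l i) * (η ^ 2 * (∑ j, (∑ k, T3 p a v i j k * ⟪v k, g⟫) ^ 2) + n * (3 * K ^ 2 * (η ^ 3 * s ^ 4))) := mll this (ps_nonneg _ _ _)
        _ = η ^ 2 * (ps β r (l i) * ∑ j, (∑ k, T3 p a v i j k * ⟪v k, g⟫) ^ 2) + ps β r (l i) * (n * (3 * K ^ 2 * (η ^ 3 * s ^ 4))) := by ring
        _ ≤ _ := by
          have := mlr (ps_le β r (l i)) (by positivity : 0 ≤ (n : ℝ) * (3 * K ^ 2 * (η ^ 3 * s ^ 4)))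
          linarith
    rw [fad, ← fms, Finset.sum_const, fcu, fcf, nem] at b2
    have b3 : ‖H‖ ^ 3 ≤ (320 * D ^ 4) ^ 3 * (η ^ 3 * s ^ 4) := by
      have : s ^ 3 ≤ s ^ 4 := ppr hs1 nN
      calc ‖H‖ ^ 3 ≤ (320 * D ^ 4 * (η * s)) ^ 3 := by gcongr
        _ = (320 * D ^ 4) ^ 3 * (η ^ 3 * s ^ 3) := by ring
        _ ≤ _ := by gcongr
    have b4 := mll b3 (by positivity : 0 ≤ β ^ 3 * (n : ℝ) ^ 2)
    have b5 : 0 ≤ 3 * n * K ^ 2 * (η ^ 3 * s ^ 4) := by positivity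
    unfold CC; nlinarith
  · rw [← tr_prj u v m]
    have : ∀ i, ⟪v i, prj u m (v i)⟫ = (∫ z, ⟪v i, z - a⟫ ^ 2 ∂p') - mm i ^ 2 := fun i => by
      rw [hc'.bil' h' a]; simp only [← sq]; rfl
    simp only [this, fsd]
    have b6 : ∑ i, mm i ^ 2 ≤ ∑ i, (η ^ 2 * (l i ^ 2 * ⟪v i, g⟫ ^ 2) + 3 * K ^ 2 * (η ^ 3 * s ^ 4)) := fsl fun i _ => (hm2 i).trans (le_of_eq (by ring))
    rw [fad, ← fms, Finset.sum_const, fcu, fcf, nem] at b6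
    have b7 : 0 ≤ (3 * β ^ 2 * n ^ 2 * K ^ 2 + β ^ 3 * n ^ 2 * (320 * D ^ 4) ^ 3) * (η ^ 3 * s ^ 4) := by positivity
    unfold CC; nlinarith

end

section
open ProbabilityTheory
variable {n : ℕ} {t D : ℝ} {p : Measure (Euc n)}
variable {a : Euc n} {v : ONB n} {l : Fin n → ℝ}

lemma cm (c : Euc n) {f : Euc n → ℝ≥0∞} (hf : Measurable f) :
    ∫⁻ g, f (c + g) ∂Gam n = ∫⁻ g, f g * oR (exp (⟪c, g⟫ - ‖c‖ ^ 2 / 2)) ∂Gam n := by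
  have hg : Measurable fun x : Euc n => oR (gk x) := (gk_cont.measurable).ennreal_ofReal
  rw [gam_eq, dens, lwd _ hg fP, lwd _ hg fP]
  conv_rhs => rw [← lintegral_add_left_eq_self _ c]
  refine lcg fun g => ?_
  simp only [Pi.mul_apply]
  rw [mul_comm (f _), ← mul_assoc, ← oRm (gk_pos _).le]
  congr 2
  rw [gk, gk, mul_assoc, ← eadd, norm_add_sq_real, inner_add_right, rin]; ring_nf

def zt (η : ℝ) (x g : Euc n) : Euc n := η ^ 2 • x + η • g
def pt (μ : Measure (Euc n)) (t : ℝ) (θ : Euc n) : Measure (Euc n) := μ.tilted (en t θ)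
def Zt (μ : Measure (Euc n)) (t : ℝ) (θ : Euc n) : ℝ := ∫ x, exp (en t θ x) ∂μ
def ro (μ : Measure (Euc n)) (t : ℝ) (θ x : Euc n) : ℝ := exp (en t θ x) / Zt μ t θ

lemma en_meas (t : ℝ) : Measurable fun z : Euc n × Euc n => en t z.1 z.2 := by unfold en; fun_prop
lemma Zt_meas [SFinite p] (t : ℝ) : Measurable (Zt p t) :=
  (StronglyMeasurable.integral_prod_right' (f := fun z : Euc n × Euc n => exp (en t z.1 z.2)) (en_meas t).exp.stronglyMeasurable).measurable
lemma en_m {α : Type*} [MeasurableSpace α] (t : ℝ) {f g : α → Euc n} (hf : Measurable f) (hg : Measurable g) : Measurable fun a => en t (f a) (g a) := by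
  exact (en_meas t).comp (hf.prodMk hg)
lemma ro_m {α : Type*} [MeasurableSpace α] [SFinite p] (t : ℝ) {f g : α → Euc n} (hf : Measurable f) (hg : Measurable g) : Measurable fun a => ro p t (f a) (g a) :=
  (en_m t hf hg).exp.div ((Zt_meas (p := p) t).comp hf)
lemma SLC.iE (h : SLC n t D p) (s : ℝ) (θ : Euc n) : Integrable (fun x => exp (en s θ x)) p := h.int (by have := en_cont s θ; fun_prop)
lemma SLC.Zpos (h : SLC n t D p) (s : ℝ) (θ : Euc n) : 0 < Zt p s θ := by have := h.prob; exact integral_exp_pos (h.iE s θ)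

lemma bay (h : SLC n t D p) (η : ℝ) (z : Euc n) : ∫⁻ x, ∫⁻ g, oR (ro p (η ^ 2) (zt η x g) z) ∂Gam n ∂p = 1 := by
  have := h.prob
  have hm : Measurable fun ζ => oR (ro p (η ^ 2) ζ z) := (ro_m (p := p) _ measurable_id mct).ennreal_ofReal
  have e : ∀ x g : Euc n, ⟪η • x, g⟫ - ‖η • x‖ ^ 2 / 2 = en (η ^ 2) (η • g) x := fun x g => by
    rw [en, rsl, rsl, norm_smul, mul_pow, ric, rna, sq_abs]; ring
  have k : ∀ x, ∫⁻ g, oR (ro p (η ^ 2) (zt η x g) z) ∂Gam n =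
      ∫⁻ g, oR (ro p (η ^ 2) (η • g) z) * oR (exp (en (η ^ 2) (η • g) x)) ∂Gam n := fun x => by
    have := cm (η • x) (f := fun g => oR (ro p (η ^ 2) (η • g) z)) (hm.comp (measurable_const_smul η))
    simp only [e, smul_add, smul_smul, ← sq] at this
    exact this
  simp only [k]
  have m1 : Measurable fun w : Euc n × Euc n => en (η ^ 2) (η • w.2) w.1 := en_m _ (measurable_snd.const_smul η) measurable_fst
  rw [lls (((hm.comp (measurable_const_smul η)).comp measurable_snd).mul m1.exp.ennreal_ofReal).aemeasurable]
  have k2 : ∀ g : Euc n, ∫⁻ x, oR (ro p (η ^ 2) (η • g) z) * oR (exp (en (η ^ 2) (η • g) x)) ∂p =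
      oR (exp (⟪η • z, g⟫ - ‖η • z‖ ^ 2 / 2)) := fun g => by
    rw [lintegral_const_mul' _ _ ont, ← oie (h.iE _ _) (aoa _ fun x => (epos _).le),
      ← Zt, e, ro, ← oRm (div_nonneg (epos _).le (h.Zpos _ _).le), div_mul_cancel₀ _ (h.Zpos _ _).ne']
  simp only [k2]
  have := cm (η • z) (f := fun _ => 1) mct
  simpa using this.symm

structure HasI {α : Type*} [MeasurableSpace α] (π : Measure α) (f : α → ℝ) (c : ℝ) : Prop where
  i : Integrable f π
  e : ∫ x, f x ∂π = c

section HI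
variable {α : Type*} [MeasurableSpace α] {π : Measure α} {f g : α → ℝ} {c d : ℝ}
lemma HasI.add (h : HasI π f c) (k : HasI π g d) : HasI π (fun x => f x + g x) (c + d) := ⟨h.i.add k.i, by rw [iad h.i k.i, h.e, k.e]⟩
lemma HasI.mul (h : HasI π f c) (b : ℝ) : HasI π (fun x => b * f x) (b * c) := ⟨h.i.const_mul b, by rw [icm, h.e]⟩
lemma HasI.sub (h : HasI π f c) (k : HasI π g d) : HasI π (fun x => f x - g x) (c - d) := ⟨h.i.sub k.i, by rw [isb h.i k.i, h.e, k.e]⟩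
lemma HasI.con [IPM π] (b : ℝ) : HasI π (fun _ => b) b := ⟨ict _, by simp⟩
lemma HasI.sum {ι : Type*} [Fintype ι] {f : ι → α → ℝ} {c : ι → ℝ} (h : ∀ i, HasI π (f i) (c i)) : HasI π (fun x => ∑ i, f i x) (∑ i, c i) :=
  ⟨igf _ fun i _ => (h i).i, by rw [ifs _ fun i _ => (h i).i]; exact fsc rfl fun i _ => (h i).e⟩
lemma HasI.le (h : HasI π f c) (k : HasI π g d) (e : ∀ᵐ x ∂π, f x ≤ g x) : c ≤ d := by rw [← h.e, ← k.e]; exact integral_mono_ae h.i k.i e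
lemma HasI.snd {γ : Type*} [MeasurableSpace γ] {ν : Measure γ} [SFinite ν] {f : γ → ℝ} [IPM π] (h : HasI ν f c) : HasI (π.prod ν) (fun w => f w.2) c :=
  ⟨h.i.comp_snd π, by rw [integral_fun_snd, h.e]; simp⟩
end HI

lemma bayG (h : SLC n t D p) (η : ℝ) {G : Euc n → ℝ} (hG : Continuous G) (h0 : ∀ z, 0 ≤ G z) :
    HasI (p.prod (Gam n)) (fun w => ∫ z, G z ∂pt p (η ^ 2) (zt η w.1 w.2)) (∫ z, G z ∂p) := by
  have := h.prob
  have hz : Measurable fun w : Euc n × Euc n => zt η w.1 w.2 := by unfold zt; fun_prop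
  have hr : ∀ θ z, 0 ≤ ro p (η ^ 2) θ z := fun θ z => div_nonneg (epos _).le (h.Zpos _ _).le
  have m3 : Measurable fun w : (Euc n × Euc n) × Euc n => ro p (η ^ 2) (zt η w.1.1 w.1.2) w.2 := ro_m (p := p) _ (hz.comp measurable_fst) measurable_snd
  have e1 : ∀ w : Euc n × Euc n, ∫ z, G z ∂pt p (η ^ 2) (zt η w.1 w.2) = ∫ z, ro p (η ^ 2) (zt η w.1 w.2) z * G z ∂p := fun w => by
    simp only [pt, integral_tilted, sem, ro, Zt]
  simp only [e1]
  have mG := hG.measurable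
  have sm : StronglyMeasurable fun w : Euc n × Euc n => ∫ z, ro p (η ^ 2) (zt η w.1 w.2) z * G z ∂p :=
    StronglyMeasurable.integral_prod_right' (f := fun w : (Euc n × Euc n) × Euc n => ro p (η ^ 2) (zt η w.1.1 w.1.2) w.2 * G w.2)
      (m3.mul (mG.comp measurable_snd)).stronglyMeasurable
  have hn : ∀ w : Euc n × Euc n, 0 ≤ ∫ z, ro p (η ^ 2) (zt η w.1 w.2) z * G z ∂p := fun w => inn fun z => mnn (hr _ _) (h0 z)
  have hGi := h.int hG
  suffices e : ∫⁻ w, oR (∫ z, ro p (η ^ 2) (zt η w.1 w.2) z * G z ∂p) ∂(p.prod (Gam n)) = ∫⁻ z, oR (G z) ∂p by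
    refine ⟨(lintegral_ofReal_ne_top_iff_integrable sm.aestronglyMeasurable (aoa _ hn)).1 ?_, ?_⟩
    · rw [e]; exact (lintegral_ofReal_ne_top_iff_integrable hGi.1 (aoa _ h0)).2 hGi
    · rw [iel (aoa _ hn) sm.aestronglyMeasurable, e, ← iel (aoa _ h0) hG.aestronglyMeasurable]
  have e2 : ∀ w : Euc n × Euc n, oR (∫ z, ro p (η ^ 2) (zt η w.1 w.2) z * G z ∂p) =
      ∫⁻ z, oR (ro p (η ^ 2) (zt η w.1 w.2) z) * oR (G z) ∂p := fun w => by
    rw [oie (h.int (by unfold ro; have := en_cont (η ^ 2) (zt η w.1 w.2); fun_prop)) (aoa _ fun z => mnn (hr _ _) (h0 z))]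
    simp only [oRm (hr _ _)]
  simp only [e2]
  rw [lls (m3.ennreal_ofReal.mul (mG.comp measurable_snd).ennreal_ofReal).aemeasurable]
  refine lcg fun z => ?_
  rw [lintegral_mul_const' _ _ ont, lintegral_prod _ (ro_m (p := p) _ hz mct).ennreal_ofReal.aemeasurable]
  have := bay h η z
  rw [this, one_mul]

lemma pt_tilt {t₀ : ℝ} (h : SLC n t₀ D p) (t s : ℝ) (θ ζ : Euc n) : (pt p t θ).tilted (en s ζ) = pt p (t + s) (θ + ζ) := by
  rw [pt, tilted_tilted (h.iE t θ), pt]; congr 1; ext x; simp only [Pi.add_apply, en, inner_add_left]; ring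

lemma pt_slc (h : SLC n 0 D p) (t : ℝ) (θ : Euc n) : SLC n t D (pt p t θ) := by simpa [pt] using h.tilt t θ

lemma ro_step (h : SLC n 0 D p) (t s : ℝ) (θ ζ x : Euc n) : ro p (t + s) (θ + ζ) x = ro p t θ x * ro (pt p t θ) s ζ x := by
  have e : ∀ z, en (t + s) (θ + ζ) z = en t θ z + en s ζ z := fun z => by simp only [en, inner_add_left]; ring
  have hz := (h.Zpos t θ).ne'
  have : Zt (pt p t θ) s ζ = Zt p (t + s) (θ + ζ) / Zt p t θ := by
    rw [Zt, pt, integral_tilted, Zt, ← integral_div]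
    refine ica (aoa _ fun z => ?_)
    simp only [e, eadd, sem]; rw [← Zt]; ring
  rw [ro, ro, ro, this, e, eadd]
  have := (h.Zpos (t + s) (θ + ζ)).ne'
  field_simp

def nx (μ : Measure (Euc n)) (t η : ℝ) (q : Measure (Euc n)) : Measure (Euc n) :=
  (((q.prod μ).withDensity fun z => oR (ro μ t z.1 z.2)).prod (Gam n)).map fun z => z.1.1 + zt η z.1.2 z.2

lemma nx_lint (h : SLC n 0 D p) (t η : ℝ) (q : Measure (Euc n)) [IPM q] {f : Euc n → ℝ≥0∞} (hf : Measurable f) :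
    ∫⁻ θ, f θ ∂nx p t η q = ∫⁻ θ, ∫⁻ x, ∫⁻ g, f (θ + zt η x g) ∂Gam n ∂pt p t θ ∂q := by
  have := h.prob
  have hz : Measurable fun w : (Euc n × Euc n) × Euc n => w.1.1 + zt η w.1.2 w.2 := by unfold zt; fun_prop
  have m1 : Measurable fun w : Euc n × Euc n => ∫⁻ g, f (w.1 + zt η w.2 g) ∂Gam n := (hf.comp hz).lintegral_prod_right'
  have mr := (ro_m (p := p) t measurable_fst measurable_snd).ennreal_ofReal
  rw [nx, lintegral_map hf hz, lintegral_prod (fun z : (Euc n × Euc n) × Euc n => f (z.1.1 + zt η z.1.2 z.2)) (hf.comp hz).aemeasurable, lwd _ mr m1, lintegral_prod _ (mr.mul m1).aemeasurable]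
  refine lcg fun θ => ?_
  rw [pt, lintegral_tilted]; rfl

structure Mx (μ : Measure (Euc n)) (t : ℝ) (q : Measure (Euc n)) : Prop where
  prob : IPM q
  one : ∀ x, ∫⁻ θ, oR (ro μ t θ x) ∂q = 1

lemma Mx.nx (h : SLC n 0 D p) {q : Measure (Euc n)} (hq : Mx p t q) (η : ℝ) : Mx p (t + η ^ 2) (nx p t η q) := by
  have := h.prob
  have := hq.prob
  refine ⟨⟨?_⟩, fun x => ?_⟩
  · rw [← lintegral_one, nx_lint h t η q mct]
    have := fun θ => (pt_slc h t θ).prob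
    simp
  · have mr := (ro_m (p := p) (t + η ^ 2) measurable_id (mct (a := x))).ennreal_ofReal
    refine (nx_lint h t η q mr).trans ?_
    rw [← hq.one x]
    refine lcg fun θ => ?_
    have h0 : 0 ≤ ro p t θ x := div_nonneg (epos _).le (h.Zpos _ _).le
    simp only [id, ro_step h, oRm h0]
    have := bay (pt_slc h t θ) η x
    simp only [lintegral_const_mul' _ _ ont, this, mul_one]

lemma Mx.zero (h : SLC n 0 D p) : Mx p 0 (Measure.dirac 0) := ⟨inferInstance, fun x => by
  have := h.prob
  simp [ro, Zt, en]⟩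

lemma lam_le (h : SLC n t D p) (hc : CovD p a v l) (hD : 0 ≤ D) (i : Fin n) : l i ≤ 4 * D ^ 2 := by
  have ha := hc.mean_le h hD
  have := hc.cov i i
  rw [if_pos rfl] at this
  rw [← this]
  refine (le_abs_self _).trans (h.bd fun x hx => ?_)
  have k : |⟪v i, x - a⟫| ≤ 2 * D := (ain _ _).trans (by
    rw [v.norm_eq_one, one_mul]; exact (norm_sub_le _ _).trans lI)
  rw [abs_mul]
  calc _ ≤ (2 * D) * (2 * D) := mlm k k (abn _) lI
    _ = _ := by ring

lemma Ef1_mono : Monotone Ef1 := fun a b h => by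
  unfold Ef1; split_ifs with h1 h2 h2
  · exact ele.2 h
  · linarith [Real.exp_le_one_iff.2 h1]
  · linarith
  · linarith

def W1 (n : ℕ) (β D δ : ℝ) : ℝ := n * (β * Ef1 (β * (4 * D ^ 2)) * δ) + n * (β ^ 2 * δ ^ 2) + β ^ 3 * n ^ 2 * δ ^ 3

lemma lip1 (h : SLC n t D p) (hD : 0 ≤ D) {s β r : ℝ} (hβ : 0 ≤ β) (hr : 0 ≤ r) (ℓ : Euc n → ℝ) (hℓ : Continuous ℓ) (h' : SLC n s D (p.tilted ℓ)) {L : ℝ} (hL0 : 0 ≤ L) (hL : ∀ x, ‖x‖ ≤ D → |ℓ x| ≤ L) :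
    Ph β r (p.tilted ℓ) ≤ Ph β r p + W1 n β D (160 * D ^ 2 * L) ∧ Tr (p.tilted ℓ) ≤ Tr p + n * (160 * D ^ 2 * L) ∧
    ∀ M, (∀ i, (cD p).2.2 i ≤ M) → Ph β r (p.tilted ℓ) ≤ n * ph β r (M + 160 * D ^ 2 * L) := by
  have hc := cD_spec h
  have hc' := cD_spec h'
  have hH := H_norm h hD hc hℓ h' hc' hL0 hL
  set H := prj (cD (p.tilted ℓ)).2.1 (cD (p.tilted ℓ)).2.2 - prj (cD p).2.1 (cD p).2.2 with hHd
  set δ := 160 * D ^ 2 * L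
  set v := (cD p).2.1
  set l := (cD p).2.2
  have hv : ∀ i, ‖H (v i)‖ ≤ δ := fun i => (H.le_opNorm _).trans (by rw [v.norm_eq_one, mul_one]; exact hH)
  have hvi : ∀ i, ⟪v i, H (v i)⟫ ≤ δ := fun i => (real_inner_le_norm _ _).trans (by rw [v.norm_eq_one, one_mul]; exact hv i)
  have hn : ∀ c : ℝ, ∑ _i : Fin n, c = n * c := fun c => by simp
  refine ⟨?_, ?_, fun M hM => ?_⟩
  · have k := klein hβ r v (cD (p.tilted ℓ)).2.1 l (cD (p.tilted ℓ)).2.2 H hHd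
    refine k.trans ?_
    rw [W1, ← hn, ← hn, ← add_assoc, ← add_assoc]
    refine add_le_add (add_le_add (add_le_add le_rfl ?_) ?_) ?_
    · refine fsl fun i _ => (mll (hvi i) (mnn hβ (Ef1_nonneg _))).trans (mlr
        (mll (Ef1_mono (mll (by linarith [lam_le h hc hD i]) hβ)) hβ) pY)
    · refine fsl fun i _ => mlm (ps_le _ _ _) (ppl (nnn _) (hv i) 2) pY pY
    · gcongr
  · have k1 := tr_prj (cD (p.tilted ℓ)).2.1 v (cD (p.tilted ℓ)).2.2
    have k2 := tr_prj v v l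
    rw [Tr, Tr, ← k1, ← k2, ← hn, ← fad]
    refine fsl fun i _ => ?_
    have := hvi i
    rw [hHd, sub_apply, isr] at this; linarith
  · rw [Ph, ← hn]
    refine fsl fun k _ => Ef_mono (mll (sub_le_sub_right ?_ _) hβ)
    set u := (cD (p.tilted ℓ)).2.1
    have k1 : ⟪u k, H (u k)⟫ ≤ δ := (real_inner_le_norm _ _).trans (by
      rw [u.norm_eq_one, one_mul]; exact (H.le_opNorm _).trans (by rw [u.norm_eq_one, mul_one]; exact hH))
    rw [hHd, sub_apply, isr, prj_in, rin, u.norm_eq_one, ← onb_in v] at k1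
    have k2 : ∑ j, ⟪v j, u k⟫ * ⟪v j, prj v l (u k)⟫ ≤ ∑ j, M * ⟪v j, u k⟫ ^ 2 := fsl fun j _ => by
      rw [prj_in]; calc _ = l j * ⟪v j, u k⟫ ^ 2 := by ring
        _ ≤ _ := mlr (hM j) (sqn _)
    rw [← fms, onb_sq, u.norm_eq_one] at k2
    linarith
end

section
open ProbabilityTheory
variable {n : ℕ} {t D : ℝ} {p : Measure (Euc n)}
variable {a : Euc n} {v : ONB n} {l : Fin n → ℝ}

lemma gau2 (w : Euc n) : HasI (Gam n) (fun g => ⟪w, g⟫ ^ 2) (‖w‖ ^ 2) := by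
  have hL : MemLp (innerSL ℝ w) 2 (Gam n) := IsGaussian.memLp_dual (Gam n) _ 2 (by simp)
  refine ⟨by simpa using hL.integrable_sq, ?_⟩
  have h1 := variance_eq_sub hL
  have h2 := integral_strongDual_stdGaussian (E := Euc n) (innerSL ℝ w)
  rw [variance_dual_stdGaussian, h2, innerSL_apply_norm] at h1
  simpa using h1.symm

lemma con_aux {f : Euc n → ℝ} {W : ℝ → ℝ} (hW : Continuous W) (hW0 : W 0 = 0) (h : ∀ θ θ', f θ' ≤ f θ + W ‖θ' - θ‖) : Continuous f := by
  refine continuous_iff_continuousAt.2 fun θ => ?_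
  have hd : Filter.Tendsto (fun θ' => W ‖θ' - θ‖) (nhds θ) (nhds 0) := by
    have : Continuous fun θ' => W ‖θ' - θ‖ := by fun_prop
    simpa [hW0] using this.tendsto θ
  refine tendsto_iff_dist_tendsto_zero.2 (squeeze_zero (fun _ => dist_nonneg) (fun θ' => ?_) hd)
  rw [Real.dist_eq, abs_le]
  have := h θ' θ
  rw [norm_sub_rev] at this
  exact ⟨by linarith, by linarith [h θ θ']⟩

lemma Ph_con (h : SLC n t D p) (hD : 0 ≤ D) {β r : ℝ} (hβ : 0 ≤ β) (hr : 0 ≤ r) (s : ℝ) :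
    Continuous (fun θ => Ph β r (pt p s θ)) ∧ Continuous fun θ => Tr (pt p s θ) := by
  have k := fun θ θ' : Euc n => lip1 (h.tilt s θ) hD hβ hr (en 0 (θ' - θ)) (en_cont _ _) ((h.tilt s θ).tilt 0 (θ' - θ)) (L := ‖θ' - θ‖ * D)
    pY fun x hx => by
      simp only [en, zero_div, zero_mul, sub_zero]
      exact (ain _ _).trans (mll hx (nnn _))
  have e : ∀ θ θ' : Euc n, (p.tilted (en s θ)).tilted (en 0 (θ' - θ)) = pt p s θ' := fun θ θ' => by
    have := pt_tilt h s 0 θ (θ' - θ); rwa [add_zero, add_sub_cancel] at this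
  simp only [e] at k
  exact ⟨con_aux (W := fun x => W1 n β D (160 * D ^ 2 * (x * D))) (by unfold W1; fun_prop) (by simp [W1]) fun θ θ' => (k θ θ').1,
    con_aux (W := fun x => n * (160 * D ^ 2 * (x * D))) fP (by simp) fun θ θ' => (k θ θ').2.1⟩

lemma Ph_bd (h : SLC n t D p) (hD : 0 ≤ D) {β r : ℝ} (hβ : 0 ≤ β) : 0 ≤ Ph β r p ∧ Ph β r p ≤ n * ph β r (4 * D ^ 2) ∧ 0 ≤ Tr p ∧ Tr p ≤ n * (4 * D ^ 2) := by
  have hc := cD_spec h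
  have hn : ∀ c : ℝ, ∑ _i : Fin n, c = n * c := fun c => by simp
  refine ⟨Finset.sum_nonneg fun i _ => (Ef_pos _).le, ?_, Finset.sum_nonneg fun i _ => hc.nonneg i, ?_⟩
  · rw [← hn]; exact fsl fun i _ => Ef_mono (mll (sub_le_sub_right (lam_le h hc hD i) _) hβ)
  · rw [← hn]; exact fsl fun i _ => lam_le h hc hD i

lemma T_sym (h : SLC n t D p) (ht : 0 < t) (hc : CovD p a v l) {β r : ℝ} (hβ : 0 ≤ β) (hr : 0 ≤ r) (hr2 : r ≤ 2) :
    ∑ i, ps β r (l i) * ∑ j, ∑ k, T3 p a v i j k ^ 2 ≤ 12 / √t * (32 * β ^ 2 + 8 / √t) * ∑ i, ph β r (l i) := by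
  let f : Fin n → Fin n → Fin n → ℝ := fun i j k => if l j ≤ l i ∧ l k ≤ l i then ps β r (l i) * T3 p a v i j k ^ 2 else 0
  have f0 : ∀ i j k, 0 ≤ f i j k := fun i j k => by
    simp only [f]; split_ifs; exacts [mnn (ps_nonneg _ _ _) (sqn _), le_rfl]
  have hm : ∀ i j, l i ≤ l j → ps β r (l i) ≤ ps β r (l j) := fun i j hij =>
    mll (Ef2_mono (mll (sub_le_sub_right hij _) hβ)) (sqn _)
  have s1 : ∀ i j k, T3 p a v j i k = T3 p a v i j k := fun i j k => by unfold T3; congr 1; ext x; ring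
  have s2 : ∀ i j k, T3 p a v k i j = T3 p a v i j k := fun i j k => by unfold T3; congr 1; ext x; ring
  have key : ∀ i j k, ps β r (l i) * T3 p a v i j k ^ 2 ≤ f i j k + f j i k + f k i j := fun i j k => by
    have a1 := f0 i j k; have a2 := f0 j i k; have a3 := f0 k i j
    have b : ∀ j', l i ≤ l j' → ps β r (l i) * T3 p a v i j k ^ 2 ≤ ps β r (l j') * T3 p a v i j k ^ 2 := fun j' hj => mlr (hm _ _ hj) (sqn _)
    by_cases c1 : l j ≤ l i ∧ l k ≤ l i
    · have : f i j k = ps β r (l i) * T3 p a v i j k ^ 2 := if_pos c1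
      linarith
    by_cases c2 : l i ≤ l j ∧ l k ≤ l j
    · have : f j i k = ps β r (l j) * T3 p a v i j k ^ 2 := by simp only [f, if_pos c2, s1]
      linarith [b j c2.1]
    have c3 : l i ≤ l k ∧ l j ≤ l k := by grind
    have : f k i j = ps β r (l k) * T3 p a v i j k ^ 2 := by simp only [f, if_pos c3, s2]
    linarith [b k c3.1]
  have t3 : ∀ i, ∑ j, ∑ k, f i j k ≤ 4 / √t * (32 * β ^ 2 + 8 / √t) * ph β r (l i) := fun i => by
    refine le_trans ?_ (ps_bound hβ ht hr hr2 (hc.nonneg i) (top_le h ht hc i))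
    refine le_trans (le_of_eq ?_) (mll (third h ht hc i) (ps_nonneg _ _ _))
    simp only [f, fms, mul_ite, mul_zero]
  calc _ = ∑ i, ∑ j, ∑ k, ps β r (l i) * T3 p a v i j k ^ 2 := by simp only [fms]
    _ ≤ ∑ i, ∑ j, ∑ k, (f i j k + f j i k + f k i j) := fsl fun i _ => fsl fun j _ => fsl fun k _ => key i j k
    _ = (∑ i, ∑ j, ∑ k, f i j k) + (∑ i, ∑ j, ∑ k, f i j k) + (∑ i, ∑ j, ∑ k, f i j k) := by
        simp only [fad]
        congr 1
        · congr 1; exact fco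
        · calc _ = ∑ i, ∑ k, ∑ j, f k i j := fsc rfl fun i _ => fco
            _ = _ := fco
    _ ≤ 3 * ∑ i, 4 / √t * (32 * β ^ 2 + 8 / √t) * ph β r (l i) := by
        have := fsl fun i (_ : i ∈ Finset.univ) => t3 i
        linarith
    _ = _ := by rw [← fms]; ring

def s4 (n : ℕ) : ℝ := ∫ g, (1 + ‖g‖) ^ 4 ∂Gam n
lemma s4_has : HasI (Gam n) (fun g => (1 + ‖g‖) ^ 4) (s4 n) := by
  refine ⟨?_, rfl⟩
  have e : (fun g : Euc n => (1 + ‖g‖) ^ 4) = fun g => 1 + 4 * ‖g‖ ^ 1 + 6 * ‖g‖ ^ 2 + 4 * ‖g‖ ^ 3 + ‖g‖ ^ 4 := by ext g; ring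
  rw [e]
  exact ((((ict _).add ((gam_mom 1 (by simp)).const_mul _)).add ((gam_mom 2 (by simp)).const_mul _)).add ((gam_mom 3 (by simp)).const_mul _)).add (gam_mom 4 (by simp))

lemma bd_has {π : Measure (Euc n × Euc n)} [IsFiniteMeasure π] {f : Euc n → ℝ} {B : ℝ} (hf : Continuous f) (h0 : ∀ θ, 0 ≤ f θ) (hB : ∀ θ, f θ ≤ B) (η : ℝ) (θ : Euc n) :
    HasI π (fun w => f (θ + zt η w.1 w.2)) (∫ w, f (θ + zt η w.1 w.2) ∂π) :=
  ⟨Integrable.of_bound (C := B) (by unfold zt; exact (by fun_prop : Continuous _).aestronglyMeasurable) (aoa _ fun w => by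
    rw [rna, aon (h0 _)]; exact hB _), rfl⟩

lemma step_int (h : SLC n t D p) (hD : 1 ≤ D) {η : ℝ} (h0 : 0 < η) (h1 : η ≤ 1) {β r : ℝ} (hβ : 0 < β) (hr : 0 ≤ r) (hr2 : r ≤ 2) :
    (0 < t → ∫ w, Ph β r (pt p (η ^ 2) (0 + zt η w.1 w.2)) ∂(p.prod (Gam n)) ≤
      (1 + η ^ 2 * (12 / √t * (32 * β ^ 2 + 8 / √t))) * Ph β r p + CC n β D * (η ^ 3 * s4 n)) ∧
    Tr p - η ^ 2 * (2 * r ^ 2 * n + 4 / β ^ 2 * Ph β r p) - CC n β D * (η ^ 3 * s4 n) ≤ ∫ w, Tr (pt p (η ^ 2) (0 + zt η w.1 w.2)) ∂(p.prod (Gam n)) := by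
  have hD0 : 0 ≤ D := by linarith
  have := h.prob
  have hc := cD_spec h
  obtain ⟨c1, c2⟩ := Ph_con h hD0 hβ.le hr (η ^ 2)
  have bd := fun θ => Ph_bd (h.tilt (η ^ 2) θ) hD0 (r := r) hβ.le
  have i1 := bd_has (π := p.prod (Gam n)) c1 (fun θ => (bd θ).1) (fun θ => (bd θ).2.1) η 0
  have i2 := bd_has (π := p.prod (Gam n)) c2 (fun θ => (bd θ).2.2.1) (fun θ => (bd θ).2.2.2) η 0
  set a := (cD p).1 with ha
  set v := (cD p).2.1 with hv
  set l := (cD p).2.2 with hl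
  have hI : ∀ i, HasI (p.prod (Gam n)) (fun w => ∫ z, ⟪v i, z - a⟫ ^ 2 ∂pt p (η ^ 2) (zt η w.1 w.2)) (l i) := fun i => by
    have := bayG h η (G := fun z => ⟪v i, z - a⟫ ^ 2) fP fun z => sqn _
    have e := hc.cov i i
    simp only [if_pos, ← sq] at e
    rwa [e] at this
  have hae : ∀ᵐ w ∂(p.prod (Gam n)), ‖w.1‖ ≤ D := Measure.quasiMeasurePreserving_fst.ae h.ball
  have hs : HasI (p.prod (Gam n)) (fun w => CC n β D * (η ^ 3 * (1 + ‖w.2‖) ^ 4)) (CC n β D * (η ^ 3 * s4 n)) := (s4_has.snd.mul _).mul _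
  have st := fun (w : Euc n × Euc n) hw => step_pt h hc hD h0 h1 (x := w.1) (g := w.2) hw (cD_spec (h.tilt (η ^ 2) (zt η w.1 w.2))) hβ.le r
  constructor
  · intro ht
    have hQ : HasI (p.prod (Gam n)) (fun w => ∑ i, ps β r (l i) * ∑ j, (∑ k, T3 p a v i j k * ⟪v k, w.2⟫) ^ 2) (∑ i, ps β r (l i) * ∑ j, ∑ k, T3 p a v i j k ^ 2) := by
      refine HasI.sum fun i => (HasI.sum fun j => ?_).mul _
      have := (gau2 (∑ k, T3 p a v i j k • v k)).snd (π := p)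
      simp only [sum_inner, rsl] at this
      convert this using 1
      rw [← onb_sq v]
      exact fsc rfl fun k _ => by rw [v.orthonormal.inner_right_fintype]
    have R := (((HasI.con (π := p.prod (Gam n)) (Ph β r p)).add (HasI.sum fun i => ((hI i).sub (HasI.con (l i))).mul (β * Ef1 (β * (l i - r))))).add (hQ.mul (η ^ 2))).add hs
    have := i1.le R (hae.mono fun w hw => by simp only [zero_add]; exact (st w hw).1)
    refine this.trans ?_
    have hT := mll (T_sym h ht hc hβ.le hr hr2) (sqn η)
    simp only [sub_self, mul_zero, Finset.sum_const_zero, add_zero]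
    have : Ph β r p = ∑ i, ph β r (l i) := rfl
    rw [← this] at hT; linarith
  · have R := ((HasI.sum hI).sub ((HasI.sum fun i => ((gau2 (v i)).snd (π := p)).mul (l i ^ 2)).mul (η ^ 2))).sub hs
    have := R.le i2 (hae.mono fun w hw => by simp only [zero_add]; exact (st w hw).2)
    refine le_trans ?_ this
    have k : ∑ i, l i ^ 2 * ‖v i‖ ^ 2 ≤ 2 * r ^ 2 * n + 4 / β ^ 2 * Ph β r p := by
      calc _ ≤ ∑ i, (2 * r ^ 2 + 4 / β ^ 2 * ph β r (l i)) := fsl fun i _ => by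
            rw [v.norm_eq_one, one_pow, mul_one]; exact sq_ph hβ hr (hc.nonneg i)
        _ = _ := by rw [fad, Finset.sum_const, ← fms, fcu, fcf, nem, mul_comm (n:ℝ)]; rfl
    have := mll k (sqn η)
    rw [Tr]; linarith
end

section
open ProbabilityTheory
variable {n : ℕ} {t D : ℝ} {p q : Measure (Euc n)}

lemma nx_has (h : SLC n 0 D p) (hq : Mx p t q) (η : ℝ) {f : Euc n → ℝ} (hf : Continuous f) (h0 : ∀ x, 0 ≤ f x) {B : ℝ} (hB : ∀ x, f x ≤ B) :
    HasI q (fun θ => ∫ w, f (θ + zt η w.1 w.2) ∂((pt p t θ).prod (Gam n))) (∫ θ, f θ ∂nx p t η q) := by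
  have := h.prob
  have := hq.prob
  have hp := fun θ => (pt_slc h t θ).prob
  set F : Euc n → ℝ≥0∞ := fun θ => ∫⁻ x, ∫⁻ g, oR (f (θ + zt η x g)) ∂Gam n ∂pt p t θ with hF
  have hz : Measurable fun w : (Euc n × Euc n) × Euc n => oR (f (w.1.1 + zt η w.1.2 w.2)) := by
    unfold zt; exact ENNReal.measurable_ofReal.comp (by fun_prop : Continuous fun w : (Euc n × Euc n) × Euc n => f (w.1.1 + (η ^ 2 • w.1.2 + η • w.2))).measurable
  have mF : Measurable F := by
    have m1 : Measurable fun w : Euc n × Euc n => oR (ro p t w.1 w.2) * ∫⁻ g, oR (f (w.1 + zt η w.2 g)) ∂Gam n :=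
      (ro_m (p := p) t measurable_fst measurable_snd).ennreal_ofReal.mul hz.lintegral_prod_right'
    convert m1.lintegral_prod_right' (ν := p) using 2 with θ
    simp only [hF]; rw [pt, lintegral_tilted]; rfl
  have eF : (fun θ => ∫ w, f (θ + zt η w.1 w.2) ∂((pt p t θ).prod (Gam n))) = fun θ => (F θ).toReal := by
    ext θ
    have c : Continuous fun w : Euc n × Euc n => f (θ + zt η w.1 w.2) := by unfold zt; fun_prop
    rw [iel (aoa _ fun w => h0 _) c.aestronglyMeasurable, lintegral_prod _ c.measurable.ennreal_ofReal.aemeasurable]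
  have bF : ∀ θ, F θ ≤ oR B := fun θ => by
    calc F θ ≤ ∫⁻ x, ∫⁻ g, oR B ∂Gam n ∂pt p t θ := lmn fun x => lmn fun g => oRl (hB _)
      _ = _ := by simp
  have fin : ∀ θ, F θ < ⊤ := fun θ => (bF θ).trans_lt olt
  rw [eF]
  refine ⟨Integrable.of_bound (C := (oR B).toReal) mF.ennreal_toReal.aestronglyMeasurable (aoa _ fun θ => ?_), ?_⟩
  · rw [rna, aon ENNReal.toReal_nonneg]; exact ENNReal.toReal_mono ont (bF θ)
  · rw [integral_toReal mF.aemeasurable (aoa _ fin), iel (aoa _ h0) hf.aestronglyMeasurable, nx_lint h t η q hf.measurable.ennreal_ofReal]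

lemma q_has {p' : Measure (Euc n)} [IsFiniteMeasure p'] {f : Euc n → ℝ} {B : ℝ} (hf : Continuous f) (h0 : ∀ θ, 0 ≤ f θ) (hB : ∀ θ, f θ ≤ B) : HasI p' f (∫ θ, f θ ∂p') :=
  ⟨Integrable.of_bound (C := B) hf.aestronglyMeasurable (aoa _ fun w => by rw [rna, aon (h0 _)]; exact hB _), rfl⟩

def eP (β r : ℝ) (p : Measure (Euc n)) (t : ℝ) (q : Measure (Euc n)) : ℝ := ∫ θ, Ph β r (pt p t θ) ∂q
def eT (p : Measure (Euc n)) (t : ℝ) (q : Measure (Euc n)) : ℝ := ∫ θ, Tr (pt p t θ) ∂q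

lemma PT_has (h : SLC n 0 D p) (hD : 0 ≤ D) [IsFiniteMeasure q] {β r : ℝ} (hβ : 0 ≤ β) (hr : 0 ≤ r) (t : ℝ) :
    HasI q (fun θ => Ph β r (pt p t θ)) (eP β r p t q) ∧ HasI q (fun θ => Tr (pt p t θ)) (eT p t q) := by
  obtain ⟨c1, c2⟩ := Ph_con h hD hβ hr t
  have bd := fun θ => Ph_bd (pt_slc h t θ) hD (r := r) hβ
  exact ⟨q_has c1 (fun θ => (bd θ).1) fun θ => (bd θ).2.1, q_has c2 (fun θ => (bd θ).2.2.1) fun θ => (bd θ).2.2.2⟩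

lemma one_step (h : SLC n 0 D p) (hD : 1 ≤ D) (hq : Mx p t q) {η : ℝ} (h0 : 0 < η) (h1 : η ≤ 1) {β r : ℝ} (hβ : 0 < β) (hr : 0 ≤ r) (hr2 : r ≤ 2) :
    (0 < t → eP β r p (t + η ^ 2) (nx p t η q) ≤ (1 + η ^ 2 * (12 / √t * (32 * β ^ 2 + 8 / √t))) * eP β r p t q + CC n β D * (η ^ 3 * s4 n)) ∧
    eT p t q - η ^ 2 * (2 * r ^ 2 * n + 4 / β ^ 2 * eP β r p t q) - CC n β D * (η ^ 3 * s4 n) ≤ eT p (t + η ^ 2) (nx p t η q) := by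
  have hD0 : 0 ≤ D := by linarith
  have := hq.prob
  obtain ⟨c1, c2⟩ := Ph_con h hD0 hβ.le hr (t + η ^ 2)
  have bd := fun θ => Ph_bd (pt_slc h (t + η ^ 2) θ) hD0 (r := r) hβ.le
  obtain ⟨k1, k2⟩ := PT_has (q := q) h hD0 hβ.le hr t
  have j1 := nx_has h hq η c1 (fun θ => (bd θ).1) fun θ => (bd θ).2.1
  have j2 := nx_has h hq η c2 (fun θ => (bd θ).2.2.1) fun θ => (bd θ).2.2.2
  have st := fun θ => step_int (pt_slc h t θ) hD h0 h1 hβ hr hr2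
  have e : ∀ θ ζ, pt (pt p t θ) (η ^ 2) (0 + ζ) = pt p (t + η ^ 2) (θ + ζ) := fun θ ζ => by rw [zero_add]; exact pt_tilt h _ _ _ _
  simp only [e] at st
  exact ⟨fun ht => j1.le ((k1.mul _).add (HasI.con _)) (aoa _ fun θ => (st θ).1 ht),
    ((k2.sub (((HasI.con _).add (k1.mul _)).mul _)).sub (HasI.con _)).le j2 (aoa _ fun θ => (st θ).2)⟩

lemma CC_nonneg {β : ℝ} (hβ : 0 ≤ β) : 0 ≤ CC n β D * s4 n := by
  have : 0 ≤ s4 n := inn fun g => by positivity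
  unfold CC; positivity

lemma eP_nonneg (h : SLC n 0 D p) (hD : 0 ≤ D) {β : ℝ} (hβ : 0 ≤ β) (r t : ℝ) (q : Measure (Euc n)) : 0 ≤ eP β r p t q :=
  inn fun θ => (Ph_bd (pt_slc h t θ) hD hβ).1

lemma iter (h : SLC n 0 D p) (hD : 1 ≤ D) (ht : 0 < t) (hq : Mx p t q) {η : ℝ} (h0 : 0 < η) (h1 : η ≤ 1) {β r : ℝ} (hβ : 0 < β) (hr : 0 ≤ r) (hr2 : r ≤ 2)
    {K G : ℝ} (hK : 12 / √t * (32 * β ^ 2 + 8 / √t) ≤ K) (N : ℕ) (hG : exp (N * (η ^ 2 * K)) * (eP β r p t q + N * (CC n β D * (η ^ 3 * s4 n))) ≤ G) :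
    ∀ k ≤ N, ∃ q', Mx p (t + k * η ^ 2) q' ∧ eP β r p (t + k * η ^ 2) q' ≤ exp (k * (η ^ 2 * K)) * (eP β r p t q + k * (CC n β D * (η ^ 3 * s4 n))) ∧
      eT p t q - k * (η ^ 2 * (2 * r ^ 2 * n + 4 / β ^ 2 * G) + CC n β D * (η ^ 3 * s4 n)) ≤ eT p (t + k * η ^ 2) q' := by
  have hD0 : 0 ≤ D := by linarith
  have hK0 : 0 ≤ K := le_trans pY hK
  have hE : 0 ≤ CC n β D * (η ^ 3 * s4 n) := by
    have := mnn (CC_nonneg (n := n) (D := D) hβ.le) (pow_nonneg h0.le 3)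
    linarith
  set E := CC n β D * (η ^ 3 * s4 n) with hEd
  have f0 := eP_nonneg h hD0 hβ.le r t q
  set f := eP β r p t q
  intro k
  induction k with
  | zero => exact fun _ => ⟨q, by simpa using hq, by simp [f], by simp⟩
  | succ k ih =>
    intro hk
    obtain ⟨q', m', a1, a2⟩ := ih (by omega)
    have ht' : t ≤ t + k * η ^ 2 := by linarith [(by positivity : 0 ≤ k * η ^ 2)]
    have et : t + (k + 1 : ℕ) * η ^ 2 = t + k * η ^ 2 + η ^ 2 := by push_cast; ring
    obtain ⟨b1, b2⟩ := one_step h hD m' h0 h1 hβ hr hr2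
    have b1 := b1 lI
    rw [← hEd] at b1 b2
    have hs : √t ≤ √(t + k * η ^ 2) := Real.sqrt_le_sqrt ht'
    have hs0 := Real.sqrt_pos.2 ht
    have hK' : 12 / √(t + k * η ^ 2) * (32 * β ^ 2 + 8 / √(t + k * η ^ 2)) ≤ K := le_trans (by gcongr) hK
    have f1 := eP_nonneg h hD0 hβ.le r (t + k * η ^ 2) q'
    have fG : eP β r p (t + k * η ^ 2) q' ≤ G := a1.trans (le_trans (by
      have : (k : ℝ) ≤ N := by exact_mod_cast (by omega : k ≤ N)
      gcongr) hG)
    refine ⟨nx p (t + k * η ^ 2) η q', et ▸ Mx.nx h m' η, ?_, ?_⟩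
    · rw [et]
      have e1 : 1 + η ^ 2 * K ≤ exp (η ^ 2 * K) := by linarith [aoe (η ^ 2 * K)]
      have e2 : exp ((k + 1 : ℕ) * (η ^ 2 * K)) = exp (η ^ 2 * K) * exp (k * (η ^ 2 * K)) := by rw [← eadd]; push_cast; ring_nf
      have e3 : 1 ≤ exp ((k + 1 : ℕ) * (η ^ 2 * K)) := Real.one_le_exp pY
      calc _ ≤ (1 + η ^ 2 * (12 / √(t + k * η ^ 2) * (32 * β ^ 2 + 8 / √(t + k * η ^ 2)))) * eP β r p (t + k * η ^ 2) q' + E := b1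
        _ ≤ exp (η ^ 2 * K) * (exp (k * (η ^ 2 * K)) * (f + k * E)) + E := by
            gcongr
            exact le_trans (by gcongr) e1
        _ ≤ exp ((k + 1 : ℕ) * (η ^ 2 * K)) * (f + k * E) + exp ((k + 1 : ℕ) * (η ^ 2 * K)) * E := by
            refine add_le_add (by rw [e2, mul_assoc]) (lmo hE e3)
        _ = _ := by push_cast; ring
    · rw [et]
      have : η ^ 2 * (2 * r ^ 2 * n + 4 / β ^ 2 * eP β r p (t + k * η ^ 2) q') ≤ η ^ 2 * (2 * r ^ 2 * n + 4 / β ^ 2 * G) := by gcongr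
      push_cast; linarith

lemma flow (h : SLC n 0 D p) (hD : 1 ≤ D) (ht : 0 < t) (hq : Mx p t q) {Δ : ℝ} (h0 : 0 < Δ) (h1 : Δ ≤ 1) {β r : ℝ} (hβ : 0 < β) (hr : 0 ≤ r) (hr2 : r ≤ 2)
    {K ε : ℝ} (hK : 12 / √t * (32 * β ^ 2 + 8 / √t) ≤ K) (hε : 0 < ε) :
    ∃ q', Mx p (t + Δ) q' ∧ eP β r p (t + Δ) q' ≤ exp (Δ * K) * (eP β r p t q + ε) ∧
      eT p t q - Δ * (2 * r ^ 2 * n + 4 / β ^ 2 * (exp (Δ * K) * (eP β r p t q + ε))) - ε ≤ eT p (t + Δ) q' := by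
  have hD0 : 0 ≤ D := by linarith
  have hC := CC_nonneg (n := n) (D := D) hβ.le
  set C := CC n β D * s4 n with hCd
  obtain ⟨N, hN⟩ := exists_nat_gt (max 1 ((C / ε) ^ 2))
  have hN1 : (1 : ℝ) < N := (le_max_left _ _).trans_lt hN
  have hN2 : (C / ε) ^ 2 < N := (le_max_right _ _).trans_lt hN
  set η := √(Δ / N) with hη
  have hN0 : (0 : ℝ) < N := by linarith
  have e2 : η ^ 2 = Δ / N := Real.sq_sqrt pY
  have η0 : 0 < η := Real.sqrt_pos.2 pY
  have e3 : N * η ^ 2 = Δ := by rw [e2]; field_simp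
  have η1 : η ≤ 1 := by
    rw [hη, Real.sqrt_le_left nN, one_pow, div_le_one hN0]; linarith
  have hE : N * (CC n β D * (η ^ 3 * s4 n)) ≤ ε := by
    have e : N * (CC n β D * (η ^ 3 * s4 n)) = Δ * (C * η) := by rw [← e3, hCd]; ring
    have k : C * η ≤ ε := by
      refine le_of_sq_le_sq ?_ hε.le
      rw [mul_pow, e2, mul_div_assoc', div_le_iff₀ hN0]
      rw [div_pow, div_lt_iff₀ pY] at hN2
      have := mor (sqn C) h1
      linarith
    rw [e]
    exact (mul_le_of_le_one_left pY h1).trans k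
  have e4 : N * (η ^ 2 * K) = Δ * K := by rw [← mul_assoc, e3]
  obtain ⟨q', m', a1, a2⟩ := iter h hD ht hq η0 η1 hβ hr hr2 hK N (G := exp (Δ * K) * (eP β r p t q + ε)) (by rw [e4]; gcongr) N le_rfl
  rw [e3] at m' a1 a2
  rw [e4] at a1
  refine ⟨q', m', a1.trans (by gcongr), le_trans ?_ a2⟩
  rw [mul_add (N : ℝ), ← mul_assoc (N : ℝ), e3]
  linarith
end

section
open ProbabilityTheory
variable {n : ℕ} {t D : ℝ} {p q : Measure (Euc n)}

lemma Ef_le_exp (y : ℝ) : Ef y ≤ exp y := by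
  unfold Ef; split_ifs with h
  · rfl
  · exact Real.quadratic_le_exp_of_nonneg lI

def St (p : Measure (Euc n)) (τ : ℝ) : Prop := ∃ q, Mx p (τ ^ 16) q ∧ eP (3 / τ ^ 5) (1.001 + 2 * τ) p (τ ^ 16) q ≤ n * exp (-(1 / τ ^ 4)) ∧ Tr p - n * τ ≤ eT p (τ ^ 16) q

lemma ph_cmp {τ : ℝ} (h0 : 0 < τ) (x : ℝ) : ph (3 / τ ^ 5) (1.001 + 2 * τ) x ≤ exp (-(3 / τ ^ 4)) + ph (3 / (τ / 2) ^ 5) (1.001 + 2 * (τ / 2)) x := by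
  have e : 3 / (τ / 2) ^ 5 = 32 * (3 / τ ^ 5) := by field_simp; norm_num
  rw [e]
  have hb : 0 < 3 / τ ^ 5 := by positivity
  unfold ph
  rcases le_total x (1.001 + τ) with hx | hx
  · refine (Ef_le_exp _).trans ((ele.2 ?_).trans (le_add_of_nonneg_right (Ef_pos _).le))
    calc _ ≤ 3 / τ ^ 5 * (-τ) := mll lI hb.le
      _ = _ := by field_simp
  · refine (Ef_mono ?_).trans (le_add_of_nonneg_left (epos _).le)
    have := mnn hb.le (sub_nonneg.2 hx)
    have := mnn hb.le h0.le
    linarith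

lemma St_step (hn : 1 ≤ n) (h : SLC n 0 D p) (hD : 1 ≤ D) {τ : ℝ} (h0 : 0 < τ) (h1 : τ ≤ 1 / 1000) (hS : St p (τ / 2)) : St p τ := by
  obtain ⟨q, hq, a1, a2⟩ := hS
  have hD0 : 0 ≤ D := by linarith
  have := hq.prob
  have hn0 : (0 : ℝ) < n := by exact_mod_cast hn
  have hb : 0 < 3 / τ ^ 5 := by positivity
  have hb' : 0 < 3 / (τ / 2) ^ 5 := by positivity
  set u := 1 / τ ^ 4 with hu
  have hu0 : 0 < u := by positivity
  have p3 : τ ^ 3 ≤ (1 / 1000) ^ 3 := by gcongr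
  have p4 : τ ^ 4 ≤ (1 / 1000) ^ 4 := by gcongr
  have u1 : 10 ^ 12 ≤ u := by rw [hu, le_div_iff₀ pY]; linarith
  have u2 : 1 / τ ^ 2 ≤ u / 10 ^ 6 := by
    rw [hu, div_div, div_le_div_iff₀ pY pY]
    have : τ ^ 2 ≤ (1 / 1000) ^ 2 := by gcongr
    have := mll this (sqn τ)
    linarith
  have e3 : 3 / τ ^ 4 = 3 * u := by rw [hu]; ring
  have e16 : 1 / (τ / 2) ^ 4 = 16 * u := by rw [hu]; field_simp; norm_num
  have f0 : eP (3 / τ ^ 5) (1.001 + 2 * τ) p ((τ / 2) ^ 16) q ≤ 2 * (n * exp (-(3 * u))) := by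
    have i1 := (PT_has (q := q) h hD0 hb.le (r := 1.001 + 2 * τ) pY ((τ / 2) ^ 16)).1
    have i2 := (PT_has (q := q) h hD0 hb'.le (r := 1.001 + 2 * (τ / 2)) pY ((τ / 2) ^ 16)).1
    have := i1.le ((HasI.con (n * exp (-(3 / τ ^ 4)))).add i2) (aoa _ fun θ => by
      unfold Ph
      refine (fsl fun i _ => ph_cmp h0 _).trans (le_of_eq ?_)
      rw [fad]; simp)
    rw [e3] at this
    rw [e16] at a1
    have : n * exp (-(16 * u)) ≤ n * exp (-(3 * u)) := by gcongr; norm_num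
    linarith
  have sq : √((τ / 2) ^ 16) = (τ / 2) ^ 8 := by
    rw [show (τ / 2) ^ 16 = ((τ / 2) ^ 8) ^ 2 by ring, Real.sqrt_sq pY]
  have p16 : (τ / 2) ^ 16 < τ ^ 16 := pow_lt_pow_left₀ lI pY nN
  have q16 : (0 : ℝ) < (τ / 2) ^ 16 := by positivity
  have o16 : τ ^ 16 ≤ τ ^ 4 := pow_le_pow_of_le_one h0.le lI nN
  set K := 12 / (τ / 2) ^ 8 * (32 * (3 / τ ^ 5) ^ 2 + 8 / (τ / 2) ^ 8) with hK
  have hK0 : 0 ≤ K := by positivity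
  obtain ⟨q', m', b1, b2⟩ := flow h hD pY hq (Δ := τ ^ 16 - (τ / 2) ^ 16) lI lI hb (r := 1.001 + 2 * τ) pY lI
    (by rw [sq]) (ε := n * exp (-(3 * u))) pY
  rw [add_sub_cancel] at m' b1 b2
  rw [← hK] at b1 b2
  have hKΔ : (τ ^ 16 - (τ / 2) ^ 16) * K ≤ u := by
    calc _ ≤ τ ^ 16 * K := mlr lI hK0
      _ = 884736 * (1 / τ ^ 2) + 6291456 := by rw [hK]; field_simp; ring
      _ ≤ _ := by linarith
  clear_value K u
  have F0 := eP_nonneg h hD0 hb.le (1.001 + 2 * τ) ((τ / 2) ^ 16) q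
  generalize eP (3 / τ ^ 5) (1.001 + 2 * τ) p ((τ / 2) ^ 16) q = F at f0 F0 b1 b2
  have G0 : 0 ≤ exp ((τ ^ 16 - (τ / 2) ^ 16) * K) * (F + n * exp (-(3 * u))) := by positivity
  have G : exp ((τ ^ 16 - (τ / 2) ^ 16) * K) * (F + n * exp (-(3 * u))) ≤ n * exp (-u) := by
    have g3 : 3 ≤ exp u := by linarith [aoe u]
    have g4 := mlr g3 (by positivity : 0 ≤ n * exp (-(3 * u)))
    calc _ ≤ exp u * (exp u * (n * exp (-(3 * u)))) := mlm (ele.2 hKΔ) lI pY (epos _).le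
      _ = n * (exp u * exp u * exp (-(3 * u))) := by ring
      _ = _ := by rw [← eadd, ← eadd]; ring_nf
  generalize exp ((τ ^ 16 - (τ / 2) ^ 16) * K) * (F + n * exp (-(3 * u))) = G₀ at *
  refine ⟨q', m', by rw [← hu]; exact b1.trans G, le_trans ?_ b2⟩
  have x1 : exp (-(3 * u)) ≤ τ ^ 4 := by
    rw [Real.exp_neg, inv_le_comm₀ (epos _) pY, ← one_div, ← hu]
    linarith [aoe (3 * u)]
  have x2 : 4 / (3 / τ ^ 5) ^ 2 * G₀ ≤ n := by
    have y1 : exp (-u) ≤ 1 := Real.exp_le_one_iff.2 lI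
    have y : 4 / (3 / τ ^ 5) ^ 2 ≤ 1 := by
      rw [div_pow, div_div_eq_mul_div, div_le_one pY]
      have : (τ ^ 5) ^ 2 ≤ 1 := pow_le_one₀ pY (pow_le_one₀ h0.le lI)
      linarith
    exact (mul_le_of_le_one_left G0 y).trans (G.trans (mor hn0.le y1))
  have x3 : (1.001 + 2 * τ) ^ 2 ≤ 2 ^ 2 := by gcongr; linarith
  have x4 : (τ ^ 16 - (τ / 2) ^ 16) * (2 * (1.001 + 2 * τ) ^ 2 * n + 4 / (3 / τ ^ 5) ^ 2 * G₀) ≤ τ ^ 4 * (2 * 2 ^ 2 * n + n) :=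
    mlm lI (add_le_add (by gcongr) x2) pY pY
  generalize (τ ^ 16 - (τ / 2) ^ 16) * (2 * (1.001 + 2 * τ) ^ 2 * n + 4 / (3 / τ ^ 5) ^ 2 * G₀) = V at *
  have x5 : n * exp (-(3 * u)) ≤ n * τ ^ 4 := by gcongr
  have x6 : n * τ ^ 4 ≤ n * (τ / 10 ^ 9) := by
    refine mll ?_ hn0.le
    calc τ ^ 4 = τ * τ ^ 3 := by ring
      _ ≤ τ * (1 / 1000) ^ 3 := by gcongr
      _ = _ := by ring
  have x7 := mul_pos hn0 h0
  clear * - a2 x4 x5 x6 x7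
  linarith

lemma exp_has : Integrable (fun g : Euc n => exp (1 + ‖g‖)) (Gam n) := by
  obtain ⟨C, hC, hi⟩ := IsGaussian.exists_integrable_exp_sq (Gam n)
  refine Integrable.mono' (hi.const_mul (exp (1 + 1 / C))) fP (aoa _ fun g => ?_)
  rw [rna, Real.abs_exp, ← eadd, ele]
  have : 0 ≤ (C * ‖g‖ - 1) ^ 2 / C + C * ‖g‖ ^ 2 + 1 / C:= by positivity
  have e : (C * ‖g‖ - 1) ^ 2 / C = C * ‖g‖ ^ 2 - 2 * ‖g‖ + 1 / C := by field_simp; ring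
  linarith [(by positivity : 0 ≤ C * ‖g‖ ^ 2), (by positivity : 0 ≤ 1 / C)]

lemma St_base (hn : 1 ≤ n) (h : SLC n 0 D p) (hD : 1 ≤ D) (hl : ∀ i, (cD p).2.2 i ≤ 1.001) : ∃ τ₁ > 0, ∀ τ, 0 < τ → τ ≤ τ₁ → St p τ := by
  have hD0 : 0 ≤ D := by linarith
  have := h.prob
  have hn0 : (0 : ℝ) < n := by exact_mod_cast hn
  have hn1 : (1 : ℝ) ≤ n := by exact_mod_cast hn
  set Mn := ∫ g, exp (1 + ‖g‖) ∂Gam n with hMn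
  have hM0 : 0 ≤ Mn := inn fun g => (epos _).le
  have hP0 := (Ph_bd h hD0 (β := 1) (r := 1) zero_le_one).1
  have hC0 := CC_nonneg (n := n) (D := D) zero_le_one
  set C := 2 * n + 4 * Ph 1 1 p + CC n 1 D * s4 n + Mn + 960 * D ^ 4 + 1 with hC
  have hC1 : 1 ≤ C := by have : 0 ≤ 960 * D ^ 4 := by positivity
                         linarith
  refine ⟨1 / C, by positivity, fun τ h0 h1 => ?_⟩
  have hτC : τ * C ≤ 1 := by rwa [le_div_iff₀ pY] at h1
  have hτ1 : τ ≤ 1 := h1.trans ((div_le_one pY).2 hC1)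
  have e0 : pt p 0 0 = p := by
    have : en 0 (0 : Euc n) = 0 := by ext; simp [en]
    rw [pt, this, tilted_zero]
  have m1 := Mx.nx h (Mx.zero h) (τ ^ 8)
  have e8 : (τ ^ 8) ^ 2 = τ ^ 16 := by ring
  have sm : ∀ k : ℕ, 2 ≤ k → ∀ x, 0 ≤ x → x ≤ C → τ ^ k * x ≤ τ := fun k hk x x0 hx => by
    calc τ ^ k * x ≤ τ ^ 2 * C := mlm (pow_le_pow_of_le_one h0.le hτ1 hk) hx x0 pY
      _ = τ * (τ * C) := by ring
      _ ≤ _ := mor h0.le hτC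
  have hη1 : τ ^ 8 ≤ 1 := pow_le_one₀ h0.le hτ1
  have s1 := (one_step h hD (Mx.zero h) (η := τ ^ 8) pY hη1 zero_lt_one (r := 1) nN nN).2
  rw [zero_add, e8] at m1 s1
  refine ⟨_, m1, ?_, le_trans ?_ s1⟩
  · set β := 3 / τ ^ 5 with hβ
    set r := 1.001 + 2 * τ with hr
    have hb : 0 ≤ β := by positivity
    obtain ⟨c1, -⟩ := Ph_con h hD0 hb (r := r) pY (τ ^ 16)
    have bd := fun θ => Ph_bd (pt_slc h (τ ^ 16) θ) hD0 (r := r) hb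
    have j := nx_has h (Mx.zero h) (τ ^ 8) c1 (fun θ => (bd θ).1) fun θ => (bd θ).2.1
    have i1 := bd_has (π := p.prod (Gam n)) c1 (fun θ => (bd θ).1) (fun θ => (bd θ).2.1) (τ ^ 8) 0
    have je := j.e
    rw [integral_dirac, e0] at je
    rw [eP, ← je]
    have hI : HasI (p.prod (Gam n)) (fun w => n * exp (-(6 / τ ^ 4)) * exp (1 + ‖w.2‖)) (n * exp (-(6 / τ ^ 4)) * Mn) := (HasI.snd ⟨exp_has, rfl⟩).mul _
    have hae : ∀ᵐ w ∂(p.prod (Gam n)), ‖w.1‖ ≤ D := Measure.quasiMeasurePreserving_fst.ae h.ball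
    refine (i1.le hI (hae.mono fun w hw => ?_)).trans ?_
    · rw [zero_add]
      have := (lip1 h hD0 hb (r := r) pY (en (τ ^ 16) (zt (τ ^ 8) w.1 w.2)) (en_cont _ _) (h.tilt _ _) (L := 2 * D ^ 2 * (τ ^ 8 * (1 + ‖w.2‖))) pY fun x hx => ?_).2.2 _ hl
      · refine this.trans ?_
        rw [mul_assoc (n : ℝ), ← eadd]
        refine mll ((Ef_le_exp _).trans (ele.2 ?_)) hn0.le
        have e : β * (1.001 + 160 * D ^ 2 * (2 * D ^ 2 * (τ ^ 8 * (1 + ‖w.2‖))) - r) = -(6 / τ ^ 4) + τ ^ 3 * (960 * D ^ 4) * (1 + ‖w.2‖) := by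
          rw [hβ, hr]; field_simp; ring
        rw [e]
        have := (sm 3 nN (960 * D ^ 4) pY lI).trans hτ1
        have := mlr this (by positivity : 0 ≤ 1 + ‖w.2‖)
        linarith
      · have := en_bd hD (η := τ ^ 8) pY hη1 (g := w.2) hw hx
        rw [e8, mul_assoc] at this; rwa [zt, e8]
    · have : Mn ≤ exp (5 / τ ^ 4) := by
        have := aoe (5 / τ ^ 4)
        have : Mn ≤ 5 / τ ^ 4 := by
          rw [le_div_iff₀ pY, mul_comm]
          linarith [sm 4 nN Mn hM0 (by linarith [(by positivity : 0 ≤ 960 * D ^ 4)])]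
        linarith
      calc _ ≤ n * exp (-(6 / τ ^ 4)) * exp (5 / τ ^ 4) := by gcongr
        _ = _ := by rw [mul_assoc, ← eadd]; ring_nf
  · have e1 : eT p 0 (Measure.dirac 0) = Tr p := by rw [eT, integral_dirac, e0]
    have e2 : eP 1 1 p 0 (Measure.dirac 0) = Ph 1 1 p := by rw [eP, integral_dirac, e0]
    rw [e1, e2]
    have y1 : CC n 1 D * ((τ ^ 8) ^ 3 * s4 n) ≤ τ ^ 16 * (CC n 1 D * s4 n) := by
      have := mlr (pow_le_pow_of_le_one h0.le hτ1 (by norm_num : 16 ≤ 24)) hC0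
      linarith
    have y2 := sm 16 nN (2 * n + 4 * Ph 1 1 p + CC n 1 D * s4 n) pY (by
      have : 0 ≤ 960 * D ^ 4 := by positivity
      linarith)
    have y3 : τ ≤ n * τ := lmo h0.le hn1
    linarith

theorem loc (hn : 1 ≤ n) (h : SLC n 0 D p) (hD : 1 ≤ D) (hl : ∀ i, (cD p).2.2 i ≤ 1.001) : St p (1 / 1000) := by
  obtain ⟨τ₁, h1, hS⟩ := St_base hn h hD hl
  obtain ⟨k, hk⟩ := exists_pow_lt_of_lt_one h1 (by norm_num : hlf < 1)
  have key : ∀ j : ℕ, St p (1 / 1000 * (1 / 2) ^ j) → St p (1 / 1000) := fun j => by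
    induction j with
    | zero => simp
    | succ j ih => exact fun hj => ih (St_step hn h hD pY (by
        have : hlf ^ j ≤ 1 := pow_le_one₀ nN nN
        linarith) (by rwa [pow_succ, ← mul_assoc, mul_one_div] at hj))
  exact key k (hS _ pY (by linarith [(by positivity : 0 ≤ hlf ^ k)]))
end

section
open ProbabilityTheory
variable {n : ℕ} {t D : ℝ} {p q : Measure (Euc n)}

def sl (b : ONB n) (S : Finset (Fin n)) (a : Euc n) : Set (Euc n) := {x | ∑ i ∈ S, ⟪b i, x - a⟫ ^ 2 ≤ n / 16}
lemma sl_cl (b : ONB n) (S : Finset (Fin n)) (a : Euc n) : IsClosed (sl b S a) := isClosed_le fP continuous_const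

lemma sball (h : SLC n t D p) (ht : 0 ≤ t) (b : ONB n) (S : Finset (Fin n)) (a : Euc n)
    (hV : 0.3 * n ≤ ∫ x, ∑ i ∈ S, ⟪b i, x - a⟫ ^ 2 ∂p) : p (sl b S a) ≤ oR (exp (-(t * n / 50))) := by
  rcases (sl b S a).eq_empty_or_nonempty with he | hne
  · simp [he]
  have hp := h.prob
  obtain ⟨g, hm, hg, -, rfl⟩ := h.dens
  have T := tau_property n g hm hg t ht _ (sl_cl b S a).measurableSet hp
  set p := dens n fun x => g x * exp (-t * ‖x‖ ^ 2 / 2)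
  set Q : Euc n → ℝ := fun x => t / 4 * (1 / 2 * ∑ i ∈ S, ⟪b i, x - a⟫ ^ 2 - n / 16) with hQ
  have hd : ∀ x, Q x ≤ t / 4 * Metric.infDist x (sl b S a) ^ 2 := fun x => by
    refine mll ?_ pY
    set m := 1 / 2 * ∑ i ∈ S, ⟪b i, x - a⟫ ^ 2 - n / 16 with hm
    rcases le_total m 0 with h0 | h0
    · exact h0.trans (sqn _)
    have : √m ≤ Metric.infDist x (sl b S a) := (Metric.le_infDist hne).2 fun y hy => by
      rw [Real.sqrt_le_left dist_nonneg, dist_eq_norm, ← onb_sq b]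
      have hy : ∑ i ∈ S, ⟪b i, y - a⟫ ^ 2 ≤ n / 16 := hy
      calc m ≤ ∑ i ∈ S, (1 / 2 * ⟪b i, x - a⟫ ^ 2 - ⟪b i, y - a⟫ ^ 2) := by rw [fsd, ← fms]; linarith
        _ ≤ ∑ i ∈ S, ⟪b i, x - y⟫ ^ 2 := fsl fun i _ => by
            have e : ⟪b i, x - y⟫ = ⟪b i, x - a⟫ - ⟪b i, y - a⟫ := by rw [← isr, sub_sub_sub_cancel_right]
            rw [e]; linarith [sqn (⟪b i, x - a⟫ - 2 * ⟪b i, y - a⟫)]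
        _ ≤ _ := fss (Finset.subset_univ _) fun _ _ _ => sqn _
    rw [← Real.sq_sqrt h0]
    exact ppl (Real.sqrt_nonneg _) this 2
  have iQ : Integrable Q p := h.int fP
  have ie : Integrable (fun x => exp (Q x)) p := h.int fP
  have is : Integrable (fun x => ∑ i ∈ S, ⟪b i, x - a⟫ ^ 2) p := h.int fP
  have mQ : t * n / 50 ≤ ∫ x, Q x ∂p := by
    rw [hQ, icm, isb (is.const_mul _) (ict _), icm]
    simp only [integral_const, probReal_univ, sem, one_mul]
    have := mll hV ht
    have := mnn ht (Nat.cast_nonneg (α := ℝ) n)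
    linarith
  set c := ∫ x, Q x ∂p
  have J : exp c ≤ ∫ x, exp (Q x) ∂p := by
    have : ∫ x, exp c * (1 + (Q x - c)) ∂p ≤ ∫ x, exp (Q x) ∂p := imn (((ict _).add (iQ.sub (ict _))).const_mul _) ie fun x => by
      have := mll (aoe (Q x - c)) (epos c).le
      rw [← eadd, add_sub_cancel] at this
      show exp c * (1 + (Q x - c)) ≤ exp (Q x)
      linarith
    rw [icm, iad (f := fun _ => (1 : ℝ)) (g := fun x => Q x - c) (ict _) (iQ.sub (ict _)), isb iQ (ict _)] at this
    simpa [c] using this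
  have hl : oR (exp (t * n / 50)) ≤ ∫⁻ x, oR (exp (t / 4 * Metric.infDist x (sl b S a) ^ 2)) ∂p := by
    calc _ ≤ oR (∫ x, exp (Q x) ∂p) := oRl ((ele.2 mQ).trans J)
      _ = ∫⁻ x, oR (exp (Q x)) ∂p := oie ie (aoa _ fun x => (epos _).le)
      _ ≤ _ := lmn fun x => oRl (ele.2 (hd x))
  have := (mul_le_mul_right hl (p (sl b S a))).trans T
  rw [Real.exp_neg, ENNReal.ofReal_inv_of_pos (epos _)]
  rwa [← ENNReal.le_inv_iff_mul_le] at this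

lemma le_ph {β r : ℝ} (hβ : 1 ≤ β) (x : ℝ) : x ≤ r + ph β r x := by
  rcases le_total x r with h | h
  · exact h.trans (le_add_of_nonneg_right (Ef_pos _).le)
  · have h1 := mlr hβ (sub_nonneg.2 h)
    have h2 : β * (x - r) ≤ ph β r x := by
      unfold ph Ef; split_ifs with c
      · linarith [epos (β * (x - r))]
      · linarith [sqn (β * (x - r))]
    linarith

lemma prj_mono (v : ONB n) {l m : Fin n → ℝ} (h : ∀ i, l i ≤ m i) (x : Euc n) : ⟪x, prj v l x⟫ ≤ ⟪x, prj v m x⟫ := by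
  rw [← onb_in v, ← onb_in v x]
  refine fsl fun j _ => ?_
  rw [prj_in, prj_in]
  have := mlr (h j) (sqn ⟪v j, x⟫)
  linarith

lemma good_tr {β : ℝ} (hβ : 1 ≤ β) (v b : ONB n) (l : Fin n → ℝ) (S : Finset (Fin n)) (hS : n ≤ 2 * S.card)
    (hY : 0.803 * n ≤ ∑ i, l i - ∑ i, ph β 1.003 (l i)) : 0.3 * n ≤ ∑ i ∈ S, ⟪b i, prj v l (b i)⟫ := by
  have e : ∀ i, ⟪b i, prj v (fun k => 1.003 + (fun k => ph β 1.003 (l k)) k) (b i)⟫ = 1.003 + ⟪b i, prj v (fun k => ph β 1.003 (l k)) (b i)⟫ := fun i => by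
    generalize (fun k => ph β 1.003 (l k)) = m
    have : ∑ j, 1.003 * (⟪v j, b i⟫ * ⟪v j, b i⟫) = (1.003 : ℝ) := by
      rw [← fms, onb_in, rin, b.norm_eq_one]; norm_num
    refine Eq.trans ?_ (congrArg (· + _) this)
    beta_reduce
    rw [← onb_in v, ← onb_in v (b i) (prj v m (b i)), ← fad]
    exact fsc rfl fun j _ => by rw [prj_in, prj_in]; ring
  have z : ∀ i, 0 ≤ ⟪b i, prj v (fun k => ph β 1.003 (l k)) (b i)⟫ := fun i => by
    have := prj_mono v (l := fun _ => 0) (m := fun k => ph β 1.003 (l k)) (fun k => (Ef_pos _).le) (b i)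
    rwa [← onb_in v (b i) (prj v (fun _ => 0) (b i)), Finset.sum_eq_zero fun j _ => by rw [prj_in]; ring] at this
  have k1 : ∑ i ∈ Sᶜ, ⟪b i, prj v l (b i)⟫ ≤ 1.003 * (n - S.card) + ∑ i, ph β 1.003 (l i) := by
    calc _ ≤ ∑ i ∈ Sᶜ, (1.003 + ⟪b i, prj v (fun k => ph β 1.003 (l k)) (b i)⟫) := fsl fun i _ => by
          rw [← e]; exact prj_mono v (fun k => le_ph hβ _) _
      _ = 1.003 * (n - S.card) + ∑ i ∈ Sᶜ, ⟪b i, prj v (fun k => ph β 1.003 (l k)) (b i)⟫ := by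
          rw [fad, Finset.sum_const, nem, Finset.card_compl, fcf, Nat.cast_sub (by simpa using S.card_le_univ)]; ring
      _ ≤ _ := by
          rw [← tr_prj v b]
          exact add_le_add le_rfl (fss (Finset.subset_univ _) fun i _ _ => z i)
  have k2 := Finset.sum_add_sum_compl S fun i => ⟪b i, prj v l (b i)⟫
  rw [tr_prj] at k2
  have : (n : ℝ) ≤ 2 * S.card := by exact_mod_cast hS
  linarith

abbrev t₀ : ℝ := (1 / 1000) ^ 16

theorem kp0 (hn : 1 ≤ n) (h : SLC n 0 D p) (hD : 1 ≤ D) (hl : ∀ i, (cD p).2.2 i ≤ 1.001) (hT : 0.999 * n ≤ Tr p) :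
    ∃ Y : Set (Euc n), MeasurableSet Y ∧ p Yᶜ ≤ oR 0.06 ∧ ∀ b S a, n ≤ 2 * S.card → p (Y ∩ sl b S a) ≤ 2 * oR (exp (-(t₀ * n / 50))) := by
  obtain ⟨q, hq, a1, a2⟩ := loc hn h hD hl
  have hD0 : 0 ≤ D := by linarith
  have := h.prob
  have := hq.prob
  have hn0 : (0 : ℝ) < n := by exact_mod_cast hn
  obtain ⟨β, hβ⟩ : ∃ β : ℝ, β = 3 / (1 / 1000) ^ 5 := ⟨_, rfl⟩
  have hβ1 : 1 ≤ β := by rw [hβ]; norm_num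
  rw [← hβ, show (1.001 + 2 * (1 / 1000) : ℝ) = 1.003 by norm_num] at a1
  have a1 : eP β 1.003 p t₀ q ≤ 0.001 * n := a1.trans (by
    rw [mul_comm]
    refine mlr ?_ hn0.le
    have := aoe (1 / (1 / 1000 : ℝ) ^ 4)
    rw [Real.exp_neg, inv_le_comm₀ (epos _) nN]
    refine le_trans ?_ this
    norm_num)
  set Y : Euc n → ℝ := fun θ => Tr (pt p t₀ θ) - Ph β 1.003 (pt p t₀ θ) with hY
  obtain ⟨c1, c2⟩ := Ph_con h hD0 (by linarith : 0 ≤ β) (by norm_num : (0 : ℝ) ≤ 1.003) t₀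
  obtain ⟨i1, i2⟩ := PT_has (q := q) h hD0 (by linarith : 0 ≤ β) (by norm_num : (0 : ℝ) ≤ 1.003) t₀
  set G : Set (Euc n) := {θ | 0.803 * n ≤ Y θ} with hG
  have mG : MeasurableSet G := (isClosed_le continuous_const (c2.sub c1)).measurableSet
  have qG : q Gᶜ ≤ oR 0.03 := by
    have i3 := (HasI.con (π := q) (1.003 * n)).sub (i2.sub i1)
    have M := mmg (aoa q fun θ => ?_) i3.i (0.2 * n)
    · rw [i3.e] at M
      have k : 0.2 * n * q.real Gᶜ ≤ 0.2 * n * 0.03 := by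
        have : q.real Gᶜ ≤ q.real {x | 0.2 * n ≤ 1.003 * n - (Tr (pt p t₀ x) - Ph β 1.003 (pt p t₀ x))} := measureReal_mono fun θ (hθ : ¬ 0.803 * n ≤ Y θ) => by
          show 0.2 * n ≤ 1.003 * n - Y θ
          linarith
        have := mll this (by positivity : 0 ≤ 0.2 * (n : ℝ))
        linarith
      rw [← ofReal_measureReal]
      exact oRl (lml k pY)
    · show 0 ≤ 1.003 * n - (∑ i, (cD (pt p t₀ θ)).2.2 i - ∑ i, ph β 1.003 ((cD (pt p t₀ θ)).2.2 i))
      have : ∑ i, (cD (pt p t₀ θ)).2.2 i ≤ ∑ i, (1.003 + ph β 1.003 ((cD (pt p t₀ θ)).2.2 i)) := fsl fun i _ => le_ph hβ1 _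
      rw [fad, Finset.sum_const, fcu, fcf, nem] at this
      linarith
  have mr := (ro_m (p := p) t₀ (measurable_snd (α := Euc n) (β := Euc n)) measurable_fst).ennreal_ofReal
  have mr' := (ro_m (p := p) t₀ (measurable_fst (α := Euc n) (β := Euc n)) measurable_snd).ennreal_ofReal
  set w : Set (Euc n) → Euc n → ℝ≥0∞ := fun A x => ∫⁻ θ in A, oR (ro p t₀ θ x) ∂q
  have mw : ∀ A, Measurable (w A) := fun A => mr.lintegral_prod_right' (ν := q.restrict A)
  have sw : ∀ A B, MeasurableSet B → ∫⁻ x in B, w A x ∂p = ∫⁻ θ in A, pt p t₀ θ B ∂q := fun A B hB => by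
    rw [lls mr.aemeasurable]
    refine lcg fun θ => ?_
    rw [pt, tilted_apply' _ _ hB]; rfl
  have pr := fun θ => (pt_slc h t₀ θ).prob
  refine ⟨{x | w Gᶜ x ≤ 1 / 2}, mbl (mw _) mct, ?_, fun b S a hS => ?_⟩
  · have h1 := mul_meas_ge_le_lintegral (μ := p) (mw Gᶜ) (1 / 2)
    have h2 := sw Gᶜ univ .univ
    simp only [Measure.restrict_univ, measure_univ, lintegral_one, Measure.restrict_apply_univ] at h2
    rw [h2] at h1
    calc _ ≤ p {x | 1 / 2 ≤ w Gᶜ x} := msm fun x (hx : ¬ w Gᶜ x ≤ 1 / 2) => (not_le.1 hx).le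
      _ = 2 * (1 / 2 * p {x | 1 / 2 ≤ w Gᶜ x}) := by rw [← mul_assoc, one_div, ENNReal.mul_inv_cancel (by simp) (by simp), one_mul]
      _ ≤ 2 * oR 0.03 := mul_le_mul_right (h1.trans qG) 2
      _ = _ := by rw [← ENNReal.ofReal_ofNat, ← oRm nN]; congr 1; norm_num
  · set B := {x | w Gᶜ x ≤ 1 / 2} ∩ sl b S a
    have mB : MeasurableSet B := (mbl (mw _) mct).inter (sl_cl b S a).measurableSet
    have h1 : ∀ x ∈ B, 1 ≤ 2 * w G x := fun x hx => by
      have hx : w Gᶜ x ≤ 1 / 2 := hx.1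
      have s : w G x + w Gᶜ x = 1 := (lintegral_add_compl _ mG).trans (hq.one x)
      have : (1 : ℝ≥0∞) / 2 ≤ w G x := by
        rw [← ENNReal.add_halves 1] at s
        by_contra hc
        exact absurd s (ENNReal.add_lt_add_of_lt_of_le (hx.trans_lt (by simp)).ne (not_le.1 hc) hx).ne
      calc (1 : ℝ≥0∞) = 2 * (1 / 2) := by rw [one_div, ENNReal.mul_inv_cancel (by simp) (by simp)]
        _ ≤ _ := mul_le_mul_right this 2
    calc p B = ∫⁻ x in B, 1 ∂p := by simp
      _ ≤ ∫⁻ x in B, 2 * w G x ∂p := setLIntegral_mono ((mw G).const_mul 2) h1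
      _ = 2 * ∫⁻ θ in G, pt p t₀ θ B ∂q := by rw [lcm' _ (mw G), sw _ _ mB]
      _ ≤ 2 * ∫⁻ θ in G, oR (exp (-(t₀ * n / 50))) ∂q := by
          gcongr 2 * ?_
          refine setLIntegral_mono mct fun θ hθ => (msm inter_subset_right).trans (sball (pt_slc h t₀ θ) pY b S a ?_)
          have hc := cD_spec (pt_slc h t₀ θ)
          refine (good_tr hβ1 (cD (pt p t₀ θ)).2.1 b _ S hS hθ).trans ?_
          rw [ifs _ fun i _ => (pt_slc h t₀ θ).int fP]
          refine fsl fun i _ => ?_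
          rw [hc.bil' (pt_slc h t₀ θ) a]
          simp only [← sq]
          exact sub_le_self _ (sqn _)
      _ ≤ _ := by
          rw [setLIntegral_const]
          gcongr 2 * ?_
          exact mor (by simp) prob_le_one
end

section
open ProbabilityTheory
variable {n : ℕ} {μ : Measure (Euc n)}

lemma Iso.nsq (h : Iso n μ) : Integrable (fun x => ‖x‖ ^ 2) μ ∧ ∫ x, ‖x‖ ^ 2 ∂μ = n := by
  let b := EuclideanSpace.basisFun (Fin n) ℝ
  have e : ∀ x : Euc n, ‖x‖ ^ 2 = ∑ i, ⟪x, b i⟫ ^ 2 := fun x => by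
    rw [← onb_sq b]; exact fsc rfl fun i _ => by rw [ric]
  simp only [e]
  refine ⟨igf _ fun i _ => h.int _, ?_⟩
  rw [ifs _ fun i _ => h.int _]
  simp only [h.sq, b.norm_eq_one]
  simp

theorem kp (hn : 1 ≤ n) (h : Iso n μ) :
    ∃ Y : Set (Euc n), MeasurableSet Y ∧ μ Yᶜ ≤ oR 0.1 ∧ ∀ b S a, n ≤ 2 * S.card → μ (Y ∩ sl b S a) ≤ 2 * oR (exp (-(t₀ * n / 50))) := by
  obtain ⟨iN, eN⟩ := h.nsq
  have := h.prob
  have hn0 : (1 : ℝ) ≤ n := by exact_mod_cast hn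
  obtain ⟨D, hD, hT⟩ : ∃ D : ℝ, 1 ≤ D ∧ ∫ x in {x | D < ‖x‖}, ‖x‖ ^ 2 ∂μ ≤ 0.0001 := by
    have T := tendsto_setIntegral_of_antitone (μ := μ) (s := fun k : ℕ => {x : Euc n | (k : ℝ) + 1 < ‖x‖}) (f := fun x => ‖x‖ ^ 2)
      (fun k => measurableSet_lt mct measurable_norm) (fun i j hij x (hx : (j : ℝ) + 1 < ‖x‖) => by
        have : (i : ℝ) ≤ j := by exact_mod_cast hij
        show (i : ℝ) + 1 < ‖x‖
        linarith) ⟨0, iN.integrableOn⟩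
    have e : ⋂ k : ℕ, {x : Euc n | (k : ℝ) + 1 < ‖x‖} = ∅ := by
      refine eq_empty_of_forall_notMem fun x hx => ?_
      obtain ⟨k, hk⟩ := exists_nat_ge ‖x‖
      have : (k : ℝ) + 1 < ‖x‖ := mem_iInter.1 hx k
      linarith
    rw [e, setIntegral_empty] at T
    obtain ⟨k, hk⟩ := (T.eventually_le_const (by norm_num : (0 : ℝ) < 0.0001)).exists
    exact ⟨k + 1, by simp, hk⟩
  set B : Set (Euc n) := {x | ‖x‖ ≤ D} with hB
  have mB : MeasurableSet B := mbl measurable_norm mct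
  have eB : {x | D < ‖x‖} = Bᶜ := by ext x; exact (not_le (a := ‖x‖) (b := D)).symm
  rw [eB] at hT
  have cB : μ.real Bᶜ ≤ 0.0001 := by
    refine le_trans ?_ hT
    have : ∫ x in Bᶜ, (1 : ℝ) ∂μ ≤ ∫ x in Bᶜ, ‖x‖ ^ 2 ∂μ := setIntegral_mono_on (by simp) iN.integrableOn mB.compl fun x hx => by
      have : D < ‖x‖ := not_le.1 hx
      exact one_le_pow₀ lI
    simpa using this
  set c := μ.real B with hc
  have c1 : 0.9999 ≤ c := by
    have := probReal_add_probReal_compl (μ := μ) mB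
    linarith
  have c2 : c ≤ 1 := measureReal_le_one
  have c0 : 0 < c := by linarith
  set p := oR c⁻¹ • μ.restrict B with hp
  have ip : ∀ f : Euc n → ℝ, ∫ x, f x ∂p = c⁻¹ * ∫ x in B, f x ∂μ := fun f => by
    rw [hp, integral_smul_measure, eto pY, sem]
  have hS : SLC n 0 D p := by
    obtain ⟨g, gm, gl, ge⟩ := h.dens
    refine ⟨⟨fun x => c⁻¹ * B.indicator g x, (gm.indicator mB).const_mul _, ⟨fun x => mnn pY (indicator_nonneg (fun x _ => gl.1 x) x), fun x y => ?_⟩, fun x hx => ?_, ?_⟩, ⟨?_⟩⟩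
    · have : B.indicator g x * B.indicator g y ≤ B.indicator g (hlf • (x + y)) ^ 2 := by
        by_cases hx : x ∈ B
        · by_cases hy : y ∈ B
          · have hxy : hlf • (x + y) ∈ B := by
              show ‖_‖ ≤ D
              rw [norm_smul, Real.norm_of_nonneg nN]
              have hx : ‖x‖ ≤ D := hx
              have hy : ‖y‖ ≤ D := hy
              linarith [norm_add_le x y]
            rw [iom hx, iom hy, iom hxy]; exact gl.2 x y
          · rw [indicator_of_notMem hy, mul_zero]; positivity
        · rw [indicator_of_notMem hx, zero_mul]; positivity
      have := mll this (by positivity : 0 ≤ c⁻¹ ^ 2)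
      rw [mul_pow]; linarith
    · have : x ∉ B := fun hx' : ‖x‖ ≤ D => absurd hx (not_lt.2 hx')
      beta_reduce; rw [indicator_of_notMem this, mul_zero]
    · rw [hp, ge, dens, dens, restrict_withDensity mB, ← withDensity_indicator mB, ← withDensity_smul _ (gm.ennreal_ofReal.indicator mB)]
      congr 1; funext x
      rw [Pi.smul_apply, sem, neg_zero, zero_mul, zero_div, Real.exp_zero, mul_one, oRm pY]
      congr 1
      by_cases hx : x ∈ B
      · rw [iom hx, iom hx]
      · rw [indicator_of_notMem hx, indicator_of_notMem hx, ENNReal.ofReal_zero]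
    · rw [hp, Measure.smul_apply, Measure.restrict_apply_univ, ← ofReal_measureReal, sem, ← oRm pY, ← hc, inv_mul_cancel₀ c0.ne', oro]
  have pp := hS.prob
  have hC := cD_spec hS
  set a := (cD p).1
  set v := (cD p).2.1
  set l := (cD p).2.2
  have hl : ∀ i, l i = c⁻¹ * ∫ x in B, ⟪v i, x - a⟫ ^ 2 ∂μ := fun i => by
    have := hC.cov i i
    simp only [if_true, ← sq] at this
    rw [← this, ip]
  have ci : c⁻¹ ≤ 1.001 := by rw [inv_le_comm₀ c0 nN]; refine le_trans ?_ c1; norm_num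
  have k1 : ∀ i, l i ≤ 1.001 := fun i => by
    have e : ∫ x, ⟪v i, x⟫ ^ 2 ∂p = l i + ⟪v i, a⟫ ^ 2 := by
      have := hC.cov i i
      simp only [if_true, ← sq] at this
      have e2 : ∀ x, ⟪v i, x⟫ ^ 2 = ⟪v i, x - a⟫ ^ 2 + (2 * ⟪v i, a⟫ * ⟪v i, x - a⟫ + ⟪v i, a⟫ ^ 2) := fun x => by
        rw [isr]; ring
      rw [ica (aoa _ e2), iad (hS.int fP) (hS.int fP), iad (hS.int fP) (ict _), icm, hC.mean, this]
      simp
    rw [ip] at e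
    have := mlm ci (setIntegral_le_integral (s := B) (h.int (v i)) (aoa _ fun x => sqn ⟪x, v i⟫)) (inn fun x => sqn _) nN
    rw [h.sq, v.norm_eq_one] at this
    simp only [ric] at this e
    linarith [sqn ⟪v i, a⟫, sqn ⟪a, v i⟫]
  have iv : ∀ w, Integrable (fun x => ⟪x, w⟫) μ := fun w => (h.memLp w).integrable nN
  have k2 : 0.999 * n ≤ Tr p := by
    have i2 : Integrable (fun x => ‖x - a‖ ^ 2) μ := by
      simp only [norm_sub_sq_real]
      exact (iN.sub ((iv a).const_mul 2)).add (ict _)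
    have e1 : Tr p = c⁻¹ * ∫ x in B, ‖x - a‖ ^ 2 ∂μ := by
      rw [← ip, ica (aoa _ fun x => (onb_sq v (x - a)).symm), ifs _ fun i _ => hS.int fP]
      exact fsc rfl fun i _ => by rw [ip]; exact hl i
    have e2 : ∫ x, ‖x - a‖ ^ 2 ∂μ = n + ‖a‖ ^ 2 := by
      simp only [norm_sub_sq_real]
      rw [iad (f := fun x => ‖x‖ ^ 2 - 2 * ⟪x, a⟫) (iN.sub ((iv a).const_mul 2)) (ict _), isb iN ((iv a).const_mul 2), icm, h.mean, eN]
      simp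
    have e3 := integral_add_compl mB i2
    have e4 : ∫ x in Bᶜ, ‖x - a‖ ^ 2 ∂μ ≤ 2 * 0.0001 + ‖a‖ ^ 2 * 0.0002 := by
      calc _ ≤ ∫ x in Bᶜ, (2 * ‖x‖ ^ 2 + 2 * ‖a‖ ^ 2) ∂μ := setIntegral_mono i2.integrableOn ((iN.const_mul 2).add (ict _)).integrableOn fun x => by
            have := parallelogram_law_with_norm ℝ x a
            have := mul_self_nonneg ‖x + a‖
            show ‖x - a‖ ^ 2 ≤ 2 * ‖x‖ ^ 2 + 2 * ‖a‖ ^ 2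
            linarith
        _ = 2 * (∫ x in Bᶜ, ‖x‖ ^ 2 ∂μ) + 2 * ‖a‖ ^ 2 * μ.real Bᶜ := by
            rw [iad (iN.const_mul 2).integrableOn (ict _), icm]
            simp [mul_comm]
        _ ≤ _ := by
            have := mll cB (sqn ‖a‖)
            linarith
    have e5 : 0 ≤ ∫ x in B, ‖x - a‖ ^ 2 ∂μ := inn fun x => sqn _
    have e6 := mlr ((one_le_inv₀ c0).2 c2) e5
    rw [e1]
    linarith [sqn ‖a‖]
  obtain ⟨Y, mY, y1, y2⟩ := kp0 hn hS hD k1 k2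
  have cp : ∀ A, MeasurableSet A → μ (A ∩ B) ≤ p A := fun A mA => by
    rw [hp, Measure.smul_apply, Measure.restrict_apply mA, sem]
    refine le_mul_of_one_le_left' ?_
    rw [← oro]
    exact oRl ((one_le_inv₀ c0).2 c2)
  refine ⟨Y ∩ B, mY.inter mB, ?_, fun b S a hS => ?_⟩
  · calc μ (Y ∩ B)ᶜ ≤ μ (Yᶜ ∩ B ∪ Bᶜ) := msm fun x hx => by
          by_cases hb : x ∈ B
          · exact .inl ⟨fun hy => hx ⟨hy, hb⟩, hb⟩
          · exact .inr hb
      _ ≤ oR 0.06 + oR 0.0001 := (mul' _ _).trans (add_le_add ((cp _ mY.compl).trans y1) (by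
          rw [← ofReal_measureReal]; exact oRl cB))
      _ ≤ _ := by rw [← ora nN nN]; exact oRl nN
  · refine le_trans ?_ ((cp _ (mY.inter (sl_cl b S a).measurableSet)).trans (y2 b S a hS))
    exact msm fun x hx => ⟨⟨hx.1.1, hx.2⟩, hx.1.2⟩
end

section
open ProbabilityTheory

lemma net (k : ℕ) {δ : ℝ} (hδ : 0 < δ) : ∃ N : Finset (Euc k), (∀ s ∈ N, ‖s‖ = 1) ∧ (N.card : ℝ) ≤ (1 + 2 / δ) ^ k ∧ ∀ t : Euc k, ‖t‖ = 1 → ∃ s ∈ N, ‖t - s‖ ≤ δ := by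
  classical
  let P : Finset (Euc k) → Prop := fun N => (∀ s ∈ N, ‖s‖ = 1) ∧ ∀ s ∈ N, ∀ t ∈ N, s ≠ t → δ ≤ dist s t
  have hb : ∀ N, P N → (N.card : ℝ) ≤ (1 + 2 / δ) ^ k := fun N hN => by
    have hd : (N : Set (Euc k)).Pairwise (Function.onFun Disjoint fun c => Metric.ball c (δ / 2)) := fun c hc d hd hcd =>
      Metric.ball_disjoint_ball (by rw [add_halves]; exact hN.2 c hc d hd hcd)
    have h1 : volume (⋃ c ∈ N, Metric.ball c (δ / 2)) ≤ volume (Metric.ball (0 : Euc k) (1 + δ / 2)) := msm (iUnion₂_subset fun c hc => Metric.ball_subset_ball' (by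
      rw [dist_zero_right, hN.1 c hc, add_comm]))
    rw [measure_biUnion_finset hd fun c _ => measurableSet_ball] at h1
    simp only [Measure.addHaar_ball_of_pos volume _ (by positivity : 0 < δ / 2), Measure.addHaar_ball_of_pos volume _ (by positivity : 0 < 1 + δ / 2), Finset.sum_const, nem, ← mul_assoc, finrank_euclideanSpace, fcf] at h1
    have h2 := (ENNReal.mul_le_mul_iff_left (Metric.measure_ball_pos volume (0 : Euc k) zero_lt_one).ne' measure_ball_lt_top.ne).1 h1
    have h3 := tlo pY h2
    rw [ENNReal.toReal_mul, ENNReal.toReal_natCast, eto pY, ← le_div_iff₀ pY, ← div_pow] at h3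
    refine h3.trans_eq ?_
    congr 1; field_simp; ring
  let C : Set ℕ := {c | ∃ N, P N ∧ N.card = c}
  have hC : BddAbove C := by
    obtain ⟨B, hB⟩ := exists_nat_ge ((1 + 2 / δ) ^ k)
    exact ⟨B, by rintro c ⟨N, hN, rfl⟩; exact_mod_cast (hb N hN).trans hB⟩
  obtain ⟨N, hN, hc⟩ := Nat.sSup_mem (s := C) ⟨0, ∅, ⟨by simp, by simp⟩, rfl⟩ hC
  refine ⟨N, hN.1, hb N hN, fun t ht => ?_⟩
  by_contra! hcon
  have ht' : t ∉ N := fun h => by have := hcon t h; simp at this; linarith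
  have : N.card + 1 ≤ sSup C := le_csSup hC ⟨insert t N, ⟨fun s hs => ?_, fun s hs u hu hsu => ?_⟩, Finset.card_insert_of_notMem ht'⟩
  · omega
  · rcases Finset.mem_insert.1 hs with rfl | hs
    exacts [ht, hN.1 s hs]
  · rcases Finset.mem_insert.1 hs with hs | hs <;> rcases Finset.mem_insert.1 hu with hu | hu
    · exact absurd (hs.trans hu.symm) hsu
    · rw [hs, dist_eq_norm]; exact (hcon u hu).le
    · rw [hu, dist_comm, dist_eq_norm]; exact (hcon s hs).le
    · exact hN.2 s hs u hu hsu

lemma mid_convex {E : Type*} [NormedAddCommGroup E] [NormedSpace ℝ E] {K : Set E} (hc : IsClosed K) (hm : ∀ x ∈ K, ∀ y ∈ K, hlf • (x + y) ∈ K) : Convex ℝ K := by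
  rw [convex_iff_segment_subset]
  intro x hx y hy z hz
  have key : ∀ N : ℕ, ∃ a ∈ K, ∃ b ∈ K, z ∈ segment ℝ a b ∧ dist a b ≤ (1 / 2) ^ N * dist x y := fun N => by
    induction N with
    | zero => exact ⟨x, hx, y, hy, hz, by simp⟩
    | succ N ih =>
      obtain ⟨a, ha, b, hb, ⟨s, t, hs, ht, hst, rfl⟩, hd⟩ := ih
      have e1 : dist a (hlf • (a + b)) = 1 / 2 * dist a b := by
        rw [dist_eq_norm, dist_eq_norm, show a - hlf • (a + b) = hlf • (a - b) by module, norm_smul]; norm_num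
      have e2 : dist (hlf • (a + b)) b = 1 / 2 * dist a b := by
        rw [dist_eq_norm, dist_eq_norm, show hlf • (a + b) - b = hlf • (a - b) by module, norm_smul]; norm_num
      have e3 : 1 / 2 * dist a b ≤ (1 / 2) ^ (N + 1) * dist x y := by rw [pow_succ]; linarith
      rcases le_total t (1 / 2) with h | h
      · exact ⟨a, ha, _, hm a ha b hb, ⟨1 - 2 * t, 2 * t, by linarith, by linarith, by ring, by
          rw [show s = 1 - t by linarith]; module⟩, e1.trans_le e3⟩
      · exact ⟨_, hm a ha b hb, b, hb, ⟨2 * s, 1 - 2 * s, by linarith, by linarith, by ring, by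
          rw [show t = 1 - s by linarith]; module⟩, e2.trans_le e3⟩
  choose a ha b hb hz' hd using key
  refine hc.mem_of_tendsto (f := a) (b := Filter.atTop) ?_ (Eof ha)
  rw [tendsto_iff_dist_tendsto_zero]
  refine squeeze_zero (fun _ => dist_nonneg) (fun N => ?_) (g := fun N => hlf ^ N * dist x y) ?_
  · have := (convex_closedBall (a N) (dist (a N) (b N))).segment_subset (Metric.mem_closedBall_self dist_nonneg) (Metric.mem_closedBall.2 (dist_comm _ _).le) (hz' N)
    rw [dist_comm]; exact (Metric.mem_closedBall.1 this).trans (hd N)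
  · simpa using (tendsto_pow_atTop_nhds_zero_of_lt_one (by norm_num : (0 : ℝ) ≤ 1 / 2) nN).mul_const (dist x y)

lemma vol_arg {k : ℕ} (hk : k ≠ 0) (ρ : Euc k → ℝ) (hc : Continuous ρ) (hm : MLC ρ) (he : ∀ y, ρ (-y) = ρ y) (hi : Integrable ρ) (h1 : ∫ y, ρ y = 1) {d R : ℝ} (hd : 0 < d) (hR : 0 < R)
    (h2 : 1 / 2 ≤ ∫ y in Metric.closedBall 0 R, ρ y) (hJ : ∀ t : Euc k, ‖t‖ = 1 → Integrable (fun y => |⟪t, y⟫| ^ k * ρ y) ∧ d ^ k ≤ ∫ y, |⟪t, y⟫| ^ k * ρ y) : d ≤ 144 * R := by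
  set M := ρ 0 with hM
  have h0 := hm.1
  have le : ∀ y, ρ y ≤ M := fun y => by
    have := hm.2 y (-y)
    rw [he, add_neg_cancel, smul_zero, ← sq] at this
    exact (sq_le_sq₀ (h0 _) (h0 _)).1 this
  have M0 : 0 < M := (h0 0).lt_of_ne fun h => by
    have : ∀ y, ρ y = 0 := fun y => le_antisymm (h ▸ le y) (h0 y)
    simp [this] at h1
  set c := M / (2 * 4 ^ k) with hcd
  have c0 : 0 < c := by positivity
  set K := {y | c ≤ ρ y}
  have Kc : IsClosed K := isClosed_le continuous_const hc
  have Kx : Convex ℝ K := mid_convex Kc fun x (hx : c ≤ ρ x) y (hy : c ≤ ρ y) => (sq_le_sq₀ c0.le (h0 _)).1 ((sq c).trans_le ((mlm hx hy c0.le (h0 _)).trans (hm.2 x y)))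
  have key : ∀ t : Euc k, ‖t‖ = 1 → ∃ y ∈ K, d / 9 < |⟪t, y⟫| := fun t ht => by
    by_contra! hb
    obtain ⟨iJ, lJ⟩ := hJ t ht
    have sc := Measure.integral_comp_smul volume (fun y => |⟪t, y⟫| ^ k * ρ y) 2
    rw [finrank_euclideanSpace, fcf, abs_of_pos pY, sem] at sc
    set J := ∫ y, |⟪t, y⟫| ^ k * ρ y
    have i2 : Integrable (fun z => 2 ^ k * ((d / 9) ^ k * ρ z + |⟪t, z⟫| ^ k * ρ z * (1 / (2 * 4 ^ k)))) := ((hi.const_mul _).add (iJ.mul_const _)).const_mul _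
    have up : ∫ y, |⟪t, (2 : ℝ) • y⟫| ^ k * ρ ((2 : ℝ) • y) ≤ ∫ z, 2 ^ k * ((d / 9) ^ k * ρ z + |⟪t, z⟫| ^ k * ρ z * (1 / (2 * 4 ^ k))) := imn (iJ.comp_smul two_ne_zero) i2 fun z => by
      beta_reduce
      rw [rsr, abs_mul, mul_pow, abs_two, mul_assoc]
      refine mll ?_ pY
      have m := hm.2 ((2 : ℝ) • z) 0
      rw [add_zero, smul_smul, show (1 / 2 * 2 : ℝ) = 1 by norm_num, one_smul] at m
      rw [← mul_le_mul_iff_left₀ M0]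
      have a0 : 0 ≤ |⟪t, z⟫| ^ k := by positivity
      have := mll m a0
      by_cases hz : z ∈ K
      · have l1 := mlm (ppl (abn _) (hb z hz) k) (mll (le z) (h0 z)) (mnn (h0 z) (h0 z)) pY
        have : 0 ≤ |⟪t, z⟫| ^ k * ρ z * (1 / (2 * 4 ^ k)) * M := mnn (mnn (mnn a0 (h0 z)) pY) M0.le
        linarith
      · have hz : ρ z < c := not_le.1 hz
        have l1 := mll hz.le (mnn a0 (h0 z))
        have : 0 ≤ (d / 9) ^ k * ρ z * M := mnn (mnn pY (h0 z)) M0.le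
        have : |⟪t, z⟫| ^ k * ρ z * (1 / (2 * 4 ^ k)) * M = |⟪t, z⟫| ^ k * ρ z * c := by rw [hcd]; ring
        linarith
    rw [icm, iad (hi.const_mul _) (iJ.mul_const _), icm, integral_mul_const, h1, sc] at up
    have p2 : (0 : ℝ) < 2 ^ k := by positivity
    have l2 : J ≤ 4 ^ k * (d / 9) ^ k + J / 2 := by
      have := mll up p2.le
      rw [← mul_assoc, mul_inv_cancel₀ p2.ne', one_mul, ← mul_assoc, ← mul_pow] at this
      refine this.trans_eq ?_
      norm_num; field_simp; rfl
    have l3 : 2 * (4 ^ k * (d / 9) ^ k) ≤ (8 * (d / 9)) ^ k := by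
      rw [← mul_pow, show 8 * (d / 9) = 2 * (4 * (d / 9)) by ring, mul_pow 2]
      refine mlr ?_ pY
      exact le_self_pow₀ nN hk
    have l4 : (8 * (d / 9)) ^ k < d ^ k := pow_lt_pow_left₀ lI pY hk
    linarith
  have sub : Metric.closedBall 0 (d / 9) ⊆ K := fun y hy => by
    by_contra hyK
    obtain ⟨f, u, hf, hu⟩ := geometric_hahn_banach_closed_point Kx Kc hyK
    set w := (InnerProductSpace.toDual ℝ (Euc k)).symm f
    have fw : ∀ x, f x = ⟪w, x⟫ := fun x => (InnerProductSpace.toDual_symm_apply).symm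
    have zK : (0 : Euc k) ∈ K := by
      show M / (2 * 4 ^ k) ≤ M
      exact div_le_self M0.le (by linarith [one_le_pow₀ (by norm_num : (1 : ℝ) ≤ 4) (n := k)])
    have u0 := hf 0 zK
    rw [map_zero] at u0
    have hy' : ‖y‖ ≤ d / 9 := by simpa using hy
    have b := real_inner_le_norm w y
    rw [← fw] at b
    have w0 : 0 < ‖w‖ := (nnn w).lt_of_ne fun h => by rw [← h, zero_mul] at b; linarith
    obtain ⟨z, hz, hz'⟩ := key (‖w‖⁻¹ • w) (by rw [norm_smul, norm_inv, norm_norm, inv_mul_cancel₀ w0.ne'])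
    rw [rsl, abs_mul, abs_inv, abs_norm, lt_inv_mul_iff₀ w0, ← fw] at hz'
    have h1 := hf z hz
    have h2 := hf (-z) (by show c ≤ ρ (-z); rw [he]; exact hz)
    rw [map_neg] at h2
    have := abs_lt.2 ⟨neg_lt.1 h2, h1⟩
    have := mll hy' w0.le
    linarith
  have vb : ∀ r : ℝ, 0 ≤ r → volume.real (Metric.closedBall (0 : Euc k) r) = r ^ k * volume.real (Metric.ball (0 : Euc k) 1) := fun r hr => by
    rw [Measure.real, Measure.addHaar_closedBall volume _ hr, finrank_euclideanSpace, fcf, ENNReal.toReal_mul, eto pY]; rfl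
  set V := volume.real (Metric.ball (0 : Euc k) 1)
  have V0 : 0 < V := ENNReal.toReal_pos (Metric.measure_ball_pos volume _ one_pos).ne' measure_ball_lt_top.ne
  have f (r : ℝ) : volume (Metric.closedBall (0 : Euc k) r) ≠ ⊤ := measure_closedBall_lt_top.ne
  have a1 : ∫ y in Metric.closedBall 0 R, ρ y ≤ M * (R ^ k * V) := by
    refine (setIntegral_mono hi.integrableOn (integrableOn_const (f R)) fun y => le y).trans_eq ?_
    rw [setIntegral_const, vb R hR.le, sem, mul_comm]
  have a2 : c * ((d / 9) ^ k * V) ≤ 1 := by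
    calc _ = ∫ y in Metric.closedBall (0 : Euc k) (d / 9), c := by rw [setIntegral_const, vb _ pY, sem, mul_comm]
      _ ≤ ∫ y in Metric.closedBall 0 (d / 9), ρ y := setIntegral_mono_on (integrableOn_const (f _)) hi.integrableOn measurableSet_closedBall fun y hy => sub hy
      _ ≤ _ := (setIntegral_le_integral hi (aoa _ h0)).trans_eq h1
  have a3 : M * V * (d / 9) ^ k ≤ M * V * (16 * R) ^ k := by
    rw [hcd, div_mul_eq_mul_div, div_le_one pY] at a2
    have a4 := mll (h2.trans a1) (by positivity : (0 : ℝ) ≤ 4 * 4 ^ k)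
    have a5 : (4 : ℝ) ≤ 4 ^ k := le_self_pow₀ nN hk
    have a6 := mlr a5 (by positivity : 0 ≤ 4 ^ k * (M * (R ^ k * V)))
    rw [mul_pow, show (16 : ℝ) = 4 * 4 by norm_num, mul_pow]
    linarith
  have := le_of_pow_le_pow_left₀ hk pY (lml a3 pY)
  linarith
lemma seminet {k : ℕ} {f : Euc k → ℝ} (fa : ∀ s t, f (s + t) ≤ f s + f t) (fs : ∀ (c : ℝ) t, f (c • t) = |c| * f t) (fc : Continuous f) {N : Finset (Euc k)} {δ a : ℝ} (h1 : δ < 1)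
    (Nn : ∀ t : Euc k, ‖t‖ = 1 → ∃ s ∈ N, ‖t - s‖ ≤ δ) (ha : ∀ s ∈ N, f s ≤ a) (v : Euc k) : f v ≤ a / (1 - δ) * ‖v‖ := by
  rcases eq_or_ne v 0 with rfl | hv
  · have := fs 0 0; simp at this; simp [this]
  have : Nontrivial (Euc k) := ⟨v, 0, hv⟩
  obtain ⟨t0, ht0, hM⟩ := (isCompact_sphere (0 : Euc k) 1).exists_isMaxOn (NormedSpace.sphere_nonempty.2 zero_le_one) fc.continuousOn
  have hM : ∀ t, ‖t‖ = 1 → f t ≤ f t0 := fun t ht => hM (by simpa using ht)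
  have ht0 : ‖t0‖ = 1 := by simpa using ht0
  have fM : ∀ v, f v ≤ ‖v‖ * f t0 := fun v => by
    rcases eq_or_ne v 0 with rfl | hv
    · have := fs 0 0; simp at this; simp [this]
    · have : v = ‖v‖ • (‖v‖⁻¹ • v) := by rw [smul_smul, mul_inv_cancel₀ (norm_ne_zero_iff.2 hv), one_smul]
      conv_lhs => rw [this, fs, abs_norm]
      exact mll (hM _ (norm_smul_inv_norm (𝕜 := ℝ) hv)) (nnn _)
  have M0 : 0 ≤ f t0 := by
    have a1 := fa t0 ((-1 : ℝ) • t0)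
    have a2 := fs 0 0
    rw [fs] at a1; simp at a1 a2; linarith
  obtain ⟨s, hs, hd⟩ := Nn t0 ht0
  have u1 := fa s (t0 - s)
  rw [add_sub_cancel] at u1
  have v1 := (fM (t0 - s)).trans (mlr hd M0)
  have : f t0 ≤ a / (1 - δ) := by rw [le_div_iff₀ lI]; linarith [ha s hs]
  exact (fM v).trans ((mul_comm _ _).trans_le (mlr this (nnn _)))

end

section
open ProbabilityTheory
variable {n k : ℕ} {μ ν : Measure (Euc n)}

def LCm (ν : Measure (Euc n)) : Prop := ∀ f g h : Euc n → ℝ≥0∞, Measurable f → Measurable g → Measurable h →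
  (∀ x y, f x * g y ≤ h (hlf • (x + y)) ^ 2) → (∫⁻ x, f x ∂ν) * (∫⁻ x, g x ∂ν) ≤ (∫⁻ x, h x ∂ν) ^ 2

lemma Iso.lc (h : Iso n μ) : LCm μ := fun f g h' hf hg hh H => by
  obtain ⟨d, dm, dl, rfl⟩ := h.dens
  have dm' := dm.ennreal_ofReal
  rw [_root_.dens, lwd _ dm' hf, lwd _ dm' hg, lwd _ dm' hh]
  refine pl_euc n _ _ _ (dm'.mul hf) (dm'.mul hg) (dm'.mul hh) fun x y => ?_
  simp only [Pi.mul_apply, mul_pow]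
  rw [mul_mul_mul_comm, ← oRm (dl.1 _), ← orp (dl.1 _)]
  exact mul_le_mul' (oRl (dl.2 x y)) (H x y)

def dif (μ : Measure (Euc n)) : Measure (Euc n) := (μ.prod μ).map fun w => w.1 - w.2

lemma dif_lint [SFinite μ] {f : Euc n → ℝ≥0∞} (hf : Measurable f) : ∫⁻ z, f z ∂dif μ = ∫⁻ x, ∫⁻ y, f (x - y) ∂μ ∂μ := by
  rw [dif, lintegral_map hf fP, lintegral_prod (fun w : Euc n × Euc n => f (w.1 - w.2)) (hf.comp fP).aemeasurable]

lemma dif_lc [SFinite μ] (h : LCm μ) : LCm (dif μ) := fun f g e hf hg he H => by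
  rw [dif_lint hf, dif_lint hg, dif_lint he]
  have m : ∀ {f : Euc n → ℝ≥0∞}, Measurable f → Measurable fun x => ∫⁻ y, f (x - y) ∂μ := fun hf =>
    (hf.comp (by fun_prop : Measurable fun w : Euc n × Euc n => w.1 - w.2)).lintegral_prod_right'
  refine h _ _ _ (m hf) (m hg) (m he) fun x y => h _ _ _ (hf.comp fP) (hg.comp fP) (he.comp fP) fun a b => ?_
  rw [← smul_sub, add_sub_add_comm]
  exact H _ _

lemma dif_even [SFinite μ] {f : Euc n → ℝ≥0∞} (hf : Measurable f) : ∫⁻ z, f (-z) ∂dif μ = ∫⁻ z, f z ∂dif μ := by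
  have m : Measurable fun w : Euc n × Euc n => f (w.1 - w.2) := hf.comp fP
  rw [dif_lint hf, dif_lint (f := fun z => f (-z)) (hf.comp measurable_neg), lls (f := fun x y => f (x - y)) m.aemeasurable]
  simp only [neg_sub]

def rh (ν : Measure (Euc n)) (A : Euc n →L[ℝ] Euc k) (y : Euc k) : ℝ := ∫ z, gk (y - A z) ∂ν

lemma gk_le (u : Euc k) : gk u ≤ (gZ k)⁻¹ := by
  unfold gk
  exact mor (inv_pos.2 gZ_pos).le (Real.exp_le_one_iff.2 (by linarith [sqn ‖u‖]))

lemma gk_neg (u : Euc k) : gk (-u) = gk u := by unfold gk; rw [norm_neg]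

lemma gk_mid (u w : Euc k) : gk u * gk w ≤ gk (hlf • (u + w)) ^ 2 := by
  unfold gk
  rw [mul_mul_mul_comm, ← eadd, mul_pow, ← sq, ← enm]
  refine mll (ele.2 ?_) pY
  rw [parallelogram_mid]; push_cast; linarith [sqn ‖u - w‖]

lemma rh_of [IPM ν] (A : Euc n →L[ℝ] Euc k) (y : Euc k) : oR (rh ν A y) = ∫⁻ z, oR (gk (y - A z)) ∂ν :=
  oie (Integrable.of_bound (gk_cont.comp fP).aestronglyMeasurable ((gZ k)⁻¹) (aoa _ fun z => by
    rw [Real.norm_of_nonneg (gk_pos _).le]; exact gk_le _)) (aoa _ fun z => (gk_pos _).le)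

lemma rh_nonneg (A : Euc n →L[ℝ] Euc k) (y : Euc k) : 0 ≤ rh ν A y := inn fun z => (gk_pos _).le

lemma rh_cont [IPM ν] (A : Euc n →L[ℝ] Euc k) : Continuous (rh ν A) :=
  continuous_of_dominated (bound := fun _ => (gZ k)⁻¹) (fun y => (gk_cont.comp fP).aestronglyMeasurable) (fun y => aoa _ fun z => by
    rw [Real.norm_of_nonneg (gk_pos _).le]; exact gk_le _) (ict _) (aoa _ fun z => gk_cont.comp fP)

lemma rh_mlc [IPM ν] (h : LCm ν) (A : Euc n →L[ℝ] Euc k) : MLC (rh ν A) := by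
  refine ⟨rh_nonneg A, fun x y => ?_⟩
  rw [← ENNReal.ofReal_le_ofReal_iff (sqn _), oRm (rh_nonneg A x), orp (rh_nonneg A _), rh_of, rh_of, rh_of]
  have m : ∀ y, Measurable fun z => oR (gk (y - A z)) := fun y => (gk_cont.measurable.comp fP).ennreal_ofReal
  refine h _ _ _ (m _) (m _) (m _) fun a b => ?_
  rw [← oRm (gk_pos _).le, ← orp (gk_pos _).le]
  refine oRl ((gk_mid _ _).trans_eq ?_)
  congr 2
  rw [map_smul, ← smul_sub, map_add]; congr 1; abel

lemma rh_lint [IPM ν] (A : Euc n →L[ℝ] Euc k) {f : Euc k → ℝ} (hf : Continuous f) (f0 : ∀ y, 0 ≤ f y) :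
    ∫⁻ y, oR (f y * rh ν A y) = ∫⁻ z, ∫⁻ g, oR (f (A z + g)) ∂Gam k ∂ν := by
  have gm := (gk_cont (n := k)).measurable
  have e : ∀ y, oR (f y * rh ν A y) = ∫⁻ z, oR (f y * gk (y - A z)) ∂ν := fun y => by
    have m : Measurable fun z => oR (gk (y - A z)) := (gm.comp fP).ennreal_ofReal
    rw [oRm (f0 y), rh_of, ← lcm' _ m]
    simp only [oRm (f0 y)]
  rw [lcg e, lls]
  · refine lcg fun z => ?_
    rw [gam_eq, dens, lwd _ gm.ennreal_ofReal (by fun_prop : Measurable fun g => f (A z + g)).ennreal_ofReal]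
    rw [← lintegral_add_left_eq_self _ (A z)]
    refine lcg fun g => ?_
    rw [add_sub_cancel_left, oRm (f0 _), mul_comm]; rfl
  · exact ((hf.measurable.comp measurable_fst).mul (gm.comp (by fun_prop : Measurable fun w : Euc k × Euc n => w.1 - A w.2))).ennreal_ofReal.aemeasurable

lemma gam_sym (f : Euc k → ℝ≥0∞) (hf : Measurable f) : ∫⁻ g, f (-g) ∂Gam k = ∫⁻ g, f g ∂Gam k := by
  have gm := (gk_cont (n := k)).measurable.ennreal_ofReal
  rw [gam_eq, dens, lwd _ gm hf, lwd _ gm (g := fun g => f (-g)) (hf.comp measurable_neg), ← lintegral_neg_eq_self]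
  refine lcg fun g => ?_
  simp only [Pi.mul_apply, gk_neg, Function.comp, neg_neg]

lemma gnorm : ∫⁻ g, oR (‖g‖ ^ 2) ∂Gam n = oR n := by
  have := HasI.sum fun i => gau2 (EuclideanSpace.basisFun (Fin n) ℝ i)
  simp only [onb_sq, OrthonormalBasis.norm_eq_one] at this
  rw [← oie this.i (aoa _ fun _ => sqn _), this.e]; simp

lemma vol2 (hk : k ≠ 0) [IPM ν] (hl : LCm ν) (he : ∀ f : Euc n → ℝ≥0∞, Measurable f → ∫⁻ z, f (-z) ∂ν = ∫⁻ z, f z ∂ν) (A : Euc n →L[ℝ] Euc k) {d Q : ℝ} (hd : 0 < d) (hQ : 0 ≤ Q)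
    (hJ : ∀ t : Euc k, ‖t‖ = 1 → oR (d ^ k) ≤ ∫⁻ z, oR (|⟪t, A z⟫| ^ k) ∂ν ∧ ∫⁻ z, oR (|⟪t, A z⟫| ^ k) ∂ν ≠ ⊤)
    (h2 : ∫⁻ z, oR (‖A z‖ ^ 2) ∂ν ≤ oR Q) : d ≤ 144 * (2 * √(Q + k)) := by
  have k0 : (0 : ℝ) < k := by exact_mod_cast Nat.pos_of_ne_zero hk
  have r0 := fun y => rh_nonneg (ν := ν) A y
  have rc := rh_cont (ν := ν) A
  have con : ∀ f : Euc k → ℝ, Continuous f → (∀ y, 0 ≤ f y) → ∫⁻ y, oR (f y * rh ν A y) ≠ ⊤ → Integrable (fun y => f y * rh ν A y) ∧ oR (∫ y, f y * rh ν A y) = ∫⁻ y, oR (f y * rh ν A y) := fun f hf f0 h => by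
    have i : Integrable (fun y => f y * rh ν A y) := ⟨(hf.mul rc).aestronglyMeasurable, by
      rw [hasFiniteIntegral_iff_ofReal (aoa _ fun y => mnn (f0 y) (r0 y))]; exact h.lt_top⟩
    exact ⟨i, oie i (aoa _ fun y => mnn (f0 y) (r0 y))⟩
  have e1 := rh_lint (ν := ν) A (f := fun _ => 1) continuous_const fun _ => zero_le_one
  simp only [one_mul, oro, lintegral_const, measure_univ, mul_one] at e1
  obtain ⟨i1, j1⟩ := con (fun _ => 1) continuous_const (fun _ => zero_le_one) (by simp [e1])
  simp only [one_mul] at i1 j1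
  rw [e1, ENNReal.ofReal_eq_one] at j1
  refine vol_arg hk (rh ν A) rc (rh_mlc hl A) (fun y => ?_) i1 j1 hd pY ?_ fun t ht => ?_
  · rw [← ENNReal.ofReal_eq_ofReal_iff (r0 _) (r0 _), rh_of, rh_of, ← he (fun z => oR (gk (y - A z))) (gk_cont.measurable.comp fP).ennreal_ofReal]
    refine lcg fun z => ?_
    rw [← gk_neg, map_neg]; congr 2; abel
  · have e2 := rh_lint (ν := ν) A (f := fun y => ‖y‖ ^ 2) fP fun _ => sqn _
    have gg := gnorm (n := k)
    have le : ∫⁻ y, oR (‖y‖ ^ 2 * rh ν A y) ≤ oR (2 * (Q + k)) := by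
      rw [e2, oRm zero_le_two, ora hQ k0.le]
      calc _ ≤ ∫⁻ z, ∫⁻ g, oR 2 * (oR (‖A z‖ ^ 2) + oR (‖g‖ ^ 2)) ∂Gam k ∂ν := lmn fun z => lmn fun g => by
            rw [← ora pY pY, ← oRm zero_le_two]
            refine oRl ?_
            have := parallelogram_law_with_norm ℝ (A z) g
            have := mul_self_nonneg ‖A z - g‖
            linarith
        _ = oR 2 * ((∫⁻ z, oR (‖A z‖ ^ 2) ∂ν) + oR k) := by
            have m1 : Measurable fun g : Euc k => oR (‖g‖ ^ 2) := (by fun_prop : Measurable fun g : Euc k => ‖g‖ ^ 2).ennreal_ofReal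
            have m2 : Measurable fun z => oR (‖A z‖ ^ 2) := (by fun_prop : Measurable fun z => ‖A z‖ ^ 2).ennreal_ofReal
            simp only [lcm' _ (m1.const_add _), lal mct, lintegral_const, measure_univ, mul_one, gg]
            rw [lcm' _ (m2.add_const _), lal m2]; simp
        _ ≤ _ := by gcongr
    obtain ⟨i2, j2⟩ := con _ (by fun_prop : Continuous fun y : Euc k => ‖y‖ ^ 2) (fun _ => sqn _) (le.trans_lt olt).ne
    rw [← j2, ENNReal.ofReal_le_ofReal_iff pY] at le
    set B := Metric.closedBall (0 : Euc k) (2 * √(Q + k))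
    have s := integral_add_compl (measurableSet_closedBall : MeasurableSet B) i1
    have q0 : 0 < 4 * (Q + k) := by positivity
    have : 4 * (Q + k) * ∫ y in Bᶜ, rh ν A y ≤ 2 * (Q + k) := by
      rw [← icm]
      refine le_trans (setIntegral_mono_on (i1.const_mul _).integrableOn i2.integrableOn measurableSet_closedBall.compl fun y hy => ?_) ((setIntegral_le_integral i2 (aoa _ fun y => mnn (sqn _) (r0 y))).trans le)
      refine mlr ?_ (r0 y)
      have hy : 2 * √(Q + k) < ‖y‖ := by simpa [B] using hy
      have := ppl pY hy.le 2
      rw [mul_pow, Real.sq_sqrt pY] at this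
      linarith
    have : ∫ y in Bᶜ, rh ν A y ≤ 1 / 2 := lml lI q0
    linarith
  · have e3 := rh_lint (ν := ν) A (f := fun y => |⟪t, y⟫| ^ k) fP fun _ => by positivity
    obtain ⟨lo, fi⟩ := hJ t ht
    have m1 : Measurable fun g : Euc k => oR (|⟪t, g⟫| ^ k) := (by fun_prop : Continuous fun g : Euc k => |⟪t, g⟫| ^ k).measurable.ennreal_ofReal
    have m2 : Measurable fun z => oR (|⟪t, A z⟫| ^ k) := m1.comp A.continuous.measurable
    have fin : ∫⁻ y, oR (|⟪t, y⟫| ^ k * rh ν A y) ≠ ⊤ := by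
      have gf : ∫⁻ g, oR (|⟪t, g⟫| ^ k) ∂Gam k ≠ ⊤ := by
        have := gam_mom (n := k) k hk
        refine ((lmn fun g => oRl (ppl (abn _) ((ain t g).trans_eq (by rw [ht, one_mul])) k)).trans_lt ?_).ne
        rw [← hasFiniteIntegral_iff_ofReal (aoa _ fun y => by positivity)]; exact this.2
      rw [e3]
      refine (lt_of_le_of_lt (b := ∫⁻ z, ∫⁻ g, oR (2 ^ (k - 1)) * (oR (|⟪t, A z⟫| ^ k) + oR (|⟪t, g⟫| ^ k)) ∂Gam k ∂ν) (lmn fun z => lmn fun g => ?_) ?_).ne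
      · rw [← ora pY pY, ← oRm pY]
        refine oRl (le_trans ?_ (add_pow_le (abn _) (abn _) k))
        rw [inner_add_right]
        exact ppl (abn _) (abs_add_le _ _) k
      · simp only [lcm' _ (m1.const_add _), lal mct, lintegral_const, measure_univ, mul_one]
        rw [lcm' _ (m2.add_const _), lal m2]
        simp only [lintegral_const, measure_univ, mul_one]
        exact ENNReal.mul_lt_top olt (ENNReal.add_lt_top.2 ⟨fi.lt_top, gf.lt_top⟩)
    obtain ⟨i3, j3⟩ := con _ (by fun_prop : Continuous fun y : Euc k => |⟪t, y⟫| ^ k) (fun _ => by positivity) fin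
    refine ⟨i3, ?_⟩
    rw [← ENNReal.ofReal_le_ofReal_iff (inn fun y => mnn pY (r0 y)), j3, e3]
    refine lo.trans (lmn fun z => ?_)
    have mg : Measurable fun g => oR (|⟪t, A z + g⟫| ^ k) := m1.comp fP
    have sy := gam_sym _ mg
    rw [← ENNReal.mul_le_mul_iff_right two_ne_zero ENNReal.ofNat_ne_top]
    nth_rewrite 2 [two_mul]
    nth_rewrite 1 [← sy]
    rw [← lintegral_add_right _ mg]
    refine le_trans ?_ (lmn (f := fun _ => 2 * oR (|⟪t, A z⟫| ^ k)) fun g => ?_)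
    · simp
    · beta_reduce
      refine (congrArg (· * oR (|⟪t, A z⟫| ^ k)) (by simp : (2 : ℝ≥0∞) = oR 2)).trans_le ?_
      rw [← oRm zero_le_two, ← ora pY pY]
      refine oRl ?_
      rw [inner_add_right, inner_add_right, inner_neg_right]
      generalize ⟪t, A z⟫ = a
      generalize ⟪t, g⟫ = b
      obtain ⟨j, rfl⟩ := Nat.exists_eq_succ_of_ne_zero hk
      have h1 : 2 * |a| ≤ |a + -b| + |a + b| := by
        have := abs_add_le (a + -b) (a + b)
        rwa [show a + -b + (a + b) = 2 * a by ring, abs_mul, abs_two] at this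
      have h2 := (ppl pY h1 j.succ).trans (add_pow_le (abn _) (abn _) j.succ)
      rw [mul_pow, Nat.succ_sub_one, pow_succ 2, mul_assoc] at h2
      exact lml h2 pY
end

section
open ProbabilityTheory
variable {n k : ℕ} {μ ν : Measure (Euc n)} {L w : ℝ}

def ss (ν : Measure (Euc n)) (k : ℕ) (u : Euc n) : ℝ := (eLpNorm (fun z => ⟪u, z⟫) k ν).toReal
def NB (ν : Measure (Euc n)) (k : ℕ) (L : ℝ) : Prop := ∀ u, eLpNorm (fun z => ⟪u, z⟫) k ν ≤ oR (L * ‖u‖)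

lemma NB.ne (h : NB ν k L) (u : Euc n) : eLpNorm (fun z => ⟪u, z⟫) k ν ≠ ⊤ := ((h u).trans_lt olt).ne
lemma NB.le (h : NB ν k L) (hL : 0 ≤ L) (u : Euc n) : ss ν k u ≤ L * ‖u‖ := tlo pY (h u)
lemma NB.add (h : NB ν k L) (hk : 1 ≤ k) (u v : Euc n) : ss ν k (u + v) ≤ ss ν k u + ss ν k v := by
  rw [ss, ss, ss, ← ENNReal.toReal_add (h.ne u) (h.ne v)]
  refine ENNReal.toReal_mono (ENNReal.add_ne_top.2 ⟨h.ne u, h.ne v⟩) ?_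
  simp only [inner_add_left]
  exact eLpNorm_add_le fP fP (by exact_mod_cast hk)
lemma ss_smul (c : ℝ) (u : Euc n) : ss ν k (c • u) = |c| * ss ν k u := by
  have := eLpNorm_const_smul c (fun z => ⟪u, z⟫) k ν
  simp only [ss, rsl]
  rw [show (fun z => c * ⟪u, z⟫) = c • fun z => ⟪u, z⟫ from rfl, this, ENNReal.toReal_mul]; simp
lemma NB.lip (h : NB ν k L) (hL : 0 ≤ L) (hk : 1 ≤ k) (u v : Euc n) : ss ν k u ≤ ss ν k v + L * ‖u - v‖ := by
  have := h.add hk v (u - v)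
  rw [add_sub_cancel] at this
  linarith [h.le hL (u - v)]
lemma NB.cont (h : NB ν k L) (hL : 0 ≤ L) (hk : 1 ≤ k) : Continuous (ss ν k) := by
  refine (LipschitzWith.of_le_add_mul ⟨L, hL⟩ fun u v => ?_).continuous
  rw [dist_eq_norm]; exact h.lip hL hk u v
lemma NB.pow (h : NB ν k L) (hk : 1 ≤ k) (u : Euc n) : oR (ss ν k u ^ k) = ∫⁻ z, oR (|⟪u, z⟫| ^ k) ∂ν := by
  have := eLpNorm_nnreal_pow_eq_lintegral (f := fun z => ⟪u, z⟫) (μ := ν) (p := (k : NNReal)) (by exact_mod_cast (by omega : k ≠ 0))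
  simp only [ENNReal.coe_natCast, NNReal.coe_natCast, ENNReal.rpow_natCast] at this
  rw [ss, orp ENNReal.toReal_nonneg, ENNReal.ofReal_toReal (h.ne u), this]
  refine lcg fun z => ?_
  rw [orp (abn _), Real.enorm_eq_ofReal_abs]

lemma gconc (S : Set (Euc n)) (hS : MeasurableSet S) (h : 1 / 2 ≤ Gam n S) {ρ : ℝ} (h0 : 0 ≤ ρ) :
    Gam n {x | ρ ≤ Metric.infDist x S} ≤ oR (2 * exp (-(ρ ^ 2 / 4))) := by
  have e : (Gam n) = dens n fun x => (gZ n)⁻¹ * exp (-1 * ‖x‖ ^ 2 / 2) := by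
    rw [gam_eq]; congr 1; funext x; rw [gk]; ring_nf
  have p : IPM (Gam n) := inferInstance
  have := tau_property n (fun _ => (gZ n)⁻¹) mct ⟨fun _ => (inv_pos.2 gZ_pos).le, fun _ _ => (sq _).ge⟩ 1 zero_le_one S hS (e ▸ p)
  rw [← e] at this
  have h2 := mul_meas_ge_le_lintegral₀ (μ := Gam n) (f := fun x => oR (exp (1 / 4 * Metric.infDist x S ^ 2))) (by
    have := (Metric.continuous_infDist_pt S).measurable
    exact ((this.pow_const 2).const_mul (1 / 4)).exp.ennreal_ofReal.aemeasurable) (oR (exp (ρ ^ 2 / 4)))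
  have h3 : Gam n {x | ρ ≤ Metric.infDist x S} ≤ Gam n {x | oR (exp (ρ ^ 2 / 4)) ≤ oR (exp (1 / 4 * Metric.infDist x S ^ 2))} :=
    msm fun x hx => oRl (ele.2 (by have := ppl h0 hx 2; linarith))
  have h4 := (mul_le_mul' h (mul_le_mul' le_rfl h3)).trans ((mul_le_mul' le_rfl h2).trans this)
  have p2 : oR (2 * exp (-(ρ ^ 2 / 4))) * (1 / 2 * oR (exp (ρ ^ 2 / 4))) = 1 := by
    rw [show (1 / 2 : ℝ≥0∞) = oR (1 / 2) by rw [ord two_pos]; simp, ← oRm nN, ← oRm pY, ENNReal.ofReal_eq_one,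
      show ∀ a b : ℝ, 2 * a * (1 / 2 * b) = a * b by intros; ring, ← eadd]; simp
  calc _ = oR (2 * exp (-(ρ ^ 2 / 4))) * (1 / 2 * (oR (exp (ρ ^ 2 / 4)) * Gam n {x | ρ ≤ Metric.infDist x S})) := by
        rw [← mul_assoc, ← mul_assoc, mul_assoc (oR _) (1 / 2), p2, one_mul]
    _ ≤ _ := mul_le_of_le_one_right' h4

lemma NB.med (h : NB ν k L) (hL : 0 < L) (hk : 1 ≤ k) (hw : w = 8 * L * √k) : ∃ j : ℕ,
    Gam n {x | (j + 1) * w ≤ ss ν k x} ≤ oR (2 * exp (-(16 * k))) ∧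
    (1 ≤ j → Gam n {x | ss ν k x ≤ (j - 2) * w} ≤ oR (2 * exp (-(16 * k)))) := by
  classical
  have k0 : (0 : ℝ) < k := by exact_mod_cast hk
  have w0 : 0 < w := by rw [hw]; have := Real.sqrt_pos.2 k0; positivity
  have c := h.cont hL.le hk
  have e16 : 2 * exp (-((w / L) ^ 2 / 4)) = 2 * exp (-(16 * k)) := by
    rw [hw, show 8 * L * √k / L = 8 * √k by field_simp, mul_pow, Real.sq_sqrt k0.le]; ring_nf
  have key : ∀ S T : Set (Euc n), MeasurableSet S → 1 / 2 ≤ Gam n S → (∀ x ∈ T, ∀ y ∈ S, w ≤ L * ‖x - y‖) → Gam n T ≤ oR (2 * exp (-(16 * k))) := fun S T hS h2 H => by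
    rw [← e16]
    refine (msm fun x hx => ?_).trans (gconc S hS h2 pY)
    have ne : S.Nonempty := nonempty_iff_ne_empty.2 fun e => by simp [e] at h2
    refine (Metric.le_infDist ne).2 fun y hy => ?_
    rw [div_le_iff₀' hL, dist_eq_norm]; exact H x hx y hy
  have ex : ∃ j : ℕ, 1 / 2 ≤ Gam n {x | ss ν k x ≤ j * w} := by
    have mono : Monotone fun j : ℕ => {x | ss ν k x ≤ j * w} := fun a b ab x hx => by
      have hx : ss ν k x ≤ a * w := hx
      exact hx.trans (by gcongr)
    have t := tendsto_measure_iUnion_atTop (μ := Gam n) mono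
    have u : ⋃ j : ℕ, {x | ss ν k x ≤ j * w} = univ := eq_univ_of_forall fun x => by
      obtain ⟨j, hj⟩ := exists_nat_ge (ss ν k x / w)
      exact mem_iUnion.2 ⟨j, (div_le_iff₀ w0).1 hj⟩
    rw [u, measure_univ] at t
    exact ((t.eventually (lt_mem_nhds (by simp : (1 / 2 : ℝ≥0∞) < 1))).exists).imp fun _ h => h.le
  refine ⟨Nat.find ex, key _ _ (mbl c.measurable mct) (Nat.find_spec ex) fun x hx y hy => ?_, fun hj => ?_⟩
  · have hx : ((Nat.find ex : ℝ) + 1) * w ≤ ss ν k x := hx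
    have hy : ss ν k y ≤ Nat.find ex * w := hy
    linarith [h.lip hL.le hk x y]
  · have lt := Nat.find_min ex (m := Nat.find ex - 1) (by omega)
    push_cast [hj] at lt
    refine key {x | ((Nat.find ex : ℝ) - 1) * w ≤ ss ν k x} _ (mbl mct c.measurable) ?_ fun x hx y hy => ?_
    · have l := measure_add_measure_compl (μ := Gam n) (mbl c.measurable mct : MeasurableSet {x | ss ν k x ≤ ((Nat.find ex : ℝ) - 1) * w})
      rw [measure_univ] at l
      by_contra hh
      have hc : Gam n {x | ss ν k x ≤ ((Nat.find ex : ℝ) - 1) * w}ᶜ ≤ Gam n {x | ((Nat.find ex : ℝ) - 1) * w ≤ ss ν k x} := msm fun x (hx : ¬ ss ν k x ≤ _) => le_of_not_ge hx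
      have := ENNReal.add_lt_add (not_le.1 lt) (hc.trans_lt (not_le.1 hh))
      rw [l, ENNReal.add_halves] at this
      exact this.false
    · have hx : ss ν k x ≤ (Nat.find ex - 2) * w := hx
      have hy : (Nat.find ex - 1) * w ≤ ss ν k y := hy
      linarith [h.lip hL.le hk y x, norm_sub_rev x y, congrArg (L * ·) (norm_sub_rev x y)]

lemma gcomb (t : Euc k) (ht : ‖t‖ = 1) : (Measure.pi fun _ : Fin k => Gam n).map (fun G => ∑ i, t i • G i) = Gam n := by
  refine Measure.ext_of_charFun (funext fun u => ?_)
  have m : Measurable fun G : Fin k → Euc n => ∑ i, t i • G i := Finset.measurable_sum _ fun i _ => (measurable_pi_apply i).const_smul (t i)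
  rw [charFun_apply, integral_map m.aemeasurable fP, charFun_stdGaussian]
  have : ∀ G : Fin k → Euc n, Complex.exp (⟪∑ i, t i • G i, u⟫ * Complex.I) = ∏ i, Complex.exp (⟪G i, t i • u⟫ * Complex.I) := fun G => by
    rw [← Complex.exp_sum, sum_inner, Complex.ofReal_sum, fsm]
    simp only [rsl, rsr]
  simp only [this]
  rw [integral_fintype_prod_eq_prod (fun i (g : Euc n) => Complex.exp (⟪g, t i • u⟫ * Complex.I))]
  simp only [← charFun_apply, charFun_stdGaussian]
  rw [← Complex.exp_sum]
  congr 1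
  simp only [norm_smul, mul_pow, rna, sq_abs, ← Complex.ofReal_pow, ← Finset.sum_div]
  have e : ∑ i, t i ^ 2 = 1 := by rw [← EuclideanSpace.real_norm_sq_eq, ht]; norm_num
  push_cast
  simp only [mul_pow, ← neg_mul, ← fsm]
  rw [Finset.sum_neg_distrib]
  have e' : ∑ i, (t i : ℂ) ^ 2 = 1 := by exact_mod_cast e
  rw [e', neg_one_mul]

lemma glow (u : Euc n) (hu : ‖u‖ = 1) (hk : 1 ≤ k) : oR (3 / 4 * exp (-(21 / 2 * k))) ≤ Gam n {g | √k ≤ |⟪g, u⟫|} := by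
  set a := √k with ha
  have a1 : 1 ≤ a := Real.one_le_sqrt.2 (by exact_mod_cast hk)
  have a2 : a ^ 2 = k := Real.sq_sqrt pY
  set S : Set (Euc n) := {g | a ≤ ⟪g, u⟫} ∩ {g | ⟪g, u⟫ ≤ a + 4}
  have hS : MeasurableSet S := (mbl mct fP).inter (mbl fP mct)
  have h := cm ((a + 2) • u) (f := S.indicator 1) (measurable_const.indicator hS)
  have up : ∫⁻ g, S.indicator 1 g * oR (exp (⟪(a + 2) • u, g⟫ - ‖(a + 2) • u‖ ^ 2 / 2)) ∂Gam n ≤ Gam n {g | a ≤ |⟪g, u⟫|} * oR (exp (21 / 2 * k)) := by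
    rw [← lintegral_indicator_one (mbl mct fP), ← lintegral_mul_const' _ _ ont]
    refine lmn fun g => ?_
    by_cases hg : g ∈ S
    · have hg' : g ∈ {g | a ≤ |⟪g, u⟫|} := le_trans (b := ⟪g, u⟫) hg.1 (le_abs_self _)
      have h2 : ⟪g, u⟫ ≤ a + 4 := hg.2
      rw [iom hg, iom hg']
      refine mul_le_mul' le_rfl (oRl (ele.2 ?_))
      rw [rsl, ric, norm_smul, hu, Real.norm_of_nonneg lI, ← a2]
      nlinarith [mll h2 (by linarith : 0 ≤ a + 2)]
    · rw [indicator_of_notMem hg, zero_mul]; exact zero_le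
  have lo : oR (3 / 4) ≤ ∫⁻ g, S.indicator 1 ((a + 2) • u + g) ∂Gam n := by
    have ch := meas_ge_le_lintegral_div (μ := Gam n) (f := fun g => oR (⟪u, g⟫ ^ 2)) (by fun_prop : Continuous fun g : Euc n => ⟪u, g⟫ ^ 2).measurable.ennreal_ofReal.aemeasurable (ε := oR 4) (by simp) (by simp)
    rw [← oie (gau2 u).i (aoa _ fun _ => sqn _), (gau2 u).e, hu, ← ord nN] at ch
    have mS : MeasurableSet {g : Euc n | (a + 2) • u + g ∈ S} := (by fun_prop : Measurable fun g : Euc n => (a + 2) • u + g) hS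
    have e : ∀ g, S.indicator (1 : Euc n → ℝ≥0∞) ((a + 2) • u + g) = {g : Euc n | (a + 2) • u + g ∈ S}.indicator 1 g := fun g => rfl
    simp only [e]
    rw [lintegral_indicator_one mS]
    have cp := measure_add_measure_compl (μ := Gam n) mS
    rw [measure_univ] at cp
    have : Gam n {g : Euc n | (a + 2) • u + g ∈ S}ᶜ ≤ oR (1 / 4) := by
      refine (msm fun g hg => ?_).trans (ch.trans nN)
      refine oRl ?_
      by_contra hh
      have := abs_lt_of_sq_lt_sq' (by linarith : ⟪u, g⟫ ^ 2 < 2 ^ 2) zero_le_two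
      refine hg ⟨show _ ≤ ⟪_, u⟫ from ?_, show ⟪_, u⟫ ≤ _ from ?_⟩ <;> rw [inner_add_left, rsl, rin, hu, ric] <;> linarith
    have t : oR (3 / 4) + oR (1 / 4) = 1 := by rw [← ora] <;> norm_num
    rw [← t] at cp
    refine (ENNReal.add_le_add_iff_right (ont (r := 1 / 4))).1 ?_
    rw [← cp]; gcongr
  rw [h] at lo
  rw [oRm nN, Real.exp_neg, ENNReal.ofReal_inv_of_pos (epos _), ← div_eq_mul_inv]
  exact ENNReal.div_le_of_le_mul (lo.trans up)
end

section
open ProbabilityTheory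
variable {n k : ℕ} {μ ν : Measure (Euc n)} {L w : ℝ}

lemma pick {j : ℕ} {N : Finset (Euc k)} (hN : ∀ s ∈ N, ‖s‖ = 1) (hc : (N.card : ℝ) ≤ 33 ^ k) (hk : 1 ≤ k) (hn : 1 ≤ n) {f : Euc n → ℝ} (fc : Continuous f) (a b : ℝ)
    (h1 : Gam n {x | a ≤ f x} ≤ oR (2 * exp (-(16 * k)))) (h2 : Gam n {x | f x ≤ b} ≤ oR (2 * exp (-(16 * k)))) :
    ∃ G : Fin k → Euc n, (∀ s ∈ N, b ≤ f (∑ i, s i • G i) ∧ f (∑ i, s i • G i) ≤ a) ∧ ∑ i, ‖G i‖ ^ 2 ≤ 4 * k * n := by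
  by_contra hh
  push Not at hh
  set π := Measure.pi fun _ : Fin k => Gam n
  have kn : (0 : ℝ) < 4 * k * n := by have : (0 : ℝ) < k := by exact_mod_cast hk
                                      have : (0 : ℝ) < n := by exact_mod_cast hn
                                      positivity
  have m : ∀ s : Euc k, Measurable fun G : Fin k → Euc n => ∑ i, s i • G i := fun s => Finset.measurable_sum _ fun i _ => (measurable_pi_apply i).const_smul (s i)
  have hs : ∀ s ∈ N, π {G | a ≤ f (∑ i, s i • G i) ∨ f (∑ i, s i • G i) ≤ b} ≤ oR (4 * exp (-(16 * k))) := fun s h => by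
    have e1 := Measure.map_apply (μ := π) (m s) (mbl (mct (a := a)) fc.measurable)
    have e2 := Measure.map_apply (μ := π) (m s) (mbl fc.measurable (mct (a := b)))
    rw [gcomb s (hN s h)] at e1 e2
    refine (mul' _ _).trans ((add_le_add (e1.symm.trans_le h1) (e2.symm.trans_le h2)).trans_eq ?_)
    rw [← ora pY pY]; ring_nf
  have h0 : π {G | 4 * k * n ≤ ∑ i, ‖G i‖ ^ 2} ≤ oR (1 / 4) := by
    have mi : ∀ i, Measurable fun G : Fin k → Euc n => oR (‖G i‖ ^ 2) := fun i => ((measurable_pi_apply i).norm.pow_const 2).ennreal_ofReal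
    have M := meas_ge_le_lintegral_div (μ := π) (f := fun G => ∑ i, oR (‖G i‖ ^ 2)) (Finset.measurable_sum _ fun i _ => mi i).aemeasurable (ε := oR (4 * k * n)) (ENNReal.ofReal_pos.2 kn).ne' ont
    rw [lintegral_finsetSum _ fun i _ => mi i] at M
    have ei : ∀ i, ∫⁻ G : Fin k → Euc n, oR (‖G i‖ ^ 2) ∂π = oR n := fun i => by
      rw [← gnorm, ← (measurePreserving_eval (fun _ : Fin k => Gam n) i).map_eq, lintegral_map (by fun_prop : Measurable fun g : Euc n => ‖g‖ ^ 2).ennreal_ofReal (measurable_pi_apply i)]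
    simp only [ei, Finset.sum_const, fcu, fcf, nem] at M
    rw [← orn, ← oRm pY, ← ord kn, show (k : ℝ) * n / (4 * k * n) = 1 / 4 by field_simp] at M
    refine (msm fun G hG => ?_).trans M
    show _ ≤ ∑ i, oR (‖G i‖ ^ 2)
    rw [← ENNReal.ofReal_sum_of_nonneg fun i _ => by positivity]
    exact oRl hG
  have cov : (univ : Set (Fin k → Euc n)) ⊆ (⋃ s ∈ N, {G | a ≤ f (∑ i, s i • G i) ∨ f (∑ i, s i • G i) ≤ b}) ∪ {G | 4 * k * n ≤ ∑ i, ‖G i‖ ^ 2} := fun G _ => by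
    by_cases q : ∀ s ∈ N, b ≤ f (∑ i, s i • G i) ∧ f (∑ i, s i • G i) ≤ a
    · exact Or.inr (hh G q).le
    · push Not at q
      obtain ⟨s, h, q⟩ := q
      refine Or.inl (mem_biUnion h (?_ : _ ∨ _))
      rcases le_or_gt b (f (∑ i, s i • G i)) with c | c
      · exact Or.inl (q c).le
      · exact Or.inr c.le
  have := (msm (μ := π) cov).trans ((mul' _ _).trans (add_le_add ((measure_biUnion_finset_le N _).trans (fcn N _ _ hs)) h0))
  rw [measure_univ, nem, ← orn, ← oRm pY, ← ora pY nN, ENNReal.one_le_ofReal] at this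
  have k1 : (1 : ℝ) ≤ k := by exact_mod_cast hk
  have e4 : (33 : ℝ) ≤ exp 4 := by
    have := ppl nN (Real.exp_one_gt_d9).le 4
    rw [← enm] at this; norm_num at this ⊢; linarith
  have e5 : (33 : ℝ) ^ k * (4 * exp (-(16 * k))) ≤ 4 * exp (-12) := by
    calc _ ≤ exp 4 ^ k * (4 * exp (-(16 * k))) := by gcongr
      _ = 4 * exp (-(12 * k)) := by rw [← enm, mul_left_comm, ← eadd]; ring_nf
      _ ≤ _ := by gcongr; linarith
  have e6 : exp (-12) ≤ 1 / 13 := by rw [Real.exp_neg, ← one_div]; exact one_div_le_one_div_of_le nN (by linarith [aoe 12])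
  have := mlr hc (by positivity : 0 ≤ 4 * exp (-(16 * k)))
  linarith

lemma bigD (hk : 1 ≤ k) (hn : k ^ 2 ≤ n) [IPM ν] (hl : LCm ν) (he : ∀ f : Euc n → ℝ≥0∞, Measurable f → ∫⁻ z, f (-z) ∂ν = ∫⁻ z, f z ∂ν)
    (h : NB ν k (3600 * k)) (h2 : ∀ u, ∫⁻ z, oR (⟪u, z⟫ ^ 2) ∂ν ≤ oR (4 * ‖u‖ ^ 2)) :
    ∃ D, 0 < D ∧ D ≤ 172800 * √(k * n) ∧ Gam n {x | D ≤ ss ν k x} ≤ oR (2 * exp (-(16 * k))) := by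
  have k0 : (1 : ℝ) ≤ k := by exact_mod_cast hk
  have n1 : 1 ≤ n := (Nat.one_le_pow _ _ hk).trans hn
  have n0 : (1 : ℝ) ≤ n := by exact_mod_cast n1
  have L0 : (0 : ℝ) < 3600 * k := by positivity
  obtain ⟨j, a, b⟩ := h.med L0 hk rfl
  set w := 8 * (3600 * k : ℝ) * √k with hw
  have w0 : 0 < w := by have := Real.sqrt_pos.2 (by linarith : (0 : ℝ) < k); positivity
  refine ⟨(j + 1) * w, by positivity, ?_, a⟩
  have q0 := Real.sqrt_nonneg (k * n)
  rcases le_or_gt j 5 with j5 | j6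
  · have : √k * k ≤ √(k * n) := by
      rw [Real.sqrt_mul pY]; gcongr
      exact Real.le_sqrt_of_sq_le (by exact_mod_cast hn)
    have j5' : (j : ℝ) ≤ 5 := by exact_mod_cast j5
    have := mlr j5' w0.le
    rw [hw] at this ⊢
    linarith
  have j6' : (6 : ℝ) ≤ j := by exact_mod_cast j6
  obtain ⟨N, N1, Nc, Nn⟩ := net k (δ := 1 / 16) nN
  obtain ⟨G, hG, G2⟩ := pick (j := j) N1 (by norm_num at Nc ⊢; exact Nc) hk n1 (h.cont L0.le hk) _ _ a (b (by omega))
  let f : Euc k → ℝ := fun t => ss ν k (∑ i, t i • G i)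
  have fa : ∀ s t, f (s + t) ≤ f s + f t := fun s t => by
    refine le_trans (le_of_eq ?_) (h.add hk _ _)
    simp only [f, PiLp.add_apply, add_smul, fad]
  have fs : ∀ (c : ℝ) t, f (c • t) = |c| * f t := fun c t => by
    rw [← ss_smul]; simp only [f, PiLp.smul_apply, sem, mul_smul, Finset.smul_sum]
  have fc : Continuous f := (h.cont L0.le hk).comp fP
  have fM := seminet fa fs fc nN Nn fun s hs => (hG s hs).2
  have jw := mlr j6' w0.le
  have fl : ∀ t, ‖t‖ = 1 → j * w / 2 ≤ f t := fun t ht => by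
    obtain ⟨s, hs, hd⟩ := Nn t ht
    have u2 := fa t (s - t)
    have v2 := (fM (s - t)).trans (mll ((norm_sub_rev _ _).trans_le hd) (by norm_num; positivity))
    rw [add_sub_cancel] at u2
    norm_num at v2
    linarith [(hG s hs).1]
  let A : Euc n →L[ℝ] Euc k := (EuclideanSpace.equiv (Fin k) ℝ).symm.toContinuousLinearMap.comp (ContinuousLinearMap.pi fun i => innerSL ℝ (G i))
  have Ai : ∀ z i, (A z) i = ⟪G i, z⟫ := fun z i => rfl
  have At : ∀ t z, ⟪t, A z⟫ = ⟪∑ i, t i • G i, z⟫ := fun t z => by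
    rw [PiLp.inner_apply, sum_inner]
    refine fsc rfl fun i _ => ?_
    rw [Ai, rsl]; simp [mul_comm]
  have v := vol2 (ν := ν) (by omega : k ≠ 0) hl he A (d := j * w / 2) (Q := 16 * k * n) pY pY (fun t ht => by
    simp only [At]
    rw [← h.pow hk]
    exact ⟨oRl (ppl pY (fl t ht) k), ont⟩) (by
    simp only [EuclideanSpace.real_norm_sq_eq, Ai]
    simp only [ENNReal.ofReal_sum_of_nonneg fun i _ => sqn _]
    rw [lintegral_finsetSum _ fun i _ => (by fun_prop : Measurable fun z : Euc n => ⟪G i, z⟫ ^ 2).ennreal_ofReal]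
    refine (fsl fun i _ => h2 (G i)).trans ?_
    rw [← ENNReal.ofReal_sum_of_nonneg fun i _ => by positivity, ← fms]
    exact oRl lI)
  have : √(16 * k * n + k) ≤ 5 * √(k * n) := by
    rw [show (5 : ℝ) = √(5 ^ 2) by rw [Real.sqrt_sq nN], ← Real.sqrt_mul nN]
    refine Real.sqrt_le_sqrt ?_
    have := mll n0 (by linarith : (0 : ℝ) ≤ k)
    linarith
  linarith

lemma bigZ (hk : 1 ≤ k) (hn : k ^ 2 ≤ n) [IPM ν] (hl : LCm ν) (he : ∀ f : Euc n → ℝ≥0∞, Measurable f → ∫⁻ z, f (-z) ∂ν = ∫⁻ z, f z ∂ν)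
    (h : NB ν k (3600 * k)) (h2 : ∀ u, ∫⁻ z, oR (⟪u, z⟫ ^ 2) ∂ν ≤ oR (4 * ‖u‖ ^ 2)) :
    ν {z | 172800 * exp 19 * √n ≤ ‖z‖} ≤ oR (4 * exp (-(8 * k))) := by
  have k0 : (1 : ℝ) ≤ k := by exact_mod_cast hk
  have n1 : 1 ≤ n := (Nat.one_le_pow _ _ hk).trans hn
  have sn : 0 < √n := Real.sqrt_pos.2 (by exact_mod_cast n1)
  have sk : 0 < √k := Real.sqrt_pos.2 lI
  obtain ⟨D, D0, hD, hb⟩ := bigD hk hn hl he h h2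
  set R := 172800 * exp 19 * √n
  have R0 : 0 < R := by positivity
  have c := (h.cont pY hk).measurable
  set Gd : Set (Euc n) := {x | ss ν k x < D}
  have mG : MeasurableSet Gd := measurableSet_lt c mct
  have up : ∫⁻ g in Gd, ∫⁻ z, oR (|⟪g, z⟫| ^ k) ∂ν ∂Gam n ≤ oR (D ^ k) := by
    calc _ ≤ ∫⁻ g in Gd, oR (D ^ k) ∂Gam n := setLIntegral_mono mct fun g hg => by
          rw [← h.pow hk]; exact oRl (ppl ENNReal.toReal_nonneg (le_of_lt hg) k)
      _ ≤ _ := by rw [setLIntegral_const]; exact mul_le_of_le_one_right' prob_le_one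
  rw [lls (by exact (by fun_prop : Continuous fun w : Euc n × Euc n => |⟪w.1, w.2⟫| ^ k).measurable.ennreal_ofReal.aemeasurable)] at up
  have lo : ∀ z : Euc n, R ≤ ‖z‖ → oR (1 / 4 * exp (-(11 * k)) * (√k * R) ^ k) ≤ ∫⁻ g in Gd, oR (|⟪g, z⟫| ^ k) ∂Gam n := fun z hz => by
    have z0 : 0 < ‖z‖ := R0.trans_le hz
    have gl := glow (‖z‖⁻¹ • z) (norm_smul_inv_norm (𝕜 := ℝ) (norm_pos_iff.1 z0)) hk
    have sub : {g | √k ≤ |⟪g, ‖z‖⁻¹ • z⟫|} ⊆ ({g | √k * ‖z‖ ≤ |⟪g, z⟫|} ∩ Gd) ∪ {x | D ≤ ss ν k x} := fun g hg => by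
      have hg : √k ≤ |⟪g, ‖z‖⁻¹ • z⟫| := hg
      rw [rsr, abs_mul, abs_inv, abs_norm, ← div_eq_inv_mul, le_div_iff₀ z0] at hg
      rcases lt_or_ge (ss ν k g) D with q | q
      · exact Or.inl ⟨hg, q⟩
      · exact Or.inr q
    have g2 := gl.trans ((msm sub).trans ((mul' _ _).trans (add_le_add le_rfl hb)))
    have e5 : 2 * exp (-(16 * k : ℝ)) + 1 / 4 * exp (-(11 * k : ℝ)) ≤ 3 / 4 * exp (-(21 / 2 * k)) := by
      have a1 : exp (-(16 * k : ℝ)) ≤ exp (-(21 / 2 * k)) * (1 / 6) := by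
        rw [show -(16 * k : ℝ) = -(21 / 2 * k) + -(11 / 2 * k) by ring, eadd]; gcongr
        rw [Real.exp_neg, ← one_div]; exact one_div_le_one_div_of_le nN (by linarith [aoe (11 / 2 * k : ℝ)])
      have a2 : exp (-(11 * k : ℝ)) ≤ exp (-(21 / 2 * k)) := ele.2 lI
      linarith [epos (-(21 / 2 * k : ℝ))]
    have g3 : oR (1 / 4 * exp (-(11 * k))) ≤ Gam n ({g | √k * ‖z‖ ≤ |⟪g, z⟫|} ∩ Gd) := by
      refine (ENNReal.add_le_add_iff_right (ont (r := 2 * exp (-(16 * k : ℝ))))).1 (le_trans ?_ g2)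
      rw [← ora pY pY]
      exact oRl lI
    have mS : MeasurableSet {g : Euc n | √k * ‖z‖ ≤ |⟪g, z⟫|} := mbl mct fP
    rw [oRm pY]
    refine (mul_le_mul' g3 le_rfl).trans ?_
    rw [← Measure.restrict_apply mS, mul_comm, ← setLIntegral_const]
    refine (setLIntegral_mono' mS fun g (hg : _ ≤ |_|) => oRl (ppl pY (le_trans ?_ hg) k)).trans (setLIntegral_le_lintegral _ _)
    gcongr
  have mR : MeasurableSet {z : Euc n | R ≤ ‖z‖} := mbl mct fP
  have f := (setLIntegral_mono' mR lo).trans ((setLIntegral_le_lintegral _ _).trans up)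
  rw [setLIntegral_const] at f
  have e : 1 / 4 * exp (-(11 * k)) * (√k * R) ^ k = 1 / 4 * exp (8 * k) * (172800 * √(k * n)) ^ k := by
    rw [Real.sqrt_mul pY, show √k * R = exp 19 * (172800 * (√k * √n)) by simp only [R]; ring, mul_pow, ← enm, ← mul_assoc, mul_assoc (1 / 4), ← eadd]; ring_nf
  have P : 0 < (172800 * √(k * n)) ^ k := by have := Real.sqrt_pos.2 (by positivity : 0 < (k * n : ℝ)); positivity
  have f2 := f.trans (oRl (ppl D0.le hD k))
  rw [e, oRm pY, mul_comm] at f2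
  have f3 := (ENNReal.le_div_iff_mul_le (Or.inl (mul_ne_zero (ENNReal.ofReal_pos.2 pY).ne' (ENNReal.ofReal_pos.2 P).ne')) (Or.inl (ENNReal.mul_ne_top ont ont))).2 f2
  refine f3.trans (le_of_eq ?_)
  rw [← oRm pY, ← ord pY]
  congr 1
  rw [Real.exp_neg]; field_simp

lemma dif_pow (hk : 1 ≤ k) [IPM μ] (u : Euc n) : ∫⁻ z, oR (|⟪u, z⟫| ^ k) ∂dif μ ≤ oR (2 ^ k) * ∫⁻ z, oR (|⟪u, z⟫| ^ k) ∂μ := by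
  have m : Measurable fun z => oR (|⟪u, z⟫| ^ k) := (by fun_prop : Continuous fun z => |⟪u, z⟫| ^ k).measurable.ennreal_ofReal
  rw [dif_lint m]
  calc _ ≤ ∫⁻ x, ∫⁻ y, oR (2 ^ (k - 1)) * (oR (|⟪u, x⟫| ^ k) + oR (|⟪u, y⟫| ^ k)) ∂μ ∂μ := lmn fun x => lmn fun y => by
        rw [← ora pY pY, ← oRm pY]
        refine oRl (le_trans ?_ (add_pow_le (abn _) (abn _) k))
        rw [isr]
        exact ppl (abn _) (abs_sub _ _) k
    _ = oR (2 ^ (k - 1)) * ((∫⁻ z, oR (|⟪u, z⟫| ^ k) ∂μ) + ∫⁻ z, oR (|⟪u, z⟫| ^ k) ∂μ) := by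
        simp only [lcm' _ (m.const_add _), lal mct, lintegral_const, measure_univ, mul_one]
        rw [lcm' _ (m.add_const _), lal m]; simp
    _ = _ := by
        obtain ⟨j, rfl⟩ := Nat.exists_eq_add_of_le' hk
        rw [← two_mul, ← mul_assoc, Nat.add_sub_cancel, pow_succ, oRm pY]; simp

lemma Iso.mom (h : Iso n μ) {u : Euc n} (hu : ‖u‖ = 1) (k : ℕ) : ∫⁻ z, oR (|⟪u, z⟫| ^ k) ∂μ ≤ oR ((6 * k) ^ k * 300) := by
  have := h.prob
  have e := exp_moment μ (fun x => ⟪x, u⟫) fP (h.tail u hu)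
  rw [oRm pY]
  refine le_trans ?_ (mul_le_mul' le_rfl e)
  rw [← lcm' _ (by fun_prop : Measurable fun x : Euc n => exp (|⟪x, u⟫| / 6)).ennreal_ofReal]
  refine lmn fun z => ?_
  rw [← oRm pY]
  refine oRl ?_
  rw [ric]
  have p := Real.pow_div_factorial_le_exp (|⟪z, u⟫| / 6) pY k
  rw [div_pow, div_div, div_le_iff₀ pY] at p
  have q : (k.factorial : ℝ) ≤ k ^ k := by exact_mod_cast Nat.factorial_le_pow k
  calc _ ≤ _ := p
    _ ≤ exp (|⟪z, u⟫| / 6) * (6 ^ k * k ^ k) := by gcongr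
    _ = _ := by rw [mul_pow, mul_comm]

theorem paouris (hn : 1 ≤ n) (h : Iso n μ) : μ {x | (172800 * exp 19 + 2) * √n ≤ ‖x‖} ≤ oR (6 * exp (-(4 * √n))) := by
  have := h.prob
  have pr : IPM (dif μ) := Measure.isProbabilityMeasure_map fP
  set k := Nat.sqrt n
  have hk : 1 ≤ k := Nat.sqrt_pos.2 hn
  have k0 : (1 : ℝ) ≤ k := by exact_mod_cast hk
  have nb : NB (dif μ) k (3600 * k) := by
    have U : ∀ u : Euc n, ‖u‖ = 1 → eLpNorm (fun z => ⟪u, z⟫) k (dif μ) ≤ oR (3600 * k) := fun u hu => by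
      have e := eLpNorm_nnreal_pow_eq_lintegral (f := fun z => ⟪u, z⟫) (μ := dif μ) (p := (k : NNReal)) (by exact_mod_cast (by omega : k ≠ 0))
      simp only [ENNReal.coe_natCast, NNReal.coe_natCast, ENNReal.rpow_natCast, Real.enorm_eq_ofReal_abs, ← orp (abn _)] at e
      refine (ENNReal.pow_le_pow_left_iff (by omega : k ≠ 0)).1 ?_
      rw [e]
      refine (dif_pow hk u).trans ((mul_le_mul' le_rfl (h.mom hu k)).trans ?_)
      rw [← oRm pY, ← orp pY]
      refine oRl ?_
      calc _ ≤ (2 : ℝ) ^ k * ((6 * k) ^ k * 300 ^ k) := by gcongr; exact le_self_pow₀ nN (by omega)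
        _ = _ := by rw [← mul_pow, ← mul_pow]; ring_nf
    intro u
    rcases eq_or_ne u 0 with rfl | hu
    · simp
    · have e : (fun z => ⟪u, z⟫) = ‖u‖ • fun z => ⟪‖u‖⁻¹ • u, z⟫ := by
        funext z; rw [Pi.smul_apply, rsl, sem, mul_inv_cancel_left₀ (norm_ne_zero_iff.2 hu)]
      rw [e, eLpNorm_const_smul, mul_comm, oRm pY, Real.enorm_eq_ofReal_abs, abs_norm]
      exact mul_le_mul' (U _ (norm_smul_inv_norm (𝕜 := ℝ) hu)) le_rfl
  have h2 : ∀ u : Euc n, ∫⁻ z, oR (⟪u, z⟫ ^ 2) ∂dif μ ≤ oR (4 * ‖u‖ ^ 2) := fun u => by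
    have := dif_pow (k := 2) (μ := μ) one_le_two u
    simp only [sq_abs] at this
    refine this.trans_eq ?_
    have i := h.int u
    have s := h.sq u
    simp only [ric] at i s
    rw [← oie i (aoa _ fun _ => sqn _), s, ← oRm pY]; norm_num
  have Z := bigZ hk (Nat.sqrt_le' n) (dif_lc h.lc) (fun f hf => dif_even hf) nb h2
  set R := 172800 * exp 19 * √n
  rw [dif, Measure.map_apply fP (mbl mct fP)] at Z
  have sn : 0 < √n := Real.sqrt_pos.2 (by exact_mod_cast hn)
  have small : oR (3 / 4) ≤ μ {x | ‖x‖ < 2 * √n} := by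
    have q := prob_compl_eq_one_sub (μ := μ) (mbl (mct (a := 2 * √n)) measurable_norm : MeasurableSet {x : Euc n | 2 * √n ≤ ‖x‖})
    have M := mmg (μ := μ) (f := fun x => ‖x‖ ^ 2) (aoa _ fun x => sqn _) h.nsq.1 (4 * n)
    rw [h.nsq.2] at M
    have M : μ.real {x | 2 * √n ≤ ‖x‖} ≤ 1 / 4 := by
      have e : μ.real {x | 2 * √n ≤ ‖x‖} ≤ μ.real {x | (4 * n : ℝ) ≤ ‖x‖ ^ 2} := measureReal_mono fun x (hx : _ ≤ ‖x‖) => by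
        have := ppl pY hx 2
        rw [mul_pow, Real.sq_sqrt pY] at this
        show _ ≤ ‖x‖ ^ 2
        linarith
      have n0 : (0 : ℝ) < n := by exact_mod_cast hn
      refine e.trans (lml ?_ n0)
      linarith
    rw [show {x : Euc n | ‖x‖ < 2 * √n} = {x | 2 * √n ≤ ‖x‖}ᶜ by ext x; exact (not_le (a := 2 * √n)).symm, q, ← ofReal_measureReal, ← oro, ← ENNReal.ofReal_sub _ measureReal_nonneg]
    exact oRl lI
  have pp : μ {x | (172800 * exp 19 + 2) * √n ≤ ‖x‖} * oR (3 / 4) ≤ oR (4 * exp (-(8 * k))) := by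
    refine (mul_le_mul' le_rfl small).trans ?_
    rw [← mpp]
    refine (msm fun w hw => ?_).trans Z
    have a : (172800 * exp 19 + 2) * √n ≤ ‖w.1‖ := hw.1
    have b : ‖w.2‖ < 2 * √n := hw.2
    have := norm_sub_norm_le w.1 w.2
    show R ≤ ‖w.1 - w.2‖
    simp only [R]; linarith
  have := (ENNReal.le_div_iff_mul_le (Or.inl nN) (Or.inl ont)).2 pp
  refine this.trans ?_
  rw [← ord nN]
  refine oRl ?_
  have sq : √n ≤ k + 1 := by
    refine Real.sqrt_le_iff.2 ⟨by positivity, ?_⟩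
    have := (Nat.lt_succ_sqrt' n).le
    exact_mod_cast this
  have : exp (-(8 * k : ℝ)) ≤ exp (-(4 * √n)) := ele.2 lI
  linarith [epos (-(4 * √n))]
end

section
open ProbabilityTheory
variable {n : ℕ} {μ : Measure (Euc n)} {ι Ω : Type*} [Fintype ι] [MeasurableSpace Ω] {P : Measure Ω}

lemma chern [IPM P] {φ : Ω → ℝ} (h0 : ∀ x, 0 ≤ φ x) (hi : Integrable φ P) {a b : ℝ} (hb : ∫ x, φ x ∂P ≤ b) (ha : 0 < a) :
    (Measure.pi fun _ : ι => P) {y | a ≤ ∏ j, φ (y j)} ≤ oR (b ^ Fintype.card ι / a) := by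
  have i := mmg (μ := Measure.pi fun _ : ι => P) (f := fun y => ∏ j, φ (y j)) (.of_forall fun y => Finset.prod_nonneg fun j _ => h0 _) (Integrable.fintype_prod fun _ => hi) a
  rw [integral_fintype_prod_eq_pow] at i
  rw [← ofReal_measureReal]
  refine oRl ((le_div_iff₀' ha).2 (i.trans (ppl (inn h0) hb _)))

open Classical in
lemma cnt [IPM P] {Z : Set Ω} (hZ : MeasurableSet Z) {q : ℝ} (q0 : 0 < q) (q1 : q ≤ 1) (h : P Z ≤ oR q) (r : ℕ) :
    (Measure.pi fun _ : ι => P) {y | r ≤ (Finset.univ.filter fun j => y j ∈ Z).card} ≤ oR (2 ^ Fintype.card ι * q ^ r) := by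
  have i1 : 1 ≤ q⁻¹ := (one_le_inv₀ q0).2 q1
  have m : Integrable (Z.indicator fun _ => q⁻¹ - 1) P := (ict _).indicator hZ
  have hb : ∫ x, (1 + Z.indicator (fun _ => q⁻¹ - 1) x) ∂P ≤ 2 := by
    rw [iad (ict _) m, integral_indicator hZ, setIntegral_const, integral_const, probReal_univ, sem, sem]
    have : P.real Z ≤ q := tlo q0.le h
    have := mlr this (sub_nonneg.2 i1)
    rw [mul_sub q, mul_inv_cancel₀ q0.ne'] at this
    linarith
  have e : ∀ x, 1 + Z.indicator (fun _ => q⁻¹ - 1) x = if x ∈ Z then q⁻¹ else 1 := fun x => by by_cases hx : x ∈ Z <;> simp [hx]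
  have c := chern (ι := ι) (φ := fun x => 1 + Z.indicator (fun _ => q⁻¹ - 1) x) (fun x => by rw [e]; split_ifs <;> linarith) ((ict (1 : ℝ)).add m) hb (a := q⁻¹ ^ r) pY
  rw [inv_pow, div_inv_eq_mul] at c
  refine (msm fun y (hy : r ≤ _) => ?_).trans c
  show (q ^ r)⁻¹ ≤ ∏ j, (1 + Z.indicator (fun _ => q⁻¹ - 1) (y j))
  simp only [e, Finset.prod_ite, Finset.prod_const, one_pow, mul_one]
  rw [← inv_pow]
  exact ppr i1 hy

def cL : ℝ := 1 / 30000
def L1 (y : ι → Euc n) : Prop := ∀ u, cL / 8 * Fintype.card ι * ‖u‖ ≤ ∑ j, |⟪y j, u⟫| ∧ ∑ j, |⟪y j, u⟫| ≤ 84 * Fintype.card ι * ‖u‖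

lemma l1u (h : Iso n μ) {u : Euc n} (hu : ‖u‖ = 1) : (Measure.pi fun _ : ι => μ) {y | 42 * Fintype.card ι ≤ ∑ j, |⟪y j, u⟫|} ≤ oR (exp (-Fintype.card ι)) := by
  have := h.prob
  have m : Measurable fun x : Euc n => ⟪x, u⟫ := by fun_prop
  have e := exp_moment μ (fun x => ⟪x, u⟫) m (h.tail u hu)
  have mm : AEStronglyMeasurable (fun x => exp (|⟪x, u⟫| / 6)) μ := (by fun_prop : Measurable fun x => exp (|⟪x, u⟫| / 6)).aestronglyMeasurable
  have i : Integrable (fun x => exp (|⟪x, u⟫| / 6)) μ := ⟨mm, by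
    rw [hasFiniteIntegral_iff_ofReal (.of_forall fun x => (epos _).le)]; exact e.trans_lt olt⟩
  have b : ∫ x, exp (|⟪x, u⟫| / 6) ∂μ ≤ exp 6 := by
    rw [iel (.of_forall fun x => (epos _).le) mm]
    refine (tlo nN e).trans ?_
    have := ppl nN (Real.exp_one_gt_d9).le 6
    rw [← enm] at this; norm_num at this ⊢; linarith
  refine (msm fun y (hy : _ ≤ (_ : ℝ)) => ?_).trans ((chern (ι := ι) (fun x => (epos _).le) i b (epos (7 * Fintype.card ι))).trans_eq ?_)
  · show _ ≤ ∏ j, exp (|⟪y j, u⟫| / 6)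
    rw [← Real.exp_sum, ← Finset.sum_div]
    exact ele.2 lI
  · rw [← enm, ← Real.exp_sub]; ring_nf

lemma l1l (h : Iso n μ) {u : Euc n} (hu : ‖u‖ = 1) : (Measure.pi fun _ : ι => μ) {y | ∑ j, |⟪y j, u⟫| ≤ cL / 4 * Fintype.card ι} ≤ oR (exp (-(cL ^ 2 / 4 * Fintype.card ι))) := by
  have := h.prob
  have c0 : 0 < cL := by norm_num [cL]
  have m4 := h.mom hu 4
  have i4' : ∀ x : Euc n, |⟪u, x⟫| ^ 4 = ⟪x, u⟫ ^ 4 := fun x => by rw [ric, pow_abs, aon pY]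
  simp only [i4'] at m4
  have mm : AEStronglyMeasurable (fun x => ⟪x, u⟫ ^ 4) μ := (by fun_prop : Measurable fun x => ⟪x, u⟫ ^ 4).aestronglyMeasurable
  have p4 : 0 ≤ᵐ[μ] fun x => ⟪x, u⟫ ^ 4 := .of_forall fun x => by positivity
  have i4 : Integrable (fun x => ⟪x, u⟫ ^ 4) μ := ⟨mm, by rw [hasFiniteIntegral_iff_ofReal p4]; exact m4.trans_lt olt⟩
  have b4 : ∫ x, ⟪x, u⟫ ^ 4 ∂μ ≤ 10 ^ 8 := by
    rw [iel p4 mm]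
    exact (tlo pY m4).trans nN
  have i : Integrable (fun x => exp (-(cL * |⟪x, u⟫|))) μ := Integrable.of_bound (C := 1) (by fun_prop : Measurable fun x => exp (-(cL * |⟪x, u⟫|))).aestronglyMeasurable (.of_forall fun x => by
    rw [rna, Real.abs_exp, Real.exp_le_one_iff]; have := abn ⟪x, u⟫; have := mnn c0.le this; linarith)
  have pt : ∀ x : Euc n, exp (-(cL * |⟪x, u⟫|)) ≤ 1 + ((cL ^ 2 / 2 - cL / 20000) * ⟪x, u⟫ ^ 2 + cL / 20000 ^ 3 * ⟪x, u⟫ ^ 4) := fun x => by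
    set t := |⟪x, u⟫|
    have t0 : 0 ≤ t := abn _
    rw [show ⟪x, u⟫ ^ 2 = t ^ 2 from (sq_abs _).symm, show ⟪x, u⟫ ^ 4 = t ^ 4 by rw [pow_abs, aon pY]]
    have e1 : exp (-(cL * t)) ≤ 1 - cL * t + (cL * t) ^ 2 / 2 := by
      have s0 := mnn c0.le t0
      rw [Real.exp_neg, inv_le_iff_one_le_mul₀ (epos _)]
      refine le_trans ?_ (mll (Real.quadratic_le_exp_of_nonneg s0) (by linarith [sqn (cL * t - 1)]))
      linarith [sqn ((cL * t) ^ 2)]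
    have e2 : t ^ 2 / 20000 - t ^ 4 / 20000 ^ 3 ≤ t := by
      rcases le_or_gt t 20000 with q | q
      · have : t * t ≤ 20000 * t := mlr q t0
        have : 0 ≤ t ^ 4 := by positivity
        linarith
      · have := mll (ppl nN q.le 2) (sqn t)
        linarith
    have := mll e2 c0.le
    linarith
  have b : ∫ x, exp (-(cL * |⟪x, u⟫|)) ∂μ ≤ exp (-(cL ^ 2 / 2)) := by
    refine (imn (g := fun x => 1 + ((cL ^ 2 / 2 - cL / 20000) * ⟪x, u⟫ ^ 2 + cL / 20000 ^ 3 * ⟪x, u⟫ ^ 4)) i ((ict _).add (((h.int u).const_mul _).add (i4.const_mul _))) pt).trans ?_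
    rw [iad (ict _) (by exact ((h.int u).const_mul _).add (i4.const_mul _)), iad ((h.int u).const_mul _) (i4.const_mul _), icm, icm, h.sq, hu, integral_const, probReal_univ]
    refine le_trans ?_ (aoe _)
    have := mll b4 (by positivity : 0 ≤ cL / 20000 ^ 3)
    norm_num [cL] at this ⊢
    linarith
  refine (msm fun y (hy : _ ≤ (_ : ℝ)) => ?_).trans ((chern (ι := ι) (fun x => (epos _).le) i b (epos (-(cL ^ 2 / 4 * Fintype.card ι)))).trans_eq ?_)
  · show _ ≤ ∏ j, exp (-(cL * |⟪y j, u⟫|))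
    rw [← Real.exp_sum, Finset.sum_neg_distrib, ← fms]
    have := mll hy c0.le
    exact ele.2 lI
  · rw [← enm, ← Real.exp_sub]; ring_nf

lemma l1 (h : Iso n μ) (hN : 144 / cL ^ 2 * n ≤ Fintype.card ι) :
    (Measure.pi fun _ : ι => μ) {y | ¬ L1 y} ≤ oR (2 * exp (-(cL ^ 2 / 8 * Fintype.card ι))) := by
  set N : ℝ := (Fintype.card ι : ℝ)
  have c0 : 0 < cL := by norm_num [cL]
  obtain ⟨A, A1, Ac, An⟩ := net n (δ := 1 / 2) nN
  obtain ⟨B, B1, Bc, Bn⟩ := net n (δ := cL / 672) pY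
  have sub : {y : ι → Euc n | ¬ L1 y} ⊆ (⋃ u ∈ A, {y | 42 * N ≤ ∑ j, |⟪y j, u⟫|}) ∪ ⋃ u ∈ B, {y | ∑ j, |⟪y j, u⟫| ≤ cL / 4 * N} := fun y hy => by
    by_contra hh
    rw [mem_union, not_or] at hh
    have hA : ∀ u ∈ A, ∑ j, |⟪y j, u⟫| ≤ 42 * N := fun u hu => le_of_not_ge fun q => hh.1 (mem_biUnion hu q)
    have hB : ∀ u ∈ B, cL / 4 * N ≤ ∑ j, |⟪y j, u⟫| := fun u hu => le_of_not_ge fun q => hh.2 (mem_biUnion hu q)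
    have fa : ∀ s t, ∑ j, |⟪y j, s + t⟫| ≤ ∑ j, |⟪y j, s⟫| + ∑ j, |⟪y j, t⟫| := fun s t => by
      rw [← fad]; exact fsl fun j _ => by rw [inner_add_right]; exact abs_add_le _ _
    have fs : ∀ (c : ℝ) t, ∑ j, |⟪y j, c • t⟫| = |c| * ∑ j, |⟪y j, t⟫| := fun c t => by simp only [rsr, abs_mul, fms]
    have up := seminet fa fs fP nN An hA
    norm_num at up
    refine hy fun u => ⟨?_, by linarith [up u]⟩
    have l : ∀ t, ‖t‖ = 1 → cL / 8 * N ≤ ∑ j, |⟪y j, t⟫| := fun t ht => by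
      obtain ⟨s, hs, hd⟩ := Bn t ht
      have u2 := fa t (s - t)
      have v2 := (up (s - t)).trans (mll ((norm_sub_rev _ _).trans_le hd) pY)
      rw [add_sub_cancel] at u2
      linarith [hB s hs]
    rcases eq_or_ne u 0 with rfl | hv
    · simp
    · have : u = ‖u‖ • (‖u‖⁻¹ • u) := by rw [smul_smul, mul_inv_cancel₀ (norm_ne_zero_iff.2 hv), one_smul]
      conv_rhs => rw [this]
      rw [fs, abs_norm, mul_comm]
      exact mll (l _ (norm_smul_inv_norm (𝕜 := ℝ) hv)) (nnn _)
  have key : ∀ (S : Finset (Euc n)) (F : Euc n → Set (ι → Euc n)) (a b : ℝ), (S.card : ℝ) ≤ exp a ^ n → (∀ u ∈ S, (Measure.pi fun _ : ι => μ) (F u) ≤ oR (exp b)) → n * a + b ≤ -(cL ^ 2 / 8 * N) →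
      (Measure.pi fun _ : ι => μ) (⋃ u ∈ S, F u) ≤ oR (exp (-(cL ^ 2 / 8 * N))) := fun S F a b h1 h2 h3 => by
    refine (measure_biUnion_finset_le S _).trans ((fcn S _ _ h2).trans ?_)
    rw [nem, ← orn, ← oRm pY]
    refine oRl ((mlr h1 (epos b).le).trans ?_)
    rw [← enm, ← eadd]; exact ele.2 h3
  rw [div_mul_eq_mul_div, div_le_iff₀ pY] at hN
  have N0 : 0 ≤ N := by positivity
  have n0 : (0 : ℝ) ≤ n := by positivity
  have pe : ∀ k : ℕ, (2.7 : ℝ) ^ k ≤ exp k := fun k => by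
    have := ppl nN (by linarith [Real.exp_one_gt_d9] : 2.7 ≤ exp 1) k
    rwa [← enm, mul_one] at this
  have k1 := key A _ 2 (-N) (Ac.trans (ppl nN (by have := pe 2; norm_num at this ⊢; linarith) n)) (fun u hu => l1u h (A1 u hu)) (by
    have : N * cL ^ 2 ≤ N * (1 / 4) := mll (by norm_num [cL]) N0
    linarith)
  have k2 := key B _ 18 (-(cL ^ 2 / 4 * N)) (Bc.trans (ppl pY (by have := pe 18; norm_num [cL] at this ⊢; linarith) n)) (fun u hu => l1l h (B1 u hu)) lI
  refine (msm sub).trans ((mul' _ _).trans ((add_le_add k1 k2).trans_eq ?_))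
  rw [← ora pY pY]; ring_nf
end

section
open ProbabilityTheory
variable {n m k : ℕ}

lemma maurey {S : Set (Euc n)} {C : ℝ} (hS : ∀ a ∈ S, ‖a‖ ≤ C) {v : Euc n} (hv : v ∈ convexHull ℝ S) (k : ℕ) : ∃ f : Fin k → Euc n, (∀ i, f i ∈ S) ∧ ‖∑ i, f i - (k : ℝ) • v‖ ^ 2 ≤ k * C ^ 2 := by
  induction k with
  | zero => exact ⟨Fin.elim0, fun i => i.elim0, by simp⟩
  | succ k ih =>
    obtain ⟨f, hf, h⟩ := ih
    obtain ⟨s, es⟩ : ∃ s, s = ∑ i, f i - (k : ℝ) • v := ⟨_, rfl⟩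
    rw [← es] at h
    obtain ⟨a, ha, h2⟩ : ∃ a ∈ S, ⟪s - v, a⟫ ≤ ⟪s - v, v⟫ := by
      by_contra! hh
      exact lt_irrefl _ (show ⟪s - v, v⟫ < ⟪s - v, v⟫ from convexHull_min (fun a ha => hh a ha) (convex_halfSpace_gt (innerSL ℝ (s - v)).isLinear _) hv)
    refine ⟨Fin.cons a f, fun i => by refine Fin.cases ?_ ?_ i; exacts [ha, hf], ?_⟩
    rw [Fin.sum_cons, show a + ∑ i, f i - ((k + 1 : ℕ) : ℝ) • v = s + (a - v) by rw [es]; push_cast; module, norm_add_sq_real, norm_sub_sq_real]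
    rw [inner_sub_left, inner_sub_left s, rin] at h2
    rw [isr]
    have := ppl (nnn _) (hS a ha) 2
    push_cast
    linarith [sqn ‖v‖, ric v a]

def pw (s : Sym (Fin m × Bool) k) (x : Fin m → Euc n) : Euc n := (k : ℝ)⁻¹ • (s.1.map fun p => if p.2 then x p.1 else -x p.1).sum

lemma pw_cont (s : Sym (Fin m × Bool) k) : Continuous (pw (n := n) s) := by
  refine (continuous_multiset_sum (f := fun (p : Fin m × Bool) (x : Fin m → Euc n) => if p.2 then x p.1 else -x p.1) s.1 fun p _ => ?_).const_smul (k : ℝ)⁻¹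
  split_ifs <;> fun_prop

lemma pw_ex {x : Fin m → Euc n} {C : ℝ} (C0 : 0 ≤ C) (hx : ∀ i, ‖x i‖ ≤ C) {v : Euc n} (hv : v ∈ absConv n (range x)) (hk : 1 ≤ k) : ∃ s : Sym (Fin m × Bool) k, ‖v - pw s x‖ ^ 2 ≤ C ^ 2 / k := by
  obtain ⟨f, hf, h⟩ := maurey (C := C) (by rintro a (⟨i, rfl⟩ | ⟨i, hi⟩); exacts [hx i, by rw [← norm_neg, ← hi]; exact hx i]) hv k
  have : ∀ i, ∃ p : Fin m × Bool, f i = if p.2 then x p.1 else -x p.1 := fun i => by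
    rcases hf i with ⟨j, hj⟩ | ⟨j, hj⟩
    exacts [⟨(j, true), by simp [hj]⟩, ⟨(j, false), by simp [hj]⟩]
  choose g hg using this
  have k0 : (0 : ℝ) < k := by exact_mod_cast hk
  refine ⟨⟨Finset.univ.val.map g, by simp⟩, ?_⟩
  have e : v - pw (⟨Finset.univ.val.map g, by simp⟩ : Sym (Fin m × Bool) k) x = -((k : ℝ)⁻¹ • (∑ i, f i - (k : ℝ) • v)) := by
    unfold pw; rw [Multiset.map_map, smul_sub, inv_smul_smul₀ k0.ne', neg_sub]
    congr 3
    exact Multiset.map_congr rfl fun i _ => (hg i).symm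
  rw [e, norm_neg, norm_smul, norm_inv, Real.norm_natCast, mul_pow]
  refine (mll h pY).trans_eq ?_
  field_simp

lemma symc {η l : ℝ} (h0 : 0 < η) (hn : 1 ≤ n) (km : k ≤ m) (hl : l = Real.log (1 + (m : ℝ) / n)) (l9 : Real.log (9 / η) ≤ l) (l0 : 0 < l) (k1 : η * n / l ≤ k) (k2 : k ≤ 2 * η * n / l) :
    (Fintype.card (Sym (Fin m × Bool) k) : ℝ) ≤ exp (6 * η * n) := by
  have n0 : (0 : ℝ) < n := by exact_mod_cast hn
  have km' : (k : ℝ) ≤ m := by exact_mod_cast km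
  have f0 : (0 : ℝ) < k.factorial := by exact_mod_cast k.factorial_pos
  rw [le_div_iff₀ l0] at k2
  have e1 : exp l = 1 + (m : ℝ) / n := by rw [hl, Real.exp_log pY]
  have e2 : (m : ℝ) / n ≤ exp l := by linarith
  have e3 : l ≤ exp l := by linarith [aoe l]
  have e4 : 9 / η ≤ exp l := (Real.log_le_iff_le_exp pY).1 l9
  have e5 : 3 * (m : ℝ) ≤ k * exp (3 * l - 1) := by
    have : 9 / η * ((m : ℝ) / n * l) ≤ exp l * (exp l * exp l) := by gcongr
    have := mlm k1 this pY pY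
    rw [show η * n / l * (9 / η * ((m : ℝ) / n * l)) = 9 * m by field_simp, ← eadd, ← eadd, show l + (l + l) = 1 + (3 * l - 1) by ring, eadd] at this
    have e : k * (exp 1 * exp (3 * l - 1)) ≤ 3 * (k * exp (3 * l - 1)) := by
      rw [mul_left_comm]; gcongr; linarith [Real.exp_one_lt_d9]
    linarith
  have c : (Fintype.card (Sym (Fin m × Bool) k) : ℝ) ≤ (3 * m) ^ k / k.factorial := by
    rw [Sym.card_sym_eq_choose]
    refine (Nat.choose_le_pow_div k _).trans (div_le_div_of_nonneg_right (ppl pY ?_ k) f0.le)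
    have : Fintype.card (Fin m × Bool) + k - 1 ≤ 3 * m := by simp; omega
    exact_mod_cast this
  refine c.trans ((div_le_div_of_nonneg_right (ppl pY e5 k) f0.le).trans ?_)
  rw [mul_pow, mul_div_right_comm]
  refine (mlr (Real.pow_div_factorial_le_exp (k : ℝ) pY k) pY).trans ?_
  rw [← enm, ← eadd]
  exact ele.2 lI

lemma svd (T : Euc n ≃ₗ[ℝ] Euc n) : ∃ (b : Fin n → Euc n) (S : Finset (Fin n)), Orthonormal ℝ b ∧ n ≤ 2 * S.card ∧ ((∀ v, ∑ i ∈ S, ⟪b i, T.symm v⟫ ^ 2 ≤ ‖v‖ ^ 2) ∨ ∀ v, ∑ i ∈ S, ⟪b i, T v⟫ ^ 2 ≤ ‖v‖ ^ 2) := by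
  let A := T.toLinearMap
  have hA : (A.adjoint ∘ₗ A).IsSymmetric := fun x y => by
    rw [LinearMap.comp_apply, LinearMap.comp_apply, LinearMap.adjoint_inner_left, LinearMap.adjoint_inner_right]
  let v := hA.eigenvectorBasis (n := n) (by simp)
  let l := hA.eigenvalues (n := n) (by simp)
  have hv : ∀ i w, ⟪A (v i), A w⟫ = l i * ⟪v i, w⟫ := fun i w => by
    rw [← LinearMap.adjoint_inner_left, ← LinearMap.comp_apply, hA.apply_eigenvectorBasis, rsl]; rfl
  have vn : ∀ i, ⟪v i, v i⟫ = 1 := fun i => by rw [rin, v.norm_eq_one, one_pow]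
  have l0 : ∀ i, 0 < l i := fun i => by
    have := hv i (v i)
    rw [vn, mul_one] at this
    rw [← this]
    refine real_inner_self_pos.2 fun h => ?_
    have h : v i = 0 := T.map_eq_zero_iff.1 h
    have := vn i
    simp [h] at this
  have sm : ∀ w, ∑ i, l i * ⟪v i, w⟫ ^ 2 = ‖A w‖ ^ 2 := fun w => by
    rw [← rin]
    have e : A w = ∑ i, (v.repr w i) • A (v i) := by conv_lhs => rw [← v.sum_repr w, map_sum]; simp only [map_smul]
    conv_rhs => rw [show ⟪A w, A w⟫ = ⟪∑ i, (v.repr w i) • A (v i), A w⟫ by rw [← e], sum_inner]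
    refine fsc rfl fun i _ => ?_
    rw [rsl, hv, v.repr_apply_apply]; ring
  have c := Finset.card_filter_add_card_filter_not (s := (Finset.univ : Finset (Fin n))) fun i => 1 ≤ l i
  rw [fcu, fcf] at c
  rcases le_or_gt n (2 * (Finset.univ.filter fun i => 1 ≤ l i).card) with q | q
  · refine ⟨v, _, v.orthonormal, q, Or.inl fun w => ?_⟩
    have := sm (T.symm w)
    rw [show A (T.symm w) = w from T.apply_symm_apply w] at this
    rw [← this]
    refine (fsl fun i hi => ?_).trans (fss (Finset.subset_univ _) fun i _ _ => mnn (l0 i).le (sqn _))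
    exact lmo (sqn _) (Finset.mem_filter.1 hi).2
  · refine ⟨fun i => (√(l i))⁻¹ • A (v i), Finset.univ.filter fun i => ¬ 1 ≤ l i, ?_, by omega, Or.inr fun w => ?_⟩
    · rw [orthonormal_iff_ite]
      intro i j
      rw [rsl, rsr, hv, orthonormal_iff_ite.1 v.orthonormal]
      split_ifs with h
      · subst h; have := Real.mul_self_sqrt (l0 i).le; have := Real.sqrt_pos.2 (l0 i); field_simp; linarith
      · simp
    · rw [← onb_sq v w]
      refine (fsl fun i hi => ?_).trans (fss (Finset.subset_univ _) fun i _ _ => sqn _)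
      rw [rsl, show T w = A w from rfl, hv, mul_pow, inv_pow, Real.sq_sqrt (l0 i).le, mul_pow]
      have : (l i)⁻¹ * (l i ^ 2 * ⟪v i, w⟫ ^ 2) = l i * ⟪v i, w⟫ ^ 2 := by have := (l0 i).ne'; field_simp
      rw [this]
      exact mul_le_of_le_one_left (sqn _) (not_le.1 (Finset.mem_filter.1 hi).2).le
end

section
open ProbabilityTheory
variable {n : ℕ} {μ : Measure (Euc n)} {ι₁ ι₂ β : Type*} [Fintype ι₁] [Fintype ι₂] [Fintype β]

lemma gabs : ∃ κ : ℝ, 0 < κ ∧ ∀ (n : ℕ) (v : Euc n), HasI (Gam n) (fun g => |⟪v, g⟫|) (κ * ‖v‖) := by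
  have i : Integrable (fun t => |t|) (gaussianReal 0 1) := (IsGaussian.integrable_id (μ := gaussianReal 0 1)).abs
  refine ⟨∫ t, |t| ∂gaussianReal 0 1, (integral_pos_iff_support_of_nonneg (fun t => abn t) i).2 ?_, fun n v => ?_⟩
  · have : Function.support (fun t : ℝ => |t|) = {0}ᶜ := by ext t; simp
    have na := noAtoms_gaussianReal (μ := 0) (v := 1) one_ne_zero
    rw [this, measure_compl (measurableSet_singleton _) (measure_ne_top _ _), measure_singleton, measure_univ]; simp
  rcases eq_or_ne v 0 with rfl | hv
  · simpa using HasI.con (π := Gam n) 0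
  have u1 := norm_smul_inv_norm (𝕜 := ℝ) hv
  set u := ‖v‖⁻¹ • v
  have mp := IsGaussian.map_eq_gaussianReal (μ := Gam n) (innerSL ℝ u)
  rw [integral_strongDual_stdGaussian, variance_dual_stdGaussian, innerSL_apply_norm, show ‖u‖ = 1 from u1, one_pow, Real.toNNReal_one] at mp
  have m : AEMeasurable (innerSL ℝ u) (Gam n) := by fun_prop
  have h : HasI (Gam n) (fun g => |⟪u, g⟫|) (∫ t, |t| ∂gaussianReal 0 1) := by
    rw [← mp] at i ⊢
    exact ⟨i.comp_aemeasurable m, (integral_map m fP).symm⟩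
  have h2 := h.mul ‖v‖
  rw [mul_comm] at h2
  convert h2 using 2 with g
  rw [rsl, abs_mul, abs_inv, abs_norm, mul_inv_cancel_left₀ (norm_ne_zero_iff.2 hv)]

lemma gav {y₁ : ι₁ → Euc n} {y₂ : ι₂ → Euc n} (h1 : L1 y₁) (h2 : L1 y₂) (D : Euc n →L[ℝ] Euc n) :
    cL / 8 * Fintype.card ι₁ * ∑ j, ‖D (y₂ j)‖ ≤ 84 * Fintype.card ι₂ * ∑ j, ‖D (y₁ j)‖ := by
  obtain ⟨κ, k0, hk⟩ := gabs
  have c0 : 0 < cL := by norm_num [cL]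
  have := HasI.le ((HasI.sum fun j => hk n (D (y₂ j))).mul (cL / 8 * Fintype.card ι₁)) ((HasI.sum fun j => hk n (D (y₁ j))).mul (84 * Fintype.card ι₂)) (.of_forall fun g => by
    simp only [← ContinuousLinearMap.adjoint_inner_right]
    have a := (h1 (D.adjoint g)).1
    have b := (h2 (D.adjoint g)).2
    refine (mll b pY).trans ?_
    refine le_trans (le_of_eq (by ring)) (mll a pY))
  simp only [← fms] at this
  exact lml lI k0

structure Rl (S : Finset (Fin n)) (T U : Euc n →L[ℝ] Euc n) (b : Fin n → Euc n) : Prop where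
  u : U.comp T = .id ℝ _
  o : Orthonormal ℝ b
  c : ∀ v, ∑ i ∈ S, ⟪b i, U v⟫ ^ 2 ≤ ‖v‖ ^ 2

def rho : ℝ := 1 / (4 * (1344 * 8 / cL + 1))

open Classical in
lemma sec (h : Iso n μ) {Y : Set (Euc n)} (Ym : MeasurableSet Y) {d : ℝ≥0∞} (hY : ∀ b S a, n ≤ 2 * S.card → μ (Y ∩ sl b S a) ≤ d)
    {S : Finset (Fin n)} (hS : n ≤ 2 * S.card) (w : β → Euc n) (a : ι₁ → Euc n) {y₁ : ι₁ → Euc n} (h1 : L1 y₁) (hn : 1 ≤ n) (hN : 0 < Fintype.card ι₁)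
    {q : ℝ} (q0 : 0 < q) (q1 : q ≤ 1) (hq : Fintype.card β * d ≤ oR q) :
    (Measure.pi fun _ : ι₂ => μ) {y | (L1 y ∧ 2 * (Finset.univ.filter fun j => y j ∈ Yᶜ).card ≤ Fintype.card ι₂) ∧ ∃ T U b, Rl S T U b ∧ (∀ j, ‖T (y₁ j) - a j‖ ≤ rho * √n) ∧ ∀ j, ∃ k, ‖T (y j) - w k‖ ≤ rho * √n}
      ≤ oR (2 ^ Fintype.card ι₂ * q ^ (Fintype.card ι₂ / 4)) := by
  have := h.prob
  set N := Fintype.card ι₁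
  set M := Fintype.card ι₂
  have c0 : 0 < cL := by norm_num [cL]
  have r0 : 0 < rho := by unfold rho; positivity
  have s0 : 0 < √(n : ℝ) := Real.sqrt_pos.2 (by exact_mod_cast hn)
  by_cases hz : ∃ T U b, Rl S T U b ∧ ∀ j, ‖T (y₁ j) - a j‖ ≤ rho * √n
  swap
  · refine (measure_mono_null (t := ∅) (fun y hy => hz ?_) measure_empty).trans_le zero_le'
    obtain ⟨-, T, U, b, h, h', -⟩ := hy
    exact ⟨T, U, b, h, h'⟩
  obtain ⟨T, U, b, hR, hT⟩ := hz
  have : Nonempty (Fin n) := ⟨⟨0, hn⟩⟩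
  let B : ONB n := (basisOfOrthonormalOfCardEqFinrank hR.o (by simp)).toOrthonormalBasis (by rw [coe_basisOfOrthonormalOfCardEqFinrank]; exact hR.o)
  have hB : ∀ i, B i = b i := fun i => by simp [B]
  let Z := ⋃ k, Y ∩ sl B S (U (w k))
  have Zm : MeasurableSet Z := .iUnion fun k => Ym.inter (sl_cl _ _ _).measurableSet
  have hZ : μ Z ≤ oR q := by
    refine (measure_iUnion_fintype_le _ _).trans (le_trans ?_ hq)
    refine (fcn _ _ _ fun k _ => hY B S _ hS).trans_eq ?_
    rw [nem, fcu]
  refine (msm fun y hy => ?_).trans (cnt Zm q0 q1 hZ (M / 4))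
  obtain ⟨⟨h2, hc⟩, T', U', b', -, hT', hy⟩ := hy
  have g := gav h1 h2 (T' - T)
  have s1 : ∑ j, ‖(T' - T) (y₁ j)‖ ≤ N * (2 * rho * √n) := by
    refine (fcn _ _ _ fun j _ => ?_).trans_eq (by rw [nem, fcu])
    have : (T' - T) (y₁ j) = (T' (y₁ j) - a j) - (T (y₁ j) - a j) := by rw [sub_apply]; abel
    rw [this]
    linarith [norm_sub_le (T' (y₁ j) - a j) (T (y₁ j) - a j), hT j, hT' j]
  set K := 1344 * 8 / cL * (rho * √n) with hK
  have K0 : 0 < K := by positivity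
  let bad := Finset.univ.filter fun j => K < ‖(T' - T) (y j)‖
  have hb : bad.card * K ≤ ∑ j, ‖(T' - T) (y j)‖ := by
    rw [← nem]
    exact (Finset.card_nsmul_le_sum bad _ _ fun j hj => (Finset.mem_filter.1 hj).2.le).trans (fss (Finset.subset_univ _) fun _ _ _ => nnn _)
  have hb8 : 8 * bad.card ≤ M := by
    have N0 : (0 : ℝ) < N := by exact_mod_cast hN
    have e1 := (mll hb (by positivity : 0 ≤ cL / 8 * N)).trans (g.trans (mll s1 pY))
    have e2 : (8 * bad.card : ℝ) * (168 * N * (rho * √n)) ≤ M * (168 * N * (rho * √n)) := by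
      refine le_trans (le_of_eq ?_) (e1.trans_eq ?_)
      · rw [hK]; field_simp; ring
      · ring
    exact_mod_cast le_of_mul_le_mul_right e2 pY
  have cov : (Finset.univ : Finset ι₂) ⊆ (Finset.univ.filter fun j => y j ∈ Yᶜ) ∪ (bad ∪ Finset.univ.filter fun j => y j ∈ Z) := fun j _ => by
    rw [Finset.mem_union, Finset.mem_union, Finset.mem_filter, Finset.mem_filter, Finset.mem_filter]
    by_contra hh
    push Not at hh
    have jY : y j ∈ Y := by simpa using hh.1 (Finset.mem_univ _)
    have jb := hh.2.1 (Finset.mem_univ _)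
    obtain ⟨k, hk⟩ := hy j
    refine hh.2.2 (Finset.mem_univ _) (mem_iUnion.2 ⟨k, jY, ?_⟩)
    show ∑ i ∈ S, ⟪B i, y j - U (w k)⟫ ^ 2 ≤ n / 16
    simp only [hB]
    have : y j - U (w k) = U (T (y j) - w k) := by rw [map_sub, ← ContinuousLinearMap.comp_apply, hR.u, ContinuousLinearMap.id_apply]
    rw [this]
    refine (hR.c _).trans ?_
    have e : T (y j) - w k = (T' (y j) - w k) - (T' - T) (y j) := by rw [sub_apply]; abel
    have e2 : ‖T (y j) - w k‖ ≤ √n / 4 := by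
      rw [e]
      refine (norm_sub_le _ _).trans ((add_le_add hk jb).trans_eq ?_)
      rw [hK, rho]; field_simp; ring
    refine (ppl (nnn _) e2 2).trans_eq ?_
    rw [div_pow, Real.sq_sqrt pY]; norm_num
  have := (Finset.card_le_card cov).trans ((Finset.card_union_le _ _).trans (add_le_add le_rfl (Finset.card_union_le _ _)))
  rw [fcu] at this
  show M / 4 ≤ _
  omega
end

section
open ProbabilityTheory
variable {n m k : ℕ} {μ : Measure (Euc n)} {ι₁ ι₂ : Type} [Fintype ι₁] [Fintype ι₂]

lemma proj_m {α β : Type*} [TopologicalSpace α] [TopologicalSpace β] [T2Space β] [SigmaCompactSpace (α × β)] [MeasurableSpace β] [BorelSpace β] {C : Set (α × β)} (hC : IsClosed C) : MeasurableSet (Prod.snd '' C) := by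
  obtain ⟨K, hK, e⟩ := (isSigmaCompact_univ.of_isClosed_subset hC (subset_univ _)).image continuous_snd
  rw [← e]
  exact .iUnion fun i => (hK i).isClosed.measurableSet

lemma prod_le' {α β : Type*} [MeasurableSpace α] [MeasurableSpace β] {P : Measure α} {Q : Measure β} [IPM P] [SFinite Q] {s : Set (α × β)} (hs : MeasurableSet s) {c : ℝ≥0∞}
    (h : ∀ x, Q (Prod.mk x ⁻¹' s) ≤ c) : (P.prod Q) s ≤ c := by
  rw [Measure.prod_apply hs]
  exact (lmn h).trans_eq (by simp)

lemma L1_cl : IsClosed {y : ι₁ → Euc n | L1 y} := by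
  simp only [L1, setOf_forall, setOf_and]
  exact isClosed_iInter fun u => (isClosed_le fP fP).inter (isClosed_le fP fP)

abbrev Z3 (n m : ℕ) (ι₁ ι₂ : Type) := (Fin m → Euc n) × (ι₁ → Euc n) × (ι₂ → Euc n)

def Ev (τ : ℝ) (S : Finset (Fin n)) (π : ι₁ → Sym (Fin m × Bool) k) : Set (Z3 n m ι₁ ι₂) :=
  {z | ∃ T U b, Rl S T U b ∧ (∀ j, ‖T (z.2.1 j) - τ • pw (π j) z.1‖ ≤ rho * √n) ∧ ∀ j, ∃ s : Sym (Fin m × Bool) k, ‖T (z.2.2 j) - τ • pw s z.1‖ ≤ rho * √n}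

abbrev Aux (n : ℕ) := (Euc n →L[ℝ] Euc n) × (Euc n →L[ℝ] Euc n) × (Fin n → Euc n)

lemma Ev_m (τ : ℝ) (S : Finset (Fin n)) (π : ι₁ → Sym (Fin m × Bool) k) : MeasurableSet (Ev (ι₂ := ι₂) τ S π) := by
  have := fun s => pw_cont (n := n) (m := m) (k := k) s
  have c : IsClosed {p : Aux n × Z3 n m ι₁ ι₂ | Rl S p.1.1 p.1.2.1 p.1.2.2 ∧ (∀ j, ‖p.1.1 (p.2.2.1 j) - τ • pw (π j) p.2.1‖ ≤ rho * √n) ∧ ∀ j, ∃ s : Sym (Fin m × Bool) k, ‖p.1.1 (p.2.2.2 j) - τ • pw s p.2.1‖ ≤ rho * √n} := by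
    simp only [setOf_and, setOf_forall, setOf_exists]
    refine IsClosed.inter ?_ ((isClosed_iInter fun j => isClosed_le ?_ continuous_const).inter (isClosed_iInter fun j => isClosed_iUnion_of_finite fun s => isClosed_le ?_ continuous_const))
    · have : {p : Aux n × Z3 n m ι₁ ι₂ | Rl S p.1.1 p.1.2.1 p.1.2.2} = {p | p.1.2.1.comp p.1.1 = .id ℝ _} ∩ ((⋂ i, ⋂ j, {p | ⟪p.1.2.2 i, p.1.2.2 j⟫ = if i = j then (1 : ℝ) else 0}) ∩ ⋂ v : Euc n, {p | ∑ i ∈ S, ⟪p.1.2.2 i, p.1.2.1 v⟫ ^ 2 ≤ ‖v‖ ^ 2}) := by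
        ext p
        simp only [mem_inter_iff, mem_iInter]
        exact ⟨fun h => ⟨h.u, orthonormal_iff_ite.1 h.o, h.c⟩, fun h => ⟨h.1, orthonormal_iff_ite.2 h.2.1, h.2.2⟩⟩
      rw [this]
      refine (isClosed_eq fP continuous_const).inter ((isClosed_iInter fun i => isClosed_iInter fun j => isClosed_eq fP continuous_const).inter (isClosed_iInter fun v => isClosed_le fP continuous_const))
    · have := this (π j); fun_prop
    · have := this s; fun_prop
  have : ProperSpace (Aux n) := FiniteDimensional.proper ℝ _
  have : ProperSpace (Aux n × Z3 n m ι₁ ι₂) := prod_properSpace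
  have : SigmaCompactSpace (Aux n × Z3 n m ι₁ ι₂) := ⟨⟨fun i : ℕ => Metric.closedBall 0 i, fun i => isCompact_closedBall _ _, Metric.iUnion_closedBall_nat 0⟩⟩
  have := proj_m c
  convert this
  ext z
  exact ⟨fun ⟨T, U, b, h⟩ => ⟨((T, U, b), z), h, rfl⟩, by rintro ⟨⟨⟨T, U, b⟩, z⟩, h, rfl⟩; exact ⟨T, U, b, h⟩⟩

open Classical in
def Gd (Y : Set (Euc n)) : Set (Z3 n m ι₁ ι₂) := {z | L1 z.2.1} ∩ {z | L1 z.2.2 ∧ 2 * (Finset.univ.filter fun j => z.2.2 j ∈ Yᶜ).card ≤ Fintype.card ι₂}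

lemma Ev_p (h : Iso n μ) {Y : Set (Euc n)} (Ym : MeasurableSet Y) {d : ℝ≥0∞} (hY : ∀ b S a, n ≤ 2 * S.card → μ (Y ∩ sl b S a) ≤ d)
    (hn : 1 ≤ n) (hN : 0 < Fintype.card ι₁) {q : ℝ} (q0 : 0 < q) (q1 : q ≤ 1) (hq : Fintype.card (Sym (Fin m × Bool) k) * d ≤ oR q) (τ : ℝ) :
    ((Measure.pi fun _ : Fin m => μ).prod ((Measure.pi fun _ : ι₁ => μ).prod (Measure.pi fun _ : ι₂ => μ))) (⋃ (S : Finset (Fin n)) (_ : n ≤ 2 * S.card) (π : ι₁ → Sym (Fin m × Bool) k), Gd Y ∩ Ev τ S π)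
      ≤ 2 ^ n * Fintype.card (Sym (Fin m × Bool) k) ^ Fintype.card ι₁ * oR (2 ^ Fintype.card ι₂ * q ^ (Fintype.card ι₂ / 4)) := by
  classical
  have := h.prob
  set PP := (Measure.pi fun _ : Fin m => μ).prod ((Measure.pi fun _ : ι₁ => μ).prod (Measure.pi fun _ : ι₂ => μ))
  have mG : MeasurableSet (Gd (m := m) (ι₁ := ι₁) (ι₂ := ι₂) Y) := by
    refine (L1_cl.measurableSet.preimage (measurable_fst.comp measurable_snd)).inter (MeasurableSet.preimage (t := {y : ι₂ → Euc n | L1 y} ∩ {y | 2 * (Finset.univ.filter fun j => y j ∈ Yᶜ).card ≤ Fintype.card ι₂}) (L1_cl.measurableSet.inter ?_) (measurable_snd.comp measurable_snd))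
    simp only [Finset.card_filter]
    exact mbl ((Finset.measurable_sum _ fun j _ => Measurable.ite (measurable_pi_apply j Ym.compl) mct mct).const_mul 2) mct
  have one : ∀ (S : Finset (Fin n)) (_ : n ≤ 2 * S.card) (π : ι₁ → Sym (Fin m × Bool) k), PP (Gd Y ∩ Ev τ S π) ≤ oR (2 ^ Fintype.card ι₂ * q ^ (Fintype.card ι₂ / 4)) := fun S hS π => by
    have ms := mG.inter (Ev_m (ι₂ := ι₂) τ S π)
    refine prod_le' ms fun x => prod_le' (ms.preimage measurable_prodMk_left) fun y₁ => ?_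
    by_cases h1 : L1 y₁
    · refine (msm fun y hy => ?_).trans (sec h Ym hY hS (fun s : Sym (Fin m × Bool) k => τ • pw s x) (fun j => τ • pw (π j) x) h1 hn hN q0 q1 hq)
      exact ⟨hy.1.2, hy.2⟩
    · exact (measure_mono_null (t := ∅) (fun y hy => h1 hy.1.1) measure_empty).trans_le zero_le'
  refine (measure_iUnion_fintype_le _ _).trans ((fcn _ _ (Fintype.card (Sym (Fin m × Bool) k) ^ Fintype.card ι₁ * oR (2 ^ Fintype.card ι₂ * q ^ (Fintype.card ι₂ / 4))) fun S _ => ?_).trans_eq ?_)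
  · by_cases hS : n ≤ 2 * S.card
    · simp only [hS, iUnion_true]
      refine (measure_iUnion_fintype_le _ _).trans ((fcn _ _ _ fun π _ => one S hS π).trans_eq ?_)
      rw [nem, fcu, Fintype.card_fun, Nat.cast_pow]
    · simp [hS]
  · rw [nem, fcu, Fintype.card_finset, fcf, mul_assoc]; simp
end

section
open ProbabilityTheory
variable {n m k : ℕ} {ι₁ ι₂ : Type} [Fintype ι₁] [Fintype ι₂]

lemma ac_cpt (y : Fin m → Euc n) : IsCompact (absConv n (range y)) := ((finite_range y).union ((finite_range y).neg)).isCompact_convexHull ℝ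

lemma nh {y : Fin m → Euc n} (f : ι₁ → Fin m) (h : L1 fun j => y (f j)) (hN : 0 < Fintype.card ι₁) : absConv n (range y) ∈ nhds 0 := by
  have c0 : 0 < cL := by norm_num [cL]
  refine Filter.mem_of_superset (Metric.ball_mem_nhds 0 (by positivity : 0 < cL / 8)) fun v hv => ?_
  rw [mem_ball_zero_iff] at hv
  by_contra hh
  obtain ⟨F, t, h1, h2⟩ := geometric_hahn_banach_closed_point (convex_convexHull ℝ _) (ac_cpt y).isClosed hh
  obtain ⟨u, rfl⟩ := (InnerProductSpace.toDual ℝ (Euc n)).surjective F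
  simp only [InnerProductSpace.toDual_apply_apply] at h1 h2
  have b : ∀ j, |⟪y (f j), u⟫| ≤ t := fun j => by
    have a1 := h1 _ (subset_convexHull ℝ _ (Or.inl ⟨f j, rfl⟩))
    have a2 := h1 (-y (f j)) (subset_convexHull ℝ _ (Or.inr ⟨f j, by simp⟩))
    rw [inner_neg_right] at a2
    rw [ric, abs_le]; constructor <;> linarith
  have s := (h u).1.trans (fcn _ _ _ fun j _ => b j)
  rw [nem, fcu, mul_right_comm, mul_comm] at s
  have N0 : (0 : ℝ) < Fintype.card ι₁ := by exact_mod_cast hN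
  have s := lml s N0
  have := real_inner_le_norm u v
  have := mll hv.le (nnn u)
  linarith

lemma op_le {A B : Set (Euc n)} (cA : IsCompact A) (vB : Convex ℝ B) (nB : B ∈ nhds 0) (T : Euc n →ₗ[ℝ] Euc n) {a : Euc n} (ha : a ∈ A) : gauge B (T a) ≤ bodyOpNorm n A B T :=
  le_csSup (cA.image ((continuous_gauge vB nB).comp T.continuous_of_finiteDimensional)).bddAbove ⟨a, ha, rfl⟩

lemma mem_of {B : Set (Euc n)} (vB : Convex ℝ B) (nB : B ∈ nhds 0) {τ : ℝ} (h0 : 0 < τ) {v : Euc n} (h : gauge B v < τ) : v ∈ τ • B := by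
  rw [mem_smul_set_iff_inv_smul_mem₀ h0.ne']
  refine interior_subset ((gauge_lt_one_iff_mem_interior vB nB).1 ?_)
  rw [gauge_smul_of_nonneg pY, sem, inv_mul_lt_iff₀ h0, mul_one]; exact h

lemma bm {A B : Set (Euc n)} (cA : IsCompact A) (vA : Convex ℝ A) (nA : A ∈ nhds 0) (cB : IsCompact B) (vB : Convex ℝ B) (nB : B ∈ nhds 0) {τ : ℝ} (h0 : 0 < τ) (h : distBM n A B < τ ^ 2) :
    ∃ T : Euc n ≃ₗ[ℝ] Euc n, (∀ a ∈ A, T a ∈ τ • B) ∧ ∀ b ∈ B, T.symm b ∈ τ • A := by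
  unfold distBM at h
  obtain ⟨_, ⟨T, rfl⟩, h⟩ := exists_lt_of_csInf_lt (by exact ⟨_, LinearEquiv.refl ℝ _, rfl⟩) h
  have hα := fun a ha => op_le (a := a) cA vB nB T.toLinearMap ha
  have hβ := fun a ha => op_le (a := a) cB vA nA T.symm.toLinearMap ha
  set α := bodyOpNorm n A B T.toLinearMap
  set β := bodyOpNorm n B A T.symm.toLinearMap
  have α0 : 0 ≤ α := (gauge_nonneg _).trans (hα 0 (mem_of_mem_nhds nA))
  have β0 : 0 ≤ β := (gauge_nonneg _).trans (hβ 0 (mem_of_mem_nhds nB))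
  have e0 : 0 < (τ ^ 2 - α * β) / (α + 1) := div_pos lI lI
  have e1 : (τ ^ 2 - α * β) / (α + 1) * α < τ ^ 2 - α * β := by
    rw [div_mul_eq_mul_div, div_lt_iff₀ lI]; linarith
  set ε := (τ ^ 2 - α * β) / (α + 1)
  set s := (β + ε) / τ with hs
  have s0 : 0 < s := by positivity
  refine ⟨T.trans (LinearEquiv.smulOfNeZero ℝ (Euc n) s s0.ne'), fun a ha => mem_of vB nB h0 ?_, fun b hb => mem_of vA nA h0 ?_⟩
  · show gauge B (s • T a) < τ
    rw [gauge_smul_of_nonneg s0.le, sem]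
    refine (mll (hα a ha) s0.le).trans_lt ?_
    rw [hs, div_mul_eq_mul_div, div_lt_iff₀ h0]; linarith
  · have : (T.trans (LinearEquiv.smulOfNeZero ℝ (Euc n) s s0.ne')).symm b = s⁻¹ • T.symm b := by
      rw [LinearEquiv.symm_apply_eq]
      show b = s • T (s⁻¹ • T.symm b)
      rw [map_smul, T.apply_symm_apply, smul_inv_smul₀ s0.ne']
    rw [this, gauge_smul_of_nonneg pY, sem, inv_mul_lt_iff₀ s0]
    refine (hβ b hb).trans_lt ?_
    rw [hs, div_mul_cancel₀ _ h0.ne']; linarith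

lemma half {x y : Fin m → Euc n} {C τ : ℝ} (C0 : 0 ≤ C) (hx : ∀ i, ‖x i‖ ≤ C) (hk : 1 ≤ k) (hC : τ ^ 2 * (C ^ 2 / k) ≤ (rho * √n) ^ 2) (T : Euc n ≃ₗ[ℝ] Euc n) {b : Fin n → Euc n} {S : Finset (Fin n)} (o : Orthonormal ℝ b)
    (hS : ∀ v, ∑ i ∈ S, ⟪b i, T.symm v⟫ ^ 2 ≤ ‖v‖ ^ 2) (hT : ∀ j, T (y j) ∈ τ • absConv n (range x)) (f : ι₁ → Fin m) (g : ι₂ → Fin m) :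
    ∃ π : ι₁ → Sym (Fin m × Bool) k, (x, (fun j => y (f j)), (fun j => y (g j))) ∈ Ev τ S π := by
  have r0 : 0 ≤ rho := by unfold rho cL; norm_num
  have : ∀ j, ∃ s : Sym (Fin m × Bool) k, ‖T (y j) - τ • pw s x‖ ≤ rho * √n := fun j => by
    obtain ⟨v, hv, e⟩ := hT j
    have e : τ • v = T (y j) := e
    obtain ⟨s, hs⟩ := pw_ex C0 hx hv hk
    refine ⟨s, le_of_sq_le_sq ?_ pY⟩
    rw [← e, ← smul_sub, norm_smul, mul_pow, rna, sq_abs]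
    exact (mll hs (sqn τ)).trans hC
  choose s hs using this
  refine ⟨fun j => s (f j), T.toContinuousLinearEquiv, T.symm.toContinuousLinearEquiv, b, ⟨?_, o, hS⟩, fun j => hs (f j), fun j => ⟨_, hs (g j)⟩⟩
  ext1 v
  exact T.symm_apply_apply v

lemma fin {x y : Fin m → Euc n} {C τ : ℝ} (C0 : 0 ≤ C) (τ0 : 0 < τ) (hx : ∀ i, ‖x i‖ ≤ C) (hy : ∀ i, ‖y i‖ ≤ C) (hk : 1 ≤ k) (hC : τ ^ 2 * (C ^ 2 / k) ≤ (rho * √n) ^ 2) (f : ι₁ → Fin m) (g : ι₂ → Fin m)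
    (h1 : L1 fun j => x (f j)) (h2 : L1 fun j => y (f j)) (hN : 0 < Fintype.card ι₁) (h : distBM n (absConv n (range y)) (absConv n (range x)) < τ ^ 2) :
    ∃ S : Finset (Fin n), n ≤ 2 * S.card ∧ ∃ π : ι₁ → Sym (Fin m × Bool) k, (x, (fun j => y (f j)), (fun j => y (g j))) ∈ Ev τ S π ∨ (y, (fun j => x (f j)), (fun j => x (g j))) ∈ Ev τ S π := by
  obtain ⟨T, t1, t2⟩ := bm (ac_cpt y) (convex_convexHull ℝ _) (nh f h2 hN) (ac_cpt x) (convex_convexHull ℝ _) (nh f h1 hN) τ0 h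
  have mm : ∀ (z : Fin m → Euc n) j, z j ∈ absConv n (range z) := fun z j => subset_convexHull ℝ _ (Or.inl ⟨j, rfl⟩)
  obtain ⟨b, S, o, hS, q | q⟩ := svd T
  · obtain ⟨π, h⟩ := half C0 hx hk hC T o q (fun j => t1 _ (mm y j)) f g
    exact ⟨S, hS, π, Or.inl h⟩
  · obtain ⟨π, h⟩ := half C0 hy hk hC T.symm o q (fun j => t2 _ (mm x j)) f g
    exact ⟨S, hS, π, Or.inr h⟩
end

section
open ProbabilityTheory
variable {n m k : ℕ} {μ : Measure (Euc n)} {ι₁ ι₂ : Type} [Fintype ι₁] [Fintype ι₂]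

def CP : ℝ := 172800 * exp 19 + 2

lemma num1 {N M : ℕ} {K δ : ℝ} (hN : N ≤ M) (nM : n ≤ M) (M9 : 9 ≤ M) (K0 : 0 ≤ K) (hK : K ≤ exp (δ / 20 * n)) (hδ : 100 ≤ δ * n) :
    2 ^ n * K ^ N * (2 ^ M * exp (-(9 / 10 * δ * n)) ^ (M / 4)) ≤ exp (-(3 * n)) := by
  have e2 : (2 : ℝ) ≤ exp 1 := by have := aoe (1 : ℝ); linarith
  have a : (2 : ℝ) ^ n ≤ exp n := (ppl nN e2 n).trans_eq (by rw [← enm, mul_one])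
  have b : (2 : ℝ) ^ M ≤ exp M := (ppl nN e2 M).trans_eq (by rw [← enm, mul_one])
  have c : K ^ N ≤ exp (N * (δ / 20 * n)) := (ppl K0 hK N).trans_eq (by rw [← enm])
  rw [← enm]
  refine (mlm (mlm a c pY pY) (mlr b pY) pY pY).trans ?_
  rw [← eadd, ← eadd, ← eadd]
  refine ele.2 ?_
  have f : (M : ℝ) ≤ 4 * (M / 4 : ℕ) + 3 := by norm_cast; omega
  have hN : (N : ℝ) ≤ M := by exact_mod_cast hN
  have nM : (n : ℝ) ≤ M := by exact_mod_cast nM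
  have M9 : (9 : ℝ) ≤ M := by exact_mod_cast M9
  have e1 := mlr hN (by linarith : 0 ≤ δ * n)
  have e2 := mlr f (by linarith : 0 ≤ δ * n)
  have e3 := mlm hδ M9 nN lI
  have e4 := mlr M9 (by linarith : 0 ≤ δ * n)
  have e5 := mlr hδ (by linarith : (0 : ℝ) ≤ M)
  linarith

lemma num2 {M : ℕ} (h : 10 * n ≤ M) : (2 : ℝ) ^ M * 0.1 ^ (M / 2 + 1) ≤ exp (-(3 * n)) := by
  have : (2 : ℝ) ^ M ≤ 4 ^ (M / 2 + 1) := by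
    rw [show (4 : ℝ) = 2 ^ 2 by norm_num, ← pow_mul]; exact ppr nN (by omega)
  refine (mlr this pY).trans ?_
  have e : (4 : ℝ) * 0.1 ≤ exp (-(3 / 5)) := by have := aoe (-(3 / 5) : ℝ); linarith
  rw [← mul_pow]
  refine (ppl nN e _).trans ?_
  rw [← enm]
  have : (5 : ℝ) * n ≤ (M / 2 + 1 : ℕ) := by norm_cast; omega
  exact ele.2 lI

lemma bd1 (h : Iso n μ) (hn : 1 ≤ n) (hm : (m : ℝ) ≤ exp √n) (hN : 144 / cL ^ 2 * n ≤ Fintype.card ι₁) (hM : Fintype.card ι₁ ≤ Fintype.card ι₂)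
    (hK : (Fintype.card (Sym (Fin m × Bool) k) : ℝ) ≤ exp (t₀ / 50 / 20 * n)) (hδ : 100 ≤ t₀ / 50 * n) (τ : ℝ) :
    ∃ B : Set (Z3 n m ι₁ ι₂), ((Measure.pi fun _ : Fin m => μ).prod ((Measure.pi fun _ : ι₁ => μ).prod (Measure.pi fun _ : ι₂ => μ))) B ≤ 5 * oR (6 * exp (-(3 * √n))) ∧
      ∀ z ∉ B, (∀ i, ‖z.1 i‖ ≤ CP * √n) ∧ L1 z.2.1 ∧ ∀ S : Finset (Fin n), n ≤ 2 * S.card → ∀ π : ι₁ → Sym (Fin m × Bool) k, z ∉ Ev τ S π := by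
  classical
  have := h.prob
  obtain ⟨Y, Ym, Y1, Y2⟩ := kp hn h
  have n1 : (1 : ℝ) ≤ n := by exact_mod_cast hn
  have sn : √(n : ℝ) ≤ n := (Real.sqrt_le_left lI).2 (le_self_pow₀ n1 two_ne_zero)
  have h10 : 10 * n ≤ Fintype.card ι₁ := by
    have : (10 : ℝ) * n ≤ Fintype.card ι₁ := (mlr (by norm_num [cL]) lI).trans hN
    exact_mod_cast this
  have ee : ∀ a, a ≤ 2 * exp (-(3 * n)) → oR a ≤ oR (6 * exp (-(3 * √n))) := fun a ha => by
    refine oRl (ha.trans ?_)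
    have := ele.2 (by linarith : -(3 * (n : ℝ)) ≤ -(3 * √n))
    have := epos (-(3 * √n))
    linarith
  have el : ∀ M : ℕ, 144 / cL ^ 2 * n ≤ M → oR (2 * exp (-(cL ^ 2 / 8 * M))) ≤ oR (6 * exp (-(3 * √n))) := fun M hM => by
    refine ee _ (mll (ele.2 ?_) nN)
    have : (144 : ℝ) * n ≤ cL ^ 2 * M := by
      have c0 : 0 < cL ^ 2 := by norm_num [cL]
      rwa [div_mul_eq_mul_div, div_le_iff₀' c0] at hM
    linarith
  set PX := Measure.pi fun _ : Fin m => μ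
  set P1 := Measure.pi fun _ : ι₁ => μ with hP1
  set P2 := Measure.pi fun _ : ι₂ => μ with hP2
  set b := oR (6 * exp (-(3 * √n))) with hb
  set A1 : Set (Z3 n m ι₁ ι₂) := {x | ∃ i, CP * √n ≤ ‖x i‖} ×ˢ univ
  set A2 : Set (Z3 n m ι₁ ι₂) := univ ×ˢ ({y | ¬ L1 y} ×ˢ univ)
  set A3 : Set (Z3 n m ι₁ ι₂) := univ ×ˢ (univ ×ˢ {y | ¬ L1 y})
  set A4 : Set (Z3 n m ι₁ ι₂) := univ ×ˢ (univ ×ˢ {y | Fintype.card ι₂ / 2 + 1 ≤ (Finset.univ.filter fun j => y j ∈ Yᶜ).card})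
  set A5 : Set (Z3 n m ι₁ ι₂) := ⋃ (S : Finset (Fin n)) (_ : n ≤ 2 * S.card) (π : ι₁ → Sym (Fin m × Bool) k), Gd Y ∩ Ev τ S π
  set PP := PX.prod (P1.prod P2)
  have p1 : PP A1 ≤ b := by
    rw [mpp, measure_univ, mul_one]
    have : {x : Fin m → Euc n | ∃ i, CP * √n ≤ ‖x i‖} = ⋃ i, (fun x => x i) ⁻¹' {v : Euc n | CP * √n ≤ ‖v‖} := by ext x; simp
    rw [this]
    have mv : MeasurableSet {v : Euc n | CP * √n ≤ ‖v‖} := mbl fP fP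
    refine (measure_iUnion_fintype_le _ _).trans ((fcn _ _ _ fun i _ => ((measurePreserving_eval (fun _ : Fin m => μ) i).measure_preimage mv.nullMeasurableSet).trans_le (paouris hn h)).trans ?_)
    rw [fcu, fcf, nem, ← orn, ← oRm pY]
    refine oRl ?_
    have := mlr hm (epos (-(4 * √n))).le
    rw [← eadd, show √(n : ℝ) + -(4 * √n) = -(3 * √n) by ring] at this
    linarith
  have p2 : PP A2 ≤ b := by
    rw [mpp, mpp, measure_univ, measure_univ, mul_one, one_mul]
    exact (l1 h hN).trans (el _ hN)
  have hN2 : 144 / cL ^ 2 * n ≤ (Fintype.card ι₂ : ℝ) := hN.trans (by exact_mod_cast hM)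
  have p3 : PP A3 ≤ b := by
    rw [mpp, mpp, measure_univ, measure_univ, one_mul, one_mul]
    exact (l1 h hN2).trans (el _ hN2)
  have p4 : PP A4 ≤ b := by
    rw [mpp, mpp, measure_univ, measure_univ, one_mul, one_mul]
    have := cnt (ι := ι₂) Ym.compl nN nN Y1 (Fintype.card ι₂ / 2 + 1)
    refine (le_of_eq (by congr!)).trans (this.trans (ee _ ((num2 (h10.trans hM)).trans ?_)))
    have := epos (-(3 * (n : ℝ))); linarith
  have p5 : PP A5 ≤ b := by
    have q1 : exp (-(9 / 10 * (t₀ / 50) * n)) ≤ 1 := Real.exp_le_one_iff.2 lI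
    refine (Ev_p h Ym Y2 hn (by omega) (epos _) q1 ?_ τ).trans ?_
    · rw [← orn, ← ENNReal.ofReal_ofNat, ← oRm nN, ← oRm pY]
      refine oRl ((mlr hK pY).trans ?_)
      have : (2 : ℝ) ≤ exp 1 := by have := aoe (1 : ℝ); linarith
      refine (mll (mlr this (epos _).le) (epos _).le).trans ?_
      rw [← eadd, ← eadd]
      exact ele.2 lI
    · rw [← orn, ← ENNReal.ofReal_ofNat, ← orp nN, ← orp pY, ← oRm pY, ← oRm pY]
      refine ee _ ((num1 hM (by omega) (by omega) pY hK hδ).trans ?_)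
      have := epos (-(3 * (n : ℝ))); linarith
  refine ⟨A1 ∪ A2 ∪ A3 ∪ A4 ∪ A5, ?_, fun z hz => ?_⟩
  · refine (mul' _ _).trans ((add_le_add ((mul' _ _).trans (add_le_add ((mul' _ _).trans (add_le_add ((mul' _ _).trans (add_le_add p1 p2)) p3)) p4)) p5).trans_eq (by ring))
  · simp only [mem_union, not_or] at hz
    obtain ⟨⟨⟨⟨z1, z2⟩, z3⟩, z4⟩, z5⟩ := hz
    have z2 : L1 z.2.1 := by_contra fun hh => z2 ⟨trivial, hh, trivial⟩
    refine ⟨fun i => le_of_not_ge fun hh => z1 ⟨⟨i, hh⟩, trivial⟩, z2, fun S hS π he => z5 ?_⟩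
    refine mem_iUnion₂.2 ⟨S, hS, mem_iUnion.2 ⟨π, ⟨z2, by_contra fun hh => z3 ⟨trivial, trivial, hh⟩, ?_⟩, he⟩⟩
    by_contra hh
    refine z4 ⟨trivial, trivial, ?_⟩
    push Not at hh
    show _ + 1 ≤ (Finset.univ.filter fun j => z.2.2 j ∈ Yᶜ).card
    have hh : Fintype.card ι₂ < 2 * (Finset.univ.filter fun j => z.2.2 j ∈ Yᶜ).card := by convert hh
    omega

lemma bd2 (h : Iso n μ) (hn : 9 ≤ n) (hm : (m : ℝ) ≤ exp √n) (hN : 300 / cL ^ 2 * n ≤ m)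
    (hK : (Fintype.card (Sym (Fin m × Bool) k) : ℝ) ≤ exp (t₀ / 50 / 20 * n)) (hδ : 100 ≤ t₀ / 50 * n) {τ : ℝ} (τ0 : 0 < τ) (hk : 1 ≤ k) (hC : τ ^ 2 * ((CP * √n) ^ 2 / k) ≤ (rho * √n) ^ 2) :
    oR (1 - exp (-√n)) ≤ ((Measure.pi fun _ : Fin m => μ).prod (Measure.pi fun _ : Fin m => μ)) {p : (Fin m → Euc n) × (Fin m → Euc n) | τ ^ 2 ≤ distBM n (absConv n (range p.2)) (absConv n (range p.1))} := by
  have := h.prob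
  let p : Fin m → Prop := fun i => (i : ℕ) < m / 2
  have c1 : Fintype.card {i // p i} = m / 2 := by
    rw [Fintype.card_subtype, Fin.card_filter_val_lt]; omega
  have c2 : Fintype.card {i // ¬ p i} = m - m / 2 := by
    rw [Fintype.card_subtype_compl, c1, fcf]
  have n9 : (9 : ℝ) ≤ n := by exact_mod_cast hn
  have c3 : 144 / cL ^ 2 * n ≤ Fintype.card {i // p i} := by
    rw [c1]
    have : (m : ℝ) ≤ 2 * (m / 2 : ℕ) + 1 := by norm_cast; omega
    have : (1 : ℝ) * 1 ≤ 1 / cL ^ 2 * n := mlm (by norm_num [cL]) lI nN (by norm_num [cL])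
    have : 300 / cL ^ 2 * n = 300 * (1 / cL ^ 2 * n) := by ring
    have : 144 / cL ^ 2 * n = 144 * (1 / cL ^ 2 * n) := by ring
    linarith
  have c4 : 0 < Fintype.card {i // p i} := by exact_mod_cast (mul_pos (by norm_num [cL]) lI).trans_le c3
  obtain ⟨B, hB, hz⟩ := bd1 (ι₁ := {i // p i}) (ι₂ := {i // ¬ p i}) h (by omega) hm c3 (by omega) hK hδ τ
  set PX := Measure.pi fun _ : Fin m => μ
  let Φ := (MeasurableEquiv.refl (Fin m → Euc n)).prodCongr (MeasurableEquiv.piEquivPiSubtypeProd (fun _ : Fin m => Euc n) p)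
  have mp : MeasurePreserving Φ (PX.prod PX) _ := (MeasurePreserving.id PX).prod (measurePreserving_piEquivPiSubtypeProd (fun _ => μ) p)
  have b1 : (PX.prod PX) (Φ ⁻¹' B) ≤ 5 * oR (6 * exp (-(3 * √n))) := (mp.measure_preimage_equiv B).trans_le hB
  have b2 : (PX.prod PX) (Prod.swap ⁻¹' (Φ ⁻¹' B)) ≤ 5 * oR (6 * exp (-(3 * √n))) :=
    ((Measure.measurePreserving_swap (μ := PX) (ν := PX)).measure_preimage_equiv (f := MeasurableEquiv.prodComm) (Φ ⁻¹' B)).trans_le b1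
  set G : Set ((Fin m → Euc n) × (Fin m → Euc n)) := {p | τ ^ 2 ≤ distBM n (absConv n (range p.2)) (absConv n (range p.1))}
  have cov : univ ⊆ G ∪ (Φ ⁻¹' B ∪ Prod.swap ⁻¹' (Φ ⁻¹' B)) := fun ⟨x, y⟩ _ => by
    by_contra hh
    simp only [mem_union, not_or] at hh
    obtain ⟨hG, h1, h2⟩ := hh
    obtain ⟨a1, a2, a3⟩ := hz _ h1
    obtain ⟨d1, d2, d3⟩ := hz _ h2
    obtain ⟨S, hS, π, q | q⟩ := fin (ι₁ := {i // p i}) (ι₂ := {i // ¬ p i}) (by unfold CP; positivity) τ0 a1 d1 hk hC Subtype.val Subtype.val d2 a2 c4 (not_le.1 hG)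
    · exact a3 S hS π q
    · exact d3 S hS π q
  have t : 1 ≤ (PX.prod PX) G + oR (exp (-√n)) := by
    calc 1 = (PX.prod PX) univ := measure_univ.symm
      _ ≤ _ := (msm cov).trans ((mul' _ _).trans (add_le_add_right ((mul' _ _).trans ((add_le_add b1 b2).trans ?_)) _))
    rw [← ENNReal.ofReal_ofNat, ← oRm nN, ← ora pY pY]
    refine oRl ?_
    have s3 : 3 ≤ √(n : ℝ) := Real.le_sqrt_of_sq_le lI
    have e6 : exp (-(3 * √n)) * 64 ≤ exp (-√n) := by
      have : (64 : ℝ) ≤ exp 1 ^ 6 := by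
        have := ppl nN (by have := aoe (1 : ℝ); linarith : 2 ≤ exp 1) 6
        linarith
      rw [← enm] at this
      refine (mll this (epos _).le).trans ?_
      rw [← eadd]
      exact ele.2 (by push_cast; linarith)
    have := epos (-(3 * √n))
    linarith
  rw [ENNReal.ofReal_sub _ (epos _).le, oro]
  exact tsub_le_iff_right.2 t

lemma main {η : ℝ} (hη : η = t₀ / 6000) (h : Iso n μ) (hn : 1 ≤ n) (h1 : exp (1 / η) * n ≤ m) (hm : (m : ℝ) ≤ exp √n) :
    oR (1 - exp (-√n)) ≤ ((Measure.pi fun _ : Fin m => μ).prod (Measure.pi fun _ : Fin m => μ)) {p : (Fin m → Euc n) × (Fin m → Euc n) | η * rho ^ 2 / CP ^ 2 * n / Real.log (1 + (m : ℝ) / n) ≤ distBM n (absConv n (range p.2)) (absConv n (range p.1))} := by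
  have η0 : 0 < η := by rw [hη]; unfold t₀; norm_num
  have η1 : 600 / cL ^ 2 ≤ 1 / η := by rw [hη]; unfold t₀ cL; norm_num
  have η2 : 1000000 ≤ 1 / η := by rw [hη]; unfold t₀; norm_num
  have n1 : (1 : ℝ) ≤ n := by exact_mod_cast hn
  have s1 : 1 / η ≤ √n := by
    refine ele.1 (le_trans ?_ (h1.trans hm))
    exact le_mul_of_one_le_right (epos _).le n1
  have ex : 9 * (1 / η) ≤ exp (1 / η) := by
    have := Real.quadratic_le_exp_of_nonneg (by positivity : 0 ≤ 1 / η)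
    have := mlr η2 (by positivity : 0 ≤ 1 / η)
    rw [sq] at *
    linarith
  have sn : √(n : ℝ) * √n = n := Real.mul_self_sqrt lI
  have sη : 1 ≤ η * √n := by rwa [div_le_iff₀' η0] at s1
  have nη : 1000000 ≤ η * n := by
    rw [← sn, ← mul_assoc]
    exact (η2.trans s1).trans (lmo (Real.sqrt_nonneg _) sη)
  have n3 : (1000000 : ℝ) ≤ n := by
    rw [← sn]; exact (η2.trans s1).trans (lmo (Real.sqrt_nonneg _) lI)
  have mn : 9 * (1 / η) ≤ (m : ℝ) / n := ex.trans ((le_div_iff₀ lI).2 h1)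
  have m2 : (9 * (1 / η)) * n ≤ m := (mlr ex lI).trans h1
  have m3 : (n : ℝ) ≤ m := le_trans (lmo lI lI) m2
  set l := Real.log (1 + (m : ℝ) / n) with hl
  have l9 : Real.log (9 / η) ≤ l := Real.log_le_log pY (by rw [div_eq_mul_one_div]; linarith)
  have l1 : 1 ≤ l := (Real.le_log_iff_exp_le lI).2 (by have := Real.exp_one_lt_three; linarith)
  have ls : l ≤ √n := by
    rw [hl, Real.log_le_iff_le_exp lI]
    refine le_trans ?_ hm
    have : (m : ℝ) / n ≤ m / 2 := div_le_div_of_nonneg_left lI nN lI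
    linarith
  have l0 : 0 < l := by linarith
  have k1 : 1 ≤ η * n / l := by
    rw [one_le_div l0]
    refine ls.trans ?_
    rw [show η * n = η * √n * √n by rw [mul_assoc, sn]]
    exact lmo (Real.sqrt_nonneg _) sη
  set k := ⌈η * n / l⌉₊ with hk
  have k2 : η * n / l ≤ k := Nat.le_ceil _
  have k3 : (k : ℝ) ≤ 2 * η * n / l := by
    have := (Nat.ceil_lt_add_one (by linarith : 0 ≤ η * n / l)).le
    have e : 2 * η * n / l = 2 * (η * n / l) := by ring
    rw [e]; linarith
  have η3 : η ≤ 1 / 2 := by rw [hη]; unfold t₀; norm_num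
  have km : k ≤ m := by
    have : (k : ℝ) ≤ m := by
      refine k3.trans ((div_le_self pY l1).trans ?_)
      have := mlr η3 (by linarith : (0 : ℝ) ≤ n)
      linarith
    exact_mod_cast this
  have sy := symc η0 hn km hl l9 l0 k2 k3
  have k0 : 1 ≤ k := by exact_mod_cast k1.trans k2
  have C0 : 0 < CP := by unfold CP; positivity
  have r0 : 0 < rho := by unfold rho cL; norm_num
  set τ := √(η * rho ^ 2 / CP ^ 2 * n / l) with hτ
  have τ2 : τ ^ 2 = η * rho ^ 2 / CP ^ 2 * n / l := Real.sq_sqrt pY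
  rw [← τ2]
  refine bd2 (k := k) h (by exact_mod_cast (by linarith : (9 : ℝ) ≤ n)) hm ?_ ?_ ?_ (Real.sqrt_pos.2 pY) k0 ?_
  · refine le_trans (mlr ?_ lI) m2
    have : 300 / cL ^ 2 = 600 / cL ^ 2 / 2 := by ring
    linarith
  · exact sy.trans_eq (by rw [hη]; congr 1; ring)
  · rw [hη] at nη; linarith
  · have kk : (0 : ℝ) < k := by linarith
    have e : τ ^ 2 * ((CP * √n) ^ 2 / k) = (η * n / l) / k * (rho * √n) ^ 2 := by
      rw [τ2]; field_simp
    rw [e]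
    exact mul_le_of_le_one_left (sqn _) ((div_le_one kk).2 k2)

end

theorem statement_1 :
    ∃ c₀ c c' : ℝ, 1 ≤ c₀ ∧ 0 < c ∧ 0 < c' ∧
      ∀ (n : ℕ) (μ : Measure (Euc n)), IsIsotropicLogConcave n μ →
      ∀ (m : ℕ), c₀ * n ≤ m → (m : ℝ) ≤ Real.exp (Real.sqrt n) →
      ENNReal.ofReal (1 - Real.exp (-c' * Real.sqrt n)) ≤
        ((Measure.pi fun _ : Fin m => μ).prod (Measure.pi fun _ : Fin m => μ))
          {p : (Fin m → Euc n) × (Fin m → Euc n) |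
            c * n / Real.log (1 + (m : ℝ) / n) ≤
              distBM n (absConv n (Set.range p.2)) (absConv n (Set.range p.1))} := by
  have η0 : 0 < t₀ / 6000 := by unfold t₀; norm_num
  refine ⟨exp (1 / (t₀ / 6000)), t₀ / 6000 * rho ^ 2 / CP ^ 2, 1, Real.one_le_exp pY, ?_, one_pos, fun n μ h m h1 h2 => ?_⟩
  · have C0 : 0 < CP := by unfold CP; positivity
    have r0 : 0 < rho := by unfold rho cL; norm_num
    positivity
  obtain rfl | hn := Nat.eq_zero_or_pos n
  · simp
  · rw [neg_one_mul]; exact main rfl (.of h) hn h1 h2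

end
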